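/- Let R be a field and let q ∈ R be invertible with q ≠ 1, and let e be the multiplicative order of q (possibly infinite). Then for every n ≥ 1 the Iwahori–Hecke algebra H_q(A_{n−1}) has finite representation type if and only if n < 2e. -/

import Mathlib

/-- A finite-dimensional right `A`-module, where `A` is a `K`-algebra.
Right modules are modules over the opposite ring `Aᵐᵒᵖ`. -/
structure FDRightModule (K A : Type) [Field K] [Ring A] [Algebra K A] : Type 1 where
  carrier : Type
  [isAddCommGroup : AddCommGroup carrier]
  [isModuleK : Module K carrier]
  [isModuleA : Module Aᵐᵒᵖ carrier]
  [isTower : IsScalarTower K Aᵐᵒᵖ carrier]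
  [isFinDim : FiniteDimensional K carrier]

attribute [instance] FDRightModule.isAddCommGroup FDRightModule.isModuleK
  FDRightModule.isModuleA FDRightModule.isTower FDRightModule.isFinDim

/-- A module is indecomposable if it is nonzero and is not the (internal) direct
sum of two nonzero submodules. -/
def IsIndecomposableModule (R M : Type*) [Ring R] [AddCommGroup M] [Module R M] : Prop :=
  Nontrivial M ∧ ∀ N₁ N₂ : Submodule R M, IsCompl N₁ N₂ → N₁ = ⊥ ∨ N₂ = ⊥

/-- A `K`-algebra `A` has finite representation type if there are only finitely many
isomorphism classes of indecomposable finite-dimensional right `A`-modules. -/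
def HasFiniteRepresentationType (K A : Type) [Field K] [Ring A] [Algebra K A] : Prop :=
  Finite (Quot fun M N : {M : FDRightModule K A // IsIndecomposableModule Aᵐᵒᵖ M.carrier} =>
    Nonempty (M.1.carrier ≃ₗ[Aᵐᵒᵖ] N.1.carrier))
/-- The multiplicative order of an element, valued in `ℕ∞`, with `⊤` for infinite order. -/
noncomputable def multOrder {M : Type*} [Monoid M] (x : M) : ℕ∞ :=
  if orderOf x = 0 then ⊤ else (orderOf x : ℕ∞)
/-- The defining relations of the Iwahori--Hecke algebra of type `A` on `m` generators. -/
inductive HeckeARel (K : Type) [Field K] (q : K) (m : ℕ) :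
    FreeAlgebra K (Fin m) → FreeAlgebra K (Fin m) → Prop
  | quad (i : Fin m) :
      HeckeARel K q m
        ((FreeAlgebra.ι K i + 1) * (FreeAlgebra.ι K i - algebraMap K (FreeAlgebra K (Fin m)) q)) 0
  | braid (i j : Fin m) (hij : (j : ℕ) = (i : ℕ) + 1) :
      HeckeARel K q m
        (FreeAlgebra.ι K j * FreeAlgebra.ι K i * FreeAlgebra.ι K j)
        (FreeAlgebra.ι K i * FreeAlgebra.ι K j * FreeAlgebra.ι K i)
  | comm (i j : Fin m) (hij : (i : ℕ) + 1 < (j : ℕ)) :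
      HeckeARel K q m (FreeAlgebra.ι K i * FreeAlgebra.ι K j)
        (FreeAlgebra.ι K j * FreeAlgebra.ι K i)

/-- The Iwahori--Hecke algebra `H_q(A_{m-1})` of type `A_{m-1}`, with the `m - 1`
generators `T_1, …, T_{m-1}`:  the quotient of the free algebra on these generators by
the two-sided ideal generated by the defining relations.  For `m ≤ 1` this is `K`. -/
abbrev HeckeA (K : Type) [Field K] (q : K) (m : ℕ) : Type := RingQuot (HeckeARel K q (m - 1))

/-- A finite-dimensional vector space with a sequence of endomorphisms. -/
structure OpRep (k : Type) [Field k] : Type 1 where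
  carrier : Type
  [isAddCommGroup : AddCommGroup carrier]
  [isModule : Module k carrier]
  [isFinDim : FiniteDimensional k carrier]
  op : ℕ → Module.End k carrier

attribute [instance] OpRep.isAddCommGroup OpRep.isModule OpRep.isFinDim

namespace OpRep

variable {k : Type} [Field k]

/-- A linear map intertwines the operators of two representations. -/
def Intertwines (M N : OpRep k) (f : M.carrier →ₗ[k] N.carrier) : Prop :=
  ∀ i v, f (M.op i v) = N.op i (f v)

/-- Isomorphism of operator representations. -/
def Iso (M N : OpRep k) : Prop :=
  ∃ f : M.carrier ≃ₗ[k] N.carrier, Intertwines M N f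

/-- `W` is isomorphic to a direct summand of `V`. -/
def Divides (W V : OpRep k) : Prop :=
  ∃ (s : W.carrier →ₗ[k] V.carrier) (r : V.carrier →ₗ[k] W.carrier),
    Intertwines W V s ∧ Intertwines V W r ∧ r ∘ₗ s = LinearMap.id

/-- The endomorphism commutes with all operators. -/
def IsEndo (M : OpRep k) (a : Module.End k M.carrier) : Prop := ∀ i, Commute a (M.op i)

/-- A nonzero representation whose only idempotent endomorphisms are `0` and `1`. -/
def Indec (M : OpRep k) : Prop :=
  Nontrivial M.carrier ∧ ∀ e : Module.End k M.carrier, M.IsEndo e → e * e = e → e = 0 ∨ e = 1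

/-- The representations satisfying `P` fall into finitely many isomorphism classes. -/
def FinitelyMany (P : OpRep k → Prop) : Prop :=
  ∃ L : List (OpRep k), ∀ M, P M → ∃ N ∈ L, M.Iso N

theorem isEndo_iff {M : OpRep k} {a : Module.End k M.carrier} :
    M.IsEndo a ↔ Intertwines M M a :=
  ⟨fun h i v => congrArg (fun f => f v) (h i).eq, fun h i => LinearMap.ext fun v => h i v⟩

theorem Intertwines.comp {M N P : OpRep k} {f : M.carrier →ₗ[k] N.carrier}
    {g : N.carrier →ₗ[k] P.carrier} (hg : Intertwines N P g) (hf : Intertwines M N f) :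
    Intertwines M P (g ∘ₗ f) := fun i v => by
  simp [hf i v, hg i (f v)]

theorem IsEndo.one (M : OpRep k) : M.IsEndo 1 := fun _ => Commute.one_left _

theorem IsEndo.sub {M : OpRep k} {a b : Module.End k M.carrier} (ha : M.IsEndo a)
    (hb : M.IsEndo b) : M.IsEndo (a - b) := fun i => (ha i).sub_left (hb i)

theorem IsEndo.mul {M : OpRep k} {a b : Module.End k M.carrier} (ha : M.IsEndo a)
    (hb : M.IsEndo b) : M.IsEndo (a * b) := fun i => (ha i).mul_left (hb i)

theorem Iso.symm {M N : OpRep k} (h : M.Iso N) : N.Iso M := by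
  obtain ⟨f, hf⟩ := h
  refine ⟨f.symm, fun i v => f.injective ?_⟩
  have := hf i (f.symm v)
  simp only [LinearEquiv.coe_coe, LinearEquiv.apply_symm_apply] at this ⊢
  exact this.symm

theorem Iso.trans {M N P : OpRep k} (h : M.Iso N) (h' : N.Iso P) : M.Iso P := by
  obtain ⟨f, hf⟩ := h
  obtain ⟨g, hg⟩ := h'
  exact ⟨f.trans g, fun i v => by
    have h1 := hf i v
    have h2 := hg i (f v)
    simp only [LinearEquiv.coe_coe, LinearEquiv.trans_apply] at h1 h2 ⊢
    rw [h1, h2]⟩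

theorem iso_of_inverse {M N : OpRep k} (f : M.carrier →ₗ[k] N.carrier)
    (g : N.carrier →ₗ[k] M.carrier) (hf : Intertwines M N f) (hfg : f ∘ₗ g = LinearMap.id)
    (hgf : g ∘ₗ f = LinearMap.id) : M.Iso N :=
  ⟨LinearEquiv.ofLinearMap f g hfg hgf, fun i v => hf i v⟩

theorem isEndo_inverse {M : OpRep k} {a b : Module.End k M.carrier} (ha : M.IsEndo a)
    (hab : a * b = 1) (hba : b * a = 1) : M.IsEndo b := fun i => by
  have h : b * (a * M.op i) * b = b * (M.op i * a) * b := by rw [(ha i).eq]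
  simp only [mul_assoc] at h
  rw [hab, mul_one, ← mul_assoc, hba, one_mul] at h
  exact h.symm

/-- **Fitting's lemma**. -/
theorem Indec.isUnit_or_isNilpotent {M : OpRep k} (hM : M.Indec) {g : Module.End k M.carrier}
    (hg : M.IsEndo g) : IsUnit g ∨ IsNilpotent g := by
  obtain ⟨N, hN⟩ := Filter.eventually_atTop.1 g.eventually_isCompl_ker_pow_range_pow
  have hc := hN (N + 1) (Nat.le_succ N)
  set n := N + 1
  have hgn : ∀ i v, (g ^ n) (M.op i v) = M.op i ((g ^ n) v) := fun i v =>
    congrArg (fun f => f v) ((hg i).pow_left n).eq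
  set e := Submodule.projection _ _ hc.symm with he
  have hE : M.IsEndo e := isEndo_iff.2 fun i v => by
    obtain ⟨a, ha, b, hb, rfl⟩ : ∃ a ∈ LinearMap.ker (g ^ n), ∃ b ∈ LinearMap.range (g ^ n),
        a + b = v := by
      have : v ∈ LinearMap.ker (g ^ n) ⊔ LinearMap.range (g ^ n) := by
        rw [hc.sup_eq_top]; trivial
      exact Submodule.mem_sup.1 this
    have ha' : M.op i a ∈ LinearMap.ker (g ^ n) := by
      rw [LinearMap.mem_ker] at ha ⊢
      rw [hgn, ha, map_zero]
    have hb' : M.op i b ∈ LinearMap.range (g ^ n) := by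
      obtain ⟨c, rfl⟩ := hb
      exact ⟨M.op i c, hgn i c⟩
    have h1 : e a = 0 := (Submodule.projection_apply_eq_zero_iff _).2 ha
    have h2 : e (M.op i a) = 0 := (Submodule.projection_apply_eq_zero_iff _).2 ha'
    have h3 : e b = b := Submodule.projection_apply_of_mem_left _ hb
    have h4 : e (M.op i b) = M.op i b := Submodule.projection_apply_of_mem_left _ hb'
    simp only [map_add, h1, h2, h3, h4, map_zero]
  have hid : e * e = e := LinearMap.ext fun v => by
    have : e v ∈ LinearMap.range (g ^ n) := by
      have h : e v ∈ LinearMap.range e := ⟨v, rfl⟩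
      rwa [he, Submodule.range_projection] at h
    exact Submodule.projection_apply_of_mem_left _ this
  rcases hM.2 e hE hid with h | h
  · right
    refine ⟨n, ?_⟩
    rw [← LinearMap.range_eq_bot, ← Submodule.range_projection hc.symm, ← he, h,
      LinearMap.range_zero]
  · left
    have : LinearMap.ker (g ^ n) = ⊥ := by
      rw [← Submodule.ker_projection hc.symm, ← he, h]
      exact LinearMap.ker_id
    have h1 : IsUnit (g ^ n) := (LinearMap.isUnit_iff_ker_eq_bot _).2 this
    exact (isUnit_pow_iff (by omega)).1 h1

theorem Indec.isUnit_or_of_add {M : OpRep k} (hM : M.Indec) {a b : Module.End k M.carrier}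
    (ha : M.IsEndo a) (hb : M.IsEndo b) (hab : IsUnit (a + b)) : IsUnit a ∨ IsUnit b := by
  obtain ⟨u, hu⟩ := hab
  have hs : M.IsEndo (a + b) := fun i => (ha i).add_left (hb i)
  have huE : M.IsEndo (↑u⁻¹ : Module.End k M.carrier) :=
    isEndo_inverse hs (by rw [← hu, Units.mul_inv]) (by rw [← hu, Units.inv_mul])
  rcases hM.isUnit_or_isNilpotent (huE.mul ha) with h | h
  · left
    have : a = u * (↑u⁻¹ * a) := by rw [← mul_assoc, Units.mul_inv, one_mul]
    rw [this]; exact u.isUnit.mul h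
  · right
    have h2 : IsUnit (1 - ↑u⁻¹ * a) := h.isUnit_one_sub
    have : b = u * (1 - ↑u⁻¹ * a) := by
      rw [mul_sub, ← mul_assoc, Units.mul_inv, one_mul, mul_one, hu]; abel
    rw [this]; exact u.isUnit.mul h2

/-- The summand cut out by an endomorphism. -/
def sub (M : OpRep k) (e : Module.End k M.carrier) (he : M.IsEndo e) : OpRep k where
  carrier := LinearMap.range e
  op i := (M.op i).restrict (p := LinearMap.range e) (q := LinearMap.range e) (by
    rintro _ ⟨v, rfl⟩
    exact ⟨M.op i v, isEndo_iff.1 he i v⟩)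

/-- The inclusion of a summand. -/
def subIncl (M : OpRep k) (e : Module.End k M.carrier) (he : M.IsEndo e) :
    (M.sub e he).carrier →ₗ[k] M.carrier := (LinearMap.range e).subtype

/-- The projection to a summand. -/
def subProj (M : OpRep k) (e : Module.End k M.carrier) (he : M.IsEndo e) :
    M.carrier →ₗ[k] (M.sub e he).carrier := e.rangeRestrict

theorem subIncl_intertwines (M : OpRep k) (e : Module.End k M.carrier) (he : M.IsEndo e) :
    Intertwines (M.sub e he) M (M.subIncl e he) := fun _ _ => rfl

theorem subProj_intertwines (M : OpRep k) (e : Module.End k M.carrier) (he : M.IsEndo e) :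
    Intertwines M (M.sub e he) (M.subProj e he) := fun i v =>
  Subtype.ext (isEndo_iff.1 he i v)

theorem subProj_comp_subIncl (M : OpRep k) (e : Module.End k M.carrier) (he : M.IsEndo e)
    (hid : e * e = e) : M.subProj e he ∘ₗ M.subIncl e he = LinearMap.id := by
  ext ⟨_, v, rfl⟩
  exact Subtype.ext (congrArg (fun f => f v) hid)

theorem finrank_sub_lt (M : OpRep k) (e : Module.End k M.carrier) (he : M.IsEndo e)
    (hid : e * e = e) (h1 : e ≠ 1) :
    Module.finrank k (M.sub e he).carrier < Module.finrank k M.carrier := by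
  apply Submodule.finrank_lt
  intro h
  apply h1
  ext v
  obtain ⟨w, rfl⟩ : v ∈ LinearMap.range e := by rw [h]; trivial
  exact congrArg (fun f => f w) hid

/-- A notion of largeness on endomorphisms which is not a union of two small ones is attained
on an indecomposable summand. -/
theorem exists_good_indec_sub (M : OpRep k) (good : Module.End k M.carrier → Prop) (h1 : good 1)
    (h0 : ¬ good 0) (hadd : ∀ a b, M.IsEndo a → M.IsEndo b → good (a + b) → good a ∨ good b) :
    ∃ (e : Module.End k M.carrier) (he : M.IsEndo e), e * e = e ∧ good e ∧ (M.sub e he).Indec := by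
  classical
  let S : ℕ → Prop := fun n => ∃ e : Module.End k M.carrier, M.IsEndo e ∧ e * e = e ∧ good e ∧
    Module.finrank k (LinearMap.range e) = n
  have hS : ∃ n, S n := ⟨_, 1, IsEndo.one M, one_mul 1, h1, rfl⟩
  obtain ⟨e, he, hid, hgood, hn⟩ := Nat.find_spec hS
  have key : ∀ a : Module.End k M.carrier, M.IsEndo a → a * a = a → e * a = a → good a →
      LinearMap.range a = LinearMap.range e := by
    intro a ha haa hea hg
    apply Submodule.eq_of_le_of_finrank_le
    · rintro _ ⟨v, rfl⟩
      exact ⟨a v, congrArg (fun f => f v) hea⟩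
    · rw [hn]
      exact Nat.find_min' hS ⟨a, ha, haa, hg, rfl⟩
  refine ⟨e, he, hid, hgood, ?_, ?_⟩
  · by_contra hnt
    rw [not_nontrivial_iff_subsingleton] at hnt
    apply h0
    have : e = 0 := by
      ext v
      have := congrArg (M.subIncl e he) (hnt.elim (M.subProj e he v) 0)
      rwa [map_zero] at this
    rwa [this] at hgood
  · intro p hp hpp
    set a : Module.End k M.carrier := M.subIncl e he ∘ₗ p ∘ₗ M.subProj e he with ha
    have hps := M.subProj_comp_subIncl e he hid
    have hpsv : ∀ x, M.subProj e he (M.subIncl e he x) = x := fun x =>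
      congrArg (fun f => f x) hps
    have hipv : ∀ x, M.subIncl e he (M.subProj e he x) = e x := fun x => rfl
    have hppv : ∀ x, p (p x) = p x := fun x => congrArg (fun f => f x) hpp
    have heev : ∀ x, e (e x) = e x := fun x => congrArg (fun f => f x) hid
    have hei : ∀ x, e (M.subIncl e he x) = M.subIncl e he x := fun x => by
      rw [← hipv, hpsv]
    have hpe : ∀ x, M.subProj e he (e x) = M.subProj e he x := fun x => by
      rw [← hipv, hpsv]
    have haE : M.IsEndo a := isEndo_iff.2
      ((M.subIncl_intertwines e he).comp ((isEndo_iff.1 hp).comp (M.subProj_intertwines e he)))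
    have haa : a * a = a := by ext x; simp [ha, hpsv, hppv]
    have hea : e * a = a := by ext x; simp [ha, hei]
    have hae : a * e = a := by ext x; simp [ha, hpe]
    have hback : ∀ x, p x = M.subProj e he (a (M.subIncl e he x)) := fun x => by
      simp [ha, hpsv]
    have hsplit : good (a + (e - a)) := by rwa [add_sub_cancel]
    have hfix : ∀ b : Module.End k M.carrier, b * b = b → ∀ x ∈ LinearMap.range b, b x = x := by
      rintro b hb _ ⟨y, rfl⟩
      exact congrArg (fun f => f y) hb
    rcases hadd a (e - a) haE (he.sub haE) hsplit with h | h
    · right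
      have hr := key a haE haa hea h
      ext x
      rw [hback]
      have : M.subIncl e he x ∈ LinearMap.range a := by
        rw [hr]; exact x.2
      rw [hfix a haa _ this, hpsv]
      rfl
    · left
      have hbb : (e - a) * (e - a) = e - a := by
        simp [mul_sub, sub_mul, hid, haa, hea, hae]
      have hr := key (e - a) (he.sub haE) hbb (by simp [mul_sub, hid, hea]) h
      ext x
      rw [hback]
      have : M.subIncl e he x ∈ LinearMap.range (e - a) := by
        rw [hr]; exact x.2
      have h2 := hfix _ hbb _ this
      rw [LinearMap.sub_apply, hei] at h2
      have h3 : a (M.subIncl e he x) = 0 := by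
        have := sub_eq_self.1 h2
        exact this
      rw [h3, map_zero]; rfl

/-- An indecomposable representation with an invertible composite `r ∘ s` is a summand. -/
theorem divides_of_isUnit {W V : OpRep k} {s : W.carrier →ₗ[k] V.carrier}
    {r : V.carrier →ₗ[k] W.carrier} (hs : Intertwines W V s) (hr : Intertwines V W r)
    (hu : IsUnit (r ∘ₗ s : Module.End k W.carrier)) : W.Divides V := by
  obtain ⟨u, hu⟩ := hu
  have hE : W.IsEndo (r ∘ₗ s) := isEndo_iff.2 (hr.comp hs)
  have hE' : W.IsEndo (↑u⁻¹ : Module.End k W.carrier) :=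
    isEndo_inverse hE (by rw [← hu, Units.mul_inv]) (by rw [← hu, Units.inv_mul])
  refine ⟨s, (↑u⁻¹ : Module.End k W.carrier) ∘ₗ r, hs, (isEndo_iff.1 hE').comp hr, ?_⟩
  rw [LinearMap.comp_assoc, ← hu]
  exact u.inv_mul

theorem Divides.iso {W V : OpRep k} (hV : V.Indec) (hW : Nontrivial W.carrier)
    (h : W.Divides V) : W.Iso V := by
  obtain ⟨s, r, hs, hr, hrs⟩ := h
  have hv : ∀ x, r (s x) = x := fun x => congrArg (fun f => f x) hrs
  rcases hV.2 (s ∘ₗ r) (isEndo_iff.2 (hs.comp hr)) (by ext x; simp [hv]) with h | h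
  · exfalso
    obtain ⟨x, hx⟩ := exists_ne (0 : W.carrier)
    apply hx
    have := congrArg (fun f => r (f (s x))) h
    simpa [hv] using this
  · exact iso_of_inverse s r hs h hrs

theorem FinitelyMany.mono {P Q : OpRep k → Prop} (h : ∀ M, P M → Q M) (hQ : FinitelyMany Q) :
    FinitelyMany P := by
  obtain ⟨L, hL⟩ := hQ
  exact ⟨L, fun M hM => hL M (h M hM)⟩

theorem FinitelyMany.or {P Q : OpRep k → Prop} (hP : FinitelyMany P) (hQ : FinitelyMany Q) :
    FinitelyMany (fun M => P M ∨ Q M) := by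
  obtain ⟨L, hL⟩ := hP
  obtain ⟨L', hL'⟩ := hQ
  refine ⟨L ++ L', fun M hM => ?_⟩
  rcases hM with h | h
  · obtain ⟨N, hN, hi⟩ := hL M h
    exact ⟨N, by simp [hN], hi⟩
  · obtain ⟨N, hN, hi⟩ := hL' M h
    exact ⟨N, by simp [hN], hi⟩

/-- A representation has finitely many indecomposable summands up to isomorphism. -/
theorem finitelyMany_divides (V : OpRep k) :
    FinitelyMany (fun W : OpRep k => W.Indec ∧ W.Divides V) := by
  suffices H : ∀ (n : ℕ) (V : OpRep k), Module.finrank k V.carrier ≤ n →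
      FinitelyMany (fun W : OpRep k => W.Indec ∧ W.Divides V) from H _ V le_rfl
  intro n
  induction n with
  | zero =>
    intro V hV
    refine ⟨[], fun W hW => ?_⟩
    exfalso
    have : Subsingleton V.carrier := Module.finrank_zero_iff.1 (Nat.le_zero.1 hV)
    obtain ⟨⟨hnt, -⟩, s, r, -, -, hrs⟩ := hW
    obtain ⟨x, hx⟩ := exists_ne (0 : W.carrier)
    apply hx
    have := congrArg (fun f => f x) hrs
    simp only [LinearMap.comp_apply, LinearMap.id_apply] at this
    rw [← this, Subsingleton.elim (s x) 0, map_zero]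
  | succ n ih =>
    intro V hV
    by_cases hI : V.Indec
    · exact ⟨[V], fun W hW => ⟨V, by simp, hW.2.iso hI hW.1.1⟩⟩
    by_cases hnt : Nontrivial V.carrier
    · have : ∃ e : Module.End k V.carrier, V.IsEndo e ∧ e * e = e ∧ e ≠ 0 ∧ e ≠ 1 := by
        by_contra! hcon
        exact hI ⟨hnt, fun e he hid => or_iff_not_imp_left.2 (hcon e he hid)⟩
      obtain ⟨e, he, hid, h0, h1⟩ := this
      have he' : V.IsEndo (1 - e) := (IsEndo.one V).sub he
      have hid' : (1 - e) * (1 - e) = 1 - e := by simp [mul_sub, sub_mul, hid]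
      have l1 := V.finrank_sub_lt e he hid h1
      have l2 := V.finrank_sub_lt (1 - e) he' hid' (by simpa using h0)
      refine ((ih (V.sub e he) (by omega)).or (ih (V.sub (1 - e) he') (by omega))).mono ?_
      rintro W ⟨hW, s, r, hs, hr, hrs⟩
      have key := hW.isUnit_or_of_add
        (a := (r ∘ₗ V.subIncl e he) ∘ₗ (V.subProj e he ∘ₗ s))
        (b := (r ∘ₗ V.subIncl _ he') ∘ₗ (V.subProj _ he' ∘ₗ s))
        (isEndo_iff.2 ((hr.comp (V.subIncl_intertwines e he)).comp
          ((V.subProj_intertwines e he).comp hs)))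
        (isEndo_iff.2 ((hr.comp (V.subIncl_intertwines _ he')).comp
          ((V.subProj_intertwines _ he').comp hs))) (by
          have : (r ∘ₗ V.subIncl e he) ∘ₗ (V.subProj e he ∘ₗ s)
            + (r ∘ₗ V.subIncl _ he') ∘ₗ (V.subProj _ he' ∘ₗ s) = LinearMap.id := by
            rw [← hrs]
            ext x
            have a1 : ∀ y, V.subIncl e he (V.subProj e he y) = e y := fun _ => rfl
            have a2 : ∀ y, V.subIncl _ he' (V.subProj _ he' y) = (1 - e) y := fun _ => rfl
            simp [a1, a2]
          rw [this]
          exact isUnit_one)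
      rcases key with h | h
      · exact Or.inl ⟨hW, divides_of_isUnit ((V.subProj_intertwines e he).comp hs)
          (hr.comp (V.subIncl_intertwines e he)) h⟩
      · exact Or.inr ⟨hW, divides_of_isUnit ((V.subProj_intertwines _ he').comp hs)
          (hr.comp (V.subIncl_intertwines _ he')) h⟩
    · refine ih V ?_
      rw [not_nontrivial_iff_subsingleton] at hnt
      rw [Module.finrank_zero_of_subsingleton]
      omega

end OpRep

section HeckeFamily

variable {k : Type} [Field k] {A : Type} [Ring A] [Algebra k A]

/-- A sequence in an algebra satisfying the relations of the Hecke algebra of type `A` on `m`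
generators, extended by zero. -/
structure IsHecke (q : k) (m : ℕ) (T : ℕ → A) : Prop where
  quad : ∀ i < m, T i * T i = (q - 1) • T i + q • (1 : A)
  braid : ∀ i, T (i + 1) * T i * T (i + 1) = T i * T (i + 1) * T i
  comm : ∀ i j, i + 1 < j → Commute (T i) (T j)
  zero : ∀ i, m ≤ i → T i = 0

/-- The Jucys-Murphy elements. -/
def jm (q : k) (T : ℕ → A) : ℕ → A
  | 0 => 1
  | i + 1 => q⁻¹ • (T i * jm q T i * T i)

/-- The intertwining elements. -/
def inter (q : k) (T : ℕ → A) (i : ℕ) : A :=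
  T i * (jm q T i - jm q T (i + 1)) + (q - 1) • jm q T (i + 1)

theorem jm_zero (q : k) (T : ℕ → A) : jm q T 0 = 1 := rfl

theorem jm_succ (q : k) (T : ℕ → A) (i : ℕ) :
    jm q T (i + 1) = q⁻¹ • (T i * jm q T i * T i) := rfl

namespace IsHecke

variable {q : k} {m : ℕ} {T : ℕ → A}

theorem commute_op_jm_lt (h : IsHecke q m T) {i j : ℕ} (hij : i < j) :
    Commute (T j) (jm q T i) := by
  induction i with
  | zero => exact Commute.one_right _
  | succ i ih =>
    have h1 : Commute (T j) (T i) := (h.comm i j hij).symm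
    exact ((h1.mul_right (ih (by omega))).mul_right h1).smul_right _

theorem commute_op_jm_gt (h : IsHecke q m T) {i j : ℕ} (hij : j + 1 < i) :
    Commute (T j) (jm q T i) := by
  obtain ⟨d, rfl⟩ := Nat.exists_eq_add_of_lt hij
  induction d with
  | zero =>
    have hc := (h.commute_op_jm_lt (Nat.lt_succ_self j)).eq
    have hb := h.braid j
    change Commute (T j) (jm q T (j + 1 + 1))
    rw [jm_succ, jm_succ]
    simp only [mul_smul_comm, smul_mul_assoc]
    refine Commute.smul_right (Commute.smul_right ?_ _) _
    change T j * _ = _ * T j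
    set S := T (j + 1)
    set L := jm q T j
    set t := T j
    calc t * (S * (t * L * t) * S) = (t * S * t) * L * t * S := by noncomm_ring
      _ = S * t * (S * L) * t * S := by rw [← hb]; noncomm_ring
      _ = S * t * L * (S * t * S) := by rw [hc]; noncomm_ring
      _ = _ := by rw [hb]; noncomm_ring
  | succ d ih =>
    have h1 : Commute (T j) (T (j + 1 + d + 1)) := h.comm _ _ (by omega)
    have h2 := ih (by omega)
    exact ((h1.mul_right h2).mul_right h1).smul_right _

theorem commute_jm_lt (h : IsHecke q m T) {i j : ℕ} (hij : i < j) :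
    Commute (jm q T i) (jm q T j) := by
  induction j generalizing i with
  | zero => omega
  | succ j ih =>
    have key : ∀ {i}, i < j → Commute (jm q T i) (jm q T (j + 1)) := fun {i} hi =>
      (((h.commute_op_jm_lt hi).symm.mul_right (ih hi)).mul_right
        (h.commute_op_jm_lt hi).symm).smul_right _
    rcases Nat.lt_succ_iff_lt_or_eq.1 hij with hi | rfl
    · exact key hi
    · cases i with
      | zero => exact Commute.one_left _
      | succ i =>
        have h1 : Commute (T i) (jm q T (i + 1 + 1)) := h.commute_op_jm_gt (by omega)
        rw [jm_succ q T i]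
        exact ((h1.mul_left (key (Nat.lt_succ_self i))).mul_left h1).smul_left _

theorem commute_jm (h : IsHecke q m T) (i j : ℕ) : Commute (jm q T i) (jm q T j) := by
  rcases lt_trichotomy i j with hij | rfl | hij
  · exact h.commute_jm_lt hij
  · exact Commute.refl _
  · exact (h.commute_jm_lt hij).symm

theorem commute_op_jm (h : IsHecke q m T) {i j : ℕ} (h1 : i ≠ j) (h2 : i ≠ j + 1) :
    Commute (T j) (jm q T i) := by
  rcases lt_or_gt_of_ne h1 with hij | hij
  · exact h.commute_op_jm_lt hij
  · exact h.commute_op_jm_gt (by omega)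

theorem jm_succ_mul (h : IsHecke q m T) (hq : q ≠ 0) (i : ℕ) :
    jm q T (i + 1) * T i = T i * jm q T i + (q - 1) • jm q T (i + 1) := by
  by_cases hi : i < m
  · rw [jm_succ, smul_mul_assoc, mul_assoc _ (T i) (T i), h.quad i hi, mul_add, smul_add,
      mul_smul_comm, mul_smul_comm, mul_one, inv_smul_smul₀ hq, smul_comm, add_comm]
  · simp [jm_succ, h.zero i (by omega)]

theorem mul_jm_succ (h : IsHecke q m T) (hq : q ≠ 0) (i : ℕ) :
    T i * jm q T (i + 1) = jm q T i * T i + (q - 1) • jm q T (i + 1) := by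
  by_cases hi : i < m
  · rw [jm_succ, mul_smul_comm, ← mul_assoc, ← mul_assoc, h.quad i hi, add_mul, add_mul, smul_add,
      smul_mul_assoc, smul_mul_assoc, smul_mul_assoc, smul_mul_assoc, one_mul, inv_smul_smul₀ hq,
      smul_comm, add_comm]
  · simp [jm_succ, h.zero i (by omega)]

theorem inter_mul_jm (h : IsHecke q m T) (hq : q ≠ 0) (i : ℕ) :
    inter q T i * jm q T i = jm q T (i + 1) * inter q T i := by
  have h1 := h.jm_succ_mul hq i
  have h3 := (h.commute_jm i (i + 1)).eq
  unfold inter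
  generalize jm q T i = a at *
  generalize jm q T (i + 1) = b at *
  rw [mul_add, ← mul_assoc, h1, add_mul]
  simp only [add_mul, mul_sub, sub_mul, smul_mul_assoc, mul_smul_comm, mul_assoc, ← h3]
  module

theorem inter_mul_jm_succ (h : IsHecke q m T) (hq : q ≠ 0) (i : ℕ) :
    inter q T i * jm q T (i + 1) = jm q T i * inter q T i := by
  have h1 := h.mul_jm_succ hq i
  have h3 := (h.commute_jm i (i + 1)).eq
  unfold inter
  generalize jm q T i = a at *
  generalize jm q T (i + 1) = b at *
  have h1' : a * T i = T i * b - (q - 1) • b := by rw [h1]; abel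
  rw [mul_add, ← mul_assoc, h1', add_mul]
  simp only [mul_sub, sub_mul, smul_mul_assoc, mul_smul_comm, mul_assoc, ← h3]
  module

theorem inter_commute_jm (h : IsHecke q m T) {i j : ℕ} (h1 : j ≠ i) (h2 : j ≠ i + 1) :
    Commute (inter q T i) (jm q T j) :=
  ((h.commute_op_jm h1 h2).mul_left ((h.commute_jm i j).sub_left (h.commute_jm _ j))).add_left
    ((h.commute_jm _ j).smul_left _)

theorem inter_sq (h : IsHecke q m T) (hq : q ≠ 0) {i : ℕ} (hi : i < m) :
    inter q T i * inter q T i = (q • jm q T i - jm q T (i + 1)) *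
      (q • jm q T (i + 1) - jm q T i) := by
  have h0 := h.quad i hi
  have h1 := h.mul_jm_succ hq i
  have h2 := h.jm_succ_mul hq i
  have h3 := (h.commute_jm i (i + 1)).eq
  have e1 := h.inter_mul_jm hq i
  have e2 := h.inter_mul_jm_succ hq i
  have : inter q T i * inter q T i = T i * (inter q T i * jm q T (i + 1) - inter q T i * jm q T i)
     + (q - 1) • (inter q T i * jm q T i) := by
    rw [e1, e2]
    nth_rewrite 1 [inter]
    noncomm_ring
  rw [this]
  unfold inter
  generalize jm q T i = a at *
  generalize jm q T (i + 1) = b at *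
  generalize T i = t at *
  have h0' : ∀ x, t * (t * x) = (q - 1) • (t * x) + q • x := fun x => by
    rw [← mul_assoc, h0, add_mul, smul_mul_assoc, smul_mul_assoc, one_mul]
  have h3' : ∀ x, b * (a * x) = a * (b * x) := fun x => by
    rw [← mul_assoc, ← h3, mul_assoc]
  simp only [mul_add, add_mul, mul_sub, sub_mul, smul_mul_assoc, mul_smul_comm, mul_assoc, ← h3,
    h0', smul_add, smul_sub]
  module

theorem inter_commute (h : IsHecke q m T) {i j : ℕ} (hij : i + 1 < j) :
    Commute (inter q T i) (inter q T j) := by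
  have h1 := h.inter_commute_jm (i := i) (j := j) (by omega) (by omega)
  have h2 := h.inter_commute_jm (i := i) (j := j + 1) (by omega) (by omega)
  have h3 : Commute (inter q T i) (T j) :=
    (((h.comm i j hij)).mul_left ((h.commute_op_jm (by omega) (by omega)).symm.sub_left
      (h.commute_op_jm (by omega) (by omega)).symm)).add_left
      ((h.commute_op_jm (by omega) (by omega)).symm.smul_left _)
  exact (h3.mul_right (h1.sub_right h2)).add_right (h2.smul_right _)

theorem inter_of_le (h : IsHecke q m T) {i : ℕ} (hi : m ≤ i) : inter q T i = 0 := by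
  simp [inter, jm_succ, h.zero i hi]

theorem inter_braid (h : IsHecke q m T) (hq : q ≠ 0) (i : ℕ) :
    inter q T i * inter q T (i + 1) * inter q T i =
      inter q T (i + 1) * inter q T i * inter q T (i + 1) := by
  by_cases hi : i + 1 < m
  swap
  · simp [h.inter_of_le (i := i + 1) (by omega)]
  have t1 := h.quad i (by omega)
  have t2 := h.quad (i + 1) hi
  have hb := h.braid i
  have a1 : jm q T i * T i = T i * jm q T (i + 1) - (q - 1) • jm q T (i + 1) := by
    rw [h.mul_jm_succ hq i]; abel
  have a2 := h.jm_succ_mul hq i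
  have a3 : jm q T (i + 1 + 1) * T i = T i * jm q T (i + 1 + 1) :=
    (h.commute_op_jm (i := i + 1 + 1) (j := i) (by omega) (by omega)).eq.symm
  have b1 : jm q T i * T (i + 1) = T (i + 1) * jm q T i :=
    (h.commute_op_jm (i := i) (j := i + 1) (by omega) (by omega)).eq.symm
  have b2 : jm q T (i + 1) * T (i + 1)
      = T (i + 1) * jm q T (i + 1 + 1) - (q - 1) • jm q T (i + 1 + 1) := by
    rw [h.mul_jm_succ hq (i + 1)]; abel
  have b3 := h.jm_succ_mul hq (i + 1)
  have c1 := (h.commute_jm (i + 1) i).eq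
  have c2 := (h.commute_jm (i + 1 + 1) i).eq
  have c3 := (h.commute_jm (i + 1 + 1) (i + 1)).eq
  unfold inter
  generalize jm q T i = a at *
  generalize jm q T (i + 1) = b at *
  generalize jm q T (i + 1 + 1) = c at *
  generalize T i = t at *
  generalize T (i + 1) = s at *
  have ext : ∀ {x y z : A}, x * y = z → ∀ w, x * (y * w) = z * w := fun h w => by
    rw [← mul_assoc, h]
  have hb'' : ∀ w, s * (t * (s * w)) = t * (s * (t * w)) := fun w => by
    simpa only [mul_assoc] using congrArg (· * w) hb
  simp only [mul_add, add_mul, mul_sub, sub_mul, smul_mul_assoc, mul_smul_comm, mul_assoc,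
    c1, c2, c3, ext t1, ext t2, ext a1, ext a2, ext a3, ext b1,
    ext b2, ext b3, ext c1, ext c2, ext c3, hb'', smul_add, smul_sub, one_mul]
  module

end IsHecke

end HeckeFamily

section RelativeTrace

variable {k : Type} [Field k] {A : Type} [Ring A] [Algebra k A]

/-- The relative trace from the subalgebra on the first `m - 1` generators. -/
def relTr (q : k) (T : ℕ → A) : ℕ → A → A
  | 0, b => b
  | m + 1, b => b + relTr q T m (q⁻¹ • (T m * b * T m))

variable {q : k} {T : ℕ → A}

theorem relTr_add (m : ℕ) (a b : A) : relTr q T m (a + b) = relTr q T m a + relTr q T m b := by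
  induction m generalizing a b with
  | zero => rfl
  | succ m ih =>
    simp only [relTr, mul_add, add_mul, smul_add, ih]
    abel

theorem relTr_smul (m : ℕ) (c : k) (b : A) : relTr q T m (c • b) = c • relTr q T m b := by
  induction m generalizing b with
  | zero => rfl
  | succ m ih =>
    simp only [relTr, mul_smul_comm, smul_mul_assoc]
    rw [smul_comm q⁻¹ c, ih, smul_add]

theorem relTr_mul_left {m : ℕ} {c : A} (hc : ∀ i < m, Commute c (T i)) (b : A) :
    relTr q T m (c * b) = c * relTr q T m b := by
  induction m generalizing b with
  | zero => rfl
  | succ m ih =>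
    have h1 : T m * (c * b) * T m = c * (T m * b * T m) := by
      rw [← mul_assoc (T m), ← (hc m (Nat.lt_succ_self m)).eq]; simp only [mul_assoc]
    simp only [relTr]
    rw [h1, ← mul_smul_comm, ih fun i hi => hc i (by omega), mul_add]

theorem relTr_mul_right {m : ℕ} {c : A} (hc : ∀ i < m, Commute c (T i)) (b : A) :
    relTr q T m (b * c) = relTr q T m b * c := by
  induction m generalizing b with
  | zero => rfl
  | succ m ih =>
    have h1 : T m * (b * c) * T m = (T m * b * T m) * c := by
      rw [mul_assoc, mul_assoc b, (hc m (Nat.lt_succ_self m)).eq]; simp only [mul_assoc]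
    simp only [relTr]
    rw [h1, ← smul_mul_assoc, ih fun i hi => hc i (by omega), add_mul]

variable {M : ℕ}

theorem IsHecke.relTr_op (h : IsHecke q M T) (hq : q ≠ 0) {m : ℕ} (hm : m < M) :
    (1 - q⁻¹) • relTr q T m (T m) = jm q T (m + 1) - 1 := by
  have fin : ∀ {j : ℕ}, j < M → ∀ x : A, (1 - q⁻¹) • T j + q⁻¹ • (T j * (x - 1) * T j) =
      q⁻¹ • (T j * x * T j) - 1 := by
    intro j hj x
    have h0 := h.quad j hj
    rw [mul_sub, sub_mul, mul_one, h0, smul_sub, smul_add, smul_smul, smul_smul,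
      inv_mul_cancel₀ hq, mul_sub, inv_mul_cancel₀ hq]
    module
  induction m with
  | zero =>
    have := fin hm 1
    simpa [relTr, jm] using this
  | succ m ih =>
    have h1 : T m * T (m + 1) * T m = T (m + 1) * T m * T (m + 1) := (h.braid m).symm
    have hc : ∀ i < m, Commute (T (m + 1)) (T i) := fun i hi => (h.comm i _ (by omega)).symm
    simp only [relTr]
    rw [h1, relTr_smul, relTr_mul_right hc, relTr_mul_left hc, smul_add,
      smul_comm (1 - q⁻¹) q⁻¹, jm_succ, ← smul_mul_assoc (1 - q⁻¹), ← mul_smul_comm (1 - q⁻¹), ih (by omega), fin hm]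

/-- Recursion for the generating function of the traces of powers of Jucys-Murphy elements. -/
theorem IsHecke.relTr_recursion (h : IsHecke q M T) (hq : q ≠ 0) {m : ℕ} (hm : m < M) {t : A}
    (ht : ∀ a, Commute t a) {D : ℕ → A} (hD : ∀ b, (1 - t * jm q T b) * D b = 1)
    (hD' : ∀ b, D b * (1 - t * jm q T b) = 1) :
    (1 - t) - (q - 2 + q⁻¹) • (t * relTr q T (m + 1) (D (m + 1))) =
      (1 - (q - 2 + q⁻¹) • (t * jm q T (m + 1) * (D (m + 1) * D (m + 1)))) *
        ((1 - t) - (q - 2 + q⁻¹) • (t * relTr q T m (D m))) := by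
  have hDc : ∀ b x, Commute (jm q T b) x → Commute (D b) x := fun b x hx => by
    have h1 : Commute (1 - t * jm q T b) x :=
      (Commute.one_left _).sub_left ((ht x).mul_left hx)
    have : D b * ((1 - t * jm q T b) * x) * D b = D b * (x * (1 - t * jm q T b)) * D b := by
      rw [h1.eq]
    rw [← mul_assoc, hD', one_mul, mul_assoc (D b), mul_assoc x, hD, mul_one] at this
    exact this.symm
  have hDT : ∀ i < m, Commute (D (m + 1)) (T i) := fun i hi =>
    hDc _ _ (h.commute_op_jm (by omega) (by omega)).symm
  have hDL : Commute (D (m + 1)) (jm q T (m + 1)) := hDc _ _ (Commute.refl _)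
  have hDD : Commute (D (m + 1)) (D m) := hDc _ _ (hDc _ _ (h.commute_jm _ _)).symm
  have hDG : Commute (D (m + 1)) (relTr q T m (D m)) := by
    have h1 := relTr_mul_left (q := q) hDT (D m)
    have h2 := relTr_mul_right (q := q) hDT (D m)
    rw [hDD.eq] at h1
    exact h1.symm.trans h2
  have e0 : t * jm q T (m + 1) * D (m + 1) = D (m + 1) - 1 := by
    have := hD (m + 1)
    rw [sub_mul, one_mul] at this
    rw [← this]; abel
  have e1 : D (m + 1) * T m = T m * D m + (q - 1) • ((D (m + 1) - 1) * D m) := by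
    have h1 : (1 - t * jm q T (m + 1)) * T m
        = T m * (1 - t * jm q T m) - (q - 1) • (t * jm q T (m + 1)) := by
      rw [sub_mul, mul_assoc, h.jm_succ_mul hq m, mul_sub, mul_add, ← mul_assoc t (T m),
        (ht (T m)).eq, mul_smul_comm]
      noncomm_ring
    have h2 := congrArg (fun x => D (m + 1) * x * D m) h1
    simp only [← mul_assoc, hD', one_mul] at h2
    rw [mul_sub, sub_mul, mul_assoc (D (m + 1)), mul_assoc (T m), hD, mul_one, mul_smul_comm,
      ((ht _).symm.mul_right hDL).eq, e0, smul_mul_assoc] at h2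
    rw [h2]; abel
  have e2 : q⁻¹ • (T m * D (m + 1) * T m) = D m + (1 - q⁻¹) • (T m * D m * D (m + 1)) := by
    rw [mul_assoc, e1, mul_add, ← mul_assoc, h.quad m hm, add_mul, mul_smul_comm, sub_mul,
      one_mul, hDD.eq, smul_mul_assoc, smul_mul_assoc, one_mul, mul_sub, mul_assoc]
    have : q⁻¹ * q = 1 := inv_mul_cancel₀ hq
    match_scalars <;> field_simp
    ring
  have e3 : T m * D m = D (m + 1) * T m - (q - 1) • (D (m + 1) * D m) + (q - 1) • D m := by
    rw [e1, sub_mul, one_mul, smul_sub]; abel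
  have e4 : relTr q T m (T m * D m) = D (m + 1) * relTr q T m (T m)
      - (q - 1) • (D (m + 1) * relTr q T m (D m)) + (q - 1) • relTr q T m (D m) := by
    rw [e3, relTr_add, sub_eq_add_neg, ← neg_smul, relTr_add, relTr_smul, relTr_smul,
      relTr_mul_left hDT, relTr_mul_left hDT]
    module
  have e5 : (1 - q⁻¹) • relTr q T m (T m * D m) = D (m + 1) * (jm q T (m + 1) - 1)
      - (q - 2 + q⁻¹) • ((D (m + 1) - 1) * relTr q T m (D m)) := by
    rw [← h.relTr_op hq hm, e4, sub_mul, one_mul, mul_smul_comm]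
    match_scalars <;> field_simp <;> ring
  have e6 : relTr q T (m + 1) (D (m + 1)) = relTr q T m (D m) + D (m + 1) +
      D (m + 1) * (jm q T (m + 1) - 1) * D (m + 1) - (q - 2 + q⁻¹) •
      (t * jm q T (m + 1) * (D (m + 1) * D (m + 1)) * relTr q T m (D m)) := by
    rw [relTr, e2, relTr_add, relTr_smul, relTr_mul_right hDT, ← smul_mul_assoc, e5, sub_mul,
      smul_mul_assoc, ← e0, mul_assoc _ (relTr q T m (D m)) (D (m + 1)), ← hDG.eq]
    simp only [mul_assoc]
    abel
  have e7 : D (m + 1) + D (m + 1) * (jm q T (m + 1) - 1) * D (m + 1)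
      = (1 - t) * jm q T (m + 1) * (D (m + 1) * D (m + 1)) := by
    have h1 : D (m + 1) = (1 - t * jm q T (m + 1)) * D (m + 1) * D (m + 1) := by rw [hD, one_mul]
    rw [mul_sub, mul_one, hDL.eq]
    nth_rewrite 1 [h1]
    noncomm_ring
  have e8 : relTr q T (m + 1) (D (m + 1)) = relTr q T m (D m) +
      (1 - t) * jm q T (m + 1) * (D (m + 1) * D (m + 1)) - (q - 2 + q⁻¹) •
      (t * jm q T (m + 1) * (D (m + 1) * D (m + 1)) * relTr q T m (D m)) := by
    rw [e6, ← e7]; abel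
  rw [e8]
  generalize q - 2 + q⁻¹ = σ
  generalize jm q T (m + 1) = L
  generalize relTr q T m (D m) = G
  have c1 : L * t = t * L := (ht L).eq.symm
  have c2 : D (m + 1) * t = t * D (m + 1) := (ht _).eq.symm
  have x1 : ∀ x, L * (t * x) = t * (L * x) := fun x => by rw [← mul_assoc, c1, mul_assoc]
  have x2 : ∀ x, D (m + 1) * (t * x) = t * (D (m + 1) * x) := fun x => by
    rw [← mul_assoc, c2, mul_assoc]
  simp only [mul_add, mul_sub, sub_mul, smul_mul_assoc, mul_smul_comm, mul_assoc, c2,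
    x1, x2, smul_add, smul_sub, one_mul, mul_one]
  module

end RelativeTrace

section TraceSeries

open PowerSeries

variable {k : Type} [Field k] {A : Type} [Ring A] [Algebra k A] {B : Type} [Ring B] [Algebra k B]

variable {q : k} {T : ℕ → A} {M : ℕ}

theorem IsHecke.map (h : IsHecke q M T) (f : A →ₐ[k] B) : IsHecke q M (fun i => f (T i)) where
  quad i hi := by rw [← map_mul, h.quad i hi, map_add, map_smul, map_smul, map_one]
  braid i := by simp only [← map_mul, h.braid i]
  comm i j hij := (h.comm i j hij).map f
  zero i hi := by rw [h.zero i hi, map_zero]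

theorem map_jm (f : A →ₐ[k] B) (i : ℕ) : f (jm q T i) = jm q (fun i => f (T i)) i := by
  induction i with
  | zero => exact map_one f
  | succ i ih => simp only [jm, map_smul, map_mul, ih]

theorem map_relTr (f : A →ₐ[k] B) (m : ℕ) (a : A) :
    f (relTr q T m a) = relTr q (fun i => f (T i)) m (f a) := by
  induction m generalizing a with
  | zero => rfl
  | succ m ih => simp only [relTr, map_add, ih, map_smul, map_mul]

/-- The geometric series of an element. -/
def geomSeries {R : Type*} [Ring R] (a : R) : PowerSeries R := PowerSeries.mk fun j => a ^ j

theorem geomSeries_mul {R : Type*} [Ring R] (a : R) :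
    (1 - X * C a) * geomSeries a = 1 := by
  ext j
  rw [sub_mul, one_mul, map_sub, mul_assoc]
  cases j with
  | zero => simp [geomSeries]
  | succ j => simp [geomSeries, coeff_succ_X_mul, coeff_C_mul, pow_succ', coeff_one]

theorem mul_geomSeries {R : Type*} [Ring R] (a : R) :
    geomSeries a * (1 - X * C a) = 1 := by
  ext j
  rw [mul_sub, mul_one, map_sub, (commute_X (C a)).symm.eq, ← mul_assoc]
  cases j with
  | zero => simp [geomSeries]
  | succ j => simp [geomSeries, coeff_succ_mul_X, coeff_mul_C, pow_succ, coeff_one]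

/-- Constant power series, as a homomorphism of algebras over the base field. -/
noncomputable def constSeries (k A : Type) [Field k] [Ring A] [Algebra k A] :
    A →ₐ[k] PowerSeries A :=
  { (PowerSeries.C : A →+* PowerSeries A) with
    commutes' := fun r => by
      simp [PowerSeries.algebraMap_apply] }

theorem constSeries_apply (a : A) : constSeries k A a = C a := rfl

theorem coeff_smul_field (c : k) (x : PowerSeries A) (j : ℕ) :
    coeff j (c • x) = c • coeff j x := rfl

theorem coeff_relTr (m j : ℕ) (D : PowerSeries A) :
    coeff j (relTr q (fun i => constSeries k A (T i)) m D) = relTr q T m (coeff j D) := by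
  induction m generalizing D with
  | zero => rfl
  | succ m ih =>
    simp only [relTr, map_add, ih]
    rw [coeff_smul_field, constSeries_apply, coeff_mul_C, coeff_C_mul]

theorem IsHecke.relTr_series (h : IsHecke q M T) (hq : q ≠ 0) {Λ : Type} [CommRing Λ]
    [Algebra k Λ] (ι : Λ →ₐ[k] A) (ℓ : ℕ → Λ) (hℓ : ∀ b, ι (ℓ b) = jm q T b) {m : ℕ}
    (hm : m ≤ M) :
    (1 - X) - (q - 2 + q⁻¹) • (X * relTr q (fun i => constSeries k A (T i)) m
      (geomSeries (jm q T m))) =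
    PowerSeries.map (ι : Λ →+* A) ((∏ b ∈ Finset.range (m + 1),
      (1 - (q - 2 + q⁻¹) • (X * C (ℓ b) * (geomSeries (ℓ b) * geomSeries (ℓ b))))) * (1 - X)) := by
  have hg : ∀ b, PowerSeries.map (ι : Λ →+* A) (geomSeries (ℓ b)) = geomSeries (jm q T b) := by
    intro b
    ext j
    simp [geomSeries, hℓ]
  have hs : ∀ (c : k) (x : PowerSeries Λ), PowerSeries.map (ι : Λ →+* A) (c • x)
      = c • PowerSeries.map (ι : Λ →+* A) x := by
    intro c x
    ext j
    simp
  have hfac : ∀ b, PowerSeries.map (ι : Λ →+* A)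
      (1 - (q - 2 + q⁻¹) • (X * C (ℓ b) * (geomSeries (ℓ b) * geomSeries (ℓ b)))) =
      1 - (q - 2 + q⁻¹) • (X * C (jm q T b) *
        (geomSeries (jm q T b) * geomSeries (jm q T b))) := by
    intro b
    rw [map_sub, map_one, hs, map_mul, map_mul, map_mul, hg, map_X, map_C]
    congr
    exact hℓ b
  induction m with
  | zero =>
    rw [Finset.prod_range_one, map_mul, hfac, map_sub, map_one, map_X]
    simp only [relTr, jm_zero, map_one, mul_one]
    have h1 := geomSeries_mul (1 : A)
    have h2 := mul_geomSeries (1 : A)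
    rw [map_one, mul_one] at h1 h2
    rw [sub_mul, one_mul, smul_mul_assoc, mul_assoc, mul_assoc, h2, mul_one]
  | succ m ih =>
    have hR := (h.map (constSeries k A)).relTr_recursion hq (m := m) (by omega)
      (t := (X : PowerSeries A)) (fun a => (commute_X a).symm)
      (D := fun b => geomSeries (jm q T b))
      (fun b => by rw [← map_jm]; exact geomSeries_mul _)
      (fun b => by rw [← map_jm]; exact mul_geomSeries _)
    rw [Finset.prod_range_succ, mul_comm (Finset.prod _ _), mul_assoc, map_mul, ← ih (by omega),
      hfac]
    rw [← map_jm] at hR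
    exact hR

theorem IsHecke.nil_prod (h : IsHecke q M T) (hq : q ≠ 0)
    (hnil : ∀ j, IsNilpotent (relTr q T M (jm q T M ^ j))) {Λ : Type} [CommRing Λ]
    [Algebra k Λ] (ι : Λ →ₐ[k] A) (hι : Function.Injective ι) (ℓ : ℕ → Λ)
    (hℓ : ∀ b, ι (ℓ b) = jm q T b) {K : Type} [Field K] [Algebra k K] (χ : Λ →ₐ[k] K) :
    ∏ b ∈ Finset.range (M + 1), ((1 - Polynomial.X * Polynomial.C (algebraMap k K q * χ (ℓ b))) *
      (1 - Polynomial.X * Polynomial.C ((algebraMap k K q)⁻¹ * χ (ℓ b)))) =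
    ∏ b ∈ Finset.range (M + 1), (1 - Polynomial.X * Polynomial.C (χ (ℓ b))) ^ 2 := by
  have hser := h.relTr_series hq ι ℓ hℓ le_rfl
  set P := (∏ b ∈ Finset.range (M + 1),
      (1 - (q - 2 + q⁻¹) • (X * C (ℓ b) * (geomSeries (ℓ b) * geomSeries (ℓ b))))) * (1 - X)
      with hP
  have hχ : PowerSeries.map (χ : Λ →+* K) P = 1 - X := by
    have hco : ∀ j, IsNilpotent (coeff j (1 - X - P)) := by
      intro j
      have : IsNilpotent (ι (coeff j (1 - X - P))) := by
        have h1 : ι (coeff j (1 - X - P)) = coeff j (PowerSeries.map (ι : Λ →+* A) (1 - X - P)) := rfl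
        rw [h1, map_sub (PowerSeries.map _), map_sub (PowerSeries.map _), map_one, map_X, ← hser,
          sub_sub_cancel, coeff_smul_field]
        cases j with
        | zero => simp
        | succ j =>
          rw [coeff_succ_X_mul, coeff_relTr]
          simp only [geomSeries, coeff_mk]
          exact (hnil j).smul _
      exact (IsNilpotent.map_iff hι).1 this
    have : PowerSeries.map (χ : Λ →+* K) (1 - X - P) = 0 := by
      ext j
      exact ((hco j).map χ).eq_zero
    rw [map_sub, map_sub, map_one, map_X] at this
    exact (sub_eq_zero.1 this).symm
  have hne : (1 - X : PowerSeries K) ≠ 0 := by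
    intro h0
    have := congrArg (coeff 0) h0
    simp at this
  have hg : ∀ b, PowerSeries.map (χ : Λ →+* K) (geomSeries (ℓ b)) = geomSeries (χ (ℓ b)) := by
    intro b
    ext j
    simp [geomSeries]
  have hs : ∀ (c : k) (x : PowerSeries Λ), PowerSeries.map (χ : Λ →+* K) (c • x)
      = C (algebraMap k K c) * PowerSeries.map (χ : Λ →+* K) x := by
    intro c x
    ext j
    rw [coeff_C_mul, PowerSeries.coeff_map, coeff_smul_field, PowerSeries.coeff_map,
      ← Algebra.smul_def]
    exact map_smul χ _ _
  rw [hP, map_mul, map_prod, map_sub, map_one, map_X] at hχ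
  have h1 := mul_right_cancel₀ hne (hχ.trans (one_mul _).symm)
  apply Polynomial.coe_injective
  have hq' : algebraMap k K q ≠ 0 := by simpa using hq
  have e1 : ((∏ b ∈ Finset.range (M + 1),
      ((1 - Polynomial.X * Polynomial.C (algebraMap k K q * χ (ℓ b))) *
      (1 - Polynomial.X * Polynomial.C ((algebraMap k K q)⁻¹ * χ (ℓ b)))) : Polynomial K) :
      PowerSeries K) = ∏ b ∈ Finset.range (M + 1),
      ((1 - X * C (algebraMap k K q * χ (ℓ b))) *
      (1 - X * C ((algebraMap k K q)⁻¹ * χ (ℓ b)))) := by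
    rw [← Polynomial.coeToPowerSeries.ringHom_apply, map_prod]
    simp
  have e2 : ((∏ b ∈ Finset.range (M + 1),
      (1 - Polynomial.X * Polynomial.C (χ (ℓ b))) ^ 2 : Polynomial K) :
      PowerSeries K) = ∏ b ∈ Finset.range (M + 1), (1 - X * C (χ (ℓ b))) ^ 2 := by
    rw [← Polynomial.coeToPowerSeries.ringHom_apply, map_prod]
    simp [-Polynomial.X_mul_C]
  rw [e1, e2]
  have h2 := congrArg (fun x => (∏ b ∈ Finset.range (M + 1), (1 - X * C (χ (ℓ b))) ^ 2) * x) h1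
  simp only [mul_one] at h2
  rw [← h2, ← Finset.prod_mul_distrib]
  refine Finset.prod_congr rfl fun b _ => ?_
  rw [map_sub, map_one, hs]
  simp only [map_mul, hg, map_X, map_C]
  have hgm := geomSeries_mul (χ (ℓ b))
  set G := geomSeries (χ (ℓ b))
  have hCq : C (algebraMap k K q) * C ((algebraMap k K q)⁻¹) = (1 : PowerSeries K) := by
    rw [← map_mul, mul_inv_cancel₀ hq', map_one]
  simp only [map_add, map_sub, map_inv₀, map_ofNat, RingHom.coe_coe]
  generalize C (χ (ℓ b)) = c at *
  generalize C (algebraMap k K q) = a at *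
  generalize C ((algebraMap k K q)⁻¹) = a' at *
  linear_combination (X ^ 2 * c ^ 2) * hCq + (a - 2 + a') * X * c * ((1 - X * c) * G + 1) * hgm

end TraceSeries

section RootCount

/-- A bounded sequence of natural numbers with vanishing second difference is constant. -/
theorem eq_of_second_difference_zero {f : ℕ → ℕ} {B : ℕ} (hB : ∀ i, f i ≤ B)
    (h : ∀ i, f (i + 2) + f i = 2 * f (i + 1)) : f 1 = f 0 := by
  have key : ∀ i : ℕ, (f (i + 1) : ℤ) - f i = f 1 - f 0 := by
    intro i
    induction i with
    | zero => rfl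
    | succ i ih => have : f (i + 1 + 1) + f i = 2 * f (i + 1) := h i; omega
  have key2 : ∀ i : ℕ, (f i : ℤ) = f 0 + i * ((f 1 : ℤ) - f 0) := by
    intro i
    induction i with
    | zero => simp
    | succ i ih => have := key i; push_cast; linarith
  have h1 := key2 (B + 1)
  have h2 := hB (B + 1)
  have h3 : (0 : ℤ) ≤ f (B + 1) := by positivity
  have h4 := hB 0
  by_contra hne
  rcases lt_or_gt_of_ne hne with hlt | hlt
  · have : (f 1 : ℤ) - f 0 ≤ -1 := by omega
    push_cast at h1
    nlinarith
  · have : (f 1 : ℤ) - f 0 ≥ 1 := by omega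
    push_cast at h1
    nlinarith

variable {K : Type} [Field K]

open Polynomial in
theorem Polynomial.roots_prod_one_sub {ι : Type} (s : Finset ι) (c : ι → K)
    (hc : ∀ i ∈ s, c i ≠ 0) :
    (∏ i ∈ s, (1 - X * C (c i))).roots = s.val.map fun i => (c i)⁻¹ := by
  classical
  have h1 : ∀ i ∈ s, (1 - X * C (c i)).roots = {(c i)⁻¹} := by
    intro i hi
    have : (1 - X * C (c i)) = C (-(c i)) * (X - C ((c i)⁻¹)) := by
      have : C (c i) * C ((c i)⁻¹) = 1 := by
        rw [← C_mul, mul_inv_cancel₀ (hc i hi), C_1]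
      rw [C_neg]
      linear_combination -this
    rw [this, roots_C_mul _ (neg_ne_zero.2 (hc i hi)), roots_X_sub_C]
  have h0 : ∏ i ∈ s, (1 - X * C (c i)) ≠ 0 := by
    refine Finset.prod_ne_zero_iff.2 fun i _ h0 => ?_
    have := congrArg (eval 0) h0
    simp at this
  rw [roots_prod _ _ h0, Multiset.bind_congr h1]
  simp

theorem map_mul_eq_of_prod_eq {q : K} (hq : q ≠ 0) {n : ℕ} {c : ℕ → K} (hc : ∀ b < n, c b ≠ 0)
    (h : ∏ b ∈ Finset.range n, ((1 - Polynomial.X * Polynomial.C (q * c b)) *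
      (1 - Polynomial.X * Polynomial.C (q⁻¹ * c b))) =
      ∏ b ∈ Finset.range n, (1 - Polynomial.X * Polynomial.C (c b)) ^ 2) :
    ((Multiset.range n).map c).map (q * ·) = (Multiset.range n).map c := by
  classical
  have hne : ∀ d : ℕ → K, ∏ i ∈ Finset.range n, (1 - Polynomial.X * Polynomial.C (d i)) ≠ 0 := by
    intro d
    refine Finset.prod_ne_zero_iff.2 fun i _ h0 => ?_
    have := congrArg (Polynomial.eval 0) h0
    simp at this
  have hr := congrArg Polynomial.roots h
  simp only [pow_two] at hr
  rw [Finset.prod_mul_distrib, Finset.prod_mul_distrib,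
    Polynomial.roots_mul (mul_ne_zero (hne _) (hne _)),
    Polynomial.roots_mul (mul_ne_zero (hne _) (hne _)),
    Polynomial.roots_prod_one_sub _ _ (fun i hi => mul_ne_zero hq (hc i (Finset.mem_range.1 hi))),
    Polynomial.roots_prod_one_sub _ _
      (fun i hi => mul_ne_zero (inv_ne_zero hq) (hc i (Finset.mem_range.1 hi))),
    Polynomial.roots_prod_one_sub _ _ (fun i hi => hc i (Finset.mem_range.1 hi))] at hr
  have hr2 := congrArg (Multiset.map fun x => x⁻¹) hr
  simp only [Multiset.map_add, Multiset.map_map, Function.comp_def, inv_inv, Finset.range_val]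
    at hr2
  set S := (Multiset.range n).map c with hS
  have e1 : (Multiset.range n).map (fun b => q * c b) = S.map (q * ·) := by
    rw [hS, Multiset.map_map]; rfl
  have e2 : (Multiset.range n).map (fun b => q⁻¹ * c b) = S.map (q⁻¹ * ·) := by
    rw [hS, Multiset.map_map]; rfl
  rw [e1, e2] at hr2
  have hcount : ∀ (a : K), a ≠ 0 → ∀ y, (S.map (a * ·)).count (a * y) = S.count y := fun a ha y =>
    Multiset.count_map_eq_count' _ _ (mul_right_injective₀ ha) _
  have hy : ∀ y, S.count (q⁻¹ * y) + S.count (q * y) = 2 * S.count y := by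
    intro y
    have := congrArg (Multiset.count y) hr2
    rw [Multiset.count_add, Multiset.count_add] at this
    have a1 := hcount q hq (q⁻¹ * y)
    have a2 := hcount q⁻¹ (inv_ne_zero hq) (q * y)
    rw [mul_inv_cancel_left₀ hq] at a1
    rw [inv_mul_cancel_left₀ hq] at a2
    rw [a1, a2] at this
    omega
  ext y
  have a1 := hcount q hq (q⁻¹ * y)
  rw [mul_inv_cancel_left₀ hq] at a1
  rw [a1]
  have key := eq_of_second_difference_zero (f := fun i => S.count (q ^ i * (q⁻¹ * y)))
    (B := S.card) (fun i => Multiset.count_le_card _ _) (fun i => by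
      have := hy (q ^ (i + 1) * (q⁻¹ * y))
      have b1 : q⁻¹ * (q ^ (i + 1) * (q⁻¹ * y)) = q ^ i * (q⁻¹ * y) := by
        field_simp
        ring
      have b2 : q * (q ^ (i + 1) * (q⁻¹ * y)) = q ^ (i + 2) * (q⁻¹ * y) := by ring
      rw [b1, b2] at this
      omega)
  simp only [pow_one, pow_zero, one_mul, mul_inv_cancel_left₀ hq] at key
  exact key.symm

theorem pow_eq_one_of_prod_eq {q : K} {n : ℕ} {c : ℕ → K} (hc : ∀ b < n, c b ≠ 0)
    (h : ((Multiset.range n).map c).map (q * ·) = (Multiset.range n).map c) : q ^ n = 1 := by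
  have hp := congrArg Multiset.prod h
  rw [Multiset.map_map] at hp
  simp only [Function.comp_def, Multiset.prod_map_mul, Multiset.map_const', Multiset.prod_replicate,
    Multiset.card_range] at hp
  refine (mul_eq_right₀ ?_).1 hp
  refine Multiset.prod_ne_zero fun h0 => ?_
  obtain ⟨b, hb, h0⟩ := Multiset.mem_map.1 h0
  exact hc b (Multiset.mem_range.1 hb) h0

theorem exists_pow_of_prod_eq {q : K} {n : ℕ} (hn : orderOf q = n) (hn0 : 0 < n)
    {c : ℕ → K} (hc0 : c 0 = 1)
    (h : ((Multiset.range n).map c).map (q * ·) = (Multiset.range n).map c) :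
    (∀ b < n, ∃ j < n, c b = q ^ j) ∧ ∀ a < n, ∀ b < n, c a = c b → a = b := by
  classical
  have hmem : ∀ j : ℕ, q ^ j ∈ (Multiset.range n).map c := by
    intro j
    induction j with
    | zero => exact Multiset.mem_map.2 ⟨0, Multiset.mem_range.2 hn0, by rw [hc0, pow_zero]⟩
    | succ j ih =>
      rw [← h, pow_succ']
      exact Multiset.mem_map_of_mem _ ih
  have hsub : (Finset.range n).image (fun j => q ^ j) ⊆ (Finset.range n).image c := by
    intro y hy
    obtain ⟨j, -, rfl⟩ := Finset.mem_image.1 hy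
    obtain ⟨b, hb, hbj⟩ := Multiset.mem_map.1 (hmem j)
    exact Finset.mem_image.2 ⟨b, Finset.mem_range.2 (Multiset.mem_range.1 hb), hbj⟩
  have hcard : ((Finset.range n).image (fun j => q ^ j)).card = n := by
    rw [Finset.card_image_of_injOn, Finset.card_range]
    intro a ha b hb hab
    simp only [Finset.coe_range, Set.mem_Iio] at ha hb
    exact pow_injOn_Iio_orderOf (by simpa [hn] using ha) (by simpa [hn] using hb) hab
  have hle : ((Finset.range n).image c).card ≤ n := by
    simpa using Finset.card_image_le (s := Finset.range n) (f := c)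
  have heq := Finset.eq_of_subset_of_card_le hsub (by rw [hcard]; exact hle)
  constructor
  · intro b hb
    have : c b ∈ (Finset.range n).image (fun j => q ^ j) := by
      rw [heq]; exact Finset.mem_image_of_mem _ (Finset.mem_range.2 hb)
    obtain ⟨j, hj, hbj⟩ := Finset.mem_image.1 this
    exact ⟨j, Finset.mem_range.1 hj, hbj.symm⟩
  · have hinj : Set.InjOn c (Finset.range n) := by
      rw [← Finset.card_image_iff, ← heq, hcard, Finset.card_range]
    intro a ha b hb hab
    exact hinj (by simpa using ha) (by simpa using hb) hab

end RootCount

section JucysMurphyAlgebra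

variable {k : Type} [Field k] {A : Type} [Ring A] [Algebra k A]
variable {q : k} {T : ℕ → A} {M : ℕ}

/-- A commutative finite-dimensional algebra `Λ` embedded in `A` and generated by lifts `ℓ` of the
Jucys-Murphy elements. -/
structure IsJMAlg (q : k) (T : ℕ → A) {Λ : Type} [CommRing Λ] [Algebra k Λ]
    (ι : Λ →ₐ[k] A) (ℓ : ℕ → Λ) : Prop where
  inj : Function.Injective ι
  apply : ∀ b, ι (ℓ b) = jm q T b
  fin : FiniteDimensional k Λ

theorem IsHecke.exists_isJMAlg [FiniteDimensional k A] (h : IsHecke q M T) :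
    ∃ (Λ : Type) (_ : CommRing Λ) (_ : Algebra k Λ) (ι : Λ →ₐ[k] A) (ℓ : ℕ → Λ),
      IsJMAlg q T ι ℓ := by
  let S : Subalgebra k A := Algebra.adjoin k (Set.range (jm q T))
  have : IsMulCommutative S := Algebra.isMulCommutative_adjoin k (by
    rintro _ ⟨i, rfl⟩ _ ⟨j, rfl⟩
    exact h.commute_jm i j)
  let : CommRing S := { (inferInstance : Ring S) with mul_comm := this.is_comm.comm }
  exact ⟨S, inferInstance, S.algebra, S.val,
    fun i => ⟨jm q T i, Algebra.subset_adjoin ⟨i, rfl⟩⟩, Subtype.val_injective, fun _ => rfl,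
    FiniteDimensional.finiteDimensional_submodule (Subalgebra.toSubmodule S)⟩

theorem IsHecke.isUnit_op (h : IsHecke q M T) (hq : q ≠ 0) {i : ℕ} (hi : i < M) :
    IsUnit (T i) := by
  have h0 := h.quad i hi
  have h1 : T i * (q⁻¹ • (T i - (q - 1) • (1 : A))) = 1 := by
    rw [mul_smul_comm, mul_sub, h0, mul_smul_comm, mul_one, add_sub_cancel_left,
      inv_smul_smul₀ hq]
  have h2 : (q⁻¹ • (T i - (q - 1) • (1 : A))) * T i = 1 := by
    rw [smul_mul_assoc, sub_mul, h0, smul_mul_assoc, one_mul, add_sub_cancel_left,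
      inv_smul_smul₀ hq]
  exact ⟨⟨_, _, h1, h2⟩, rfl⟩

theorem IsHecke.isUnit_jm (h : IsHecke q M T) (hq : q ≠ 0) {i : ℕ} (hi : i ≤ M) :
    IsUnit (jm q T i) := by
  induction i with
  | zero => exact isUnit_one
  | succ i ih =>
    have h1 := ((h.isUnit_op hq (i := i) (by omega)).mul (ih (by omega))).mul
      (h.isUnit_op hq (i := i) (by omega))
    obtain ⟨u, hu⟩ := h1
    rw [jm_succ, ← hu]
    exact (u.isUnit.smul (Units.mk0 q⁻¹ (inv_ne_zero hq)))

variable {Λ : Type} [CommRing Λ] [Algebra k Λ] {ι : Λ →ₐ[k] A} {ℓ : ℕ → Λ}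

theorem IsJMAlg.isUnit_of_map (hJ : IsJMAlg q T ι ℓ) {x : Λ} (hx : IsUnit (ι x)) : IsUnit x := by
  have := hJ.fin
  have : IsArtinianRing Λ := IsArtinianRing.of_finite k Λ
  refine IsArtinianRing.isUnit_of_mem_nonZeroDivisors ?_
  rw [mem_nonZeroDivisors_iff_right]
  intro y hy
  apply hJ.inj
  have := congrArg ι hy
  rw [map_mul, map_zero] at this
  rw [map_zero]
  exact hx.mul_left_eq_zero.1 this

theorem IsJMAlg.isUnit (hJ : IsJMAlg q T ι ℓ) (h : IsHecke q M T) (hq : q ≠ 0) {i : ℕ}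
    (hi : i ≤ M) : IsUnit (ℓ i) :=
  hJ.isUnit_of_map (by rw [hJ.apply]; exact h.isUnit_jm hq hi)

/-- All traces of powers of the last Jucys-Murphy element are nilpotent. -/
def TraceNil (q : k) (M : ℕ) (T : ℕ → A) : Prop :=
  ∀ j, IsNilpotent (relTr q T M (jm q T M ^ j))

theorem IsJMAlg.map_char (hJ : IsJMAlg q T ι ℓ) (h : IsHecke q M T) (hq : q ≠ 0)
    (hnil : TraceNil q M T) {K : Type} [Field K] [Algebra k K] (χ : Λ →ₐ[k] K) :
    ((Multiset.range (M + 1)).map fun b => χ (ℓ b)).map (algebraMap k K q * ·) =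
      (Multiset.range (M + 1)).map fun b => χ (ℓ b) :=
  map_mul_eq_of_prod_eq (by simpa using hq)
    (fun b hb => ((hJ.isUnit h hq (by omega)).map χ).ne_zero)
    (h.nil_prod hq hnil ι hJ.inj ℓ hJ.apply χ)

theorem IsJMAlg.pow_eq_one (hJ : IsJMAlg q T ι ℓ) (h : IsHecke q M T) (hq : q ≠ 0)
    (hnil : TraceNil q M T) {K : Type} [Field K] [Algebra k K] (χ : Λ →ₐ[k] K) :
    q ^ (M + 1) = 1 := by
  have := pow_eq_one_of_prod_eq (fun b hb => ((hJ.isUnit h hq (by omega)).map χ).ne_zero)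
    (hJ.map_char h hq hnil χ)
  apply (algebraMap k K).injective
  rw [map_pow, this, map_one]

theorem IsJMAlg.zero (hJ : IsJMAlg q T ι ℓ) : ℓ 0 = 1 := hJ.inj (by rw [hJ.apply, jm_zero, map_one])

theorem IsJMAlg.char_eq_pow (hJ : IsJMAlg q T ι ℓ) (h : IsHecke q M T) (hq : q ≠ 0)
    (hnil : TraceNil q M T) (hord : orderOf q = M + 1) {K : Type} [Field K] [Algebra k K]
    (χ : Λ →ₐ[k] K) :
    (∀ b ≤ M, ∃ j ≤ M, χ (ℓ b) = algebraMap k K (q ^ j)) ∧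
      ∀ a ≤ M, ∀ b ≤ M, χ (ℓ a) = χ (ℓ b) → a = b := by
  have ho : orderOf (algebraMap k K q) = M + 1 := by
    rw [← hord]
    exact orderOf_injective (algebraMap k K : k →* K) (algebraMap k K).injective q
  obtain ⟨h1, h2⟩ := exists_pow_of_prod_eq ho (Nat.succ_pos M) (c := fun b => χ (ℓ b))
    (by simp [hJ.zero]) (hJ.map_char h hq hnil χ)
  refine ⟨fun b hb => ?_, fun a ha b hb => h2 a (by omega) b (by omega)⟩
  obtain ⟨j, hj, hbj⟩ := h1 b (by omega)
  exact ⟨j, by omega, by rw [hbj, map_pow]⟩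

theorem IsHecke.pow_eq_one_of_traceNil [FiniteDimensional k A] [Nontrivial A] (h : IsHecke q M T)
    (hq : q ≠ 0) (hnil : TraceNil q M T) : q ^ (M + 1) = 1 := by
  obtain ⟨Λ, _, _, ι, ℓ, hJ⟩ := h.exists_isJMAlg
  have : Nontrivial Λ := by
    refine ⟨0, 1, fun h01 => zero_ne_one (α := A) ?_⟩
    rw [← map_zero ι, ← map_one ι, h01]
  obtain ⟨I, hI⟩ := Ideal.exists_maximal Λ
  let := Ideal.Quotient.field I
  exact hJ.pow_eq_one h hq hnil (Ideal.Quotient.mkₐ k I)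

end JucysMurphyAlgebra

section CosetProducts

variable {k : Type} [Field k] {A : Type} [Ring A] [Algebra k A]

/-- The descending product `T (n - 1) * ⋯ * T j`. -/
def descProd (T : ℕ → A) : ℕ → ℕ → A
  | 0, _ => 1
  | n + 1, j => if j ≤ n then T n * descProd T n j else 1

/-- The ascending product `T j * ⋯ * T (n - 1)`. -/
def ascProd (T : ℕ → A) : ℕ → ℕ → A
  | 0, _ => 1
  | n + 1, j => if j ≤ n then ascProd T n j * T n else 1

variable {T : ℕ → A} {q : k} {M : ℕ}

theorem descProd_of_le {n j : ℕ} (h : n ≤ j) : descProd T n j = 1 := by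
  cases n with
  | zero => rfl
  | succ n => rw [descProd, if_neg (by omega)]

theorem ascProd_of_le {n j : ℕ} (h : n ≤ j) : ascProd T n j = 1 := by
  cases n with
  | zero => rfl
  | succ n => rw [ascProd, if_neg (by omega)]

theorem descProd_succ {n j : ℕ} (h : j ≤ n) : descProd T (n + 1) j = T n * descProd T n j := by
  rw [descProd, if_pos h]

theorem ascProd_succ {n j : ℕ} (h : j ≤ n) : ascProd T (n + 1) j = ascProd T n j * T n := by
  rw [ascProd, if_pos h]

theorem descProd_eq_mul {n j : ℕ} (h : j < n) : descProd T n j = descProd T n (j + 1) * T j := by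
  induction n with
  | zero => omega
  | succ n ih =>
    rw [descProd_succ (by omega)]
    rcases Nat.lt_succ_iff_lt_or_eq.1 h with h1 | rfl
    · rw [ih h1, descProd_succ h1, mul_assoc]
    · rw [descProd_of_le le_rfl, descProd_of_le (by omega), mul_one, one_mul]

theorem op_ascProd (n j : ℕ) :
    MulOpposite.op (ascProd T n j) = descProd (fun i => MulOpposite.op (T i)) n j := by
  induction n with
  | zero => rfl
  | succ n ih =>
    rw [ascProd, descProd]
    split_ifs
    · rw [MulOpposite.op_mul, ih]
    · rfl

theorem IsHecke.op (h : IsHecke q M T) : IsHecke q M (fun i => MulOpposite.op (T i)) where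
  quad i hi := by
    rw [← MulOpposite.op_mul, h.quad i hi]; rfl
  braid i := by
    simp only [← MulOpposite.op_mul, ← mul_assoc, h.braid i]
  comm i j hij := by
    have := (h.comm i j hij).eq
    change MulOpposite.op (T i) * MulOpposite.op (T j) = MulOpposite.op (T j) * MulOpposite.op (T i)
    rw [← MulOpposite.op_mul, ← MulOpposite.op_mul, this]
  zero i hi := by rw [h.zero i hi]; rfl

theorem IsHecke.commute_descProd_of_le (h : IsHecke q M T) {n j l : ℕ} (hl : n < l) :
    Commute (T l) (descProd T n j) := by
  induction n with
  | zero => exact Commute.one_right _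
  | succ n ih =>
    rw [descProd]
    split_ifs
    · exact (h.comm n l hl).symm.mul_right (ih (by omega))
    · exact Commute.one_right _

theorem IsHecke.commute_descProd (h : IsHecke q M T) {n j l : ℕ} (hl : l + 1 < j) :
    Commute (T l) (descProd T n j) := by
  induction n with
  | zero => exact Commute.one_right _
  | succ n ih =>
    rw [descProd]
    split_ifs
    · exact (h.comm l n (by omega)).mul_right ih
    · exact Commute.one_right _

theorem IsHecke.descProd_mul (h : IsHecke q M T) {n j l : ℕ} (hj : j < l) (hl : l < n) :
    descProd T n j * T l = T (l - 1) * descProd T n j := by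
  induction n with
  | zero => omega
  | succ n ih =>
    rw [descProd_succ (by omega)]
    rcases Nat.lt_succ_iff_lt_or_eq.1 hl with h1 | rfl
    · rw [mul_assoc, ih h1, ← mul_assoc, ← mul_assoc, (h.comm (l - 1) n (by omega)).eq]
    · obtain ⟨l, rfl⟩ : ∃ l', l = l' + 1 := ⟨l - 1, by omega⟩
      rw [descProd_succ (by omega), Nat.add_sub_cancel]
      have h1 := (h.commute_descProd_of_le (n := l) (j := j) (Nat.lt_succ_self l)).eq
      have h2 := h.braid l
      calc T (l + 1) * (T l * descProd T l j) * T (l + 1)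
          = T (l + 1) * T l * (descProd T l j * T (l + 1)) := by noncomm_ring
        _ = T (l + 1) * T l * T (l + 1) * descProd T l j := by rw [← h1]; noncomm_ring
        _ = _ := by rw [h2]; noncomm_ring

theorem IsHecke.descProd_mul_self (h : IsHecke q M T) {n l : ℕ} (hl : l < n) (hn : n ≤ M) :
    descProd T n l * T l = (q - 1) • descProd T n l + q • descProd T n (l + 1) := by
  rw [descProd_eq_mul hl, mul_assoc, h.quad l (by omega), mul_add, mul_smul_comm, mul_smul_comm,
    mul_one]

theorem IsHecke.mul_ascProd (h : IsHecke q M T) {n j l : ℕ} (hj : j < l) (hl : l < n) :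
    T l * ascProd T n j = ascProd T n j * T (l - 1) := by
  apply MulOpposite.op_injective
  rw [MulOpposite.op_mul, MulOpposite.op_mul, op_ascProd]
  exact h.op.descProd_mul hj hl

theorem ascProd_eq_mul {n j : ℕ} (h : j < n) : ascProd T n j = T j * ascProd T n (j + 1) := by
  apply MulOpposite.op_injective
  rw [MulOpposite.op_mul, op_ascProd, op_ascProd]
  exact descProd_eq_mul h

theorem IsHecke.commute_ascProd (h : IsHecke q M T) {n j l : ℕ} (hl : l + 1 < j) :
    Commute (T l) (ascProd T n j) := by
  apply MulOpposite.op_injective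
  rw [MulOpposite.op_mul, MulOpposite.op_mul, op_ascProd]
  exact (h.op.commute_descProd hl).eq.symm

theorem IsHecke.mul_ascProd_self (h : IsHecke q M T) {n l : ℕ} (hl : l < n) (hn : n ≤ M) :
    T l * ascProd T n l = (q - 1) • ascProd T n l + q • ascProd T n (l + 1) := by
  apply MulOpposite.op_injective
  rw [MulOpposite.op_mul, MulOpposite.op_add, MulOpposite.op_smul, MulOpposite.op_smul, op_ascProd,
    op_ascProd]
  exact h.op.descProd_mul_self hl hn

theorem relTr_eq_sum (n : ℕ) (b : A) : relTr q T n b =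
    ∑ j ∈ Finset.range (n + 1), (q⁻¹) ^ (n - j) • (ascProd T n j * b * descProd T n j) := by
  induction n generalizing b with
  | zero => simp [relTr, ascProd, descProd]
  | succ n ih =>
    rw [relTr, ih, Finset.sum_range_succ _ (n + 1), ascProd_of_le le_rfl, descProd_of_le le_rfl,
      Nat.sub_self, pow_zero, one_smul, one_mul, mul_one, add_comm]
    congr 1
    refine Finset.sum_congr rfl fun j hj => ?_
    have hj' : j ≤ n := by simpa [Nat.lt_succ_iff] using hj
    rw [ascProd_succ hj', descProd_succ hj', Nat.succ_sub hj', pow_succ, mul_smul_comm,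
      smul_mul_assoc, smul_smul]
    simp only [mul_assoc]

end CosetProducts

section Induction

variable {k : Type} [Field k]

/-- The action of a generator on the induced module, before truncation. -/
def indFun (q : k) {N : Type} [AddCommGroup N] [Module k N] (T : ℕ → Module.End k N) (i : ℕ) :
    Module.End k (ℕ → N) where
  toFun F j := if j < i then T (i - 1) (F j) else if j = i then (q - 1) • F i + F (i + 1) else
    if j = i + 1 then q • F i else T i (F j)
  map_add' F G := by
    ext j
    simp only [Pi.add_apply, map_add, smul_add]
    split_ifs <;> abel
  map_smul' c F := by
    ext j
    simp only [Pi.smul_apply, map_smul, RingHom.id_apply]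
    split_ifs <;> simp only [smul_comm c, smul_add]

section

variable {q : k} {N : Type} [AddCommGroup N] [Module k N] {T : ℕ → Module.End k N} {i j : ℕ}
  {F : ℕ → N}

theorem indFun_lt (h : j < i) : indFun q T i F j = T (i - 1) (F j) := if_pos h

theorem indFun_self : indFun q T i F i = (q - 1) • F i + F (i + 1) := by simp [indFun]

theorem indFun_succ : indFun q T i F (i + 1) = q • F i := by simp [indFun]

theorem indFun_gt (h : i + 1 < j) : indFun q T i F j = T i (F j) := by
  change (if _ then _ else _) = _
  rw [if_neg (by omega), if_neg (by omega), if_neg (by omega)]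

theorem IsHecke.indFun_quad {m : ℕ} (h : IsHecke q m T) (hi : i ≤ m)
    (hF : ∀ j, m + 2 ≤ j → F j = 0) :
    indFun q T i (indFun q T i F) = (q - 1) • indFun q T i F + q • F := by
  ext j
  simp only [Pi.add_apply, Pi.smul_apply]
  have hq : ∀ l < m, ∀ v, T l (T l v) = (q - 1) • T l v + q • v := fun l hl v =>
    congrArg (fun f => f v) (h.quad l hl)
  rcases lt_trichotomy j i with hj | rfl | hj
  · rw [indFun_lt hj, indFun_lt hj, hq _ (by omega)]
  · rw [indFun_self, indFun_self, indFun_succ]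
  · rcases Nat.lt_or_ge (i + 1) j with hj' | hj'
    · rw [indFun_gt hj', indFun_gt hj']
      rcases Nat.lt_or_ge j (m + 2) with hjm | hjm
      · rw [hq _ (by omega)]
      · rw [hF j hjm]; simp
    · obtain rfl : j = i + 1 := by omega
      rw [indFun_succ, indFun_self, indFun_succ]
      module

theorem IsHecke.indFun_braid {m : ℕ} (h : IsHecke q m T) (hi : i + 1 ≤ m) :
    indFun q T (i + 1) (indFun q T i (indFun q T (i + 1) F)) =
      indFun q T i (indFun q T (i + 1) (indFun q T i F)) := by
  have hq : ∀ v, T i (T i v) = (q - 1) • T i v + q • v := fun v =>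
    congrArg (fun f => f v) (h.quad i (by omega))
  have hb : ∀ l v, T (l + 1) (T l (T (l + 1) v)) = T l (T (l + 1) (T l v)) := fun l v =>
    congrArg (fun f => f v) (h.braid l)
  have s1 : ∀ (G : ℕ → N), indFun q T i G (i + 1) = q • G i := fun G => indFun_succ
  have s2 : ∀ (G : ℕ → N), indFun q T (i + 1) G (i + 1 + 1) = q • G (i + 1) := fun G => indFun_succ
  ext j
  rcases Nat.lt_or_ge j i with hj | hj
  · obtain ⟨l, rfl⟩ : ∃ l, i = l + 1 := ⟨i - 1, by omega⟩
    simp (disch := omega) only [indFun_lt, Nat.add_sub_cancel]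
    exact hb l _
  rcases Nat.lt_or_ge (i + 2) j with hj' | hj'
  · simp (disch := omega) only [indFun_gt]
    exact hb i _
  obtain rfl | rfl | rfl : j = i ∨ j = i + 1 ∨ j = i + 1 + 1 := by omega
  · simp (disch := omega) only [indFun_lt, indFun_self, s1, indFun_gt, Nat.add_sub_cancel,
      map_add, map_smul, smul_add, hq]
    module
  · simp (disch := omega) only [indFun_lt, indFun_self, s1, s2, indFun_gt, Nat.add_sub_cancel,
      map_add, map_smul, smul_add]
    module
  · simp (disch := omega) only [indFun_lt, s1, s2, indFun_gt, Nat.add_sub_cancel, map_smul]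

theorem IsHecke.indFun_comm {m : ℕ} (h : IsHecke q m T) {l : ℕ} (hi : i + 1 < l) :
    indFun q T i (indFun q T l F) = indFun q T l (indFun q T i F) := by
  have hc : ∀ a b v, a + 1 < b → T a (T b v) = T b (T a v) := fun a b v hab =>
    congrArg (fun f => f v) (h.comm a b hab).eq
  have s1 : ∀ (l : ℕ) (G : ℕ → N), indFun q T l G (l + 1) = q • G l := fun l G => indFun_succ
  ext j
  obtain hj | rfl | rfl | hj | rfl | rfl | hj : j < i ∨ j = i ∨ j = i + 1 ∨ (i + 1 < j ∧ j < l) ∨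
    j = l ∨ j = l + 1 ∨ l + 1 < j := by omega
  · simp (disch := omega) only [indFun_lt]
    exact hc _ _ _ (by omega)
  · simp (disch := omega) only [indFun_lt, indFun_self, map_add, map_smul]
  · simp (disch := omega) only [indFun_lt, map_smul, s1]
  · obtain ⟨h1, h2⟩ := hj
    simp (disch := omega) only [indFun_lt, indFun_gt]
    exact hc _ _ _ (by omega)
  · simp (disch := omega) only [indFun_gt, indFun_self, map_add, map_smul]
  · simp (disch := omega) only [indFun_gt, s1, map_smul]
  · simp (disch := omega) only [indFun_gt]
    exact hc _ _ _ (by omega)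

end

/-- Sequences vanishing from index `n` on. -/
def supportedBelow (k : Type) [Field k] (N : Type) [AddCommGroup N] [Module k N] (n : ℕ) :
    Submodule k (ℕ → N) where
  carrier := {F | ∀ j, n ≤ j → F j = 0}
  add_mem' hF hG j hj := by simp [hF j hj, hG j hj]
  zero_mem' _ _ := rfl
  smul_mem' c F hF j hj := by simp [hF j hj]

instance (N : Type) [AddCommGroup N] [Module k N] [FiniteDimensional k N] (n : ℕ) :
    FiniteDimensional k (supportedBelow k N n) := by
  let f : supportedBelow k N n →ₗ[k] (Fin n → N) :=
    (LinearMap.funLeft k N (fun i : Fin n => (i : ℕ))) ∘ₗ (supportedBelow k N n).subtype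
  refine Module.Finite.of_injective f fun F G hFG => Subtype.ext (funext fun j => ?_)
  rcases Nat.lt_or_ge j n with h | h
  · exact congrFun hFG ⟨j, h⟩
  · rw [F.2 j h, G.2 j h]

namespace OpRep

/-- The induced representation, from `m` to `m + 1` generators. -/
def ind (q : k) (m : ℕ) (N : OpRep k) : OpRep k where
  carrier := supportedBelow k N.carrier (m + 2)
  op i := if h : i ≤ m then (indFun q N.op i).restrict (p := supportedBelow k N.carrier (m + 2))
    (q := supportedBelow k N.carrier (m + 2)) (fun F hF j hj => by
      rw [indFun_gt (by omega), hF j hj, map_zero]) else 0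

theorem ind_op_apply {q : k} {m : ℕ} {N : OpRep k} {i : ℕ} (hi : i ≤ m)
    (F : supportedBelow k N.carrier (m + 2)) :
    (show supportedBelow k N.carrier (m + 2) from (ind q m N).op i F) =
      (indFun q N.op i F : ℕ → N.carrier) := by
  simp only [ind, dif_pos hi]
  rfl

theorem ind_op_eq_zero {q : k} {m : ℕ} {N : OpRep k} {i : ℕ} (hi : ¬ i ≤ m) :
    (ind q m N).op i = 0 := dif_neg hi

theorem isHecke_ind {q : k} {m : ℕ} {N : OpRep k} (h : IsHecke q m N.op) :
    IsHecke q (m + 1) (ind q m N).op where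
  quad i hi := by
    refine LinearMap.ext fun F => Subtype.ext ?_
    have e := h.indFun_quad (i := i) (F := F.1) (by omega) F.2
    simp only [ind, dif_pos (show i ≤ m by omega)]
    exact e
  braid i := by
    by_cases hi : i + 1 ≤ m
    · refine LinearMap.ext fun F => Subtype.ext ?_
      have e := h.indFun_braid (i := i) (F := F.1) hi
      simp only [ind, dif_pos (show i ≤ m by omega), dif_pos hi]
      exact e
    · rw [ind_op_eq_zero hi, zero_mul, zero_mul, mul_zero, zero_mul]
  comm i j hij := by
    by_cases hj : j ≤ m
    · refine LinearMap.ext fun F => Subtype.ext ?_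
      have e := h.indFun_comm (i := i) (l := j) (F := F.1) hij
      simp only [ind, dif_pos (show i ≤ m by omega), dif_pos hj]
      exact e
    · rw [ind_op_eq_zero hj]; exact Commute.zero_right _
  zero i hi := ind_op_eq_zero (by omega)

end OpRep

end Induction

theorem Finset.sum_range_congr_pair {A : Type*} [AddCommMonoid A] {n i : ℕ} {f g : ℕ → A}
    (hi : i + 1 < n) (h : ∀ j < n, j ≠ i → j ≠ i + 1 → f j = g j)
    (hp : f i + f (i + 1) = g i + g (i + 1)) :
    ∑ j ∈ Finset.range n, f j = ∑ j ∈ Finset.range n, g j := by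
  have hs : ({i, i + 1} : Finset ℕ) ⊆ Finset.range n := by
    intro x hx
    simp only [Finset.mem_insert, Finset.mem_singleton] at hx
    simp only [Finset.mem_range]
    omega
  rw [← Finset.sum_sdiff hs, ← Finset.sum_sdiff (f := g) hs, Finset.sum_pair (by omega),
    Finset.sum_pair (by omega), hp]
  congr 1
  refine Finset.sum_congr rfl fun j hj => ?_
  simp only [Finset.mem_sdiff, Finset.mem_range, Finset.mem_insert, Finset.mem_singleton] at hj
  exact h j hj.1 (by tauto) (by tauto)

namespace OpRep

variable {k : Type} [Field k] {q : k} {m : ℕ}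

/-- The unit-like map into the induced representation attached to a linear map. -/
noncomputable def toInd (q : k) (m : ℕ) (M N : OpRep k) (p : M.carrier →ₗ[k] N.carrier) :
    M.carrier →ₗ[k] (ind q m N).carrier :=
  LinearMap.codRestrict (supportedBelow k N.carrier (m + 2))
    (LinearMap.pi fun j => if j ≤ m + 1 then
      (q⁻¹) ^ (m + 1 - j) • (p ∘ₗ descProd M.op (m + 1) j) else 0)
    (fun v j hj => by simp [LinearMap.pi_apply, show ¬ j ≤ m + 1 by omega])

theorem toInd_apply_of_lt {M N : OpRep k} {p : M.carrier →ₗ[k] N.carrier} (v : M.carrier) {j : ℕ}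
    (hj : m + 1 < j) :
    (show supportedBelow k N.carrier (m + 2) from toInd q m M N p v).1 j = 0 := by
  change (if j ≤ m + 1 then (q⁻¹) ^ (m + 1 - j) • (p ∘ₗ descProd M.op (m + 1) j) else 0 :
    M.carrier →ₗ[k] N.carrier) v = 0
  rw [if_neg (by omega)]; rfl

theorem toInd_apply {M N : OpRep k} {p : M.carrier →ₗ[k] N.carrier} (v : M.carrier) {j : ℕ}
    (hj : j ≤ m + 1) :
    (show supportedBelow k N.carrier (m + 2) from toInd q m M N p v).1 j =
      (q⁻¹) ^ (m + 1 - j) • p (descProd M.op (m + 1) j v) := by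
  change (if j ≤ m + 1 then (q⁻¹) ^ (m + 1 - j) • (p ∘ₗ descProd M.op (m + 1) j) else 0 :
    M.carrier →ₗ[k] N.carrier) v = _
  rw [if_pos hj]; rfl

/-- The counit-like map out of the induced representation attached to a linear map. -/
def ofInd (q : k) (m : ℕ) (M N : OpRep k) (i : N.carrier →ₗ[k] M.carrier) :
    (ind q m N).carrier →ₗ[k] M.carrier where
  toFun F := ∑ j ∈ Finset.range (m + 2), ascProd M.op (m + 1) j (i (F.1 j))
  map_add' F G := by
    rw [← Finset.sum_add_distrib]
    exact Finset.sum_congr rfl fun j _ => by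
      change ascProd M.op (m + 1) j (i (F.1 j + G.1 j)) = _
      rw [map_add, map_add]
  map_smul' c F := by
    rw [Finset.smul_sum]
    exact Finset.sum_congr rfl fun j _ => by
      change ascProd M.op (m + 1) j (i (c • F.1 j)) = _
      rw [map_smul, map_smul]; rfl

theorem ofInd_apply {M N : OpRep k} {i : N.carrier →ₗ[k] M.carrier}
    (F : supportedBelow k N.carrier (m + 2)) :
    ofInd q m M N i F = ∑ j ∈ Finset.range (m + 2), ascProd M.op (m + 1) j (i (F.1 j)) := rfl

theorem toInd_intertwines {M N : OpRep k} (hq : q ≠ 0) (hM : IsHecke q (m + 1) M.op)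
    {p : M.carrier →ₗ[k] N.carrier} (hp : ∀ l < m, ∀ v, p (M.op l v) = N.op l (p v)) :
    Intertwines M (ind q m N) (toInd q m M N p) := by
  intro i v
  by_cases hi : i ≤ m
  swap
  · rw [hM.zero i (by omega)]
    rw [ind_op_eq_zero hi]; simp
  refine Subtype.ext (funext fun j => ?_)
  refine Eq.trans ?_ (congrFun (ind_op_apply (q := q) (N := N) hi (toInd q m M N p v)) j).symm
  rcases Nat.lt_or_ge (m + 1) j with hjm | hjm
  · rw [indFun_gt (by omega)]
    rw [toInd_apply_of_lt (q := q) v (by omega), map_zero]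
    exact toInd_apply_of_lt (q := q) _ (by omega)
  refine (toInd_apply (q := q) (M.op i v) hjm).trans ?_
  rcases lt_trichotomy j i with hj | rfl | hj
  · rw [indFun_lt hj]
    rw [toInd_apply (q := q) v hjm, ← Module.End.mul_apply, hM.descProd_mul hj (by omega),
      Module.End.mul_apply, hp _ (by omega), map_smul]
  · rw [indFun_self]
    rw [toInd_apply (q := q) v hjm, toInd_apply (q := q) v (by omega), ← Module.End.mul_apply,
      hM.descProd_mul_self (by omega) le_rfl, show m + 1 - j = m + 1 - (j + 1) + 1 by omega, pow_succ]
    simp only [LinearMap.add_apply, LinearMap.smul_apply, map_add, map_smul]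
    match_scalars <;> field_simp
  · rcases Nat.lt_or_ge (i + 1) j with hj' | hj'
    · rw [indFun_gt hj', toInd_apply (q := q) v hjm, ← Module.End.mul_apply,
        ← (hM.commute_descProd hj').eq, Module.End.mul_apply, hp _ (by omega), map_smul]
    · obtain rfl : j = i + 1 := by omega
      rw [indFun_succ, toInd_apply (q := q) v (by omega), ← Module.End.mul_apply,
        ← descProd_eq_mul (by omega), show m + 1 - i = m + 1 - (i + 1) + 1 by omega, pow_succ]
      match_scalars
      field_simp

theorem ofInd_intertwines {M N : OpRep k} (hM : IsHecke q (m + 1) M.op)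
    {i : N.carrier →ₗ[k] M.carrier} (hi : ∀ l < m, ∀ v, i (N.op l v) = M.op l (i v)) :
    Intertwines (ind q m N) M (ofInd q m M N i) := by
  intro l F
  by_cases hl : l ≤ m
  swap
  · rw [hM.zero l (by omega)]
    rw [ind_op_eq_zero hl]; simp
  refine (ofInd_apply (q := q) (m := m) (M := M) ((ind q m N).op l F)).trans ?_
  rw [show ((ind q m N).op l F).1 = _ from ind_op_apply (q := q) (N := N) hl F]
  rw [show M.op l (ofInd q m M N i F) = _ from congrArg (M.op l) (ofInd_apply (q := q) F), map_sum]
  refine Finset.sum_range_congr_pair (i := l) (by omega) (fun j hj h1 h2 => ?_) ?_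
  · rcases Nat.lt_or_ge j l with h | h
    · rw [indFun_lt h, hi _ (by omega), ← Module.End.mul_apply, ← Module.End.mul_apply,
        hM.mul_ascProd h (by omega)]
    · rw [indFun_gt (by omega), hi _ (by omega), ← Module.End.mul_apply, ← Module.End.mul_apply,
        (hM.commute_ascProd (by omega)).eq]
  · rw [indFun_self, indFun_succ, ← Module.End.mul_apply, hM.mul_ascProd_self (by omega) le_rfl,
      ← Module.End.mul_apply (M.op l), ← ascProd_eq_mul (by omega)]
    simp only [LinearMap.add_apply, LinearMap.smul_apply, map_add, map_smul]
    module

theorem ofInd_comp_toInd {M N : OpRep k} {p : M.carrier →ₗ[k] N.carrier}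
    {i : N.carrier →ₗ[k] M.carrier} :
    ofInd q m M N i ∘ₗ toInd q m M N p = relTr q M.op (m + 1) (i ∘ₗ p) := by
  refine LinearMap.ext fun v => ?_
  refine (ofInd_apply (q := q) (m := m) (M := M) (toInd q m M N p v)).trans ?_
  rw [relTr_eq_sum, LinearMap.sum_apply]
  refine Finset.sum_congr rfl fun j hj => ?_
  rw [toInd_apply (q := q) v (by simpa [Nat.lt_succ_iff] using hj)]
  simp only [map_smul]
  rfl

/-- Forgetting all but the first `m` operators. -/
def trunc (m : ℕ) (M : OpRep k) : OpRep k where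
  carrier := M.carrier
  op i := if i < m then M.op i else 0

theorem trunc_op_of_lt {M : OpRep k} {i : ℕ} (hi : i < m) : (trunc m M).op i = M.op i := if_pos hi

theorem trunc_op_of_not_lt {M : OpRep k} {i : ℕ} (hi : ¬ i < m) : (trunc m M).op i = 0 := if_neg hi

theorem isHecke_trunc {M : OpRep k} (hM : IsHecke q (m + 1) M.op) :
    IsHecke q m (trunc m M).op where
  quad i hi := by
    simp only [trunc, if_pos hi]
    exact hM.quad i (by omega)
  braid i := by
    by_cases h : i + 1 < m
    · simp only [trunc, if_pos h, if_pos (show i < m by omega)]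
      exact hM.braid i
    · rw [trunc_op_of_not_lt h, zero_mul, zero_mul, mul_zero, zero_mul]
  comm i j hij := by
    by_cases h : j < m
    · simp only [trunc, if_pos h, if_pos (show i < m by omega)]
      exact hM.comm i j hij
    · rw [trunc_op_of_not_lt h]; exact Commute.zero_right _
  zero i hi := trunc_op_of_not_lt (by omega)

theorem isHecke_sub {M : OpRep k} (hM : IsHecke q m M.op) {e : Module.End k M.carrier}
    (he : M.IsEndo e) : IsHecke q m (M.sub e he).op where
  quad i hi := LinearMap.ext fun v => Subtype.ext (congrArg (fun f => f v.1) (hM.quad i hi))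
  braid i := LinearMap.ext fun v => Subtype.ext (congrArg (fun f => f v.1) (hM.braid i))
  comm i j hij := LinearMap.ext fun v =>
    Subtype.ext (congrArg (fun f => f v.1) (hM.comm i j hij).eq)
  zero i hi := LinearMap.ext fun v => Subtype.ext (congrArg (fun f => f v.1) (hM.zero i hi))

/-- Relative traces of elements commuting with the first generators are endomorphisms. -/
theorem isEndo_relTr {M : OpRep k} (hq : q ≠ 0) (hM : IsHecke q (m + 1) M.op)
    {b : Module.End k M.carrier} (hb : (trunc m M).IsEndo b) :
    M.IsEndo (relTr q M.op (m + 1) b) := by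
  have h1 : ∀ l < m, ∀ v, b (M.op l v) = M.op l (b v) := fun l hl v => by
    have := congrArg (fun f => f v) (hb l).eq
    rw [trunc_op_of_lt hl] at this
    exact this
  have : _ = relTr q M.op (m + 1) b := ofInd_comp_toInd (q := q) (m := m) (M := M)
    (N := trunc m M) (p := LinearMap.id) (i := b)
  rw [← this]
  refine isEndo_iff.2 ((ofInd_intertwines hM fun l hl v => ?_).comp
    (toInd_intertwines hq hM fun l hl v => ?_))
  · rw [trunc_op_of_lt hl]; exact h1 l hl v
  · rw [trunc_op_of_lt hl]; rfl

theorem trunc_isEndo_of_commute {M : OpRep k} {b : Module.End k M.carrier}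
    (h : ∀ l < m, Commute b (M.op l)) : (trunc m M).IsEndo b := fun i => by
  by_cases hi : i < m
  · rw [trunc_op_of_lt hi]; exact h i hi
  · rw [trunc_op_of_not_lt hi]; exact Commute.zero_right _

/-- The step from `m` to `m + 1` generators, assuming that there are only finitely many
indecomposables which are not relatively projective. -/
theorem finitelyMany_step (hq : q ≠ 0)
    (h1 : FinitelyMany fun M : OpRep k => M.Indec ∧ IsHecke q m M.op)
    (h2 : FinitelyMany fun M : OpRep k => M.Indec ∧ IsHecke q (m + 1) M.op ∧
      TraceNil q (m + 1) M.op) :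
    FinitelyMany fun M : OpRep k => M.Indec ∧ IsHecke q (m + 1) M.op := by
  obtain ⟨L, hL⟩ := h1
  have hfin : ∀ L : List (OpRep k), FinitelyMany fun W : OpRep k =>
      W.Indec ∧ ∃ N ∈ L, W.Divides (ind q m N) := by
    intro L
    induction L with
    | nil => exact ⟨[], fun W hW => by simp at hW⟩
    | cons N L ih =>
      refine (FinitelyMany.or (finitelyMany_divides (ind q m N)) ih).mono ?_
      rintro W ⟨hW, N', hN', hd⟩
      rcases List.mem_cons.1 hN' with rfl | h
      · exact Or.inl ⟨hW, hd⟩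
      · exact Or.inr ⟨hW, N', h, hd⟩
  refine (h2.or (hfin L)).mono ?_
  rintro M ⟨hM, hH⟩
  by_cases hT : TraceNil q (m + 1) M.op
  · exact Or.inl ⟨hM, hH, hT⟩
  right
  refine ⟨hM, ?_⟩
  obtain ⟨j, hj⟩ := not_forall.1 hT
  set b := jm q M.op (m + 1) ^ j with hb
  have hbE : (trunc m M).IsEndo b := trunc_isEndo_of_commute fun l hl =>
    ((hH.commute_op_jm (by omega) (by omega)).symm.pow_left j)
  have hu : IsUnit (relTr q M.op (m + 1) b) :=
    (hM.isUnit_or_isNilpotent (isEndo_relTr hq hH hbE)).resolve_right hj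
  let good : Module.End k M.carrier → Prop := fun a => IsUnit (relTr q M.op (m + 1) (a * b))
  have good_one : good 1 := by
    change IsUnit (relTr q M.op (m + 1) (1 * b))
    rwa [one_mul]
  have good_zero : ¬ good 0 := by
    change ¬ IsUnit (relTr q M.op (m + 1) (0 * b))
    rw [zero_mul, ← zero_smul k (0 : Module.End k M.carrier), relTr_smul, zero_smul]
    have := hM.1
    exact not_isUnit_zero
  have good_add : ∀ x y : Module.End k M.carrier, (trunc m M).IsEndo x → (trunc m M).IsEndo y →
      good (x + y) → good x ∨ good y := fun x y hx hy hxy => by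
    change IsUnit (relTr q M.op (m + 1) ((x + y) * b)) at hxy
    rw [add_mul, relTr_add] at hxy
    exact hM.isUnit_or_of_add (isEndo_relTr hq hH (IsEndo.mul hx hbE))
      (isEndo_relTr hq hH (IsEndo.mul hy hbE)) hxy
  obtain ⟨e, he, hid, hgood, hI⟩ :=
    exists_good_indec_sub (trunc m M) good good_one good_zero good_add
  obtain ⟨N, hN, φ, hφ⟩ := hL _ ⟨hI, isHecke_sub (isHecke_trunc hH) he⟩
  refine ⟨N, hN, ?_⟩
  set p : M.carrier →ₗ[k] N.carrier := (φ : _ →ₗ[k] _) ∘ₗ (trunc m M).subProj e he ∘ₗ b with hp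
  set i : N.carrier →ₗ[k] M.carrier := (trunc m M).subIncl e he ∘ₗ (φ.symm : _ →ₗ[k] _) with hi
  have hφ' : Intertwines N ((trunc m M).sub e he) (φ.symm : _ →ₗ[k] _) := fun l v =>
    φ.injective (by
      have := hφ l (φ.symm v)
      simp only [LinearEquiv.coe_coe, LinearEquiv.apply_symm_apply] at this ⊢
      exact this.symm)
  have hpI : Intertwines (trunc m M) N p :=
    Intertwines.comp hφ ((subProj_intertwines _ e he).comp (isEndo_iff.1 hbE))
  have hiI : Intertwines N (trunc m M) i := (subIncl_intertwines _ e he).comp hφ'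
  have hop : ∀ l < m, (trunc m M).op l = M.op l := fun l hl => if_pos hl
  refine divides_of_isUnit (s := toInd q m M N p) (r := ofInd q m M N i)
    (toInd_intertwines hq hH fun l hl v => hop l hl ▸ hpI l v)
    (ofInd_intertwines hH fun l hl v => hop l hl ▸ hiI l v) ?_
  rw [ofInd_comp_toInd]
  have : i ∘ₗ p = (show Module.End k M.carrier from e) * b := by
    refine LinearMap.ext fun v => ?_
    have := φ.symm_apply_apply ((trunc m M).subProj e he (b v))
    exact congrArg ((trunc m M).subIncl e he) this
  rw [this]
  exact hgood

theorem finitelyMany_zero : FinitelyMany fun M : OpRep k => M.Indec ∧ IsHecke q 0 M.op := by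
  refine ⟨[{ carrier := k, op := fun _ => 0 }], ?_⟩
  rintro M ⟨hM, hH⟩
  refine ⟨_, List.mem_singleton.2 rfl, ?_⟩
  have h0 : ∀ i, M.op i = 0 := fun i => hH.zero i (Nat.zero_le i)
  have hall : ∀ e : Module.End k M.carrier, M.IsEndo e := fun e i => by
    rw [h0]; exact Commute.zero_right e
  obtain ⟨hnt, hM⟩ := hM
  obtain ⟨v, hv⟩ := exists_ne (0 : M.carrier)
  obtain ⟨ξ, hξ⟩ : ∃ ξ : M.carrier →ₗ[k] k, ξ v = 1 :=
    Module.Projective.exists_dual_eq_one k hv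
  have := hM (ξ.smulRight v) (hall _) (by ext x; simp [hξ])
  rcases this with h | h
  · exact absurd (by simpa [hξ] using congrArg (fun f => f v) h) hv
  · refine iso_of_inverse ξ (LinearMap.toSpanSingleton k _ v) (fun i w => by simp [h0]) ?_ ?_
    · ext; simp [hξ]
    · ext x
      simpa using congrArg (fun f => f x) h

/-- Finiteness for `m` generators follows from finiteness of the relatively nilpotent
indecomposables at each level. -/
theorem finitelyMany_of_traceNil (hq : q ≠ 0) (m : ℕ)
    (h : ∀ l < m, FinitelyMany fun M : OpRep k => M.Indec ∧ IsHecke q (l + 1) M.op ∧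
      TraceNil q (l + 1) M.op) :
    FinitelyMany fun M : OpRep k => M.Indec ∧ IsHecke q m M.op := by
  induction m with
  | zero => exact finitelyMany_zero
  | succ m ih => exact finitelyMany_step hq (ih fun l hl => h l (by omega)) (h m (by omega))

end OpRep

section Weights

variable {k : Type} [Field k] {A : Type} [Ring A] [Algebra k A]

theorem SemiconjBy.aeval_right {a x y : A} (h : SemiconjBy a x y) (p : Polynomial k) :
    SemiconjBy a (Polynomial.aeval x p) (Polynomial.aeval y p) := by
  induction p using Polynomial.induction_on' with
  | add p r hp hr => rw [map_add, map_add]; exact hp.add_right hr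
  | monomial n c =>
    rw [Polynomial.aeval_monomial, Polynomial.aeval_monomial]
    have h1 : SemiconjBy a (algebraMap k A c) (algebraMap k A c) :=
      (Algebra.commutes c a).symm
    exact h1.mul_right (h.pow_right n)

/-- Orthogonal idempotent polynomials for an element annihilated by a power of a product of
distinct linear factors. -/
theorem exists_spectral_polynomials (S : Finset k) (N : ℕ) :
    ∃ P : k → Polynomial k, ∀ (B : Type) [CommRing B] [Algebra k B] (y : B),
      (∏ a ∈ S, (y - algebraMap k B a)) ^ N = 0 →
      (∑ a ∈ S, Polynomial.aeval y (P a) = 1) ∧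
      (∀ a b, a ≠ b → Polynomial.aeval y (P a) * Polynomial.aeval y (P b) = 0) ∧
      (∀ a, (y - algebraMap k B a) ^ N * Polynomial.aeval y (P a) = 0) ∧
      (∀ a ∉ S, Polynomial.aeval y (P a) = 0) := by
  classical
  have hcop : Pairwise fun a b : S =>
      IsCoprime ((Polynomial.X - Polynomial.C (a : k)) ^ N)
        ((Polynomial.X - Polynomial.C (b : k)) ^ N) := fun a b hab =>
    (Polynomial.pairwise_coprime_X_sub_C Subtype.val_injective hab).pow
  rcases S.eq_empty_or_nonempty with rfl | hS
  · refine ⟨0, fun B _ _ y hy => ?_⟩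
    have h01 : (1 : B) = 0 := by simpa using hy
    have : Subsingleton B := ⟨fun u v => by rw [← one_mul u, ← one_mul v, h01, zero_mul, zero_mul]⟩
    exact ⟨Subsingleton.elim _ _, fun _ _ _ => Subsingleton.elim _ _,
      fun _ => Subsingleton.elim _ _, fun _ _ => Subsingleton.elim _ _⟩
  have : Nonempty S := hS.to_subtype
  obtain ⟨μ, hμ⟩ := exists_sum_eq_one_iff_pairwise_coprime'.2 hcop
  let D : k → Polynomial k := fun a => ∏ b ∈ S.erase a, (Polynomial.X - Polynomial.C b) ^ N
  let P : k → Polynomial k := fun a => if h : a ∈ S then μ ⟨a, h⟩ * D a else 0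
  have hD : ∀ a : S, ∏ b ∈ {a}ᶜ, (Polynomial.X - Polynomial.C (b : k)) ^ N = D a := by
    intro a
    refine Finset.prod_bij (fun b _ => (b : k)) ?_ ?_ ?_ ?_
    · intro b hb
      simp only [Finset.mem_compl, Finset.mem_singleton] at hb
      exact Finset.mem_erase.2 ⟨fun h => hb (Subtype.ext h), b.2⟩
    · intro b _ c _ h
      exact Subtype.ext h
    · intro b hb
      obtain ⟨h1, h2⟩ := Finset.mem_erase.1 hb
      exact ⟨⟨b, h2⟩, by simpa [Subtype.ext_iff] using h1, rfl⟩
    · intro b _; rfl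
  refine ⟨P, fun B _ _ y hy => ?_⟩
  have hfac : ∀ a, Polynomial.aeval y ((Polynomial.X - Polynomial.C a) ^ N : Polynomial k) =
      (y - algebraMap k B a) ^ N := fun a => by simp
  have hprod : ∏ a ∈ S, (y - algebraMap k B a) ^ N = 0 := by rw [Finset.prod_pow, hy]
  have hkill : ∀ a, (y - algebraMap k B a) ^ N * Polynomial.aeval y (P a) = 0 := by
    intro a
    by_cases ha : a ∈ S
    · simp only [P, dif_pos ha, D, map_mul, map_prod, hfac]
      rw [mul_left_comm, Finset.mul_prod_erase S (fun a => (y - algebraMap k B a) ^ N) ha, hprod,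
        mul_zero]
    · simp [P, dif_neg ha]
  refine ⟨?_, ?_, hkill, fun a ha => by simp [P, dif_neg ha]⟩
  · rw [← map_sum, ← Finset.sum_attach]
    have : ∑ a ∈ S.attach, P a = 1 := by
      rw [← hμ]
      refine Finset.sum_congr rfl fun a _ => ?_
      simp only [P, dif_pos a.2, hD]
    rw [this, map_one]
  · intro a b hab
    by_cases hb : b ∈ S
    · by_cases ha : a ∈ S
      · have : P b = (Polynomial.X - Polynomial.C a) ^ N *
            (μ ⟨b, hb⟩ * ∏ c ∈ (S.erase b).erase a, (Polynomial.X - Polynomial.C c) ^ N) := by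
          simp only [P, dif_pos hb, D]
          rw [← Finset.mul_prod_erase (S.erase b) _ (Finset.mem_erase.2 ⟨hab, ha⟩)]
          ring
        rw [this, map_mul, hfac, ← mul_assoc, mul_comm (Polynomial.aeval y (P a)), hkill, zero_mul]
      · simp [P, dif_neg ha]
    · simp [P, dif_neg hb]

/-- The subalgebra generated by the Jucys-Murphy elements. -/
def jmAlg (q : k) (T : ℕ → A) : Subalgebra k A := Algebra.adjoin k (Set.range (jm q T))

/-- A complete system of idempotents projecting to simultaneous generalized eigenspaces of the
Jucys-Murphy elements. -/
structure IsWeightSystem (q : k) (m : ℕ) (T : ℕ → A) (f : (ℕ → k) → A) : Prop where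
  mem : ∀ c, f c ∈ jmAlg q T
  idem : ∀ c, f c * f c = f c
  congr : ∀ c d, (∀ i ≤ m, c i = d i) → f c = f d
  swap : ∀ i < m, ∀ c, inter q T i * f c = f (c ∘ Equiv.swap i (i + 1)) * inter q T i
  sep : ∀ t ≤ m, ∀ b, Commute b (jm q T t) → ∀ c d, d t ≠ c t → f d * b * f c = 0
  nil : ∀ i ≤ m, ∀ c, IsNilpotent ((jm q T i - algebraMap k A (c i)) * f c)
  complete : ∀ S : AddSubgroup A, (∀ c, f c ∈ S) → 1 ∈ S
  apply_zero : ∀ c, f c ≠ 0 → c 0 = 1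
  injective : ∀ c, f c ≠ 0 → ∀ i ≤ m, ∀ j ≤ m, c i = c j → i = j
  pow : ∀ c, f c ≠ 0 → ∀ i ≤ m, ∃ j ≤ m, c i = q ^ j
  inverse : ∀ i < m, ∃ d ∈ jmAlg q T, (jm q T i - jm q T (i + 1)) * d = 1

variable {q : k} {m : ℕ} {T : ℕ → A}

theorem IsHecke.exists_isWeightSystem [FiniteDimensional k A] (h : IsHecke q m T) (hq : q ≠ 0)
    (hnil : TraceNil q m T) (hord : orderOf q = m + 1) :
    ∃ f, IsWeightSystem q m T f := by
  classical
  obtain ⟨Λ, _, _, ι, ℓ, hJ, hmem⟩ : ∃ (Λ : Type) (_ : CommRing Λ) (_ : Algebra k Λ)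
      (ι : Λ →ₐ[k] A) (ℓ : ℕ → Λ), IsJMAlg q T ι ℓ ∧ ∀ x, ι x ∈ jmAlg q T := by
    let S : Subalgebra k A := Algebra.adjoin k (Set.range (jm q T))
    have : IsMulCommutative S := Algebra.isMulCommutative_adjoin k (by
      rintro _ ⟨i, rfl⟩ _ ⟨j, rfl⟩
      exact h.commute_jm i j)
    let : CommRing S := { (inferInstance : Ring S) with mul_comm := this.is_comm.comm }
    exact ⟨S, inferInstance, S.algebra, S.val,
      fun i => ⟨jm q T i, Algebra.subset_adjoin ⟨i, rfl⟩⟩, ⟨Subtype.val_injective, fun _ => rfl,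
      FiniteDimensional.finiteDimensional_submodule (Subalgebra.toSubmodule S)⟩, fun x => x.2⟩
  have hfin := hJ.fin
  set R : Finset k := (Finset.range (m + 1)).image (q ^ ·) with hR
  -- characters at primes
  have hchar : ∀ I : Ideal Λ, I.IsPrime → ∃ (K : Type) (_ : Field K) (_ : Algebra k K)
      (χ : Λ →ₐ[k] K), ∀ x, χ x = 0 ↔ x ∈ I := by
    intro I hI
    refine ⟨FractionRing (Λ ⧸ I), inferInstance, inferInstance,
      (IsScalarTower.toAlgHom k (Λ ⧸ I) (FractionRing (Λ ⧸ I))).comp (Ideal.Quotient.mkₐ k I),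
      fun x => ?_⟩
    rw [AlgHom.comp_apply, IsScalarTower.coe_toAlgHom',
      (injective_iff_map_eq_zero' _).1 (IsFractionRing.injective (Λ ⧸ I) (FractionRing (Λ ⧸ I)))]
    exact Ideal.Quotient.eq_zero_iff_mem
  have hnilp : ∀ i ≤ m, IsNilpotent (∏ a ∈ R, (ℓ i - algebraMap k Λ a)) := by
    intro i hi
    rw [nilpotent_iff_mem_prime]
    intro I hI
    obtain ⟨K, _, _, χ, hχ⟩ := hchar I hI
    rw [← hχ, map_prod]
    obtain ⟨j, hj, hij⟩ := (hJ.char_eq_pow h hq hnil hord χ).1 i hi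
    refine Finset.prod_eq_zero (i := q ^ j)
      (Finset.mem_image.2 ⟨j, Finset.mem_range.2 (by omega), rfl⟩) ?_
    rw [map_sub, AlgHom.commutes, hij, sub_self]
  obtain ⟨N, hN⟩ : ∃ N, ∀ i ≤ m, (∏ a ∈ R, (ℓ i - algebraMap k Λ a)) ^ N = 0 := by
    choose! n hn using hnilp
    refine ⟨∑ i ∈ Finset.range (m + 1), n i, fun i hi => ?_⟩
    exact pow_eq_zero_of_le (Finset.single_le_sum (fun _ _ => Nat.zero_le _)
      (Finset.mem_range.2 (by omega))) (hn i hi)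
  obtain ⟨P, hP⟩ := exists_spectral_polynomials R N
  set E : ℕ → k → Λ := fun i a => Polynomial.aeval (ℓ i) (P a) with hE
  have hEs : ∀ i ≤ m, ∑ a ∈ R, E i a = 1 := fun i hi => (hP Λ (ℓ i) (hN i hi)).1
  have hEo : ∀ i ≤ m, ∀ a b, a ≠ b → E i a * E i b = 0 := fun i hi => (hP Λ (ℓ i) (hN i hi)).2.1
  have hEk : ∀ i ≤ m, ∀ a, (ℓ i - algebraMap k Λ a) ^ N * E i a = 0 :=
    fun i hi => (hP Λ (ℓ i) (hN i hi)).2.2.1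
  have hEz : ∀ i ≤ m, ∀ a ∉ R, E i a = 0 := fun i hi => (hP Λ (ℓ i) (hN i hi)).2.2.2
  have hEi : ∀ i ≤ m, ∀ a, E i a * E i a = E i a := by
    intro i hi a
    by_cases ha : a ∈ R
    · calc E i a * E i a = E i a * ∑ b ∈ R, E i b := by
            rw [Finset.mul_sum, Finset.sum_eq_single a (fun b _ hb => hEo i hi a b hb.symm)
              (fun h => absurd ha h)]
        _ = E i a := by rw [hEs i hi, mul_one]
    · rw [hEz i hi a ha, mul_zero]
  have hιE : ∀ i a, ι (E i a) = Polynomial.aeval (jm q T i) (P a) := fun i a => by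
    rw [hE, ← Polynomial.aeval_algHom_apply, hJ.apply]
  set F : (ℕ → k) → Λ := fun c => ∏ i ∈ Finset.range (m + 1), E i (c i) with hF
  have hFi : ∀ c, F c * F c = F c := fun c => by
    simp only [hF]
    rw [← Finset.prod_mul_distrib]
    exact Finset.prod_congr rfl fun i hi => hEi i (by simpa [Nat.lt_succ_iff] using hi) _
  have hFE : ∀ c, ∀ i ≤ m, F c * E i (c i) = F c := fun c i hi => by
    simp only [hF]
    rw [← Finset.mul_prod_erase _ _ (Finset.mem_range.2 (show i < m + 1 by omega)), mul_right_comm,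
      hEi i hi]
  have hFk : ∀ c, ∀ i ≤ m, (ℓ i - algebraMap k Λ (c i)) ^ N * F c = 0 := fun c i hi => by
    rw [← hFE c i hi, mul_left_comm, hEk i hi, mul_zero]
  have hFχ : ∀ c, ι (F c) ≠ 0 → ∃ (K : Type) (_ : Field K) (_ : Algebra k K) (χ : Λ →ₐ[k] K),
      ∀ i ≤ m, χ (ℓ i) = algebraMap k K (c i) := by
    intro c hc
    have h0 : ¬ IsNilpotent (F c) := by
      rintro ⟨n, hn⟩
      apply hc
      have : IsIdempotentElem (F c) := hFi c
      rcases Nat.eq_zero_or_pos n with rfl | hnp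
      · have h01 : (1 : Λ) = 0 := by simpa using hn
        rw [← mul_one (F c), h01, mul_zero, map_zero]
      · rw [this.pow_eq (by omega)] at hn
        rw [hn, map_zero]
    rw [nilpotent_iff_mem_prime] at h0
    push Not at h0
    obtain ⟨I, hI, hFI⟩ := h0
    obtain ⟨K, _, _, χ, hχ⟩ := hchar I hI
    refine ⟨K, inferInstance, inferInstance, χ, fun i hi => ?_⟩
    have h1 := congrArg χ (hFk c i hi)
    rw [map_mul, map_pow, map_sub, AlgHom.commutes, map_zero] at h1
    rcases mul_eq_zero.1 h1 with h2 | h2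
    · exact sub_eq_zero.1 (IsReduced.eq_zero _ ⟨N, h2⟩)
    · exact absurd ((hχ _).1 h2) hFI
  have hjm : ∀ i, jm q T i ∈ jmAlg q T := fun i => Algebra.subset_adjoin ⟨i, rfl⟩
  refine ⟨fun c => ι (F c), fun c => hmem _, fun c => by rw [← map_mul, hFi], ?_, ?_, ?_, ?_, ?_, ?_,
    ?_, ?_, ?_⟩
  · intro c d hcd
    congr 1
    exact Finset.prod_congr rfl fun i hi => by rw [hcd i (by simpa [Nat.lt_succ_iff] using hi)]
  · intro i hi c
    set s := Equiv.swap i (i + 1) with hs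
    have h1 : ∀ j a, SemiconjBy (inter q T i) (ι (E j a)) (ι (E (s j) a)) := by
      intro j a
      rw [hιE, hιE]
      refine SemiconjBy.aeval_right ?_ _
      by_cases hj1 : j = i
      · subst hj1
        rw [hs, Equiv.swap_apply_left]
        exact h.inter_mul_jm hq j
      by_cases hj2 : j = i + 1
      · subst hj2
        rw [hs, Equiv.swap_apply_right]
        exact h.inter_mul_jm_succ hq i
      · rw [hs, Equiv.swap_apply_of_ne_of_ne hj1 hj2]
        exact h.inter_commute_jm hj1 hj2
    have h2 : ∀ t : Finset ℕ, SemiconjBy (inter q T i) (ι (∏ j ∈ t, E j (c j)))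
        (ι (∏ j ∈ t, E (s j) (c j))) := by
      intro t
      induction t using Finset.induction_on with
      | empty => simp
      | insert j t hj ih =>
        rw [Finset.prod_insert hj, Finset.prod_insert hj, map_mul, map_mul]
        exact (h1 j _).mul_right ih
    have h3 : ∏ j ∈ Finset.range (m + 1), E (s j) (c j) = F (c ∘ s) := by
      refine Finset.prod_equiv s (fun j => ?_) (fun j _ => ?_)
      · simp only [Finset.mem_range]
        by_cases hj1 : j = i
        · subst hj1
          rw [hs, Equiv.swap_apply_left]; omega
        by_cases hj2 : j = i + 1
        · subst hj2
          rw [hs, Equiv.swap_apply_right]; omega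
        · rw [hs, Equiv.swap_apply_of_ne_of_ne hj1 hj2]
      · simp [hs]
    rw [← h3]
    exact h2 _
  · intro t ht b hb c d hcd
    have h1 : Commute b (ι (E t (c t))) := by
      rw [hιE]; exact SemiconjBy.aeval_right hb _
    rw [← hFE c t ht, mul_comm (F c), map_mul, mul_assoc, ← mul_assoc b, h1.eq, mul_assoc,
      ← mul_assoc, ← map_mul, ← hFE d t ht, mul_assoc, hEo t ht _ _ hcd, mul_zero, map_zero,
      zero_mul]
  · intro i hi c
    have h1 : IsNilpotent ((ℓ i - algebraMap k Λ (c i)) * F c) := by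
      refine ⟨N + 1, ?_⟩
      calc ((ℓ i - algebraMap k Λ (c i)) * F c) ^ (N + 1) = ((ℓ i - algebraMap k Λ (c i)) ^ N * F c) *
            ((ℓ i - algebraMap k Λ (c i)) * F c ^ N) := by
            generalize ℓ i - algebraMap k Λ (c i) = z
            ring
        _ = 0 := by rw [hFk c i hi, zero_mul]
    have := h1.map ι
    rwa [map_mul, map_sub, hJ.apply, AlgHom.commutes] at this
  · intro S hS
    have key : ∀ s t, s + t = m + 1 → ∀ c : ℕ → k, ι (∏ i ∈ Finset.range t, E i (c i)) ∈ S := by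
      intro s
      induction s with
      | zero =>
        intro t ht c
        obtain rfl : t = m + 1 := by omega
        exact hS c
      | succ s ih =>
        intro t ht c
        rw [← mul_one (∏ i ∈ Finset.range t, E i (c i)), ← hEs t (by omega), Finset.mul_sum, map_sum]
        refine S.sum_mem fun a _ => ?_
        have := ih (t + 1) (by omega) (Function.update c t a)
        rw [Finset.prod_range_succ, Function.update_self] at this
        convert this using 4 with i hi
        rw [Function.update_of_ne (by simpa using (Finset.mem_range.1 hi).ne)]
    simpa using key (m + 1) 0 (by omega) 0
  · intro c hc
    obtain ⟨K, _, _, χ, hχ⟩ := hFχ c hc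
    have := hχ 0 (Nat.zero_le _)
    rw [hJ.zero, map_one] at this
    exact (algebraMap k K).injective (by rw [← this, map_one])
  · intro c hc i hi j hj hij
    obtain ⟨K, _, _, χ, hχ⟩ := hFχ c hc
    exact (hJ.char_eq_pow h hq hnil hord χ).2 i hi j hj (by rw [hχ i hi, hχ j hj, hij])
  · intro c hc i hi
    obtain ⟨K, _, _, χ, hχ⟩ := hFχ c hc
    obtain ⟨j, hj, hij⟩ := (hJ.char_eq_pow h hq hnil hord χ).1 i hi
    exact ⟨j, hj, (algebraMap k K).injective (by rw [← hχ i hi, hij])⟩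
  · intro i hi
    have : IsUnit (ℓ i - ℓ (i + 1)) := by
      by_contra hu
      obtain ⟨I, hI, hmem⟩ := exists_max_ideal_of_mem_nonunits hu
      obtain ⟨K, _, _, χ, hχ⟩ := hchar I hI.isPrime
      have h1 := (hχ _).2 hmem
      rw [map_sub, sub_eq_zero] at h1
      have := (hJ.char_eq_pow h hq hnil hord χ).2 i (by omega) (i + 1) (by omega) h1
      omega
    obtain ⟨u, hu⟩ := this
    refine ⟨ι ↑u⁻¹, hmem _, ?_⟩
    rw [← hJ.apply, ← hJ.apply, ← map_sub, ← map_mul, ← hu, Units.mul_inv, map_one]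

end Weights

section Weighted

variable {k : Type} [Field k] {A : Type} [Ring A] [Algebra k A]

/-- Intertwining elements `φ`, commuting elements `L` and a complete system of weight idempotents
`f`, at a root of unity `q` of order `m + 1`. -/
structure IsWeighted (q : k) (m : ℕ) (L φ : ℕ → A) (Λ : Subalgebra k A) (f : (ℕ → k) → A) :
    Prop where
  pos : 1 ≤ m
  ne_zero : q ≠ 0
  order : orderOf q = m + 1
  comm : ∀ a ∈ Λ, ∀ b ∈ Λ, Commute a b
  mem : ∀ i, L i ∈ Λ
  gen : Λ ≤ Algebra.adjoin k (Set.range L)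
  zero : L 0 = 1
  zero_of_lt : ∀ i, m < i → L i = 0
  mul_left : ∀ i, φ i * L i = L (i + 1) * φ i
  mul_right : ∀ i, φ i * L (i + 1) = L i * φ i
  mul_other : ∀ i j, j ≠ i → j ≠ i + 1 → Commute (φ i) (L j)
  sq : ∀ i < m, φ i * φ i = (q • L i - L (i + 1)) * (q • L (i + 1) - L i)
  far : ∀ i j, i + 1 < j → Commute (φ i) (φ j)
  braid : ∀ i, φ i * φ (i + 1) * φ i = φ (i + 1) * φ i * φ (i + 1)
  f_mem : ∀ c, f c ∈ Λ
  idem : ∀ c, f c * f c = f c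
  congr : ∀ c d, (∀ i ≤ m, c i = d i) → f c = f d
  swap : ∀ i < m, ∀ c, φ i * f c = f (c ∘ Equiv.swap i (i + 1)) * φ i
  sep : ∀ t ≤ m, ∀ b, Commute b (L t) → ∀ c d, d t ≠ c t → f d * b * f c = 0
  nil : ∀ i ≤ m, ∀ c, IsNilpotent ((L i - algebraMap k A (c i)) * f c)
  complete : ∀ S : AddSubgroup A, (∀ c, f c ∈ S) → 1 ∈ S
  apply_zero : ∀ c, f c ≠ 0 → c 0 = 1
  injective : ∀ c, f c ≠ 0 → ∀ i ≤ m, ∀ j ≤ m, c i = c j → i = j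
  pow : ∀ c, f c ≠ 0 → ∀ i ≤ m, ∃ j ≤ m, c i = q ^ j

theorem IsWeightSystem.isWeighted {q : k} {m : ℕ} {T : ℕ → A} {f : (ℕ → k) → A}
    (hf : IsWeightSystem q m T f) (h : IsHecke q m T) (hm : 1 ≤ m) (hq : q ≠ 0)
    (hord : orderOf q = m + 1) :
    IsWeighted q m (jm q T) (inter q T) (jmAlg q T) f where
  pos := hm
  ne_zero := hq
  order := hord
  comm a ha b hb := by
    have : IsMulCommutative (jmAlg q T) := Algebra.isMulCommutative_adjoin k (by
      rintro _ ⟨i, rfl⟩ _ ⟨j, rfl⟩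
      exact h.commute_jm i j)
    exact congrArg Subtype.val (this.is_comm.comm ⟨a, ha⟩ ⟨b, hb⟩)
  mem i := Algebra.subset_adjoin ⟨i, rfl⟩
  gen := le_rfl
  zero := rfl
  zero_of_lt i hi := by
    obtain ⟨i, rfl⟩ : ∃ i', i = i' + 1 := ⟨i - 1, by omega⟩
    rw [jm_succ, h.zero i (by omega), mul_zero, smul_zero]
  mul_left := h.inter_mul_jm hq
  mul_right := h.inter_mul_jm_succ hq
  mul_other i j h1 h2 := h.inter_commute_jm h1 h2
  sq i hi := h.inter_sq hq hi
  far i j hij := h.inter_commute hij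
  braid := h.inter_braid hq
  f_mem := hf.mem
  idem := hf.idem
  congr := hf.congr
  swap := hf.swap
  sep := hf.sep
  nil := hf.nil
  complete := hf.complete
  apply_zero := hf.apply_zero
  injective := hf.injective
  pow := hf.pow

/-- `y` acts invertibly on the idempotent `g`. -/
def InvOn (Λ : Subalgebra k A) (g y : A) : Prop := y ∈ Λ ∧ ∃ z ∈ Λ, z * y * g = g

namespace IsWeighted

variable {q : k} {m : ℕ} {L φ : ℕ → A} {Λ : Subalgebra k A} {f : (ℕ → k) → A}

theorem zpow_ne (hw : IsWeighted q m L φ Λ f) {a b : ℤ} (h1 : a ≠ b) (h2 : a - b < m + 1)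
    (h3 : b - a < m + 1) : q ^ a ≠ q ^ b := by
  intro hab
  have h4 : q ^ (a - b) = 1 := by rw [zpow_sub₀ hw.ne_zero, hab, div_self (zpow_ne_zero _ hw.ne_zero)]
  have h5 : ((m + 1 : ℕ) : ℤ) ∣ a - b := by
    rw [← hw.order]
    have hu : (Units.mk0 q hw.ne_zero) ^ (a - b) = 1 := by
      ext; simpa using h4
    have := orderOf_dvd_iff_zpow_eq_one.2 hu
    rwa [← orderOf_units, Units.val_mk0] at this
  obtain ⟨c, hc⟩ := h5
  have : c = 0 := by
    by_contra hne
    rcases lt_or_gt_of_ne hne with h | h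
    · have : (m + 1 : ℤ) * c ≤ (m + 1) * (-1) := by
        apply mul_le_mul_of_nonneg_left <;> omega
      push_cast at hc
      omega
    · have : (m + 1 : ℤ) * 1 ≤ (m + 1) * c := by
        apply mul_le_mul_of_nonneg_left <;> omega
      push_cast at hc
      omega
  subst this
  simp only [mul_zero] at hc
  omega

theorem zpow_period (hw : IsWeighted q m L φ Λ f) {a b : ℤ} (h : a = b + (m + 1)) :
    q ^ a = q ^ b := by
  rw [h, zpow_add₀ hw.ne_zero]
  have : q ^ ((m : ℤ) + 1) = 1 := by
    have := pow_orderOf_eq_one q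
    rw [hw.order] at this
    exact_mod_cast this
  rw [this, mul_one]

theorem mul_zpow (hw : IsWeighted q m L φ Λ f) (a : ℤ) : q * q ^ a = q ^ (a + 1) :=
  (zpow_one_add₀ hw.ne_zero a).symm.trans (by rw [add_comm])

theorem smul_sub_mem (hw : IsWeighted q m L φ Λ f) (i j : ℕ) : q • L i - L j ∈ Λ :=
  Λ.sub_mem (Λ.smul_mem (hw.mem i) q) (hw.mem j)

theorem inter_right (hw : IsWeighted q m L φ Λ f) (i : ℕ) {a : A} (ha : a ∈ Λ) :
    ∃ b ∈ Λ, a * φ i = φ i * b := by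
  replace ha := hw.gen ha
  induction ha using Algebra.adjoin_induction with
  | mem x hx =>
    obtain ⟨j, rfl⟩ := hx
    by_cases h1 : j = i
    · subst h1; exact ⟨_, hw.mem _, (hw.mul_right j).symm⟩
    by_cases h2 : j = i + 1
    · subst h2; exact ⟨_, hw.mem _, (hw.mul_left i).symm⟩
    exact ⟨_, hw.mem _, (hw.mul_other i j h1 h2).symm⟩
  | algebraMap r => exact ⟨_, Λ.algebraMap_mem r, Algebra.commutes r _⟩
  | add x y _ _ hx hy =>
    obtain ⟨x', h1, h2⟩ := hx
    obtain ⟨y', h3, h4⟩ := hy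
    exact ⟨_, Λ.add_mem h1 h3, by rw [add_mul, h2, h4, mul_add]⟩
  | mul x y _ _ hx hy =>
    obtain ⟨x', h1, h2⟩ := hx
    obtain ⟨y', h3, h4⟩ := hy
    exact ⟨_, Λ.mul_mem h1 h3, by rw [mul_assoc, h4, ← mul_assoc, h2, mul_assoc]⟩

theorem invOn_mul (hw : IsWeighted q m L φ Λ f) {g y y' : A} (h : InvOn Λ g y)
    (h' : InvOn Λ g y') : InvOn Λ g (y * y') := by
  obtain ⟨hy, z, hz, h1⟩ := h
  obtain ⟨hy', z', hz', h1'⟩ := h'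
  refine ⟨Λ.mul_mem hy hy', z' * z, Λ.mul_mem hz' hz, ?_⟩
  calc z' * z * (y * y') * g = z' * ((z * y) * y') * g := by simp only [mul_assoc]
    _ = z' * (y' * (z * y)) * g := by rw [(hw.comm _ (Λ.mul_mem hz hy) _ hy').eq]
    _ = z' * y' * (z * y * g) := by simp only [mul_assoc]
    _ = g := by rw [h1, h1']

theorem invOn_of_nil (hw : IsWeighted q m L φ Λ f) {c : ℕ → k} {y : A} {a : k} (hy : y ∈ Λ)
    (ha : a ≠ 0) (hn : IsNilpotent ((y - algebraMap k A a) * f c)) : InvOn Λ (f c) y := by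
  refine ⟨hy, ?_⟩
  set n := (y - algebraMap k A a) * f c with hn'
  have hnm : n ∈ Λ := Λ.mul_mem (Λ.sub_mem hy (Λ.algebraMap_mem _)) (hw.f_mem c)
  obtain ⟨N, hN⟩ := hn
  set w : A := (-a⁻¹) • n with hw'
  have hwm : w ∈ Λ := Λ.smul_mem hnm _
  have hwN : w ^ N = 0 := by rw [hw', smul_pow, hN, smul_zero]
  refine ⟨a⁻¹ • ∑ i ∈ Finset.range N, w ^ i,
    Λ.smul_mem (Λ.sum_mem fun i _ => Λ.pow_mem hwm i) _, ?_⟩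
  have h1 : y * f c = a • ((1 - w) * f c) := by
    have hnf : n * f c = n := by rw [hn', mul_assoc, hw.idem]
    rw [sub_mul, one_mul, hw', smul_mul_assoc, hnf, neg_smul, sub_neg_eq_add, smul_add, smul_smul,
      mul_inv_cancel₀ ha, one_smul, hn', sub_mul, ← Algebra.smul_def]
    abel
  rw [mul_assoc, h1, smul_mul_assoc, mul_smul_comm, smul_smul, inv_mul_cancel₀ ha, one_smul,
    ← mul_assoc, geom_sum_mul_neg, hwN, sub_zero, one_mul]

theorem nil_sub (hw : IsWeighted q m L φ Λ f) {i j : ℕ} (hi : i ≤ m) (hj : j ≤ m) (c : ℕ → k) :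
    IsNilpotent ((q • L i - L j - algebraMap k A (q * c i - c j)) * f c) := by
  have h1 : (q • L i - L j - algebraMap k A (q * c i - c j)) * f c =
      q • ((L i - algebraMap k A (c i)) * f c) - (L j - algebraMap k A (c j)) * f c := by
    rw [map_sub, map_mul, ← Algebra.smul_def, ← smul_mul_assoc, ← sub_mul, smul_sub]
    congr 1
    abel
  have hmem : ∀ i, (L i - algebraMap k A (c i)) * f c ∈ Λ := fun i =>
    Λ.mul_mem (Λ.sub_mem (hw.mem i) (Λ.algebraMap_mem _)) (hw.f_mem c)
  rw [h1]
  exact ((hw.comm _ (hmem i) _ (hmem j)).smul_left q).isNilpotent_sub ((hw.nil i hi c).smul q)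
    (hw.nil j hj c)

theorem invOn_smul_sub (hw : IsWeighted q m L φ Λ f) {i j : ℕ} (hi : i ≤ m) (hj : j ≤ m)
    {c : ℕ → k} (h : q * c i ≠ c j) : InvOn Λ (f c) (q • L i - L j) :=
  hw.invOn_of_nil (hw.smul_sub_mem i j) (sub_ne_zero.2 h) (hw.nil_sub hi hj c)

theorem exists_eq_of_admissible (hw : IsWeighted q m L φ Λ f) {i : ℕ} (hi : i < m) {c : ℕ → k}
    (h1 : q * c i ≠ c (i + 1)) (h2 : q * c (i + 1) ≠ c i) :
    ∃ z ∈ Λ, f c = z * φ i * f (c ∘ Equiv.swap i (i + 1)) * φ i := by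
  obtain ⟨_, z, hz, hzf⟩ := hw.invOn_mul (hw.invOn_smul_sub hi.le hi h1)
    (hw.invOn_smul_sub hi hi.le h2)
  refine ⟨z, hz, ?_⟩
  rw [mul_assoc _ _ (φ i), ← hw.swap i hi, ← mul_assoc, mul_assoc z, hw.sq i hi, hzf]

theorem eq_zero_of_nonadjacent (hw : IsWeighted q m L φ Λ f) {i : ℕ} (hi : i ≤ m) {c : ℕ → k}
    (h : ∀ l < i, q * c l ≠ c i ∧ q * c i ≠ c l) (h1 : c i ≠ 1) : f c = 0 := by
  induction i generalizing c with
  | zero =>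
    by_contra h0
    exact h1 (hw.apply_zero c h0)
  | succ i ih =>
    obtain ⟨z, -, hz⟩ := hw.exists_eq_of_admissible (i := i) hi (h i (by omega)).1 (h i (by omega)).2
    have : f (c ∘ Equiv.swap i (i + 1)) = 0 := by
      refine ih (by omega) (fun l hl => ?_) (by simpa using h1)
      simp only [Function.comp, Equiv.swap_apply_left,
        Equiv.swap_apply_of_ne_of_ne (show l ≠ i by omega) (show l ≠ i + 1 by omega)]
      exact h l (by omega)
    rw [hz, this, mul_zero, zero_mul]

theorem sq_eq_zero_of_swap (hw : IsWeighted q m L φ Λ f) {i : ℕ} (hi : i < m) {c : ℕ → k}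
    (h : f (c ∘ Equiv.swap i (i + 1)) = 0) :
    (q • L i - L (i + 1)) * (q • L (i + 1) - L i) * f c = 0 := by
  rw [← hw.sq i hi, mul_assoc, hw.swap i hi, h, zero_mul, mul_zero]

theorem eq_zero_of_invOn (hw : IsWeighted q m L φ Λ f) {c : ℕ → k} {y w : A}
    (hy : InvOn Λ (f c) y) (hwm : w ∈ Λ) (h : y * w * f c = 0) : w * f c = 0 := by
  obtain ⟨hym, z, hz, hzf⟩ := hy
  calc w * f c = w * (z * y * f c) := by rw [hzf]
    _ = (w * z) * (y * f c) := by simp only [mul_assoc]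
    _ = z * (w * y) * f c := by rw [(hw.comm w hwm z hz).eq]; simp only [mul_assoc]
    _ = 0 := by rw [(hw.comm w hwm y hym).eq, mul_assoc, h, mul_zero]

/-- Propagation of exact eigenvalues to an adjacent position. -/
theorem eigen_succ (hw : IsWeighted q m L φ Λ f) {i : ℕ} (hi : i < m) {c : ℕ → k}
    (h0 : f (c ∘ Equiv.swap i (i + 1)) = 0) (hs : L i * f c = c i • f c)
    (hc : c (i + 1) = q * c i ∨ q * c (i + 1) = c i) (hne : c i ≠ 0) (hq2 : q * q ≠ 1) :
    L (i + 1) * f c = c (i + 1) • f c := by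
  have h1 := hw.sq_eq_zero_of_swap hi h0
  have hq := hw.ne_zero
  rcases hc with hc | hc
  · have h2 : InvOn Λ (f c) (q • L (i + 1) - L i) := by
      refine hw.invOn_smul_sub hi hi.le ?_
      rw [hc, ← mul_assoc]
      intro h
      exact hq2 (mul_right_cancel₀ hne (by rw [h, one_mul]))
    have h3 := hw.eq_zero_of_invOn h2 (hw.smul_sub_mem i (i + 1)) (by
      rw [(hw.comm _ (hw.smul_sub_mem _ _) _ (hw.smul_sub_mem _ _)).eq, h1])
    rw [sub_mul, smul_mul_assoc, hs, sub_eq_zero] at h3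
    rw [← h3, hc, smul_smul]
  · have h2 : InvOn Λ (f c) (q • L i - L (i + 1)) := by
      refine hw.invOn_smul_sub hi.le hi ?_
      rw [← hc, ← mul_assoc]
      intro h
      have : c (i + 1) ≠ 0 := by rintro h; exact hne (by rw [← hc, h, mul_zero])
      exact hq2 (mul_right_cancel₀ this (by rw [h, one_mul]))
    have h3 := hw.eq_zero_of_invOn h2 (hw.smul_sub_mem (i + 1) i) h1
    rw [sub_mul, smul_mul_assoc, hs, sub_eq_zero, ← hc, mul_smul] at h3
    exact (smul_right_injective A hq) h3

end IsWeighted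

end Weighted

section Canonical

variable {k : Type} [Field k] {A : Type} [Ring A] [Algebra k A]

/-- The canonical weight `(1, q, …, q ^ (r - 1), q⁻¹, q⁻², …)`. -/
def hookWeight (q : k) (r i : ℕ) : k := if i < r then q ^ (i : ℤ) else q ^ ((r : ℤ) - i - 1)

theorem hookWeight_of_lt {q : k} {r i : ℕ} (h : i < r) : hookWeight q r i = q ^ (i : ℤ) := if_pos h

theorem hookWeight_of_le {q : k} {r i : ℕ} (h : r ≤ i) :
    hookWeight q r i = q ^ ((r : ℤ) - i - 1) := if_neg (by omega)

namespace IsWeighted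

variable {q : k} {m : ℕ} {L φ : ℕ → A} {Λ : Subalgebra k A} {f : (ℕ → k) → A}

theorem eq_zero_of_exponents (hw : IsWeighted q m L φ Λ f) {i : ℕ} (hi : i ≤ m) {c : ℕ → k} {a : ℤ}
    (ha : c i = q ^ a) (ha0 : a ≠ 0) (ha1 : a < m + 1) (ha2 : -a < m + 1)
    (h : ∀ l < i, ∃ b : ℤ, c l = q ^ b ∧ b + 1 ≠ a ∧ a + 1 ≠ b ∧ b - a < m ∧ a - b < m) :
    f c = 0 := by
  refine hw.eq_zero_of_nonadjacent hi (fun l hl => ?_) ?_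
  · obtain ⟨b, hb, h1, h2, h3, h4⟩ := h l hl
    rw [ha, hb, hw.mul_zpow, hw.mul_zpow]
    exact ⟨hw.zpow_ne h1 (by omega) (by omega), hw.zpow_ne h2 (by omega) (by omega)⟩
  · rw [ha, ← zpow_zero q]
    exact hw.zpow_ne ha0 (by omega) (by omega)

theorem hookWeight_last (hw : IsWeighted q m L φ Λ f) {r : ℕ} (hr : r ≤ m) :
    hookWeight q r m = q ^ (r : ℤ) := by
  rw [hookWeight_of_le hr]
  exact (hw.zpow_period (by ring)).symm

theorem swap_eq_zero_of_lt (hw : IsWeighted q m L φ Λ f) {r i : ℕ} (hr : r ≤ m) (hi : i + 1 < r) :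
    f (hookWeight q r ∘ Equiv.swap i (i + 1)) = 0 := by
  refine hw.eq_zero_of_exponents (i := i) (a := i + 1) (by omega) ?_ (by omega) (by omega)
    (by omega) fun l hl => ⟨l, ?_, by omega, by omega, by omega, by omega⟩
  · simp [hookWeight_of_lt hi]
  · simp only [Function.comp,
      Equiv.swap_apply_of_ne_of_ne (show l ≠ i by omega) (show l ≠ i + 1 by omega)]
    exact hookWeight_of_lt (by omega)

theorem swap_eq_zero_of_le (hw : IsWeighted q m L φ Λ f) {r i : ℕ} (hr : 1 ≤ r) (hi : r ≤ i)
    (him : i + 1 < m) : f (hookWeight q r ∘ Equiv.swap i (i + 1)) = 0 := by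
  refine hw.eq_zero_of_exponents (i := i) (a := r - i - 2) (by omega) ?_ (by omega) (by omega)
    (by omega) fun l hl => ?_
  · simp only [Function.comp, Equiv.swap_apply_left, hookWeight_of_le (show r ≤ i + 1 by omega)]
    congr 1
    push_cast
    ring
  · simp only [Function.comp,
      Equiv.swap_apply_of_ne_of_ne (show l ≠ i by omega) (show l ≠ i + 1 by omega)]
    by_cases hl : l < r
    · exact ⟨l, hookWeight_of_lt hl, by omega, by omega, by omega, by omega⟩
    · exact ⟨r - l - 1, hookWeight_of_le (by omega), by omega, by omega, by omega, by omega⟩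

theorem mul_self_ne_one (hw : IsWeighted q m L φ Λ f) (hm : 2 ≤ m) : q * q ≠ 1 := by
  have := hw.zpow_ne (a := 2) (b := 0) (by omega) (by omega) (by omega)
  rwa [zpow_zero, zpow_two] at this

theorem eigen_neg_one (hw : IsWeighted q m L φ Λ f) {p : ℕ} (hp : 1 ≤ p) (hpm : p < m) {c : ℕ → k}
    (hc : ∀ i < p, c i = q ^ (i : ℤ)) (hcp : c p = q ^ (-1 : ℤ)) :
    L p * f c = c p • f c := by
  induction p, hp using Nat.le_induction generalizing c with
  | base =>
    have hc0 : c 0 = 1 := by simpa using hc 0 (by omega)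
    refine hw.eigen_succ (i := 0) hw.pos ?_ ?_ (Or.inr ?_) ?_ (hw.mul_self_ne_one hpm)
    · by_contra h0
      have := hw.apply_zero _ h0
      simp only [zero_add, Function.comp, Equiv.swap_apply_left, hcp] at this
      rw [← zpow_zero q] at this
      exact hw.zpow_ne (by omega) (by omega) (by omega) this
    · rw [hw.zero, hc0, one_mul, one_smul]
    · rw [zero_add, hcp, hc0, hw.mul_zpow, neg_add_cancel, zpow_zero]
    · rw [hc0]; exact one_ne_zero
  | succ p hp ih =>
    obtain ⟨z, hz, hzf⟩ := hw.exists_eq_of_admissible (i := p) (c := c) (by omega) (by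
        rw [hc p (by omega), hcp, hw.mul_zpow]
        exact hw.zpow_ne (by omega) (by omega) (by omega)) (by
        rw [hc p (by omega), hcp, hw.mul_zpow]
        exact hw.zpow_ne (by omega) (by omega) (by omega))
    have h1 := ih (c := c ∘ Equiv.swap p (p + 1)) (by omega) (fun i hi => by
        simp only [Function.comp,
          Equiv.swap_apply_of_ne_of_ne (show i ≠ p by omega) (show i ≠ p + 1 by omega)]
        exact hc i (by omega)) (by simpa using hcp)
    simp only [Function.comp_apply, Equiv.swap_apply_left] at h1
    rw [hzf]
    calc L (p + 1) * (z * φ p * f (c ∘ Equiv.swap p (p + 1)) * φ p)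
        = L (p + 1) * z * φ p * f (c ∘ Equiv.swap p (p + 1)) * φ p := by simp only [mul_assoc]
      _ = z * (L (p + 1) * φ p) * f (c ∘ Equiv.swap p (p + 1)) * φ p := by
        rw [(hw.comm _ (hw.mem _) _ hz).eq]; simp only [mul_assoc]
      _ = z * φ p * (L p * f (c ∘ Equiv.swap p (p + 1))) * φ p := by
        rw [← hw.mul_left]; simp only [mul_assoc]
      _ = _ := by rw [h1, mul_smul_comm, smul_mul_assoc]

theorem eigen_hookWeight (hw : IsWeighted q m L φ Λ f) {r i : ℕ} (hr : 1 ≤ r) (hrm : r ≤ m)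
    (hi : i < m) : L i * f (hookWeight q r) = hookWeight q r i • f (hookWeight q r) := by
  have hnz : ∀ j, hookWeight q r j ≠ 0 := fun j => by
    rw [hookWeight]; split_ifs <;> exact zpow_ne_zero _ hw.ne_zero
  induction i with
  | zero => rw [hw.zero, hookWeight_of_lt (by omega)]; simp
  | succ i ih =>
    by_cases h1 : i + 1 < r
    · refine hw.eigen_succ (by omega) (hw.swap_eq_zero_of_lt hrm h1) (ih (by omega)) (Or.inl ?_)
        (hnz _) (hw.mul_self_ne_one (by omega))
      rw [hookWeight_of_lt h1, hookWeight_of_lt (by omega), hw.mul_zpow]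
      push_cast
      rfl
    by_cases h2 : i + 1 = r
    · subst h2
      refine hw.eigen_neg_one (by omega) hi (fun j hj => hookWeight_of_lt hj) ?_
      rw [hookWeight_of_le le_rfl]
      congr 1
      ring
    · refine hw.eigen_succ (by omega) (hw.swap_eq_zero_of_le hr (by omega) hi) (ih (by omega))
        (Or.inr ?_) (hnz _) (hw.mul_self_ne_one (by omega))
      rw [hookWeight_of_le (by omega), hookWeight_of_le (by omega), hw.mul_zpow]
      congr 1
      push_cast
      ring

end IsWeighted

end Canonical

section NormalForm

variable {k : Type} [Field k] {A : Type} [Ring A] [Algebra k A]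

/-- The additive span of the normally ordered products. -/
def normalSpan (φ : ℕ → A) (Λ : Subalgebra k A) : ℕ → AddSubgroup A
  | 0 => (Subalgebra.toSubmodule Λ).toAddSubgroup
  | t + 1 => AddSubgroup.closure
      {x | ∃ j ≤ t + 1, ∃ b ∈ normalSpan φ Λ t, x = ascProd φ (t + 1) j * b}

/-- The weights interpolating between two neighbouring canonical weights. -/
def bridgeWeight (q : k) (s p i : ℕ) : k :=
  if i < p then hookWeight q s i else if i = p then q ^ (s : ℤ) else hookWeight q (s + 1) i

namespace IsWeighted

variable {q : k} {m : ℕ} {L φ : ℕ → A} {Λ : Subalgebra k A} {f : (ℕ → k) → A}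

theorem commute_ascProd (hw : IsWeighted q m L φ Λ f) {t j l : ℕ} (hl : t < l ∨ l < j) :
    Commute (L l) (ascProd φ t j) := by
  induction t with
  | zero => exact Commute.one_right _
  | succ t ih =>
    rw [ascProd]
    split_ifs
    · exact (ih (by omega)).mul_right (hw.mul_other t l (by omega) (by omega)).symm
    · exact Commute.one_right _

theorem commute_descProd (hw : IsWeighted q m L φ Λ f) {t j l : ℕ} (hl : t < l ∨ l < j) :
    Commute (L l) (descProd φ t j) := by
  induction t with
  | zero => exact Commute.one_right _
  | succ t ih =>
    rw [descProd]
    split_ifs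
    · exact (hw.mul_other t l (by omega) (by omega)).symm.mul_right (ih (by omega))
    · exact Commute.one_right _

theorem mul_ascProd_first (hw : IsWeighted q m L φ Λ f) {t j : ℕ} (h : j ≤ t) :
    L j * ascProd φ t j = ascProd φ t j * L t := by
  induction t, h using Nat.le_induction with
  | base => rw [ascProd_of_le le_rfl, mul_one, one_mul]
  | succ t ht ih => rw [ascProd_succ ht, ← mul_assoc, ih, mul_assoc, ← hw.mul_right, mul_assoc]

theorem ascProd_mul_pred (hw : IsWeighted q m L φ Λ f) {t j : ℕ} (h : j ≤ t) :
    ascProd φ (t + 1) j * L t = L (t + 1) * ascProd φ (t + 1) j := by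
  rw [ascProd_succ h, mul_assoc, hw.mul_left, ← mul_assoc, ← mul_assoc,
    (hw.commute_ascProd (Or.inl (Nat.lt_succ_self t))).eq]

theorem descProd_mul_first (hw : IsWeighted q m L φ Λ f) {t j : ℕ} (h : j ≤ t) :
    descProd φ t j * L j = L t * descProd φ t j := by
  induction t, h using Nat.le_induction with
  | base => rw [descProd_of_le le_rfl, mul_one, one_mul]
  | succ t ht ih => rw [descProd_succ ht, mul_assoc, ih, ← mul_assoc, hw.mul_left, mul_assoc]

theorem descProd_mul_last (hw : IsWeighted q m L φ Λ f) {t j : ℕ} (h : j ≤ t) :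
    descProd φ (t + 1) j * L (t + 1) = L t * descProd φ (t + 1) j := by
  rw [descProd_succ h, mul_assoc, ← (hw.commute_descProd (Or.inl (Nat.lt_succ_self t))).eq,
    ← mul_assoc, hw.mul_right, mul_assoc]

theorem inter_commute_ascProd (hw : IsWeighted q m L φ Λ f) {t j l : ℕ}
    (hl : t < l ∨ l + 1 < j) : Commute (φ l) (ascProd φ t j) := by
  induction t with
  | zero => exact Commute.one_right _
  | succ t ih =>
    rw [ascProd]
    split_ifs
    · refine (ih (by omega)).mul_right ?_
      rcases hl with hl | hl
      · exact (hw.far t l hl).symm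
      · exact hw.far l t (by omega)
    · exact Commute.one_right _

theorem inter_mul_ascProd (hw : IsWeighted q m L φ Λ f) {t j l : ℕ} (hj : j < l) (hl : l < t) :
    φ l * ascProd φ t j = ascProd φ t j * φ (l - 1) := by
  induction t with
  | zero => omega
  | succ t ih =>
    rw [ascProd_succ (by omega)]
    rcases Nat.lt_succ_iff_lt_or_eq.1 hl with h1 | rfl
    · rw [← mul_assoc, ih h1, mul_assoc, mul_assoc, (hw.far (l - 1) t (by omega)).eq]
    · obtain ⟨l, rfl⟩ : ∃ l', l = l' + 1 := ⟨l - 1, by omega⟩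
      rw [ascProd_succ (by omega), Nat.add_sub_cancel]
      calc φ (l + 1) * (ascProd φ l j * φ l * φ (l + 1))
          = φ (l + 1) * ascProd φ l j * (φ l * φ (l + 1)) := by noncomm_ring
        _ = ascProd φ l j * (φ (l + 1) * φ l * φ (l + 1)) := by
          rw [(hw.inter_commute_ascProd (Or.inl (Nat.lt_succ_self l))).eq]; noncomm_ring
        _ = _ := by rw [← hw.braid]; noncomm_ring

theorem mul_swap (hw : IsWeighted q m L φ Λ f) {i : ℕ} (hi : i < m) (c : ℕ → k) :
    f c * φ i = φ i * f (c ∘ Equiv.swap i (i + 1)) := by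
  rw [hw.swap i hi]
  congr 2
  ext j
  simp

theorem mul_ascProd (hw : IsWeighted q m L φ Λ f) {t j : ℕ} (h : j ≤ t) (ht : t ≤ m)
    (d : ℕ → k) : f d * ascProd φ t j = ascProd φ t j * f (fun i => if i < j then d i else
      if i < t then d (i + 1) else if i = t then d j else d i) := by
  induction t, h using Nat.le_induction with
  | base =>
    rw [ascProd_of_le le_rfl, mul_one, one_mul]
    congr 1
    ext i
    split_ifs with h1 h2
    · rfl
    · rw [h2]
    · rfl
  | succ t hjt ih =>
    rw [ascProd_succ hjt, ← mul_assoc, ih (by omega), mul_assoc, hw.mul_swap (by omega), mul_assoc]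
    congr 3
    ext i
    simp only [Function.comp_apply]
    by_cases h1 : i = t
    · subst h1
      rw [Equiv.swap_apply_left, if_neg (by omega), if_neg (by omega), if_neg (by omega),
        if_neg (by omega), if_pos (by omega)]
    by_cases h2 : i = t + 1
    · subst h2
      rw [Equiv.swap_apply_right, if_neg (by omega), if_neg (by omega), if_pos rfl,
        if_neg (by omega), if_neg (by omega), if_pos rfl]
    rw [Equiv.swap_apply_of_ne_of_ne h1 h2]
    split_ifs <;> first | rfl | omega

theorem descProd_mul_ascProd (hw : IsWeighted q m L φ Λ f) {i t : ℕ} (hi : i < t) (ht : t ≤ m) :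
    descProd φ t i * ascProd φ t i = descProd φ t (i + 1) * ascProd φ t (i + 1) *
      ((q • L i - L t) * (q • L t - L i)) := by
  have h1 : SemiconjBy (ascProd φ t (i + 1)) (L t) (L (i + 1)) := (hw.mul_ascProd_first hi).symm
  have h2 : SemiconjBy (ascProd φ t (i + 1)) (L i) (L i) :=
    (hw.commute_ascProd (Or.inr (Nat.lt_succ_self i))).symm
  have h3 := (((h2.smul_right q).sub_right h1).mul_right ((h1.smul_right q).sub_right h2)).eq
  rw [descProd_eq_mul hi, ascProd_eq_mul hi, mul_assoc, ← mul_assoc (φ i), hw.sq i (by omega),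
    ← h3, mul_assoc]

theorem ascProd_mul_descProd (hw : IsWeighted q m L φ Λ f) {r t : ℕ} (hr : r ≤ t) (ht : t < m) :
    ascProd φ (t + 1) r * descProd φ (t + 1) r = ascProd φ t r * descProd φ t r *
      ((q • L r - L (t + 1)) * (q • L (t + 1) - L r)) := by
  have h1 : SemiconjBy (descProd φ t r) (L r) (L t) := hw.descProd_mul_first hr
  have h2 : SemiconjBy (descProd φ t r) (L (t + 1)) (L (t + 1)) :=
    (hw.commute_descProd (Or.inl (Nat.lt_succ_self t))).symm
  have h3 := (((h1.smul_right q).sub_right h2).mul_right ((h2.smul_right q).sub_right h1)).eq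
  rw [ascProd_succ hr, descProd_succ hr, mul_assoc, ← mul_assoc (φ t), hw.sq t ht, ← h3, mul_assoc]

theorem normalSpan_le (t : ℕ) : normalSpan φ Λ t ≤ normalSpan φ Λ (t + 1) := fun b hb =>
  AddSubgroup.subset_closure ⟨t + 1, le_rfl, b, hb, by rw [ascProd_of_le le_rfl, one_mul]⟩

theorem one_mem_normalSpan (t : ℕ) : (1 : A) ∈ normalSpan φ Λ t := by
  induction t with
  | zero => exact Λ.one_mem
  | succ t ih => exact normalSpan_le t ih

theorem mul_mem_normalSpan (hw : IsWeighted q m L φ Λ f) (t : ℕ) {a b : A} (ha : a ∈ Λ)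
    (hb : b ∈ normalSpan φ Λ t) : a * b ∈ normalSpan φ Λ t := by
  have key : ∀ (n j : ℕ) (a : A), a ∈ Λ → ∃ a' ∈ Λ, a * ascProd φ n j = ascProd φ n j * a' := by
    intro n j
    induction n with
    | zero => exact fun a ha => ⟨a, ha, by rw [ascProd, mul_one, one_mul]⟩
    | succ n ih =>
      intro a ha
      rw [ascProd]
      split_ifs
      · obtain ⟨a', ha', h1⟩ := ih a ha
        obtain ⟨a'', ha'', h2⟩ := hw.inter_right n ha'
        exact ⟨a'', ha'', by rw [← mul_assoc, h1, mul_assoc, h2, mul_assoc]⟩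
      · exact ⟨a, ha, by rw [mul_one, one_mul]⟩
  induction t generalizing a b with
  | zero => exact Λ.mul_mem ha hb
  | succ t ih =>
    induction hb using AddSubgroup.closure_induction with
    | mem x hx =>
      obtain ⟨j, hj, b, hb, rfl⟩ := hx
      obtain ⟨a', ha', h1⟩ := key (t + 1) j a ha
      exact AddSubgroup.subset_closure ⟨j, hj, a' * b, ih ha' hb, by rw [← mul_assoc, h1, mul_assoc]⟩
    | zero => rw [mul_zero]; exact zero_mem _
    | add x y _ _ hx hy => rw [mul_add]; exact add_mem hx hy
    | neg x _ hx => rw [mul_neg]; exact neg_mem hx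

theorem inter_mul_mem_normalSpan (hw : IsWeighted q m L φ Λ f) {t : ℕ} (ht : t ≤ m) {i : ℕ}
    (hi : i < t) {b : A} (hb : b ∈ normalSpan φ Λ t) : φ i * b ∈ normalSpan φ Λ t := by
  induction t generalizing i b with
  | zero => omega
  | succ t ih =>
    induction hb using AddSubgroup.closure_induction with
    | mem x hx =>
      obtain ⟨j, hj, b, hb, rfl⟩ := hx
      rcases lt_trichotomy (i + 1) j with h1 | rfl | h1
      · refine AddSubgroup.subset_closure ⟨j, hj, φ i * b, ih (by omega) (by omega) hb, ?_⟩
        rw [← mul_assoc, (hw.inter_commute_ascProd (Or.inr h1)).eq, mul_assoc]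
      · refine AddSubgroup.subset_closure ⟨i, by omega, b, hb, ?_⟩
        rw [ascProd_eq_mul hi, mul_assoc]
      · rcases (Nat.lt_succ_iff.1 h1).eq_or_lt with rfl | h2
        · rw [ascProd_eq_mul hi, ← mul_assoc, ← mul_assoc, hw.sq j (by omega), mul_assoc]
          refine hw.mul_mem_normalSpan (t + 1)
            (Λ.mul_mem (hw.smul_sub_mem _ _) (hw.smul_sub_mem _ _)) ?_
          exact AddSubgroup.subset_closure ⟨j + 1, hi, b, hb, rfl⟩
        · rw [← mul_assoc, hw.inter_mul_ascProd h2 hi, mul_assoc]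
          exact AddSubgroup.subset_closure ⟨j, hj, φ (i - 1) * b, ih (by omega) (by omega) hb, rfl⟩
    | zero => rw [mul_zero]; exact zero_mem _
    | add x y _ _ hx hy => rw [mul_add]; exact add_mem hx hy
    | neg x _ hx => rw [mul_neg]; exact neg_mem hx

theorem commute_normalSpan (hw : IsWeighted q m L φ Λ f) {t l : ℕ} (hl : t < l) {b : A}
    (hb : b ∈ normalSpan φ Λ t) : Commute b (L l) := by
  induction t generalizing b with
  | zero => exact hw.comm b hb _ (hw.mem l)
  | succ t ih =>
    induction hb using AddSubgroup.closure_induction with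
    | mem x hx =>
      obtain ⟨j, hj, b, hb, rfl⟩ := hx
      exact (hw.commute_ascProd (Or.inl hl)).symm.mul_left (ih (by omega) hb)
    | zero => exact Commute.zero_left _
    | add x y _ _ hx hy => exact hx.add_left hy
    | neg x _ hx => exact hx.neg_left

theorem weight_mul_normalSpan (hw : IsWeighted q m L φ Λ f) {t j : ℕ} (ht : t + 1 ≤ m)
    (hj : j ≤ t + 1) {c d : ℕ → k} (hjt : d j = c (t + 1)) {b : A}
    (hb : b ∈ normalSpan φ Λ (t + 1)) :
    ∃ b' ∈ normalSpan φ Λ t, f d * b * f c = f d * ascProd φ (t + 1) j * b' * f c := by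
  by_cases hd : f d = 0
  · exact ⟨0, zero_mem _, by simp [hd]⟩
  induction hb using AddSubgroup.closure_induction with
  | mem x hx =>
    obtain ⟨i, hi, b, hb, rfl⟩ := hx
    by_cases hij : i = j
    · subst hij
      exact ⟨b, hb, by simp only [mul_assoc]⟩
    · refine ⟨0, zero_mem _, ?_⟩
      rw [mul_zero, zero_mul, ← mul_assoc, hw.mul_ascProd hi ht, mul_assoc, mul_assoc,
        ← mul_assoc (f _), hw.sep (t + 1) ht b (hw.commute_normalSpan (Nat.lt_succ_self t) hb),
        mul_zero]
      rw [if_neg (by omega), if_neg (by omega), if_pos rfl, ← hjt]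
      exact fun h => hij (hw.injective d hd i (by omega) j (by omega) h)
  | zero => exact ⟨0, zero_mem _, by simp⟩
  | add x y _ _ hx hy =>
    obtain ⟨x', hx', h1⟩ := hx
    obtain ⟨y', hy', h2⟩ := hy
    exact ⟨_, add_mem hx' hy', by rw [mul_add, add_mul, h1, h2, mul_add, add_mul]⟩
  | neg x _ hx =>
    obtain ⟨x', hx', h1⟩ := hx
    exact ⟨_, neg_mem hx', by rw [mul_neg, neg_mul, h1, mul_neg, neg_mul]⟩

theorem diag_normalSpan (hw : IsWeighted q m L φ Λ f) {t : ℕ} (ht : t ≤ m) {c : ℕ → k} {b : A}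
    (hb : b ∈ normalSpan φ Λ t) : ∃ a ∈ Λ, f c * b * f c = a * f c := by
  induction t generalizing b with
  | zero => exact ⟨f c * b, Λ.mul_mem (hw.f_mem c) hb, rfl⟩
  | succ t ih =>
    obtain ⟨b', hb', h1⟩ := hw.weight_mul_normalSpan ht le_rfl (rfl : c (t + 1) = c (t + 1)) hb
    rw [ascProd_of_le le_rfl, mul_one] at h1
    rw [h1]
    exact ih (by omega) hb'

theorem bridgeWeight_swap (q : k) {s p : ℕ} (hs : s ≤ p) :
    bridgeWeight q s (p + 1) ∘ Equiv.swap p (p + 1) = bridgeWeight q s p := by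
  ext i
  simp only [Function.comp_apply, bridgeWeight]
  by_cases h1 : i = p
  · subst h1
    simp
  by_cases h2 : i = p + 1
  · subst h2
    rw [Equiv.swap_apply_right, if_pos (by omega), if_neg (by omega), if_neg (by omega),
      hookWeight_of_le hs, hookWeight_of_le (by omega)]
    congr 1
    push_cast
    ring
  rw [Equiv.swap_apply_of_ne_of_ne h1 h2]
  split_ifs <;> first | rfl | omega

theorem bridgeWeight_self (q : k) (s : ℕ) : bridgeWeight q s s = hookWeight q (s + 1) := by
  ext i
  simp only [bridgeWeight]
  split_ifs with h1 h2
  · rw [hookWeight_of_lt h1, hookWeight_of_lt (by omega)]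
  · rw [h2, hookWeight_of_lt (by omega)]
  · rfl

theorem f_bridgeWeight_last (hw : IsWeighted q m L φ Λ f) {s : ℕ} (hs : s ≤ m) :
    f (bridgeWeight q s m) = f (hookWeight q s) := by
  refine hw.congr _ _ fun i hi => ?_
  simp only [bridgeWeight]
  split_ifs with h1 h2
  · rfl
  · rw [h2, hw.hookWeight_last hs]
  · omega

theorem bridge_normalSpan (hw : IsWeighted q m L φ Λ f) {s p : ℕ} (hs : s ≤ p) (hp : p ≤ m) {b : A}
    (hb : b ∈ normalSpan φ Λ p) : ∃ a ∈ Λ, f (bridgeWeight q s p) * b * f (hookWeight q (s + 1)) =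
      descProd φ p s * (a * f (hookWeight q (s + 1))) := by
  induction p, hs using Nat.le_induction generalizing b with
  | base =>
    rw [descProd_of_le le_rfl, bridgeWeight_self]
    simp only [one_mul]
    exact hw.diag_normalSpan hp hb
  | succ p hsp ih =>
    obtain ⟨b', hb', h1⟩ := hw.weight_mul_normalSpan (j := p) (c := hookWeight q (s + 1))
      (d := bridgeWeight q s (p + 1)) hp (by omega) (by
        rw [bridgeWeight, if_pos (by omega), hookWeight_of_le hsp, hookWeight_of_le (by omega)]
        congr 1
        push_cast
        ring) hb
    obtain ⟨a, ha, h2⟩ := ih (by omega) hb'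
    refine ⟨a, ha, ?_⟩
    rw [h1, ascProd_succ le_rfl, ascProd_of_le le_rfl, one_mul, hw.mul_swap (by omega),
      bridgeWeight_swap q hsp, mul_assoc, mul_assoc, ← mul_assoc _ b', h2, descProd_succ hsp,
      mul_assoc]

theorem descProd_mul_bridge (hw : IsWeighted q m L φ Λ f) {s p : ℕ} (hs : s ≤ p) (hp : p ≤ m) :
    descProd φ p s * f (hookWeight q (s + 1)) = f (bridgeWeight q s p) * descProd φ p s := by
  induction p, hs using Nat.le_induction with
  | base => rw [descProd_of_le le_rfl, bridgeWeight_self, one_mul, mul_one]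
  | succ p hsp ih =>
    rw [descProd_succ hsp, mul_assoc, ih (by omega), ← mul_assoc, ← bridgeWeight_swap q hsp,
      ← hw.mul_swap (by omega), mul_assoc]

end IsWeighted

end NormalForm

section Zigzag

variable {k : Type} [Field k] {A : Type} [Ring A] [Algebra k A]

/-- The relations of a zigzag algebra of type `A_m`. -/
structure IsZigzag (m : ℕ) (u v : ℕ → k) (F α β x : ℕ → A) : Prop where
  idem : ∀ r, F r * F r = F r
  orth : ∀ r s, r ≠ s → F r * F s = 0
  F_zero : ∀ r, ¬ (1 ≤ r ∧ r ≤ m) → F r = 0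
  α_left : ∀ r, F (r + 1) * α r = α r
  α_right : ∀ r, α r * F r = α r
  β_left : ∀ r, F r * β r = β r
  β_right : ∀ r, β r * F (r + 1) = β r
  x_left : ∀ r, F r * x r = x r
  x_right : ∀ r, x r * F r = x r
  α_x : ∀ r, α r * x r = 0
  x_α : ∀ r, x (r + 1) * α r = 0
  β_x : ∀ r, β r * x (r + 1) = 0
  x_β : ∀ r, x r * β r = 0
  x_x : ∀ r, x r * x r = 0
  α_α : ∀ r, α (r + 1) * α r = 0
  β_β : ∀ r, β r * β (r + 1) = 0
  β_α : ∀ r, 1 ≤ r → r < m → β r * α r = u r • x r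
  α_β : ∀ r, 1 ≤ r → r < m → α r * β r = v r • x (r + 1)
  u_ne : ∀ r, u r ≠ 0
  v_ne : ∀ r, v r ≠ 0

namespace IsWeighted

variable {q : k} {m : ℕ} {L φ : ℕ → A} {Λ : Subalgebra k A} {f : (ℕ → k) → A}

/-- The nilpotent part of the last commuting element on a canonical weight. -/
def hookNil (q : k) (m : ℕ) (L : ℕ → A) (f : (ℕ → k) → A) (r : ℕ) : A :=
  (L m - algebraMap k A (q ^ (r : ℤ))) * f (hookWeight q r)

theorem hookNil_mem (hw : IsWeighted q m L φ Λ f) (r : ℕ) : hookNil q m L f r ∈ Λ :=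
  Λ.mul_mem (Λ.sub_mem (hw.mem _) (Λ.algebraMap_mem _)) (hw.f_mem _)

theorem hookNil_right (hw : IsWeighted q m L φ Λ f) (r : ℕ) :
    hookNil q m L f r * f (hookWeight q r) = hookNil q m L f r := by
  rw [hookNil, mul_assoc, hw.idem]

theorem hookNil_left (hw : IsWeighted q m L φ Λ f) (r : ℕ) :
    f (hookWeight q r) * hookNil q m L f r = hookNil q m L f r := by
  rw [(hw.comm _ (hw.f_mem _) _ (hw.hookNil_mem r)).eq, hw.hookNil_right]

theorem hookWeight_mul_ascProd (hw : IsWeighted q m L φ Λ f) {r : ℕ} (hr : r < m) :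
    f (hookWeight q (r + 1)) * ascProd φ m r = ascProd φ m r * f (hookWeight q r) := by
  rw [hw.mul_ascProd hr.le le_rfl]
  congr 1
  refine hw.congr _ _ fun i hi => ?_
  split_ifs with h1 h2 h3
  · rw [hookWeight_of_lt (by omega), hookWeight_of_lt h1]
  · rw [hookWeight_of_le (by omega), hookWeight_of_le (by omega)]
    congr 1
    push_cast
    ring
  · rw [h3, hw.hookWeight_last hr.le, hookWeight_of_lt (by omega)]
  · omega

theorem descProd_mul_hookWeight (hw : IsWeighted q m L φ Λ f) {r : ℕ} (hr : r < m) :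
    descProd φ m r * f (hookWeight q (r + 1)) = f (hookWeight q r) * descProd φ m r := by
  rw [hw.descProd_mul_bridge hr.le le_rfl, hw.f_bridgeWeight_last hr.le]

theorem pred_mul_hookWeight (hw : IsWeighted q m L φ Λ f) {r : ℕ} (hr : 1 ≤ r) (hrm : r < m) :
    L (m - 1) * f (hookWeight q r) = algebraMap k A (q ^ ((r + 1 : ℕ) : ℤ)) * f (hookWeight q r) := by
  rw [hw.eigen_hookWeight hr hrm.le (by omega), hookWeight_of_le (by omega), Algebra.smul_def]
  congr 2
  refine (hw.zpow_period ?_).symm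
  rw [Nat.cast_sub (by omega)]
  push_cast
  ring

theorem mul_hookWeight_succ (hw : IsWeighted q m L φ Λ f) {r : ℕ} (hrm : r < m) :
    L r * f (hookWeight q (r + 1)) = algebraMap k A (q ^ (r : ℤ)) * f (hookWeight q (r + 1)) := by
  rw [hw.eigen_hookWeight (by omega) hrm hrm, hookWeight_of_lt (by omega), Algebra.smul_def]

theorem mul_ascProd_last (hw : IsWeighted q m L φ Λ f) {r : ℕ} (hr : r < m) :
    L m * ascProd φ m r = ascProd φ m r * L (m - 1) := by
  obtain ⟨t, rfl⟩ : ∃ t, m = t + 1 := ⟨m - 1, by omega⟩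
  exact (hw.ascProd_mul_pred (by omega)).symm

theorem descProd_mul_last' (hw : IsWeighted q m L φ Λ f) {r : ℕ} (hr : r < m) :
    descProd φ m r * L m = L (m - 1) * descProd φ m r := by
  obtain ⟨t, rfl⟩ : ∃ t, m = t + 1 := ⟨m - 1, by omega⟩
  exact hw.descProd_mul_last (by omega)

theorem hookNil_mul_ascProd (hw : IsWeighted q m L φ Λ f) {r : ℕ} (hr : 1 ≤ r) (hrm : r < m) :
    hookNil q m L f (r + 1) * (ascProd φ m r * f (hookWeight q r)) = 0 := by
  rw [hookNil, mul_assoc, ← mul_assoc _ (ascProd φ m r), hw.hookWeight_mul_ascProd hrm, mul_assoc,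
    hw.idem, sub_mul, ← mul_assoc, hw.mul_ascProd_last hrm, mul_assoc,
    hw.pred_mul_hookWeight hr hrm, ← mul_assoc, ← mul_assoc, Algebra.commutes, sub_self]

theorem ascProd_mul_hookNil (hw : IsWeighted q m L φ Λ f) {r : ℕ} (hrm : r < m) :
    ascProd φ m r * f (hookWeight q r) * hookNil q m L f r = 0 := by
  rw [mul_assoc, hw.hookNil_left, hookNil, ← mul_assoc, mul_sub, ← hw.mul_ascProd_first hrm.le,
    ← Algebra.commutes, ← sub_mul, mul_assoc, ← hw.hookWeight_mul_ascProd hrm, ← mul_assoc, sub_mul,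
    hw.mul_hookWeight_succ hrm, sub_self, zero_mul]

theorem hookNil_mul_descProd (hw : IsWeighted q m L φ Λ f) {r : ℕ} (hrm : r < m) :
    hookNil q m L f r * (descProd φ m r * f (hookWeight q (r + 1))) = 0 := by
  rw [hw.descProd_mul_hookWeight hrm, hookNil, mul_assoc, ← mul_assoc (f _), hw.idem,
    ← hw.descProd_mul_hookWeight hrm, ← mul_assoc, sub_mul, ← hw.descProd_mul_first hrm.le,
    Algebra.commutes, ← mul_sub, mul_assoc, sub_mul, hw.mul_hookWeight_succ hrm, sub_self, mul_zero]

theorem descProd_mul_hookNil (hw : IsWeighted q m L φ Λ f) {r : ℕ} (hr : 1 ≤ r) (hrm : r < m) :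
    descProd φ m r * f (hookWeight q (r + 1)) * hookNil q m L f (r + 1) = 0 := by
  rw [mul_assoc, hw.hookNil_left, hookNil, ← mul_assoc, mul_sub, hw.descProd_mul_last' hrm,
    ← Algebra.commutes, ← sub_mul, mul_assoc, hw.descProd_mul_hookWeight hrm, ← mul_assoc, sub_mul,
    hw.pred_mul_hookWeight hr hrm, sub_self, zero_mul]

theorem _root_.InvOn.smul {g y : A} (h : InvOn Λ g y) {a : k} (ha : a ≠ 0) :
    InvOn Λ g (a • y) := by
  obtain ⟨hy, z, hz, h1⟩ := h
  exact ⟨Λ.smul_mem hy a, a⁻¹ • z, Λ.smul_mem hz _, by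
    rw [smul_mul_smul_comm, inv_mul_cancel₀ ha, one_smul, h1]⟩

theorem descProd_mul_ascProd_hook (hw : IsWeighted q m L φ Λ f) {r : ℕ} (hr : 1 ≤ r) (hrm : r < m) :
    ∃ y, InvOn Λ (f (hookWeight q r)) y ∧
      descProd φ m r * ascProd φ m r * f (hookWeight q r) = y * hookNil q m L f r := by
  have key : ∀ d i, r ≤ i → i + d + 1 = m → ∃ y, InvOn Λ (f (hookWeight q r)) y ∧
      descProd φ m i * ascProd φ m i * f (hookWeight q r) = y * hookNil q m L f r := by
    intro d
    induction d with
    | zero =>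
      intro i hi him
      obtain rfl : i = m - 1 := by omega
      refine ⟨q • (q • L (m - 1) - L m), (hw.invOn_smul_sub (by omega) le_rfl ?_).smul
        hw.ne_zero, ?_⟩
      · rw [hookWeight_of_le (by omega), hookWeight_of_le (by omega), hw.mul_zpow]
        exact hw.zpow_ne (by omega) (by omega) (by omega)
      · have h4 : (q • L m - L (m - 1)) * f (hookWeight q r) = q • hookNil q m L f r := by
          rw [sub_mul, hw.pred_mul_hookWeight hr hrm, hookNil, sub_mul, smul_mul_assoc, smul_sub,
            ← smul_mul_assoc q (algebraMap k A _), Algebra.smul_def q (algebraMap k A _),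
            ← map_mul, hw.mul_zpow]
          push_cast
          rfl
        rw [hw.descProd_mul_ascProd (by omega) le_rfl, descProd_of_le (by omega),
          ascProd_of_le (by omega), one_mul, one_mul, mul_assoc, h4, mul_smul_comm,
          smul_mul_assoc]
    | succ d ih =>
      intro i hi him
      obtain ⟨y, hy, h1⟩ := ih (i + 1) (by omega) (by omega)
      have hY : InvOn Λ (f (hookWeight q r)) ((q • L i - L m) * (q • L m - L i)) := by
        refine hw.invOn_mul (hw.invOn_smul_sub (by omega) le_rfl ?_)
          (hw.invOn_smul_sub le_rfl (by omega) ?_)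
        · rw [hw.hookWeight_last hrm.le, hookWeight_of_le hi, hw.mul_zpow]
          exact hw.zpow_ne (by omega) (by omega) (by omega)
        · rw [hw.hookWeight_last hrm.le, hookWeight_of_le hi, hw.mul_zpow]
          exact hw.zpow_ne (by omega) (by omega) (by omega)
      refine ⟨y * ((q • L i - L m) * (q • L m - L i)), hw.invOn_mul hy hY, ?_⟩
      rw [hw.descProd_mul_ascProd (by omega) le_rfl, mul_assoc,
        (hw.comm _ hY.1 _ (hw.f_mem _)).eq, ← mul_assoc, h1, mul_assoc, mul_assoc,
        (hw.comm _ hY.1 _ (hw.hookNil_mem _)).eq]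
  exact key (m - 1 - r) r le_rfl (by omega)

theorem ascProd_mul_descProd_hook (hw : IsWeighted q m L φ Λ f) {r : ℕ} (hr : 1 ≤ r) (hrm : r < m) :
    ∃ y, InvOn Λ (f (hookWeight q (r + 1))) y ∧
      ascProd φ m r * descProd φ m r * f (hookWeight q (r + 1)) =
        y * hookNil q m L f (r + 1) := by
  have key : ∀ t, r ≤ t → t < m → ∃ y, InvOn Λ (f (hookWeight q (r + 1))) y ∧
      ascProd φ t r * descProd φ t r * f (hookWeight q (r + 1)) =
        y * f (hookWeight q (r + 1)) := by
    intro t hrt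
    induction t, hrt using Nat.le_induction with
    | base =>
      intro _
      refine ⟨1, ⟨Λ.one_mem, 1, Λ.one_mem, by simp⟩, ?_⟩
      rw [descProd_of_le le_rfl, ascProd_of_le le_rfl, one_mul]
    | succ t ht ih =>
      intro htm
      obtain ⟨y, hy, h1⟩ := ih (by omega)
      have hY : InvOn Λ (f (hookWeight q (r + 1)))
          ((q • L r - L (t + 1)) * (q • L (t + 1) - L r)) := by
        refine hw.invOn_mul (hw.invOn_smul_sub (by omega) (by omega) ?_)
          (hw.invOn_smul_sub (by omega) (by omega) ?_)
        · rw [hookWeight_of_lt (show r < r + 1 by omega),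
            hookWeight_of_le (show r + 1 ≤ t + 1 by omega), hw.mul_zpow]
          exact hw.zpow_ne (by omega) (by omega) (by omega)
        · rw [hookWeight_of_lt (show r < r + 1 by omega),
            hookWeight_of_le (show r + 1 ≤ t + 1 by omega), hw.mul_zpow]
          exact hw.zpow_ne (by omega) (by omega) (by omega)
      refine ⟨_, hw.invOn_mul hy hY, ?_⟩
      rw [hw.ascProd_mul_descProd ht (by omega), mul_assoc, (hw.comm _ hY.1 _ (hw.f_mem _)).eq,
        ← mul_assoc, h1, mul_assoc, mul_assoc, (hw.comm _ hY.1 _ (hw.f_mem _)).eq]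
  obtain ⟨y, hy, h1⟩ := key (m - 1) (by omega) (by omega)
  have h2 := hw.ascProd_mul_descProd (r := r) (t := m - 1) (by omega) (by omega)
  rw [show m - 1 + 1 = m by omega] at h2
  have h3 : InvOn Λ (f (hookWeight q (r + 1))) (q • L m - L r) := by
    refine hw.invOn_smul_sub le_rfl (by omega) ?_
    rw [hookWeight_of_lt (show r < r + 1 by omega),
      hw.hookWeight_last (show r + 1 ≤ m by omega), hw.mul_zpow]
    exact hw.zpow_ne (by omega) (by omega) (by omega)
  have h4 : (q • L r - L m) * f (hookWeight q (r + 1)) = - hookNil q m L f (r + 1) := by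
    rw [sub_mul, smul_mul_assoc, hw.mul_hookWeight_succ hrm, ← smul_mul_assoc, Algebra.smul_def,
      ← map_mul, hw.mul_zpow, hookNil, ← neg_mul, neg_sub, sub_mul]
    push_cast
    rfl
  refine ⟨(-1 : k) • (y * (q • L m - L r)), (hw.invOn_mul hy h3).smul (by simp), ?_⟩
  have h5 : (q • L r - L m) * (q • L m - L r) ∈ Λ :=
    Λ.mul_mem (hw.smul_sub_mem _ _) (hw.smul_sub_mem _ _)
  rw [h2, mul_assoc, (hw.comm _ h5 _ (hw.f_mem _)).eq, ← mul_assoc, h1, mul_assoc,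
    ← (hw.comm _ h5 _ (hw.f_mem _)).eq, (hw.comm _ (hw.smul_sub_mem r m) _
    (hw.smul_sub_mem m r)).eq, mul_assoc, h4, neg_one_smul, mul_neg, mul_neg, neg_mul, mul_assoc]

theorem eq_zero_of_hookNil (hw : IsWeighted q m L φ Λ f) {r : ℕ} {y : A}
    (hy : InvOn Λ (f (hookWeight q r)) y)
    (h : hookNil q m L f r * (y * hookNil q m L f r) = 0) :
    hookNil q m L f r * hookNil q m L f r = 0 := by
  obtain ⟨hym, z, hz, hzf⟩ := hy
  calc hookNil q m L f r * hookNil q m L f r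
      = hookNil q m L f r * (z * y * f (hookWeight q r) * hookNil q m L f r) := by
        rw [hzf, hw.hookNil_left]
    _ = (hookNil q m L f r * z) * (y * (f (hookWeight q r) * hookNil q m L f r)) := by
        simp only [mul_assoc]
    _ = z * (hookNil q m L f r * (y * hookNil q m L f r)) := by
        rw [(hw.comm _ (hw.hookNil_mem r) _ hz).eq, hw.hookNil_left, mul_assoc]
    _ = 0 := by rw [h, mul_zero]

theorem hookNil_mul_self (hw : IsWeighted q m L φ Λ f) {r : ℕ} (hr : 1 ≤ r) (hrm : r ≤ m) :
    hookNil q m L f r * hookNil q m L f r = 0 := by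
  rcases hrm.lt_or_eq with hlt | rfl
  · obtain ⟨y, hy, h1⟩ := hw.descProd_mul_ascProd_hook hr hlt
    refine hw.eq_zero_of_hookNil hy ?_
    rw [← h1, mul_assoc (descProd φ m r), ← hw.hookWeight_mul_ascProd hlt, ← mul_assoc, ← mul_assoc,
      mul_assoc _ (descProd φ m r), hw.hookNil_mul_descProd hlt, zero_mul]
  rcases hr.lt_or_eq with h2 | rfl
  · obtain ⟨s, rfl⟩ : ∃ s, r = s + 1 := ⟨r - 1, by omega⟩
    obtain ⟨y, hy, h1⟩ := hw.ascProd_mul_descProd_hook (r := s) (by omega) (by omega)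
    refine hw.eq_zero_of_hookNil hy ?_
    rw [← h1, mul_assoc (ascProd φ _ s), hw.descProd_mul_hookWeight (by omega), ← mul_assoc,
      ← mul_assoc, mul_assoc _ (ascProd φ _ s), hw.hookNil_mul_ascProd (by omega) (by omega),
      zero_mul]
  · have hqq : q * q = 1 := by
      have := pow_orderOf_eq_one q
      rwa [hw.order, pow_two] at this
    have h0 : f (hookWeight q 1 ∘ Equiv.swap 0 (0 + 1)) = 0 := by
      by_contra h0
      have := hw.apply_zero _ h0
      simp only [zero_add, Function.comp, Equiv.swap_apply_left,
        hw.hookWeight_last le_rfl] at this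
      rw [← zpow_zero q] at this
      exact hw.zpow_ne (by omega) (by omega) (by omega) this
    have h1 := hw.sq_eq_zero_of_swap (by omega) h0
    rw [hw.zero, zero_add] at h1
    have hX : hookNil q 1 L f 1 * hookNil q 1 L f 1 =
        (L 1 - algebraMap k A q) * (L 1 - algebraMap k A q) * f (hookWeight q 1) := by
      have : hookNil q 1 L f 1 = (L 1 - algebraMap k A q) * f (hookWeight q 1) := by
        simp [hookNil]
      nth_rw 1 [this]
      rw [mul_assoc, hw.hookNil_left, this, mul_assoc]
    have h2 : (q • (1 : A) - L 1) * (q • L 1 - 1) =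
        (-q) • ((L 1 - algebraMap k A q) * (L 1 - algebraMap k A q)) := by
      have h3 : q • L 1 - 1 = q • (L 1 - algebraMap k A q) := by
        rw [smul_sub, Algebra.smul_def q (algebraMap k A q), ← map_mul, hqq, map_one]
      rw [h3, ← Algebra.algebraMap_eq_smul_one, mul_smul_comm, neg_smul, ← smul_neg, ← neg_mul,
        neg_sub]
    rw [h2, smul_mul_assoc, ← hX] at h1
    exact (smul_eq_zero.1 h1).resolve_left (neg_ne_zero.2 hw.ne_zero)

end IsWeighted

end Zigzag

section Chain

variable {k : Type} [Field k] {A : Type} [Ring A] [Algebra k A]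

namespace IsWeighted

variable {q : k} {m : ℕ} {L φ : ℕ → A} {Λ : Subalgebra k A} {f : (ℕ → k) → A}

theorem exists_eq_smul_add (hw : IsWeighted q m L φ Λ f) {r : ℕ} (hr : 1 ≤ r) (hrm : r ≤ m)
    {a : A} (ha : a ∈ Λ) : ∃ s t : k, a * f (hookWeight q r) =
      s • f (hookWeight q r) + t • hookNil q m L f r := by
  replace ha := hw.gen ha
  induction ha using Algebra.adjoin_induction with
  | mem x hx =>
    obtain ⟨i, rfl⟩ := hx
    rcases lt_trichotomy i m with h | rfl | h
    · exact ⟨hookWeight q r i, 0, by rw [hw.eigen_hookWeight hr hrm h, zero_smul, add_zero]⟩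
    · refine ⟨q ^ (r : ℤ), 1, ?_⟩
      rw [hookNil, sub_mul, one_smul, Algebra.smul_def]
      abel
    · exact ⟨0, 0, by rw [hw.zero_of_lt i h]; simp⟩
  | algebraMap c => exact ⟨c, 0, by rw [← Algebra.smul_def, zero_smul, add_zero]⟩
  | add x y _ _ hx hy =>
    obtain ⟨s, t, h1⟩ := hx
    obtain ⟨s', t', h2⟩ := hy
    exact ⟨s + s', t + t', by rw [add_mul, h1, h2]; module⟩
  | mul x y _ _ hx hy =>
    obtain ⟨s, t, h1⟩ := hx
    obtain ⟨s', t', h2⟩ := hy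
    refine ⟨s * s', t * s' + s * t', ?_⟩
    have h3 : x * hookNil q m L f r = s • hookNil q m L f r := by
      rw [← hw.hookNil_left, ← mul_assoc, h1, add_mul, smul_mul_assoc, smul_mul_assoc,
        hw.hookNil_mul_self hr hrm, smul_zero, add_zero, hw.hookNil_left]
    rw [mul_assoc, h2, mul_add, mul_smul_comm, mul_smul_comm, h1, h3]
    module

theorem exists_smul_hookNil (hw : IsWeighted q m L φ Λ f) {r : ℕ} (hr : 1 ≤ r) (hrm : r ≤ m)
    {y : A} (hy : InvOn Λ (f (hookWeight q r)) y) :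
    ∃ c : k, c ≠ 0 ∧ y * hookNil q m L f r = c • hookNil q m L f r := by
  obtain ⟨hym, z, hz, hzy⟩ := hy
  obtain ⟨s, t, h1⟩ := hw.exists_eq_smul_add hr hrm hym
  have h3 : ∀ a : A, ∀ s t : k, a * f (hookWeight q r) =
      s • f (hookWeight q r) + t • hookNil q m L f r →
      a * hookNil q m L f r = s • hookNil q m L f r := fun a s t h => by
    rw [← hw.hookNil_left, ← mul_assoc, h, add_mul, smul_mul_assoc, smul_mul_assoc,
        hw.hookNil_mul_self hr hrm, smul_zero, add_zero, hw.hookNil_left]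
  by_cases hs : s = 0
  · refine ⟨1, one_ne_zero, ?_⟩
    have h4 : hookNil q m L f r = 0 := by
      rw [← hw.hookNil_left, ← hzy, mul_assoc, hw.hookNil_left, mul_assoc, h3 y s t h1, hs]
      simp
    rw [h4]
    simp
  · exact ⟨s, hs, h3 y s t h1⟩

theorem ascProd_mul_mem_normalSpan (hw : IsWeighted q m L φ Λ f) {t j : ℕ} (ht : t ≤ m) {b : A}
    (hb : b ∈ normalSpan φ Λ m) : ascProd φ t j * b ∈ normalSpan φ Λ m := by
  induction t generalizing b with
  | zero => rwa [ascProd, one_mul]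
  | succ t ih =>
    rw [ascProd]
    split_ifs
    · rw [mul_assoc]
      exact ih (by omega) (hw.inter_mul_mem_normalSpan le_rfl ht hb)
    · rwa [one_mul]

theorem descProd_mul_mem_normalSpan (hw : IsWeighted q m L φ Λ f) {t j : ℕ} (ht : t ≤ m) {b : A}
    (hb : b ∈ normalSpan φ Λ m) : descProd φ t j * b ∈ normalSpan φ Λ m := by
  induction t with
  | zero => rwa [descProd, one_mul]
  | succ t ih =>
    rw [descProd]
    split_ifs
    · rw [mul_assoc]
      exact hw.inter_mul_mem_normalSpan le_rfl ht (ih (by omega))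
    · rwa [one_mul]

theorem _root_.ascProd_mem {B : Subalgebra k A} {m : ℕ} {φ : ℕ → A} (h : ∀ i < m, φ i ∈ B) (j : ℕ) :
    ascProd φ m j ∈ B := by
  induction m with
  | zero => exact B.one_mem
  | succ t ih =>
    rw [ascProd]
    split_ifs
    · exact B.mul_mem (ih fun i hi => h i (by omega)) (h t (by omega))
    · exact B.one_mem

theorem _root_.descProd_mem {B : Subalgebra k A} {m : ℕ} {φ : ℕ → A} (h : ∀ i < m, φ i ∈ B) (j : ℕ) :
    descProd φ m j ∈ B := by
  induction m with
  | zero => exact B.one_mem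
  | succ t ih =>
    rw [descProd]
    split_ifs
    · exact B.mul_mem (h t (by omega)) (ih fun i hi => h i (by omega))
    · exact B.one_mem

theorem hook_orth (hw : IsWeighted q m L φ Λ f) {r s : ℕ} (hrm : r ≤ m) (hsm : s ≤ m)
    (h : r ≠ s) : f (hookWeight q r) * f (hookWeight q s) = 0 := by
  have := hw.sep m le_rfl 1 (Commute.one_left _) (hookWeight q s) (hookWeight q r) (by
    rw [hw.hookWeight_last hrm, hw.hookWeight_last hsm]
    exact hw.zpow_ne (by omega) (by omega) (by omega))
  rwa [mul_one] at this

theorem hook_far_left (hw : IsWeighted q m L φ Λ f) {r s : ℕ} (hrs : r + 1 < s)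
    (hsm : s ≤ m) {b : A} (hb : b ∈ normalSpan φ Λ m) :
    f (hookWeight q s) * b * f (hookWeight q r) = 0 := by
  obtain ⟨t, rfl⟩ : ∃ t, m = t + 1 := ⟨m - 1, by omega⟩
  obtain ⟨b', -, h⟩ := hw.weight_mul_normalSpan le_rfl (show r ≤ t + 1 by omega)
    (c := hookWeight q r) (d := hookWeight q s)
    (by rw [hw.hookWeight_last (by omega), hookWeight_of_lt (by omega)]) hb
  rw [h, ascProd_eq_mul (by omega), ← mul_assoc, hw.mul_swap (by omega),
    hw.swap_eq_zero_of_lt hsm hrs]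
  simp

theorem hook_far_right (hw : IsWeighted q m L φ Λ f) {r s : ℕ} (hs : 1 ≤ s) (hrs : s + 1 < r)
    (hrm : r ≤ m) {b : A} (hb : b ∈ normalSpan φ Λ m) :
    f (hookWeight q s) * b * f (hookWeight q r) = 0 := by
  obtain ⟨t, rfl⟩ : ∃ t, m = t + 1 := ⟨m - 1, by omega⟩
  obtain ⟨b', -, h⟩ := hw.weight_mul_normalSpan le_rfl (show t + 1 + s - r ≤ t + 1 by omega)
    (c := hookWeight q r) (d := hookWeight q s)
    (by
      rw [hw.hookWeight_last hrm, hookWeight_of_le (by omega)]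
      refine (hw.zpow_period ?_).symm
      rw [Nat.cast_sub (by omega)]
      push_cast
      ring) hb
  rw [h, ascProd_eq_mul (by omega), ← mul_assoc, hw.mul_swap (by omega),
    hw.swap_eq_zero_of_le hs (by omega) (by omega)]
  simp

theorem hook_succ (hw : IsWeighted q m L φ Λ f) {r : ℕ} (hr : 1 ≤ r) (hrm : r < m) {b : A}
    (hb : b ∈ normalSpan φ Λ m) : ∃ c : k, f (hookWeight q (r + 1)) * b * f (hookWeight q r) =
      c • (ascProd φ m r * f (hookWeight q r)) := by
  have h0 := hw.hookWeight_mul_ascProd hrm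
  have h5 := hw.ascProd_mul_hookNil hrm
  obtain ⟨t, rfl⟩ : ∃ t, m = t + 1 := ⟨m - 1, by omega⟩
  obtain ⟨b', hb', h⟩ := hw.weight_mul_normalSpan le_rfl (show r ≤ t + 1 by omega)
    (c := hookWeight q r) (d := hookWeight q (r + 1))
    (by rw [hw.hookWeight_last (by omega), hookWeight_of_lt (by omega)]) hb
  obtain ⟨a, ha, h2⟩ := hw.diag_normalSpan (c := hookWeight q r) (by omega) hb'
  obtain ⟨c, c', h3⟩ := hw.exists_eq_smul_add hr hrm.le ha
  refine ⟨c, ?_⟩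
  rw [mul_assoc, hw.hookNil_left] at h5
  rw [h, h0, mul_assoc, mul_assoc, ← mul_assoc (f _), h2, h3, mul_add, mul_smul_comm,
    mul_smul_comm, h5, smul_zero, add_zero]

theorem hook_pred (hw : IsWeighted q m L φ Λ f) {r : ℕ} (hr : 1 ≤ r) (hrm : r < m) {b : A}
    (hb : b ∈ normalSpan φ Λ m) : ∃ c : k, f (hookWeight q r) * b * f (hookWeight q (r + 1)) =
      c • (descProd φ m r * f (hookWeight q (r + 1))) := by
  obtain ⟨a, ha, h⟩ := hw.bridge_normalSpan hrm.le le_rfl hb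
  obtain ⟨c, c', h3⟩ := hw.exists_eq_smul_add (r := r + 1) (by omega) hrm ha
  have h5 := hw.descProd_mul_hookNil hr hrm
  rw [mul_assoc, hw.hookNil_left] at h5
  refine ⟨c, ?_⟩
  rw [hw.f_bridgeWeight_last hrm.le] at h
  rw [h, h3, mul_add, mul_smul_comm, mul_smul_comm, h5, smul_zero, add_zero]

theorem exists_isZigzag (hw : IsWeighted q m L φ Λ f) : ∃ (u v : ℕ → k) (F α β x : ℕ → A),
    IsZigzag m u v F α β x ∧ (∀ r, 1 ≤ r → r ≤ m → F r = f (hookWeight q r)) ∧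
    (∀ B : Subalgebra k A, Λ ≤ B → (∀ i < m, φ i ∈ B) →
      ∀ r, F r ∈ B ∧ α r ∈ B ∧ β r ∈ B ∧ x r ∈ B) ∧
    ∀ r s, ∀ b ∈ normalSpan φ Λ m, F s * b * F r ∈
      Submodule.span k (Set.range F ∪ Set.range α ∪ Set.range β ∪ Set.range x) := by
  classical
  have hu : ∀ r, ∃ c : k, c ≠ 0 ∧ (1 ≤ r → r < m →
      descProd φ m r * ascProd φ m r * f (hookWeight q r) = c • hookNil q m L f r) := fun r => by
    by_cases h : 1 ≤ r ∧ r < m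
    · obtain ⟨y, hy, h1⟩ := hw.descProd_mul_ascProd_hook h.1 h.2
      obtain ⟨c, hc, h2⟩ := hw.exists_smul_hookNil h.1 h.2.le hy
      exact ⟨c, hc, fun _ _ => h1.trans h2⟩
    · exact ⟨1, one_ne_zero, fun h1 h2 => absurd ⟨h1, h2⟩ h⟩
  have hv : ∀ r, ∃ c : k, c ≠ 0 ∧ (1 ≤ r → r < m →
      ascProd φ m r * descProd φ m r * f (hookWeight q (r + 1)) =
        c • hookNil q m L f (r + 1)) := fun r => by
    by_cases h : 1 ≤ r ∧ r < m
    · obtain ⟨y, hy, h1⟩ := hw.ascProd_mul_descProd_hook h.1 h.2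
      obtain ⟨c, hc, h2⟩ := hw.exists_smul_hookNil (r := r + 1) (by omega) (by omega) hy
      exact ⟨c, hc, fun _ _ => h1.trans h2⟩
    · exact ⟨1, one_ne_zero, fun h1 h2 => absurd ⟨h1, h2⟩ h⟩
  choose u hu0 hu using hu
  choose v hv0 hv using hv
  obtain ⟨F, hF⟩ : ∃ F : ℕ → A, ∀ r, F r = if 1 ≤ r ∧ r ≤ m then f (hookWeight q r) else 0 :=
    ⟨_, fun _ => rfl⟩
  obtain ⟨α, hα⟩ : ∃ α : ℕ → A, ∀ r, α r = if 1 ≤ r ∧ r < m then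
    ascProd φ m r * f (hookWeight q r) else 0 := ⟨_, fun _ => rfl⟩
  obtain ⟨β, hβ⟩ : ∃ β : ℕ → A, ∀ r, β r = if 1 ≤ r ∧ r < m then
    descProd φ m r * f (hookWeight q (r + 1)) else 0 := ⟨_, fun _ => rfl⟩
  obtain ⟨x, hx⟩ : ∃ x : ℕ → A, ∀ r, x r = if 1 ≤ r ∧ r ≤ m then hookNil q m L f r else 0 :=
    ⟨_, fun _ => rfl⟩
  have F1 : ∀ r, 1 ≤ r → r ≤ m → F r = f (hookWeight q r) := fun r h1 h2 => by
    rw [hF, if_pos ⟨h1, h2⟩]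
  have F0 : ∀ r, ¬ (1 ≤ r ∧ r ≤ m) → F r = 0 := fun r h => by rw [hF, if_neg h]
  have x1 : ∀ r, 1 ≤ r → r ≤ m → x r = hookNil q m L f r := fun r h1 h2 => by
    rw [hx, if_pos ⟨h1, h2⟩]
  have x0 : ∀ r, ¬ (1 ≤ r ∧ r ≤ m) → x r = 0 := fun r h => by rw [hx, if_neg h]
  have α1 : ∀ r, 1 ≤ r → r < m → α r = ascProd φ m r * f (hookWeight q r) := fun r h1 h2 => by
    rw [hα, if_pos ⟨h1, h2⟩]
  have α0 : ∀ r, ¬ (1 ≤ r ∧ r < m) → α r = 0 := fun r h => by rw [hα, if_neg h]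
  have β1 : ∀ r, 1 ≤ r → r < m → β r = descProd φ m r * f (hookWeight q (r + 1)) :=
    fun r h1 h2 => by rw [hβ, if_pos ⟨h1, h2⟩]
  have β0 : ∀ r, ¬ (1 ≤ r ∧ r < m) → β r = 0 := fun r h => by rw [hβ, if_neg h]
  have hone := one_mem_normalSpan (φ := φ) (Λ := Λ) m
  refine ⟨u, v, F, α, β, x, ?_, F1, ?_, ?_⟩
  · constructor
    · intro r
      by_cases h : 1 ≤ r ∧ r ≤ m
      · rw [F1 r h.1 h.2, hw.idem]
      · rw [F0 r h, zero_mul]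
    · intro r s hrs
      by_cases h : 1 ≤ r ∧ r ≤ m
      · by_cases h' : 1 ≤ s ∧ s ≤ m
        · rw [F1 r h.1 h.2, F1 s h'.1 h'.2, hw.hook_orth h.2 h'.2 hrs]
        · rw [F0 s h', mul_zero]
      · rw [F0 r h, zero_mul]
    · exact F0
    · intro r
      by_cases h : 1 ≤ r ∧ r < m
      · rw [F1 _ (by omega) (by omega), α1 r h.1 h.2, ← mul_assoc, hw.hookWeight_mul_ascProd h.2,
          mul_assoc, hw.idem]
      · rw [α0 r h, mul_zero]
    · intro r
      by_cases h : 1 ≤ r ∧ r < m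
      · rw [F1 _ (by omega) (by omega), α1 r h.1 h.2, mul_assoc, hw.idem]
      · rw [α0 r h, zero_mul]
    · intro r
      by_cases h : 1 ≤ r ∧ r < m
      · rw [F1 _ (by omega) (by omega), β1 r h.1 h.2, hw.descProd_mul_hookWeight h.2,
          ← mul_assoc, hw.idem]
      · rw [β0 r h, mul_zero]
    · intro r
      by_cases h : 1 ≤ r ∧ r < m
      · rw [F1 _ (by omega) (by omega), β1 r h.1 h.2, mul_assoc, hw.idem]
      · rw [β0 r h, zero_mul]
    · intro r
      by_cases h : 1 ≤ r ∧ r ≤ m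
      · rw [F1 r h.1 h.2, x1 r h.1 h.2, hw.hookNil_left]
      · rw [x0 r h, mul_zero]
    · intro r
      by_cases h : 1 ≤ r ∧ r ≤ m
      · rw [F1 r h.1 h.2, x1 r h.1 h.2, hw.hookNil_right]
      · rw [x0 r h, zero_mul]
    · intro r
      by_cases h : 1 ≤ r ∧ r < m
      · rw [α1 r h.1 h.2, x1 r h.1 h.2.le, hw.ascProd_mul_hookNil h.2]
      · rw [α0 r h, zero_mul]
    · intro r
      by_cases h : 1 ≤ r ∧ r < m
      · rw [α1 r h.1 h.2, x1 (r + 1) (by omega) h.2, hw.hookNil_mul_ascProd h.1 h.2]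
      · rw [α0 r h, mul_zero]
    · intro r
      by_cases h : 1 ≤ r ∧ r < m
      · rw [β1 r h.1 h.2, x1 (r + 1) (by omega) h.2, hw.descProd_mul_hookNil h.1 h.2]
      · rw [β0 r h, zero_mul]
    · intro r
      by_cases h : 1 ≤ r ∧ r < m
      · rw [β1 r h.1 h.2, x1 r h.1 h.2.le, hw.hookNil_mul_descProd h.2]
      · rw [β0 r h, mul_zero]
    · intro r
      by_cases h : 1 ≤ r ∧ r ≤ m
      · rw [x1 r h.1 h.2, hw.hookNil_mul_self h.1 h.2]
      · rw [x0 r h, mul_zero]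
    · intro r
      by_cases h : 1 ≤ r ∧ r + 1 < m
      · rw [α1 r h.1 (by omega), α1 (r + 1) (by omega) h.2, ← hw.hookWeight_mul_ascProd h.2,
          mul_assoc, ← mul_assoc (ascProd φ m (r + 1)), ← mul_assoc]
        exact hw.hook_far_left (by omega) (by omega) (hw.ascProd_mul_mem_normalSpan le_rfl
          (by simpa using hw.ascProd_mul_mem_normalSpan (j := r) le_rfl hone))
      · rcases not_and_or.1 h with h | h
        · rw [α0 r (by omega), mul_zero]
        · rw [α0 (r + 1) (by omega), zero_mul]
    · intro r
      by_cases h : 1 ≤ r ∧ r + 1 < m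
      · rw [β1 r h.1 (by omega), β1 (r + 1) (by omega) h.2,
          hw.descProd_mul_hookWeight (show r < m by omega),
          mul_assoc, ← mul_assoc (descProd φ m r), ← mul_assoc]
        exact hw.hook_far_right h.1 (by omega) (by omega) (hw.descProd_mul_mem_normalSpan le_rfl
          (by simpa using hw.descProd_mul_mem_normalSpan (j := r + 1) le_rfl hone))
      · rcases not_and_or.1 h with h | h
        · rw [β0 r (by omega), zero_mul]
        · rw [β0 (r + 1) (by omega), mul_zero]
    · intro r h1 h2
      rw [β1 r h1 h2, α1 r h1 h2, x1 r h1 h2.le, ← hu r h1 h2, mul_assoc, ← mul_assoc (f _),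
        hw.hookWeight_mul_ascProd h2, mul_assoc, hw.idem, mul_assoc]
    · intro r h1 h2
      rw [β1 r h1 h2, α1 r h1 h2, x1 _ (by omega) h2, ← hv r h1 h2, mul_assoc, ← mul_assoc (f _),
        ← hw.descProd_mul_hookWeight h2, mul_assoc, hw.idem, mul_assoc]
    · exact hu0
    · exact hv0
  · intro B hΛ hB r
    rw [hF, hα, hβ, hx]
    refine ⟨?_, ?_, ?_, ?_⟩ <;> split_ifs
    · exact hΛ (hw.f_mem _)
    · exact B.zero_mem
    · exact B.mul_mem (ascProd_mem hB r) (hΛ (hw.f_mem _))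
    · exact B.zero_mem
    · exact B.mul_mem (descProd_mem hB r) (hΛ (hw.f_mem _))
    · exact B.zero_mem
    · exact hΛ (hw.hookNil_mem r)
    · exact B.zero_mem
  · intro r s b hb
    have mF : ∀ r, F r ∈ Submodule.span k (Set.range F ∪ Set.range α ∪ Set.range β ∪
        Set.range x) := fun r => Submodule.subset_span (Or.inl (Or.inl (Or.inl ⟨r, rfl⟩)))
    have mα : ∀ r, α r ∈ Submodule.span k (Set.range F ∪ Set.range α ∪ Set.range β ∪
        Set.range x) := fun r => Submodule.subset_span (Or.inl (Or.inl (Or.inr ⟨r, rfl⟩)))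
    have mβ : ∀ r, β r ∈ Submodule.span k (Set.range F ∪ Set.range α ∪ Set.range β ∪
        Set.range x) := fun r => Submodule.subset_span (Or.inl (Or.inr ⟨r, rfl⟩))
    have mx : ∀ r, x r ∈ Submodule.span k (Set.range F ∪ Set.range α ∪ Set.range β ∪
        Set.range x) := fun r => Submodule.subset_span (Or.inr ⟨r, rfl⟩)
    by_cases h1 : 1 ≤ r ∧ r ≤ m
    swap
    · rw [F0 r h1, mul_zero]
      exact zero_mem _
    by_cases h2 : 1 ≤ s ∧ s ≤ m
    swap
    · rw [F0 s h2, zero_mul, zero_mul]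
      exact zero_mem _
    rw [F1 r h1.1 h1.2, F1 s h2.1 h2.2]
    obtain h | rfl | rfl | rfl | h : r + 1 < s ∨ s = r + 1 ∨ s = r ∨ r = s + 1 ∨ s + 1 < r := by
      omega
    · rw [hw.hook_far_left h h2.2 hb]
      exact zero_mem _
    · obtain ⟨c, hc⟩ := hw.hook_succ h1.1 (by omega) hb
      rw [hc, ← α1 r h1.1 (by omega)]
      exact Submodule.smul_mem _ _ (mα r)
    · obtain ⟨a, ha, h⟩ := hw.diag_normalSpan (c := hookWeight q s) le_rfl hb
      obtain ⟨c, c', h3⟩ := hw.exists_eq_smul_add h1.1 h1.2 ha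
      rw [h, h3, ← F1 s h1.1 h1.2, ← x1 s h1.1 h1.2]
      exact add_mem (Submodule.smul_mem _ _ (mF s)) (Submodule.smul_mem _ _ (mx s))
    · obtain ⟨c, hc⟩ := hw.hook_pred h2.1 (by omega) hb
      rw [hc, ← β1 s h2.1 (by omega)]
      exact Submodule.smul_mem _ _ (mβ s)
    · rw [hw.hook_far_right h2.1 h h1.2 hb]
      exact zero_mem _

end IsWeighted

end Chain

section Generation

variable {k : Type} [Field k] {A : Type} [Ring A] [Algebra k A]

namespace IsWeighted

variable {q : k} {m : ℕ} {L φ : ℕ → A} {Λ : Subalgebra k A} {f : (ℕ → k) → A}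

theorem exists_apply_eq (hw : IsWeighted q m L φ Λ f) {c : ℕ → k} (h0 : f c ≠ 0) {r : ℕ}
    (hr : r ≤ m) : ∃ i ≤ m, c i = q ^ (r : ℤ) := by
  choose! g hg hcg using hw.pow c h0
  let G : Fin (m + 1) → Fin (m + 1) := fun i => ⟨g i, by have := hg i (by omega); omega⟩
  have hG : Function.Injective G := fun i j hij => by
    have h1 : g i = g j := congrArg Fin.val hij
    apply Fin.ext
    apply hw.injective c h0 i (by omega) j (by omega)
    rw [hcg i (by omega), hcg j (by omega), h1]
  obtain ⟨i, hi⟩ := Finite.surjective_of_injective hG ⟨r, by omega⟩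
  have h1 : g i = r := congrArg Fin.val hi
  exact ⟨i, by omega, by rw [hcg i (by omega), h1, zpow_natCast]⟩

theorem apply_eq_of_forall_lt (hw : IsWeighted q m L φ Λ f) {c : ℕ → k} (h0 : f c ≠ 0) {r p : ℕ}
    (hr : 1 ≤ r) (hrp : r < p) (hp : p ≤ m) (hc : ∀ i < r, c i = q ^ (i : ℤ))
    (hcp : c p = q ^ (r : ℤ)) {i : ℕ} (hri : r ≤ i) (hip : i < p) :
    c i = q ^ ((r : ℤ) - i - 1) := by
  induction i using Nat.strong_induction_on with
  | _ i ih =>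
  have inj := hw.injective c h0
  have h1 : c i ≠ 1 := fun h => by
    have := inj i (by omega) 0 (by omega) (by rw [h, hc 0 (by omega)]; simp)
    omega
  have h2 : ¬ ∀ l < i, q * c l ≠ c i ∧ q * c i ≠ c l := fun h =>
    h0 (hw.eq_zero_of_nonadjacent (by omega) h h1)
  push Not at h2
  obtain ⟨l, hl, h3⟩ := h2
  obtain ⟨b, hb, hbl⟩ : ∃ b : ℤ, c l = q ^ b ∧ (l < r ∧ b = l ∨ r ≤ l ∧ b = r - l - 1) := by
    by_cases hlr : l < r
    · exact ⟨l, hc l hlr, Or.inl ⟨hlr, rfl⟩⟩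
    · exact ⟨_, ih l hl (by omega) (by omega), Or.inr ⟨by omega, rfl⟩⟩
  have h4 : c i = q ^ (b + 1) ∨ c i = q ^ (b - 1) := by
    by_cases h5 : q * c l = c i
    · left
      rw [← h5, hb, hw.mul_zpow]
    · right
      have := h3 h5
      rw [hb, show b = b - 1 + 1 by ring, ← hw.mul_zpow] at this
      exact mul_left_cancel₀ hw.ne_zero this
  have bad : ∀ j, j ≤ m → j ≠ i → c j ≠ c i := fun j hj hji h => hji (inj j hj i (by omega) h)
  rcases h4 with h4 | h4
  · exfalso
    rcases hbl with ⟨hlr, rfl⟩ | ⟨hlr, rfl⟩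
    · by_cases h5 : l + 1 < r
      · exact bad (l + 1) (by omega) (by omega) (by rw [h4, hc _ h5]; push_cast; rfl)
      · obtain rfl : r = l + 1 := by omega
        exact bad p hp (by omega) (by rw [h4, hcp]; push_cast; rfl)
    · by_cases h5 : l = r
      · subst h5
        exact bad 0 (by omega) (by omega) (by rw [h4, hc 0 (by omega)]; congr 1; push_cast; ring)
      · refine bad (l - 1) (by omega) (by omega) ?_
        rw [h4, ih (l - 1) (by omega) (by omega) (by omega), Nat.cast_sub (by omega)]
        congr 1
        push_cast
        ring
  · rcases hbl with ⟨hlr, rfl⟩ | ⟨hlr, rfl⟩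
    · by_cases h5 : l = 0
      · subst h5
        by_cases h6 : i = r
        · rw [h4, h6]
          congr 1
          push_cast
          ring
        · refine absurd ?_ (bad r (by omega) (Ne.symm h6))
          rw [h4, ih r (by omega) le_rfl (by omega)]
          congr 1
          push_cast
          ring
      · refine absurd ?_ (bad (l - 1) (by omega) (by omega))
        rw [h4, hc _ (by omega), Nat.cast_sub (by omega)]
        push_cast
        rfl
    · by_cases h5 : i = l + 1
      · rw [h4, h5]
        congr 1
        push_cast
        ring
      · refine absurd ?_ (bad (l + 1) (by omega) (by omega))
        rw [h4, ih (l + 1) (by omega) (by omega) (by omega)]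
        congr 1
        push_cast
        ring

theorem mem_of_forall_lt (hw : IsWeighted q m L φ Λ f) {J : AddSubgroup A}
    (hΛ : ∀ a ∈ Λ, ∀ y ∈ J, a * y ∈ J) (hl : ∀ i < m, ∀ y ∈ J, φ i * y ∈ J)
    (hr : ∀ i < m, ∀ y ∈ J, y * φ i ∈ J)
    (hf : ∀ r, 1 ≤ r → r ≤ m → f (hookWeight q r) ∈ J) {d r p : ℕ} (hd : r + d = m + 1) (h1 : 1 ≤ r)
    (hrp : r ≤ p) (hp : p ≤ m) {c : ℕ → k} (hc : ∀ i < r, c i = q ^ (i : ℤ))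
    (hcp : c p = q ^ (r : ℤ)) : f c ∈ J := by
  induction d generalizing r p c with
  | zero => omega
  | succ d ihd =>
    induction p, hrp using Nat.le_induction generalizing c with
    | base =>
      have hc' : ∀ i < r + 1, c i = q ^ (i : ℤ) := fun i hi => by
        rcases Nat.lt_succ_iff_lt_or_eq.1 hi with h | rfl
        exacts [hc i h, hcp]
      by_cases h0 : f c = 0
      · rw [h0]
        exact zero_mem _
      rcases hp.lt_or_eq with hlt | rfl
      · obtain ⟨i, hi, hci⟩ := hw.exists_apply_eq h0 (r := r + 1) (by omega)
        refine ihd (r := r + 1) (p := i) (by omega) (by omega) ?_ hi hc' hci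
        by_contra h
        rw [hc' i (by omega)] at hci
        exact hw.zpow_ne (by omega) (by omega) (by omega) hci
      · rw [hw.congr c (hookWeight q r) fun i hi => ?_]
        · exact hf r h1 le_rfl
        · rcases hi.lt_or_eq with h | rfl
          · rw [hc i h, hookWeight_of_lt h]
          · rw [hcp, hw.hookWeight_last le_rfl]
    | succ p hrp ihp =>
      by_cases h0 : f c = 0
      · rw [h0]
        exact zero_mem _
      have h2 : ∀ i, r ≤ i → i < p + 1 → c i = q ^ ((r : ℤ) - i - 1) := fun i =>
        hw.apply_eq_of_forall_lt h0 h1 (by omega) hp hc hcp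
      rcases hp.lt_or_eq with hlt | h3
      · obtain ⟨z, hz, h⟩ := hw.exists_eq_of_admissible (i := p) (c := c) (by omega)
          (by
            rw [hcp, h2 p hrp (by omega), hw.mul_zpow]
            exact hw.zpow_ne (by omega) (by omega) (by omega))
          (by
            rw [hcp, h2 p hrp (by omega), hw.mul_zpow]
            exact hw.zpow_ne (by omega) (by omega) (by omega))
        rw [h]
        refine hr p (by omega) _ ?_
        rw [mul_assoc]
        refine hΛ z hz _ (hl p (by omega) _ (ihp (by omega) (fun i hi => ?_) ?_))
        · rw [Function.comp_apply, Equiv.swap_apply_of_ne_of_ne (by omega) (by omega), hc i hi]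
        · simpa using hcp
      · rw [hw.congr c (hookWeight q r) fun i hi => ?_]
        · exact hf r h1 (by omega)
        · rcases lt_or_ge i r with h | h
          · rw [hc i h, hookWeight_of_lt h]
          · rcases hi.lt_or_eq with h4 | h4
            · rw [h2 i h (by omega), hookWeight_of_le h]
            · rw [h4, hw.hookWeight_last (by omega), ← h3, hcp]

theorem one_mem_of_hook (hw : IsWeighted q m L φ Λ f) {J : AddSubgroup A}
    (hΛ : ∀ a ∈ Λ, ∀ y ∈ J, a * y ∈ J) (hl : ∀ i < m, ∀ y ∈ J, φ i * y ∈ J)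
    (hr : ∀ i < m, ∀ y ∈ J, y * φ i ∈ J)
    (hf : ∀ r, 1 ≤ r → r ≤ m → f (hookWeight q r) ∈ J) : 1 ∈ J := by
  refine hw.complete J fun c => ?_
  by_cases h0 : f c = 0
  · rw [h0]
    exact zero_mem _
  obtain ⟨p, hp, hcp⟩ := hw.exists_apply_eq h0 hw.pos
  have hc0 := hw.apply_zero c h0
  refine hw.mem_of_forall_lt hΛ hl hr hf (show 1 + m = m + 1 by omega) le_rfl ?_ hp ?_ hcp
  · by_contra h
    obtain rfl : p = 0 := by omega
    have h3 : q ^ (0 : ℤ) ≠ q ^ (1 : ℤ) :=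
      hw.zpow_ne (by omega) (by have := hw.pos; omega) (by have := hw.pos; omega)
    exact h3 (by rw [zpow_zero, ← hc0, hcp]; simp)
  · intro i hi
    obtain rfl : i = 0 := by omega
    simpa using hc0

end IsWeighted

theorem jm_mem_adjoin (q : k) (T : ℕ → A) (i : ℕ) :
    jm q T i ∈ Algebra.adjoin k (Set.range T) := by
  induction i with
  | zero => exact Subalgebra.one_mem _
  | succ i ih =>
    have h : T i ∈ Algebra.adjoin k (Set.range T) := Algebra.subset_adjoin ⟨i, rfl⟩
    exact Subalgebra.smul_mem _ (Subalgebra.mul_mem _ (Subalgebra.mul_mem _ h ih) h) _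

theorem jmAlg_le_adjoin (q : k) (T : ℕ → A) : jmAlg q T ≤ Algebra.adjoin k (Set.range T) :=
  Algebra.adjoin_le (by rintro _ ⟨i, rfl⟩; exact jm_mem_adjoin q T i)

theorem inter_mem_adjoin (q : k) (T : ℕ → A) (i : ℕ) :
    inter q T i ∈ Algebra.adjoin k (Set.range T) :=
  Subalgebra.add_mem _ (Subalgebra.mul_mem _ (Algebra.subset_adjoin ⟨i, rfl⟩)
    (Subalgebra.sub_mem _ (jm_mem_adjoin q T _) (jm_mem_adjoin q T _)))
    (Subalgebra.smul_mem _ (jm_mem_adjoin q T _) _)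

theorem IsWeightSystem.adjoin_le_normalSpan {q : k} {m : ℕ} {T : ℕ → A} {f : (ℕ → k) → A}
    (hf : IsWeightSystem q m T f) (h : IsHecke q m T)
    (hw : IsWeighted q m (jm q T) (inter q T) (jmAlg q T) f) {b : A}
    (hb : b ∈ Algebra.adjoin k (Set.range T)) :
    b ∈ normalSpan (inter q T) (jmAlg q T) m := by
  have hT : ∀ i, ∀ y ∈ normalSpan (inter q T) (jmAlg q T) m,
      T i * y ∈ normalSpan (inter q T) (jmAlg q T) m := by
    intro i y hy
    by_cases hi : i < m
    · obtain ⟨d, hd, h1⟩ := hf.inverse i hi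
      have h2 : T i = inter q T i * d - (q - 1) • (jm q T (i + 1) * d) := by
        rw [inter, add_mul, mul_assoc, h1, mul_one, smul_mul_assoc, add_sub_cancel_right]
      have h3 := hw.mul_mem_normalSpan m hd hy
      rw [h2, sub_mul, mul_assoc]
      exact sub_mem (hw.inter_mul_mem_normalSpan le_rfl hi h3) (hw.mul_mem_normalSpan m
        (Subalgebra.smul_mem _ (Subalgebra.mul_mem _ (hw.mem _) hd) _) hy)
    · rw [h.zero i (by omega), zero_mul]
      exact zero_mem _
  have key : ∀ y ∈ normalSpan (inter q T) (jmAlg q T) m,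
      b * y ∈ normalSpan (inter q T) (jmAlg q T) m := by
    induction hb using Algebra.adjoin_induction with
    | mem x hx =>
      obtain ⟨i, rfl⟩ := hx
      exact hT i
    | algebraMap c => exact fun y hy => hw.mul_mem_normalSpan m (Subalgebra.algebraMap_mem _ c) hy
    | add x y _ _ hx hy =>
      intro w hw
      rw [add_mul]
      exact add_mem (hx w hw) (hy w hw)
    | mul x y _ _ hx hy =>
      intro w hw
      rw [mul_assoc]
      exact hx _ (hy w hw)
  simpa using key 1 (IsWeighted.one_mem_normalSpan m)

theorem IsHecke.exists_isZigzag [FiniteDimensional k A] {q : k} {m : ℕ} {T : ℕ → A}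
    (h : IsHecke q m T) (hq : q ≠ 0) (hm : 1 ≤ m) (hnil : TraceNil q m T)
    (hord : orderOf q = m + 1) : ∃ (u v : ℕ → k) (F α β x : ℕ → A), IsZigzag m u v F α β x ∧
      (∀ r, F r ∈ Algebra.adjoin k (Set.range T) ∧ α r ∈ Algebra.adjoin k (Set.range T) ∧
        β r ∈ Algebra.adjoin k (Set.range T) ∧ x r ∈ Algebra.adjoin k (Set.range T)) ∧
      (∀ r s, ∀ b ∈ Algebra.adjoin k (Set.range T), F s * b * F r ∈
        Submodule.span k (Set.range F ∪ Set.range α ∪ Set.range β ∪ Set.range x)) ∧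
      1 ∈ AddSubgroup.closure {y : A | ∃ r, ∃ a ∈ Algebra.adjoin k (Set.range T),
        ∃ b ∈ Algebra.adjoin k (Set.range T), y = a * F r * b} := by
  obtain ⟨f, hf⟩ := h.exists_isWeightSystem hq hnil hord
  have hw := hf.isWeighted h hm hq hord
  obtain ⟨u, v, F, α, β, x, hZ, hF, hmem, hspan⟩ := hw.exists_isZigzag
  refine ⟨u, v, F, α, β, x, hZ, hmem _ (jmAlg_le_adjoin q T) fun i _ => inter_mem_adjoin q T i,
    fun r s b hb => hspan r s b (hf.adjoin_le_normalSpan h hw hb), ?_⟩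
  have hL : ∀ c ∈ Algebra.adjoin k (Set.range T), ∀ y ∈ AddSubgroup.closure
      {y : A | ∃ r, ∃ a ∈ Algebra.adjoin k (Set.range T),
        ∃ b ∈ Algebra.adjoin k (Set.range T), y = a * F r * b}, c * y ∈ AddSubgroup.closure
      {y : A | ∃ r, ∃ a ∈ Algebra.adjoin k (Set.range T),
        ∃ b ∈ Algebra.adjoin k (Set.range T), y = a * F r * b} := by
    intro c hc y hy
    induction hy using AddSubgroup.closure_induction with
    | mem y hy =>
      obtain ⟨r, a, ha, b, hb, rfl⟩ := hy
      exact AddSubgroup.subset_closure ⟨r, c * a, Subalgebra.mul_mem _ hc ha, b, hb, by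
        simp only [mul_assoc]⟩
    | zero => rw [mul_zero]; exact zero_mem _
    | add y z _ _ hy hz => rw [mul_add]; exact add_mem hy hz
    | neg y _ hy => rw [mul_neg]; exact neg_mem hy
  have hR : ∀ c ∈ Algebra.adjoin k (Set.range T), ∀ y ∈ AddSubgroup.closure
      {y : A | ∃ r, ∃ a ∈ Algebra.adjoin k (Set.range T),
        ∃ b ∈ Algebra.adjoin k (Set.range T), y = a * F r * b}, y * c ∈ AddSubgroup.closure
      {y : A | ∃ r, ∃ a ∈ Algebra.adjoin k (Set.range T),
        ∃ b ∈ Algebra.adjoin k (Set.range T), y = a * F r * b} := by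
    intro c hc y hy
    induction hy using AddSubgroup.closure_induction with
    | mem y hy =>
      obtain ⟨r, a, ha, b, hb, rfl⟩ := hy
      exact AddSubgroup.subset_closure ⟨r, a, ha, b * c, Subalgebra.mul_mem _ hb hc, by
        simp only [mul_assoc]⟩
    | zero => rw [zero_mul]; exact zero_mem _
    | add y z _ _ hy hz => rw [add_mul]; exact add_mem hy hz
    | neg y _ hy => rw [neg_mul]; exact neg_mem hy
  refine hw.one_mem_of_hook (fun a ha => hL a (jmAlg_le_adjoin q T ha))
    (fun i _ => hL _ (inter_mem_adjoin q T i)) (fun i _ => hR _ (inter_mem_adjoin q T i)) ?_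
  intro r h1 h2
  rw [← hF r h1 h2]
  exact AddSubgroup.subset_closure ⟨r, 1, Subalgebra.one_mem _, 1, Subalgebra.one_mem _, by simp⟩

end Generation

/-- A representation of a zigzag algebra of type `A_m`, given by operators on one vector space. -/
structure ZigzagRep (k : Type) [Field k] (m : ℕ) (u v : ℕ → k) : Type 1 where
  carrier : Type
  [isAddCommGroup : AddCommGroup carrier]
  [isModule : Module k carrier]
  F : ℕ → Module.End k carrier
  α : ℕ → Module.End k carrier
  β : ℕ → Module.End k carrier
  x : ℕ → Module.End k carrier
  rel : IsZigzag m u v F α β x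

attribute [instance] ZigzagRep.isAddCommGroup ZigzagRep.isModule

namespace ZigzagRep

variable {k : Type} [Field k] {m : ℕ} {u v : ℕ → k}

section Relations

variable (Z : ZigzagRep k m u v) (r : ℕ) (y : Z.carrier)

theorem F_F : Z.F r (Z.F r y) = Z.F r y := LinearMap.congr_fun (Z.rel.idem r) y

theorem F_α : Z.F (r + 1) (Z.α r y) = Z.α r y := LinearMap.congr_fun (Z.rel.α_left r) y

theorem α_F : Z.α r (Z.F r y) = Z.α r y := LinearMap.congr_fun (Z.rel.α_right r) y

theorem F_β : Z.F r (Z.β r y) = Z.β r y := LinearMap.congr_fun (Z.rel.β_left r) y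

theorem β_F : Z.β r (Z.F (r + 1) y) = Z.β r y := LinearMap.congr_fun (Z.rel.β_right r) y

theorem F_x : Z.F r (Z.x r y) = Z.x r y := LinearMap.congr_fun (Z.rel.x_left r) y

theorem x_F : Z.x r (Z.F r y) = Z.x r y := LinearMap.congr_fun (Z.rel.x_right r) y

theorem α_x : Z.α r (Z.x r y) = 0 := LinearMap.congr_fun (Z.rel.α_x r) y

theorem x_α : Z.x (r + 1) (Z.α r y) = 0 := LinearMap.congr_fun (Z.rel.x_α r) y

theorem β_x : Z.β r (Z.x (r + 1) y) = 0 := LinearMap.congr_fun (Z.rel.β_x r) y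

theorem x_β : Z.x r (Z.β r y) = 0 := LinearMap.congr_fun (Z.rel.x_β r) y

theorem x_x : Z.x r (Z.x r y) = 0 := LinearMap.congr_fun (Z.rel.x_x r) y

theorem α_α : Z.α (r + 1) (Z.α r y) = 0 := LinearMap.congr_fun (Z.rel.α_α r) y

theorem β_β : Z.β r (Z.β (r + 1) y) = 0 := LinearMap.congr_fun (Z.rel.β_β r) y

variable {r}

theorem F_eq_zero (h : ¬ (1 ≤ r ∧ r ≤ m)) : Z.F r y = 0 :=
  LinearMap.congr_fun (Z.rel.F_zero r h) y

theorem α_eq_zero (h : ¬ (1 ≤ r ∧ r < m)) : Z.α r y = 0 := by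
  rw [not_and_or] at h
  rcases h with h | h
  · rw [← Z.α_F, Z.F_eq_zero _ (by omega), map_zero]
  · rw [← Z.F_α, Z.F_eq_zero _ (by omega)]

theorem β_eq_zero (h : ¬ (1 ≤ r ∧ r < m)) : Z.β r y = 0 := by
  rw [not_and_or] at h
  rcases h with h | h
  · rw [← Z.F_β, Z.F_eq_zero _ (by omega)]
  · rw [← Z.β_F, Z.F_eq_zero _ (by omega), map_zero]

theorem β_α (h : 1 ≤ r) (h' : r < m) : Z.β r (Z.α r y) = u r • Z.x r y :=
  LinearMap.congr_fun (Z.rel.β_α r h h') y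

theorem α_β (h : 1 ≤ r) (h' : r < m) : Z.α r (Z.β r y) = v r • Z.x (r + 1) y :=
  LinearMap.congr_fun (Z.rel.α_β r h h') y

end Relations

/-- A homomorphism of zigzag representations, given by its components at the vertices. -/
structure IsHom (Z Z' : ZigzagRep k m u v) (θ : ℕ → Z.carrier →ₗ[k] Z'.carrier) : Prop where
  left : ∀ r y, Z'.F r (θ r y) = θ r y
  right : ∀ r y, θ r (Z.F r y) = θ r y
  α : ∀ r y, Z'.α r (θ r y) = θ (r + 1) (Z.α r y)
  β : ∀ r y, Z'.β r (θ (r + 1) y) = θ r (Z.β r y)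
  x : ∀ r y, Z'.x r (θ r y) = θ r (Z.x r y)

/-- The only idempotent endomorphisms are the trivial ones. -/
def Indec (Z : ZigzagRep k m u v) : Prop :=
  ∀ θ : ℕ → Module.End k Z.carrier, IsHom Z Z θ → (∀ r y, θ r (θ r y) = θ r y) →
    (∀ r, θ r = 0) ∨ (∀ r, θ r = Z.F r)

/-- Isomorphism of zigzag representations. -/
def Iso (Z Z' : ZigzagRep k m u v) : Prop :=
  ∃ (θ : ℕ → Z.carrier →ₗ[k] Z'.carrier) (θ' : ℕ → Z'.carrier →ₗ[k] Z.carrier),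
    IsHom Z Z' θ ∧ IsHom Z' Z θ' ∧ (∀ r y, θ' r (θ r y) = Z.F r y) ∧
      ∀ r y, θ r (θ' r y) = Z'.F r y

section Projective

/-- The homomorphism determined by a generator `w` of the target and a functional `ξ`. -/
def thread (Z Z' : ZigzagRep k m u v) (a : ℕ) (w : Z'.carrier) (ξ : Z.carrier →ₗ[k] k) (r : ℕ) :
    Z.carrier →ₗ[k] Z'.carrier :=
  if r = a then (ξ ∘ₗ Z.x a).smulRight w + (ξ ∘ₗ Z.F a).smulRight (Z'.x a w)
  else if r = a + 1 then (u a)⁻¹ • (ξ ∘ₗ Z.β a).smulRight (Z'.α a w)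
  else if r + 1 = a then (v r)⁻¹ • (ξ ∘ₗ Z.α r).smulRight (Z'.β r w)
  else 0

variable {Z Z' Z'' : ZigzagRep k m u v} {a : ℕ} {w : Z'.carrier} {ξ : Z.carrier →ₗ[k] k}

theorem thread_self (y : Z.carrier) :
    thread Z Z' a w ξ a y = ξ (Z.x a y) • w + ξ (Z.F a y) • Z'.x a w := by
  simp [thread]

theorem thread_succ (y : Z.carrier) :
    thread Z Z' a w ξ (a + 1) y = (u a)⁻¹ • ξ (Z.β a y) • Z'.α a w := by
  simp [thread]

theorem thread_pred (a : ℕ) (y : Z.carrier) :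
    thread Z Z' (a + 1) w ξ a y = (v a)⁻¹ • ξ (Z.α a y) • Z'.β a w := by
  simp [thread, show a ≠ a + 1 + 1 by omega]

theorem thread_of_ne {r : ℕ} (h1 : r ≠ a) (h2 : r ≠ a + 1) (h3 : r + 1 ≠ a) :
    thread Z Z' a w ξ r = 0 := by
  simp [thread, h1, h2, h3]

theorem isHom_thread (hw : Z'.F a w = w) : IsHom Z Z' (thread Z Z' a w ξ) := by
  have hcases : ∀ r, r = a ∨ r = a + 1 ∨ r + 1 = a ∨ (r ≠ a ∧ r ≠ a + 1 ∧ r + 1 ≠ a) := by omega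
  constructor
  · intro r y
    rcases hcases r with rfl | rfl | rfl | ⟨h1, h2, h3⟩
    · simp [thread_self, hw, Z'.F_x]
    · simp [thread_succ, Z'.F_α]
    · simp [thread_pred, Z'.F_β]
    · simp [thread_of_ne h1 h2 h3]
  · intro r y
    rcases hcases r with rfl | rfl | rfl | ⟨h1, h2, h3⟩
    · simp [thread_self, Z.x_F, Z.F_F]
    · simp [thread_succ, Z.β_F]
    · simp [thread_pred, Z.α_F]
    · simp [thread_of_ne h1 h2 h3]
  · intro r y
    rcases hcases r with rfl | rfl | rfl | ⟨h1, h2, h3⟩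
    · by_cases h : 1 ≤ r ∧ r < m
      · simp [thread_self, thread_succ, Z'.α_x, Z.β_α _ h.1 h.2, smul_smul, Z.rel.u_ne r]
      · simp [Z'.α_eq_zero _ h, Z.α_eq_zero _ h]
    · rw [thread_of_ne (r := a + 1 + 1) (by omega) (by omega) (by omega)]
      simp [thread_succ, Z'.α_α]
    · by_cases h : 1 ≤ r ∧ r < m
      · have h0 : ξ (Z.x (r + 1) (Z.α r y)) = 0 := by rw [Z.x_α, map_zero]
        simp [thread_self, thread_pred, Z'.α_β _ h.1 h.2, smul_smul, h0, Z.F_α,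
          Z'.rel.v_ne r, mul_right_comm _ _ (v r)]
      · simp [Z'.α_eq_zero _ h, Z.α_eq_zero _ h]
    · by_cases h4 : r + 1 + 1 = a
      · subst h4
        rw [thread_of_ne h1 h2 h3]
        simp [thread_pred, Z.α_α]
      · rw [thread_of_ne h1 h2 h3, thread_of_ne (r := r + 1) h3 (by omega) h4]
        simp
  · intro r y
    rcases hcases r with rfl | rfl | rfl | ⟨h1, h2, h3⟩
    · by_cases h : 1 ≤ r ∧ r < m
      · have h0 : ξ (Z.x r (Z.β r y)) = 0 := by rw [Z.x_β, map_zero]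
        simp [thread_self, thread_succ, Z'.β_α _ h.1 h.2, smul_smul, h0, Z.F_β,
          Z'.rel.u_ne r, mul_right_comm _ _ (u r)]
      · simp [Z'.β_eq_zero _ h, Z.β_eq_zero _ h]
    · rw [thread_of_ne (r := a + 1 + 1) (by omega) (by omega) (by omega)]
      simp [thread_succ, Z.β_β]
    · by_cases h : 1 ≤ r ∧ r < m
      · simp [thread_self, thread_pred, Z'.β_x, Z.α_β _ h.1 h.2, smul_smul, Z.rel.v_ne r]
      · simp [Z'.β_eq_zero _ h, Z.β_eq_zero _ h]
    · by_cases h4 : r + 1 + 1 = a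
      · subst h4
        rw [thread_of_ne h1 h2 h3]
        simp [thread_pred, Z'.β_β]
      · rw [thread_of_ne h1 h2 h3, thread_of_ne (r := r + 1) h3 (by omega) h4]
        simp
  · intro r y
    rcases hcases r with rfl | rfl | rfl | ⟨h1, h2, h3⟩
    · simp [thread_self, Z.x_x, Z'.x_x, Z.F_x]
    · simp [thread_succ, Z.β_x, Z'.x_α]
    · simp [thread_pred, Z.α_x, Z'.x_β]
    · simp [thread_of_ne h1 h2 h3]

theorem thread_comp {w' : Z''.carrier} {ξ' : Z'.carrier →ₗ[k] k} (hw : Z'.F a w = w)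
    (h1 : ξ' (Z'.x a w) = 1) (h0 : ξ' w = 0) (r : ℕ) (y : Z.carrier) :
    thread Z' Z'' a w' ξ' r (thread Z Z' a w ξ r y) = thread Z Z'' a w' ξ r y := by
  obtain rfl | rfl | rfl | ⟨h2, h3, h4⟩ :
      r = a ∨ r = a + 1 ∨ r + 1 = a ∨ (r ≠ a ∧ r ≠ a + 1 ∧ r + 1 ≠ a) := by omega
  · simp [thread_self, h1, h0, hw, Z'.F_x, Z'.x_x]
  · by_cases h : 1 ≤ a ∧ a < m
    · simp [thread_succ, Z'.β_α _ h.1 h.2, h1, smul_smul, Z'.rel.u_ne a]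
    · simp [thread_succ, Z'.α_eq_zero _ h, Z''.α_eq_zero _ h]
  · by_cases h : 1 ≤ r ∧ r < m
    · simp [thread_pred, Z'.α_β _ h.1 h.2, h1, smul_smul, Z'.rel.v_ne r]
    · simp [thread_pred, Z'.β_eq_zero _ h, Z''.β_eq_zero _ h]
  · simp [thread_of_ne h2 h3 h4]

theorem Indec.exists_thread (hZ : Z.Indec) (hx : Z.x a ≠ 0) :
    ∃ (w : Z.carrier) (ξ : Z.carrier →ₗ[k] k), Z.F a w = w ∧ ξ (Z.x a w) = 1 ∧ ξ w = 0 ∧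
      ∀ r, thread Z Z a w ξ r = Z.F r := by
  obtain ⟨y, hy⟩ : ∃ y, Z.x a y ≠ 0 := by
    by_contra h
    push Not at h
    exact hx (LinearMap.ext h)
  obtain ⟨ξ, hξ⟩ := Module.Projective.exists_dual_eq_one k hy
  have hw : Z.F a (Z.F a y - ξ (Z.F a y) • Z.x a y) = Z.F a y - ξ (Z.F a y) • Z.x a y := by
    simp [Z.F_F, Z.F_x]
  have h1 : ξ (Z.x a (Z.F a y - ξ (Z.F a y) • Z.x a y)) = 1 := by simp [Z.x_F, Z.x_x, hξ]
  have h0 : ξ (Z.F a y - ξ (Z.F a y) • Z.x a y) = 0 := by simp [hξ]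
  refine ⟨_, ξ, hw, h1, h0, ?_⟩
  refine (hZ _ (isHom_thread hw) fun r y => thread_comp hw h1 h0 r y).resolve_left fun h => ?_
  have h2 := LinearMap.congr_fun (h a) (Z.F a y - ξ (Z.F a y) • Z.x a y)
  rw [thread_self, h1, hw, h0, zero_smul, add_zero, one_smul] at h2
  rw [h2] at h1
  simp at h1

theorem Indec.iso_of_x_ne_zero (hZ : Z.Indec) (hZ' : Z'.Indec) (hx : Z.x a ≠ 0)
    (hx' : Z'.x a ≠ 0) : Z.Iso Z' := by
  obtain ⟨w, ξ, hw, h1, h0, h⟩ := hZ.exists_thread hx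
  obtain ⟨w', ξ', hw', h1', h0', h'⟩ := hZ'.exists_thread hx'
  refine ⟨_, _, isHom_thread hw' (ξ := ξ), isHom_thread hw (ξ := ξ'), fun r y => ?_, fun r y => ?_⟩
  · rw [thread_comp hw' h1' h0', h]
  · rw [thread_comp hw h1 h0, h']

end Projective

end ZigzagRep

namespace ZigzagRep

variable {k : Type} [Field k] {m : ℕ} {u v : ℕ → k}

section Parity

/-- The part of the component at a vertex that is hit by the arrows. -/
def socle (Z : ZigzagRep k m u v) : ℕ → Submodule k Z.carrier
  | 0 => ⊥
  | r + 1 => LinearMap.range (Z.α r) ⊔ LinearMap.range (Z.β (r + 1))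

variable {Z : ZigzagRep k m u v}

theorem F_of_mem_socle {r : ℕ} {y : Z.carrier} (hy : y ∈ Z.socle r) : Z.F r y = y := by
  cases r with
  | zero =>
    obtain rfl : y = 0 := hy
    exact map_zero _
  | succ r =>
    obtain ⟨_, ⟨a, rfl⟩, _, ⟨b, rfl⟩, rfl⟩ := Submodule.mem_sup.1 hy
    rw [map_add, Z.F_α, Z.F_β]

theorem α_mem_socle (r : ℕ) (y : Z.carrier) : Z.α r y ∈ Z.socle (r + 1) :=
  Submodule.mem_sup_left ⟨y, rfl⟩

theorem β_mem_socle (r : ℕ) (y : Z.carrier) : Z.β r y ∈ Z.socle r := by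
  cases r with
  | zero =>
    rw [Z.β_eq_zero _ (by omega)]
    exact Submodule.zero_mem _
  | succ r => exact Submodule.mem_sup_right ⟨y, rfl⟩

theorem α_of_mem_socle (hx : ∀ r, Z.x r = 0) {r : ℕ} {y : Z.carrier} (hy : y ∈ Z.socle r) :
    Z.α r y = 0 := by
  cases r with
  | zero => exact Z.α_eq_zero _ (by omega)
  | succ r =>
    obtain ⟨_, ⟨a, rfl⟩, _, ⟨b, rfl⟩, rfl⟩ := Submodule.mem_sup.1 hy
    rw [map_add, Z.α_α, zero_add]
    by_cases h : 1 ≤ r + 1 ∧ r + 1 < m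
    · rw [Z.α_β _ h.1 h.2, hx, LinearMap.zero_apply, smul_zero]
    · exact Z.α_eq_zero _ h

theorem β_of_mem_socle (hx : ∀ r, Z.x r = 0) {r : ℕ} {y : Z.carrier}
    (hy : y ∈ Z.socle (r + 1)) : Z.β r y = 0 := by
  obtain ⟨_, ⟨a, rfl⟩, _, ⟨b, rfl⟩, rfl⟩ := Submodule.mem_sup.1 hy
  rw [map_add, Z.β_β, add_zero]
  by_cases h : 1 ≤ r ∧ r < m
  · rw [Z.β_α _ h.1 h.2, hx, LinearMap.zero_apply, smul_zero]
  · exact Z.β_eq_zero _ h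

theorem exists_projection_socle (Z : ZigzagRep k m u v) (r : ℕ) :
    ∃ g : Module.End k Z.carrier, (∀ y, g y ∈ Z.socle r) ∧ (∀ y ∈ Z.socle r, g y = y) ∧
      ∀ y, g (Z.F r y) = g y := by
  obtain ⟨π, hπ⟩ := LinearMap.exists_leftInverse_of_injective (Z.socle r).subtype
    (Submodule.ker_subtype _)
  refine ⟨(Z.socle r).subtype ∘ₗ π ∘ₗ Z.F r, fun y => (π _).2, fun y hy => ?_, fun y => ?_⟩
  · have := LinearMap.congr_fun hπ ⟨y, hy⟩
    simp only [LinearMap.comp_apply, Submodule.subtype_apply, LinearMap.id_apply] at this ⊢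
    rw [F_of_mem_socle hy, this]
  · simp [Z.F_F]

/-- If all `x` act as zero then an indecomposable representation is a representation of a quiver
with alternating orientation. -/
theorem Indec.α_eq_zero_or_β_eq_zero (hZ : Z.Indec) (hx : ∀ r, Z.x r = 0) (r : ℕ) :
    Z.α r = 0 ∨ Z.β r = 0 := by
  choose g hg hgs hgF using exists_projection_socle Z
  have hFg : ∀ r y, Z.F r (g r y) = g r y := fun r y => F_of_mem_socle (hg r y)
  have hgg : ∀ r y, g r (g r y) = g r y := fun r y => hgs r _ (hg r y)
  have hαg : ∀ r y, Z.α r (g r y) = 0 := fun r y => α_of_mem_socle hx (hg r y)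
  have hβg : ∀ r y, Z.β r (g (r + 1) y) = 0 := fun r y => β_of_mem_socle hx (hg (r + 1) y)
  have hgα : ∀ r y, g (r + 1) (Z.α r y) = Z.α r y := fun r y => hgs _ _ (α_mem_socle r y)
  have hgβ : ∀ r y, g r (Z.β r y) = Z.β r y := fun r y => hgs _ _ (β_mem_socle r y)
  have key := hZ (fun r => if Odd r then Z.F r - g r else g r)
    (by
      constructor
      · intro r y
        by_cases h : Odd r <;> simp [h, hFg, Z.F_F]
      · intro r y
        by_cases h : Odd r <;> simp [h, hgF, Z.F_F]
      · intro r y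
        by_cases h : Odd r
        · simp [h, hαg, hgα, Z.α_F, Nat.odd_add_one]
        · simp [h, hαg, hgα, Z.F_α, Nat.odd_add_one]
      · intro r y
        by_cases h : Odd r
        · simp [h, hβg, hgβ, Z.F_β, Nat.odd_add_one]
        · simp [h, hβg, hgβ, Z.β_F, Nat.odd_add_one]
      · intro r y
        simp [hx])
    (by
      intro r y
      by_cases h : Odd r <;> simp [h, hFg, hgF, hgg, Z.F_F])
  rcases key with key | key
  · by_cases h : Odd r
    · left
      ext y
      have h1 := LinearMap.congr_fun (key r) y
      simp only [h, if_true, LinearMap.sub_apply, LinearMap.zero_apply, sub_eq_zero] at h1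
      rw [← Z.α_F, h1, hαg, LinearMap.zero_apply]
    · right
      ext y
      have h1 := LinearMap.congr_fun (key (r + 1)) y
      simp only [Nat.odd_add_one, h, not_false_eq_true, if_true, LinearMap.sub_apply,
        LinearMap.zero_apply, sub_eq_zero] at h1
      rw [← Z.β_F, h1, hβg, LinearMap.zero_apply]
  · by_cases h : Odd r
    · right
      ext y
      have h1 := LinearMap.congr_fun (key (r + 1)) y
      simp only [Nat.odd_add_one, h, not_true_eq_false, if_false] at h1
      rw [← Z.β_F, ← h1, hβg, LinearMap.zero_apply]
    · left
      ext y
      have h1 := LinearMap.congr_fun (key r) y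
      simp only [h, if_false] at h1
      rw [← Z.α_F, ← h1, hαg, LinearMap.zero_apply]

end Parity

section Strings

/-- A rank-at-most-one direct summand supported on the vertices up to `n`. -/
structure IsString (Z : ZigzagRep k m u v) (n : ℕ) (w : ℕ → Z.carrier)
    (ξ : ℕ → Z.carrier →ₗ[k] k) : Prop where
  F_vec : ∀ r, Z.F r (w r) = w r
  fun_F : ∀ r y, ξ r (Z.F r y) = ξ r y
  pairing : ∀ r, ξ r (w r) = 1 ∨ (w r = 0 ∧ ξ r = 0)
  vec_zero : ∀ r, n < r → w r = 0
  fun_zero : ∀ r, n < r → ξ r = 0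
  α : ∀ r, r < n → ∀ y, ξ r y • Z.α r (w r) = ξ (r + 1) (Z.α r y) • w (r + 1)
  β : ∀ r, r < n → ∀ y, ξ (r + 1) y • Z.β r (w (r + 1)) = ξ r (Z.β r y) • w r

variable {Z : ZigzagRep k m u v}

theorem IsString.zero (Z : ZigzagRep k m u v) (n : ℕ) : IsString Z n 0 0 := by
  constructor <;> simp

theorem IsString.update {n : ℕ} {w : ℕ → Z.carrier} {ξ : ℕ → Z.carrier →ₗ[k] k}
    (h : IsString Z n w ξ) {w' : Z.carrier} {ξ' : Z.carrier →ₗ[k] k}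
    (hw : Z.F (n + 1) w' = w') (hξ : ∀ y, ξ' (Z.F (n + 1) y) = ξ' y) (h1 : ξ' w' = 1)
    (hα : ∀ y, ξ n y • Z.α n (w n) = ξ' (Z.α n y) • w')
    (hβ : ∀ y, ξ' y • Z.β n w' = ξ n (Z.β n y) • w n) :
    IsString Z (n + 1) (Function.update w (n + 1) w') (Function.update ξ (n + 1) ξ') := by
  constructor
  · intro r
    by_cases hr : r = n + 1
    · subst hr; simpa using hw
    · simpa [hr] using h.F_vec r
  · intro r
    by_cases hr : r = n + 1
    · subst hr; simpa using hξ
    · simpa [hr] using h.fun_F r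
  · intro r
    by_cases hr : r = n + 1
    · subst hr; simp [h1]
    · simpa [hr] using h.pairing r
  · intro r hr
    simpa [show r ≠ n + 1 by omega] using h.vec_zero r (by omega)
  · intro r hr
    simpa [show r ≠ n + 1 by omega] using h.fun_zero r (by omega)
  · intro r hr y
    by_cases h2 : r = n
    · subst h2; simpa using hα y
    · simpa [h2, show r ≠ n + 1 by omega] using h.α r (by omega) y
  · intro r hr y
    by_cases h2 : r = n
    · subst h2; simpa using hβ y
    · simpa [h2, show r ≠ n + 1 by omega] using h.β r (by omega) y

theorem exists_functional {V : Type} [AddCommGroup V] [Module k V] {H : Submodule k V} {y : V}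
    (h : y ∉ H) : ∃ ξ : V →ₗ[k] k, ξ y = 1 ∧ ∀ z ∈ H, ξ z = 0 := by
  have h1 : H.mkQ y ≠ 0 := by simpa using h
  obtain ⟨f, hf⟩ := Module.Projective.exists_dual_eq_one k h1
  exact ⟨f ∘ₗ H.mkQ, hf, fun z hz => by simp [(Submodule.Quotient.mk_eq_zero H).2 hz]⟩

theorem exists_isString (h : ∀ r, Z.α r = 0 ∨ Z.β r = 0) (n : ℕ) (H : Submodule k Z.carrier)
    (hH : ∀ y ∈ H, Z.F n y = y) (y : Z.carrier) (hy : Z.F n y = y) (hyH : y ∉ H) :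
    ∃ w ξ, IsString Z n w ξ ∧ w n - y ∈ H ∧ (∀ z ∈ H, ξ n z = 0) ∧ ξ n (w n) = 1 := by
  induction n generalizing H y with
  | zero =>
    rw [Z.F_eq_zero _ (by omega)] at hy
    exact absurd (hy ▸ H.zero_mem) hyH
  | succ n ih =>
    rcases (h n).symm with hβ | hα
    · by_cases hc : y ∈ H ⊔ LinearMap.range (Z.α n)
      · obtain ⟨a, ha, _, ⟨b, rfl⟩, rfl⟩ := Submodule.mem_sup.1 hc
        obtain ⟨w, ξ, hs, h1, h2, h3⟩ := ih
          (LinearMap.range (Z.F n) ⊓ H.comap (Z.α n))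
          (fun z hz => by obtain ⟨c, rfl⟩ := hz.1; exact Z.F_F _ _) (Z.F n b) (Z.F_F _ _)
          (fun hz => hyH (H.add_mem ha (by simpa [Z.α_F] using hz.2)))
        have hw : Z.α n (w n) ∉ H ⊔ (LinearMap.ker (ξ n)).map (Z.α n) := fun hz => by
          obtain ⟨c, hcH, _, ⟨d, hd, rfl⟩, hcd⟩ := Submodule.mem_sup.1 hz
          have hd' : ξ n d = 0 := hd
          have h4 := h2 (w n - Z.F n d) ⟨⟨w n - d, by simp [hs.F_vec]⟩, by
            have : Z.α n (w n - Z.F n d) = c := by rw [map_sub, Z.α_F, ← hcd]; abel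
            simpa [this] using hcH⟩
          rw [map_sub, h3, hs.fun_F, hd'] at h4
          simp at h4
        obtain ⟨ξ', hξ1, hξ0⟩ := exists_functional hw
        refine ⟨_, _, hs.update (w' := Z.α n (w n)) (ξ' := ξ' ∘ₗ Z.F (n + 1)) (Z.F_α _ _)
          (fun z => by simp [Z.F_F]) (by simp [Z.F_α, hξ1]) (fun z => ?_) (fun z => ?_), ?_, ?_, ?_⟩
        · have h5 : ξ' (Z.α n (z - ξ n z • w n)) = 0 :=
            hξ0 _ (Submodule.mem_sup_right ⟨_, by simp [h3], rfl⟩)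
          rw [map_sub, map_sub, map_smul, map_smul, hξ1, sub_eq_zero] at h5
          simp [Z.F_α, h5]
        · simp [hβ]
        · have h6 := h1.2
          have : Z.α n (w n) - (a + Z.α n b) = Z.α n (w n - Z.F n b) - a := by
            rw [map_sub, Z.α_F]; abel
          simpa [this] using H.sub_mem h6 ha
        · intro z hz
          simpa [hH z hz] using hξ0 z (Submodule.mem_sup_left hz)
        · simp [Z.F_α, hξ1]
      · obtain ⟨ξ', hξ1, hξ0⟩ := exists_functional hc
        refine ⟨_, _, (IsString.zero Z n).update (w' := y) (ξ' := ξ' ∘ₗ Z.F (n + 1)) hy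
          (fun z => by simp [Z.F_F]) (by simp [hy, hξ1]) (fun z => ?_) (fun z => ?_), ?_, ?_, ?_⟩
        · simp [Z.F_α, hξ0 _ (Submodule.mem_sup_right ⟨z, rfl⟩)]
        · simp [hβ]
        · simp
        · intro z hz
          simpa [hH z hz] using hξ0 z (Submodule.mem_sup_left hz)
        · simp [hy, hξ1]
    · by_cases hc : y ∈ H ⊔ (LinearMap.range (Z.F (n + 1)) ⊓ LinearMap.ker (Z.β n))
      · obtain ⟨a, ha, z, ⟨⟨c, hcz⟩, hz⟩, rfl⟩ := Submodule.mem_sup.1 hc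
        have hFz : Z.F (n + 1) z = z := by rw [← hcz, Z.F_F]
        have hβz : Z.β n z = 0 := hz
        obtain ⟨ξ', hξ1, hξ0⟩ := exists_functional (fun hzH : z ∈ H => hyH (H.add_mem ha hzH))
        refine ⟨_, _, (IsString.zero Z n).update (w' := z) (ξ' := ξ' ∘ₗ Z.F (n + 1)) hFz
          (fun z => by simp [Z.F_F]) (by simp [hFz, hξ1]) (fun z => ?_) (fun z => ?_), ?_, ?_, ?_⟩
        · simp [hα]
        · simp [hβz]
        · simpa using ha
        · intro z hz
          simpa [hH z hz] using hξ0 z hz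
        · simp [hFz, hξ1]
      · obtain ⟨w, ξ, hs, ⟨a, ha, h1⟩, h2, h3⟩ := ih (H.map (Z.β n))
          (by rintro _ ⟨z, -, rfl⟩; exact Z.F_β _ _) (Z.β n y) (Z.F_β _ _) (by
            rintro ⟨a, ha, hab⟩
            refine hc (Submodule.mem_sup.2 ⟨a, ha, y - a, ⟨⟨y - a, ?_⟩, ?_⟩, by abel⟩)
            · rw [map_sub, hy, hH a ha]
            · simp [hab])
        have hw : Z.β n (y + a) = w n := by rw [map_add, h1]; abel
        refine ⟨_, _, hs.update (w' := y + a) (ξ' := ξ n ∘ₗ Z.β n) (by rw [map_add, hy, hH a ha])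
          (fun z => by simp [Z.β_F]) ?_ (fun z => ?_) (fun z => ?_), ?_, ?_, ?_⟩
        · rw [LinearMap.comp_apply, hw, h3]
        · simp [hα]
        · rw [LinearMap.comp_apply, hw]
        · simpa using ha
        · intro z hz
          simpa using h2 _ ⟨z, hz, rfl⟩
        · rw [Function.update_self, Function.update_self, LinearMap.comp_apply, hw, h3]

/-- A basis of each component by at most one vector, with its dual basis. -/
structure IsThin (Z : ZigzagRep k m u v) (w : ℕ → Z.carrier) (ξ : ℕ → Z.carrier →ₗ[k] k) :
    Prop where
  F_vec : ∀ r, Z.F r (w r) = w r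
  fun_F : ∀ r y, ξ r (Z.F r y) = ξ r y
  pairing : ∀ r, ξ r (w r) = 1 ∨ (w r = 0 ∧ ξ r = 0)
  F_eq : ∀ r y, Z.F r y = ξ r y • w r

theorem Indec.exists_isThin (hZ : Z.Indec) (hx : ∀ r, Z.x r = 0) : ∃ w ξ, IsThin Z w ξ := by
  have hαβ := hZ.α_eq_zero_or_β_eq_zero hx
  by_cases h0 : ∀ r, Z.F r = 0
  · exact ⟨0, 0, by constructor <;> simp [h0]⟩
  push Not at h0
  obtain ⟨n, hn, hmax⟩ : ∃ n, Z.F n ≠ 0 ∧ ∀ r, n < r → Z.F r = 0 := by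
    have hb : ∀ r, Z.F r ≠ 0 → r ≤ m := fun r hr => by
      by_contra h
      exact hr (Z.rel.F_zero r (by omega))
    obtain ⟨r, hr⟩ := h0
    classical
    refine ⟨Nat.findGreatest (fun r => Z.F r ≠ 0) m,
      Nat.findGreatest_spec (P := fun r => Z.F r ≠ 0) (hb r hr) hr, fun r hr => ?_⟩
    by_contra h
    exact Nat.findGreatest_is_greatest hr (hb r h) h
  obtain ⟨y, hy⟩ : ∃ y, Z.F n y ≠ 0 := by
    by_contra h
    push Not at h
    exact hn (LinearMap.ext h)
  obtain ⟨w, ξ, hs, -, -, h1⟩ := exists_isString hαβ n ⊥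
    (fun z hz => by rw [(Submodule.mem_bot k).1 hz, map_zero]) (Z.F n y) (Z.F_F _ _) (by simpa using hy)
  refine ⟨w, ξ, hs.F_vec, hs.fun_F, hs.pairing, fun r z => ?_⟩
  have hα : ∀ r, n ≤ r → ∀ z, Z.α r z = 0 := fun r hr z => by
    rw [← Z.F_α, hmax _ (by omega), LinearMap.zero_apply]
  have hβ : ∀ r, n ≤ r → ∀ z, Z.β r z = 0 := fun r hr z => by
    rw [← Z.β_F, hmax _ (by omega), LinearMap.zero_apply, map_zero]
  have key := (hZ (fun r => (ξ r).smulRight (w r))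
    (by
      constructor
      · intro r z
        simp [hs.F_vec]
      · intro r z
        simp [hs.fun_F]
      · intro r z
        by_cases hr : r < n
        · simpa using hs.α r hr z
        · simp [hα r (by omega)]
      · intro r z
        by_cases hr : r < n
        · simpa using hs.β r hr z
        · simp [hβ r (by omega)]
      · intro r z
        simp [hx])
    (fun r z => by
      rcases hs.pairing r with h | ⟨h, h'⟩
      · simp [h]
      · simp [h])).resolve_left (fun h => by
        have := LinearMap.congr_fun (h n) (w n)
        simp only [LinearMap.smulRight_apply, h1, one_smul, LinearMap.zero_apply] at this
        rw [this] at h1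
        simp at h1)
  simp [← key]

namespace IsThin

variable {Z' : ZigzagRep k m u v} {w : ℕ → Z.carrier} {ξ : ℕ → Z.carrier →ₗ[k] k}
  {w' : ℕ → Z'.carrier} {ξ' : ℕ → Z'.carrier →ₗ[k] k}

theorem α_apply (h : IsThin Z w ξ) (r : ℕ) (y : Z.carrier) :
    Z.α r y = (ξ r y * ξ (r + 1) (Z.α r (w r))) • w (r + 1) := by
  rw [← Z.α_F, h.F_eq, map_smul, mul_smul, ← h.F_eq, Z.F_α]

theorem β_apply (h : IsThin Z w ξ) (r : ℕ) (y : Z.carrier) :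
    Z.β r y = (ξ (r + 1) y * ξ r (Z.β r (w (r + 1)))) • w r := by
  rw [← Z.β_F, h.F_eq, map_smul, mul_smul, ← h.F_eq, Z.F_β]

theorem fun_α (h : IsThin Z w ξ) (r : ℕ) (y : Z.carrier) :
    ξ (r + 1) (Z.α r y) = ξ r y * ξ (r + 1) (Z.α r (w r)) := by
  rw [← Z.α_F, h.F_eq, map_smul, map_smul, smul_eq_mul]

theorem fun_β (h : IsThin Z w ξ) (r : ℕ) (y : Z.carrier) :
    ξ r (Z.β r y) = ξ (r + 1) y * ξ r (Z.β r (w (r + 1))) := by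
  rw [← Z.β_F, h.F_eq, map_smul, map_smul, smul_eq_mul]

theorem isHom (h : IsThin Z w ξ) (h' : IsThin Z' w' ξ') (hx : ∀ r, Z.x r = 0)
    (hx' : ∀ r, Z'.x r = 0) {c : ℕ → k}
    (hα : ∀ r, c r * ξ' (r + 1) (Z'.α r (w' r)) = c (r + 1) * ξ (r + 1) (Z.α r (w r)))
    (hβ : ∀ r, c (r + 1) * ξ' r (Z'.β r (w' (r + 1))) = c r * ξ r (Z.β r (w (r + 1)))) :
    IsHom Z Z' fun r => c r • (ξ r).smulRight (w' r) := by
  constructor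
  · intro r y
    simp [h'.F_vec]
  · intro r y
    simp [h.fun_F]
  · intro r y
    have h1 : Z'.α r (w' r) = ξ' (r + 1) (Z'.α r (w' r)) • w' (r + 1) := by
      rw [← h'.F_eq, Z'.F_α]
    simp only [LinearMap.smul_apply, LinearMap.smulRight_apply, map_smul]
    rw [h1, h.fun_α]
    simp only [smul_smul]
    congr 1
    linear_combination ξ r y * hα r
  · intro r y
    have h1 : Z'.β r (w' (r + 1)) = ξ' r (Z'.β r (w' (r + 1))) • w' r := by
      rw [← h'.F_eq, Z'.F_β]
    simp only [LinearMap.smul_apply, LinearMap.smulRight_apply, map_smul]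
    rw [h1, h.fun_β]
    simp only [smul_smul]
    congr 1
    linear_combination ξ (r + 1) y * hβ r
  · intro r y
    simp [hx, hx']

theorem α_eq_zero_iff (h : IsThin Z w ξ) (r : ℕ) :
    Z.α r = 0 ↔ ξ (r + 1) (Z.α r (w r)) = 0 := by
  refine ⟨fun h0 => by simp [h0], fun h0 => LinearMap.ext fun y => ?_⟩
  rw [h.α_apply, h0, mul_zero, zero_smul, LinearMap.zero_apply]

theorem β_eq_zero_iff (h : IsThin Z w ξ) (r : ℕ) :
    Z.β r = 0 ↔ ξ r (Z.β r (w (r + 1))) = 0 := by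
  refine ⟨fun h0 => by simp [h0], fun h0 => LinearMap.ext fun y => ?_⟩
  rw [h.β_apply, h0, mul_zero, zero_smul, LinearMap.zero_apply]

theorem fun_vec_of_F_ne_zero (h : IsThin Z w ξ) {r : ℕ} (hF : Z.F r ≠ 0) : ξ r (w r) = 1 :=
  (h.pairing r).resolve_right fun h0 => hF (LinearMap.ext fun y => by simp [h.F_eq, h0.1])

theorem iso (h : IsThin Z w ξ) (h' : IsThin Z' w' ξ') (hx : ∀ r, Z.x r = 0)
    (hx' : ∀ r, Z'.x r = 0) (hαβ : ∀ r, Z.α r = 0 ∨ Z.β r = 0)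
    (hF : ∀ r, Z.F r = 0 ↔ Z'.F r = 0) (hα : ∀ r, Z.α r = 0 ↔ Z'.α r = 0)
    (hβ : ∀ r, Z.β r = 0 ↔ Z'.β r = 0) : Z.Iso Z' := by
  classical
  simp only [h.α_eq_zero_iff, h.β_eq_zero_iff, h'.α_eq_zero_iff, h'.β_eq_zero_iff] at hα hβ hαβ
  obtain ⟨a, ha⟩ : ∃ a : ℕ → k, ∀ r, a r = ξ (r + 1) (Z.α r (w r)) := ⟨_, fun _ => rfl⟩
  obtain ⟨b, hb⟩ : ∃ b : ℕ → k, ∀ r, b r = ξ r (Z.β r (w (r + 1))) := ⟨_, fun _ => rfl⟩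
  obtain ⟨a', ha'⟩ : ∃ a : ℕ → k, ∀ r, a r = ξ' (r + 1) (Z'.α r (w' r)) := ⟨_, fun _ => rfl⟩
  obtain ⟨b', hb'⟩ : ∃ b : ℕ → k, ∀ r, b r = ξ' r (Z'.β r (w' (r + 1))) := ⟨_, fun _ => rfl⟩
  simp only [← ha, ← hb, ← ha', ← hb'] at hα hβ hαβ
  obtain ⟨c, hc, hca, hcb⟩ : ∃ c : ℕ → k, (∀ r, c r ≠ 0) ∧
      (∀ r, c r * a' r = c (r + 1) * a r) ∧ ∀ r, c (r + 1) * b' r = c r * b r := by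
    let c : ℕ → k := fun r => Nat.rec 1 (fun r z => z *
      (if a r ≠ 0 then a' r / a r else if b r ≠ 0 then b r / b' r else 1)) r
    have hcs : ∀ r, c (r + 1) = c r *
      (if a r ≠ 0 then a' r / a r else if b r ≠ 0 then b r / b' r else 1) := fun r => rfl
    refine ⟨c, fun r => ?_, fun r => ?_, fun r => ?_⟩
    · induction r with
      | zero => exact one_ne_zero
      | succ r ih =>
        rw [hcs]
        refine mul_ne_zero ih ?_
        split_ifs with h1 h2
        · exact div_ne_zero (mt (hα r).2 h1) h1
        · exact div_ne_zero h2 (mt (hβ r).2 h2)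
        · exact one_ne_zero
    · rw [hcs]
      by_cases h1 : a r = 0
      · rw [h1, (hα r).1 h1, mul_zero, mul_zero]
      · rw [if_pos h1]
        field_simp
    · rw [hcs]
      by_cases h1 : b r = 0
      · rw [h1, (hβ r).1 h1, mul_zero, mul_zero]
      · have h2 := mt (hβ r).2 h1
        rw [if_neg (not_not.2 ((hαβ r).resolve_right h1)), if_pos h1]
        field_simp
  have hu : ∀ r, ξ r (w r) = 1 ∧ ξ' r (w' r) = 1 ∨ Z.F r = 0 ∧ Z'.F r = 0 := fun r => by
    by_cases h0 : Z.F r = 0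
    · exact Or.inr ⟨h0, (hF r).1 h0⟩
    · exact Or.inl ⟨h.fun_vec_of_F_ne_zero h0, h'.fun_vec_of_F_ne_zero (mt (hF r).2 h0)⟩
  refine ⟨_, _, h.isHom h' hx hx' (c := c) (fun r => ?_) (fun r => ?_),
    h'.isHom h hx' hx (c := fun r => (c r)⁻¹) (fun r => ?_) (fun r => ?_), fun r y => ?_,
    fun r y => ?_⟩
  · rw [← ha, ← ha', hca]
  · rw [← hb, ← hb', hcb]
  · have h1 := hc r
    have h2 := hc (r + 1)
    have h3 := hca r
    rw [← ha, ← ha']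
    field_simp
    linear_combination - h3
  · have h1 := hc r
    have h2 := hc (r + 1)
    have h3 := hcb r
    rw [← hb, ← hb']
    field_simp
    linear_combination - h3
  · rcases hu r with ⟨h1, h2⟩ | ⟨h1, h2⟩
    · simp [h2, h.F_eq, smul_smul, hc r, mul_right_comm (c r)]
    · have h3 : w r = 0 := by rw [← h.F_vec, h1, LinearMap.zero_apply]
      simp [h3, h1]
  · rcases hu r with ⟨h1, h2⟩ | ⟨h1, h2⟩
    · simp [h1, h'.F_eq, smul_smul, hc r, mul_right_comm _ _ (c r)]
    · have h3 : w' r = 0 := by rw [← h'.F_vec, h2, LinearMap.zero_apply]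
      simp [h3, h2]

end IsThin

end Strings

/-- The supports of the structure maps. -/
noncomputable def support (Z : ZigzagRep k m u v) (r : Fin (m + 1)) : Bool × Bool × Bool × Bool :=
  by classical exact
    (decide (Z.F r = 0), decide (Z.α r = 0), decide (Z.β r = 0), decide (Z.x r = 0))

/-- Indecomposable zigzag representations are determined by the supports of their structure
maps. -/
theorem Indec.iso_of_support_eq {Z Z' : ZigzagRep k m u v} (hZ : Z.Indec) (hZ' : Z'.Indec)
    (h : Z.support = Z'.support) : Z.Iso Z' := by
  have hs : ∀ r, (Z.F r = 0 ↔ Z'.F r = 0) ∧ (Z.α r = 0 ↔ Z'.α r = 0) ∧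
      (Z.β r = 0 ↔ Z'.β r = 0) ∧ (Z.x r = 0 ↔ Z'.x r = 0) := fun r => by
    by_cases hr : r < m + 1
    · have := congrFun h ⟨r, hr⟩
      simpa [support] using this
    · have hF : ∀ Z : ZigzagRep k m u v, Z.F r = 0 := fun Z => Z.rel.F_zero r (by omega)
      have hα : ∀ Z : ZigzagRep k m u v, Z.α r = 0 := fun Z => by
        rw [← Z.rel.α_right, hF, mul_zero]
      have hβ : ∀ Z : ZigzagRep k m u v, Z.β r = 0 := fun Z => by
        rw [← Z.rel.β_left, hF, zero_mul]
      have hx : ∀ Z : ZigzagRep k m u v, Z.x r = 0 := fun Z => by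
        rw [← Z.rel.x_left, hF, zero_mul]
      simp [hF, hα, hβ, hx]
  by_cases hx : ∀ r, Z.x r = 0
  · have hx' : ∀ r, Z'.x r = 0 := fun r => (hs r).2.2.2.1 (hx r)
    obtain ⟨w, ξ, h1⟩ := hZ.exists_isThin hx
    obtain ⟨w', ξ', h2⟩ := hZ'.exists_isThin hx'
    exact h1.iso h2 hx hx' (hZ.α_eq_zero_or_β_eq_zero hx) (fun r => (hs r).1)
      (fun r => (hs r).2.1) fun r => (hs r).2.2.1
  · push Not at hx
    obtain ⟨a, ha⟩ := hx
    exact hZ.iso_of_x_ne_zero hZ' ha (mt (hs a).2.2.2.2 ha)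

end ZigzagRep

theorem IsZigzag.map {k : Type} [Field k] {A B : Type} [Ring A] [Algebra k A] [Ring B]
    [Algebra k B] {m : ℕ} {u v : ℕ → k} {F α β x : ℕ → A} (h : IsZigzag m u v F α β x)
    (f : A →ₐ[k] B) : IsZigzag m u v (fun r => f (F r)) (fun r => f (α r)) (fun r => f (β r))
      fun r => f (x r) where
  idem r := by rw [← map_mul, h.idem]
  orth r s hrs := by rw [← map_mul, h.orth r s hrs, map_zero]
  F_zero r hr := by rw [h.F_zero r hr, map_zero]
  α_left r := by rw [← map_mul, h.α_left]
  α_right r := by rw [← map_mul, h.α_right]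
  β_left r := by rw [← map_mul, h.β_left]
  β_right r := by rw [← map_mul, h.β_right]
  x_left r := by rw [← map_mul, h.x_left]
  x_right r := by rw [← map_mul, h.x_right]
  α_x r := by rw [← map_mul, h.α_x, map_zero]
  x_α r := by rw [← map_mul, h.x_α, map_zero]
  β_x r := by rw [← map_mul, h.β_x, map_zero]
  x_β r := by rw [← map_mul, h.x_β, map_zero]
  x_x r := by rw [← map_mul, h.x_x, map_zero]
  α_α r := by rw [← map_mul, h.α_α, map_zero]
  β_β r := by rw [← map_mul, h.β_β, map_zero]
  β_α r h1 h2 := by rw [← map_mul, h.β_α r h1 h2, map_smul]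
  α_β r h1 h2 := by rw [← map_mul, h.α_β r h1 h2, map_smul]
  u_ne := h.u_ne
  v_ne := h.v_ne

theorem exists_sum_of_mem_closure {A : Type} [Ring A] {F : ℕ → A} {S : Set A}
    (hS : ∀ a ∈ S, -a ∈ S) {y : A}
    (hy : y ∈ AddSubgroup.closure {y : A | ∃ r, ∃ a ∈ S, ∃ b ∈ S, y = a * F r * b}) :
    ∃ (κ : Type) (_ : Fintype κ) (r : κ → ℕ) (a b : κ → A), (∀ i, a i ∈ S) ∧ (∀ i, b i ∈ S) ∧
      y = ∑ i, a i * F (r i) * b i := by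
  induction hy using AddSubgroup.closure_induction with
  | mem y hy =>
    obtain ⟨r, a, ha, b, hb, rfl⟩ := hy
    exact ⟨Unit, inferInstance, fun _ => r, fun _ => a, fun _ => b, fun _ => ha, fun _ => hb,
      by simp⟩
  | zero =>
    exact ⟨Empty, inferInstance, Empty.elim, Empty.elim, Empty.elim, by simp, by simp, by simp⟩
  | add y z _ _ hy hz =>
    obtain ⟨κ, hκ, r, a, b, ha, hb, rfl⟩ := hy
    obtain ⟨κ', hκ', r', a', b', ha', hb', rfl⟩ := hz
    exact ⟨κ ⊕ κ', inferInstance, Sum.elim r r', Sum.elim a a', Sum.elim b b',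
      by rintro (i | i); exacts [ha i, ha' i], by rintro (i | i); exacts [hb i, hb' i], by simp⟩
  | neg y _ hy =>
    obtain ⟨κ, hκ, r, a, b, ha, hb, rfl⟩ := hy
    exact ⟨κ, hκ, r, fun i => - a i, b, fun i => hS _ (ha i), hb, by simp⟩

namespace OpRep

variable {k : Type} [Field k]

/-- If any family of `K + 1` representations satisfying `P` has an isomorphic pair, then the
representations satisfying `P` fall into finitely many isomorphism classes. -/
theorem finitelyMany_of_pigeonhole {P : OpRep k → Prop} (K : ℕ)
    (h : ∀ M : Fin (K + 1) → OpRep k, (∀ i, P (M i)) → ∃ i j, i ≠ j ∧ (M i).Iso (M j)) :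
    FinitelyMany P := by
  by_contra hP
  obtain ⟨f, hf, hf'⟩ := exists_seq_of_forall_finset_exists P (fun M N => ¬ N.Iso M)
    (fun s _ => by
      by_contra hs
      push Not at hs
      exact hP ⟨s.toList, fun M hM => by
        obtain ⟨N, hN, hMN⟩ := hs M hM
        exact ⟨N, Finset.mem_toList.2 hN, hMN⟩⟩)
  obtain ⟨i, j, hij, hiso⟩ := h (fun i => f i) fun i => hf i
  rcases lt_or_gt_of_ne hij with hlt | hlt
  · exact hf' i j hlt hiso.symm
  · exact hf' j i hlt hiso

section Transfer

variable {ι : Type} (M : ι → OpRep k)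

/-- The algebra acting on all representations of a family. -/
abbrev FamilyAlg : Type := ∀ i, Module.End k (M i).carrier

/-- The operators of a family, as elements of the algebra acting on all of them. -/
def familyOp (j : ℕ) : FamilyAlg M := fun i => (M i).op j

variable {M} {m : ℕ} {u v : ℕ → k} {F α β x : ℕ → FamilyAlg M}
  (hz : IsZigzag m u v F α β x)

/-- The zigzag representation on a member of a family. -/
def zigzag (i : ι) : ZigzagRep k m u v where
  carrier := (M i).carrier
  F r := F r i
  α r := α r i
  β r := β r i
  x r := x r i
  rel := hz.map (Pi.evalAlgHom k (fun i => Module.End k (M i).carrier) i)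

variable {hz} {i j l : ι}

open ZigzagRep in
theorem isHom_aux {θ : ℕ → (M i).carrier →ₗ[k] (M j).carrier}
    (hθ : IsHom (zigzag hz i) (zigzag hz j) θ) {y : FamilyAlg M} {a b : ℕ}
    (h1 : F b * y = y) (h2 : y * F a = y) (h3 : ∀ z, y j (θ a z) = θ b (y i z)) (r s : ℕ)
    (z : (M i).carrier) : F s j (y j (θ r z)) = θ s (y i (F r i z)) := by
  have hF1 : ∀ r z, F r j (θ r z) = θ r z := hθ.left
  have hF2 : ∀ r z, θ r (F r i z) = θ r z := hθ.right
  have h1' : ∀ i z, F b i (y i z) = y i z := fun i z =>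
    LinearMap.congr_fun (congrFun h1 i) z
  have h2' : ∀ i z, y i (F a i z) = y i z := fun i z =>
    LinearMap.congr_fun (congrFun h2 i) z
  have ho : ∀ {r s}, r ≠ s → ∀ i z, F r i (F s i z) = 0 := fun h i z =>
    LinearMap.congr_fun (congrFun (hz.orth _ _ h) i) z
  by_cases hr : a = r
  · subst hr
    rw [h2', h3]
    by_cases hs : s = b
    · subst hs
      rw [hF1]
    · rw [← hF1 b, ho hs, ← hF2 s, ← h1', ho hs, map_zero]
  · rw [← h2' j, ← h2' i, ← hF1, ho hr, ho hr, map_zero, map_zero, map_zero, map_zero]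

open ZigzagRep in
theorem isHom_span {θ : ℕ → (M i).carrier →ₗ[k] (M j).carrier}
    (hθ : IsHom (zigzag hz i) (zigzag hz j) θ) {y : FamilyAlg M}
    (hy : y ∈ Submodule.span k (Set.range F ∪ Set.range α ∪ Set.range β ∪ Set.range x)) (r s : ℕ)
    (z : (M i).carrier) : F s j (y j (θ r z)) = θ s (y i (F r i z)) := by
  induction hy using Submodule.span_induction with
  | mem y hy =>
    rcases hy with ((⟨t, rfl⟩ | ⟨t, rfl⟩) | ⟨t, rfl⟩) | ⟨t, rfl⟩
    · exact isHom_aux hθ (hz.idem t) (hz.idem t)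
        (fun z => (hθ.left t z).trans (hθ.right t z).symm) r s z
    · exact isHom_aux hθ (hz.α_left t) (hz.α_right t) (hθ.α t) r s z
    · exact isHom_aux hθ (hz.β_left t) (hz.β_right t) (hθ.β t) r s z
    · exact isHom_aux hθ (hz.x_left t) (hz.x_right t) (hθ.x t) r s z
  | zero => simp
  | add c d _ _ hc hd => simp [hc, hd]
  | smul t c _ hc => simp [hc]

variable {Λ : Subalgebra k (FamilyAlg M)}
  (hspan : ∀ r s, ∀ b ∈ Λ,
    F s * b * F r ∈ Submodule.span k (Set.range F ∪ Set.range α ∪ Set.range β ∪ Set.range x))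
include hspan

open ZigzagRep in
theorem isHom_corner {θ : ℕ → (M i).carrier →ₗ[k] (M j).carrier}
    (hθ : IsHom (zigzag hz i) (zigzag hz j) θ) {b : FamilyAlg M} (hb : b ∈ Λ) (r s : ℕ)
    (z : (M i).carrier) : F s j (b j (θ r z)) = θ s (b i (F r i z)) := by
  have h := isHom_span hθ (hspan r s b hb) r s z
  have hF1 : ∀ r z, F r j (θ r z) = θ r z := hθ.left
  have hF2 : ∀ r z, θ r (F r i z) = θ r z := hθ.right
  have hF3 : ∀ r i z, F r i (F r i z) = F r i z := fun r i z =>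
    LinearMap.congr_fun (congrFun (hz.idem r) i) z
  simpa [hF1, hF2, hF3] using h

variable {κ : Type} [Fintype κ] {ρ : κ → ℕ} {a b : κ → FamilyAlg M} (ha : ∀ t, a t ∈ Λ)
  (hb : ∀ t, b t ∈ Λ) (hone : 1 = ∑ t, a t * F (ρ t) * b t)
include ha hb hone

omit hspan ha hb in
theorem sum_apply_eq (i : ι) (z : (M i).carrier) :
    ∑ t, a t i (F (ρ t) i (b t i z)) = z := by
  have := LinearMap.congr_fun (congrFun hone i) z
  simpa using this.symm

open ZigzagRep in
theorem exists_lift {θ : ℕ → (M i).carrier →ₗ[k] (M j).carrier}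
    (hθ : IsHom (zigzag hz i) (zigzag hz j) θ) :
    ∃ Θ : (M i).carrier →ₗ[k] (M j).carrier, (∀ c ∈ Λ, ∀ z, Θ (c i z) = c j (Θ z)) ∧
      ∀ r z, Θ (F r i z) = θ r z := by
  have hF1 : ∀ r z, F r j (θ r z) = θ r z := hθ.left
  have hF2 : ∀ r z, θ r (F r i z) = θ r z := hθ.right
  refine ⟨∑ t, (a t j) ∘ₗ θ (ρ t) ∘ₗ (b t i), fun c hc z => ?_, fun r z => ?_⟩
  · simp only [LinearMap.sum_apply, LinearMap.comp_apply, map_sum]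
    have hl : ∀ t, a t j (θ (ρ t) (b t i (c i z))) =
        ∑ s, a t j (F (ρ t) j (b t j (c j (a s j (θ (ρ s) (b s i z)))))) := fun t => by
      conv_lhs => rw [← sum_apply_eq hone i z]
      simp only [map_sum]
      refine Finset.sum_congr rfl fun s _ => congrArg _ ?_
      exact (isHom_corner hspan hθ (Λ.mul_mem (Λ.mul_mem (hb t) hc) (ha s)) (ρ s) (ρ t)
        (b s i z)).symm
    simp only [hl]
    rw [Finset.sum_comm]
    exact Finset.sum_congr rfl fun s _ => sum_apply_eq hone j _
  · simp only [LinearMap.sum_apply, LinearMap.comp_apply]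
    refine (Finset.sum_congr rfl fun t _ => ?_).trans (sum_apply_eq hone j (θ r z))
    rw [isHom_corner hspan hθ (hb t)]

omit hspan ha hb in
theorem lift_unique {Θ Θ' : (M i).carrier →ₗ[k] (M j).carrier}
    (hΘ : ∀ c ∈ Λ, ∀ z, Θ (c i z) = c j (Θ z)) (hΘ' : ∀ c ∈ Λ, ∀ z, Θ' (c i z) = c j (Θ' z))
    (h : ∀ r z, Θ (F r i z) = Θ' (F r i z)) (ha : ∀ t, a t ∈ Λ) : Θ = Θ' := by
  ext z
  rw [← sum_apply_eq hone i z]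
  simp only [map_sum]
  exact Finset.sum_congr rfl fun t _ => by rw [hΘ _ (ha t), hΘ' _ (ha t), h]

open ZigzagRep in
theorem zigzag_indec (hop : ∀ l, familyOp M l ∈ Λ) (hM : (M i).Indec) :
    (zigzag hz i).Indec := by
  intro θ hθ hidem
  have hF1 : ∀ r z, F r i (θ r z) = θ r z := hθ.left
  obtain ⟨Θ, h1, h2⟩ := exists_lift hspan ha hb hone hθ
  have hE : (M i).IsEndo Θ := isEndo_iff.2 fun l z => h1 _ (hop l) z
  have hsq : Θ ∘ₗ Θ = Θ := lift_unique hone (fun c hc z => by simp [h1 c hc]) h1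
    (fun r z => by
      rw [LinearMap.comp_apply, h2]
      exact ((congrArg Θ (hF1 r z)).symm.trans (h2 r (θ r z))).trans (hidem r z)) ha
  rcases hM.2 Θ hE hsq with h | h
  · left
    intro r
    exact LinearMap.ext fun z => (h2 r z).symm.trans (by rw [h]; rfl)
  · right
    intro r
    exact LinearMap.ext fun z => (h2 r z).symm.trans (by rw [h]; rfl)

open ZigzagRep in
theorem iso_of_zigzag_iso (hop : ∀ l, familyOp M l ∈ Λ)
    (h : (zigzag hz i).Iso (zigzag hz j)) : (M i).Iso (M j) := by
  obtain ⟨θ, θ', hθ, hθ', hl, hr⟩ := h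
  have hF1 : ∀ r z, F r j (θ r z) = θ r z := hθ.left
  have hF1' : ∀ r z, F r i (θ' r z) = θ' r z := hθ'.left
  obtain ⟨Θ, h1, h2⟩ := exists_lift hspan ha hb hone hθ
  obtain ⟨Θ', h1', h2'⟩ := exists_lift hspan ha hb hone hθ'
  refine iso_of_inverse Θ Θ' (fun l z => h1 _ (hop l) z) ?_ ?_
  · refine lift_unique hone (fun c hc z => by simp [h1 c hc, h1' c hc]) (fun c hc z => rfl)
      (fun r z => ?_) ha
    rw [LinearMap.comp_apply, h2']
    exact ((congrArg Θ (hF1' r z)).symm.trans (h2 r (θ' r z))).trans (hr r z)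
  · refine lift_unique hone (fun c hc z => by simp [h1 c hc, h1' c hc]) (fun c hc z => rfl)
      (fun r z => ?_) ha
    rw [LinearMap.comp_apply, h2]
    exact ((congrArg Θ' (hF1 r z)).symm.trans (h2' r (θ r z))).trans (hl r z)

end Transfer

theorem isHecke_familyOp {ι : Type} {M : ι → OpRep k} {q : k} {m : ℕ}
    (h : ∀ i, IsHecke q m (M i).op) : IsHecke q m (familyOp M) where
  quad l hl := funext fun i => (h i).quad l hl
  braid l := funext fun i => (h i).braid l
  comm l l' hl := funext fun i => (h i).comm l l' hl
  zero l hl := funext fun i => (h i).zero l hl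

theorem traceNil_familyOp {ι : Type} [Fintype ι] {M : ι → OpRep k} {q : k} {m : ℕ}
    (h : ∀ i, TraceNil q m (M i).op) : TraceNil q m (familyOp M) := by
  intro l
  choose n hn using fun i => h i l
  refine ⟨∑ i, n i, funext fun i => ?_⟩
  have h1 : (relTr q (familyOp M) m (jm q (familyOp M) m ^ l)) i =
      relTr q (M i).op m (jm q (M i).op m ^ l) := by
    have := map_relTr (q := q) (T := familyOp M)
      (Pi.evalAlgHom k (fun i => Module.End k (M i).carrier) i) m (jm q (familyOp M) m ^ l)
    rw [map_pow, map_jm] at this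
    exact this
  rw [Pi.pow_apply, h1, Pi.zero_apply]
  exact pow_eq_zero_of_le (Finset.single_le_sum (fun _ _ => Nat.zero_le _) (Finset.mem_univ i))
    (hn i)

theorem finitelyMany_indec_traceNil {q : k} (hq : q ≠ 0) {m : ℕ} (hm : 1 ≤ m)
    (hord : orderOf q = m + 1) :
    FinitelyMany fun M : OpRep k => M.Indec ∧ IsHecke q m M.op ∧ TraceNil q m M.op := by
  refine finitelyMany_of_pigeonhole (Fintype.card (Fin (m + 1) → Bool × Bool × Bool × Bool))
    fun M hM => ?_
  obtain ⟨u, v, F, α, β, x, hz, -, hspan, hone⟩ :=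
    (isHecke_familyOp fun i => (hM i).2.1).exists_isZigzag hq hm
      (traceNil_familyOp fun i => (hM i).2.2) hord
  obtain ⟨κ, hκ, ρ, a, b, ha, hb, hone⟩ := exists_sum_of_mem_closure
    (S := (Algebra.adjoin k (Set.range (familyOp M)) : Set (FamilyAlg M)))
    (fun y hy => neg_mem (S := Subalgebra k (FamilyAlg M)) hy) hone
  obtain ⟨i, j, hij, hs⟩ := Fintype.exists_ne_map_eq_of_card_lt
    (fun i => (zigzag hz i).support) (by rw [Fintype.card_fin]; exact Nat.lt_succ_self _)
  have hop : ∀ l, familyOp M l ∈ Algebra.adjoin k (Set.range (familyOp M)) := fun l =>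
    Algebra.subset_adjoin ⟨l, rfl⟩
  exact ⟨i, j, hij, iso_of_zigzag_iso hspan ha hb hone hop
    ((zigzag_indec hspan ha hb hone hop (hM i).1).iso_of_support_eq
      (zigzag_indec hspan ha hb hone hop (hM j).1) hs)⟩

theorem finitelyMany_isHecke {q : k} (hq : q ≠ 0) (hq1 : q ≠ 1) (m : ℕ)
    (h : orderOf q = 0 ∨ m + 1 < 2 * orderOf q) :
    FinitelyMany fun M : OpRep k => M.Indec ∧ IsHecke q m M.op := by
  refine finitelyMany_of_traceNil hq m fun l hl => ?_
  by_cases h1 : orderOf q = l + 2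
  · exact finitelyMany_indec_traceNil hq (by omega) h1
  · refine ⟨[], fun M hM => absurd ?_ h1⟩
    have := hM.1.1
    have h2 := orderOf_dvd_of_pow_eq_one (hM.2.1.pow_eq_one_of_traceNil hq hM.2.2)
    have h3 : orderOf q ≠ 1 := by rwa [Ne, orderOf_eq_one_iff]
    obtain ⟨c, hc⟩ := h2
    have hc1 : c = 1 := by
      rcases Nat.lt_or_ge c 2 with h4 | h4
      · interval_cases c <;> omega
      · rcases h with h | h
        · rw [h] at hc; omega
        · have := Nat.mul_le_mul_left (orderOf q) h4
          omega
    rw [hc1] at hc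
    omega

end OpRep

namespace OpRep

variable {k : Type} [Field k] {q : k} {m : ℕ}

/-- The dimensions of the indecomposable representations are bounded. -/
def BoundedDim (q : k) (m : ℕ) : Prop :=
  ∃ d, ∀ M : OpRep k, M.Indec → IsHecke q m M.op → Module.finrank k M.carrier ≤ d

theorem boundedDim_of_finitelyMany
    (h : FinitelyMany fun M : OpRep k => M.Indec ∧ IsHecke q m M.op) : BoundedDim q m := by
  obtain ⟨L, hL⟩ := h
  refine ⟨(L.map fun M => Module.finrank k M.carrier).sum, fun M hM hT => ?_⟩
  obtain ⟨N, hN, f, -⟩ := hL M ⟨hM, hT⟩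
  rw [f.finrank_eq]
  exact List.le_sum_of_mem (List.mem_map_of_mem hN)

theorem BoundedDim.exists_forall_le (h : BoundedDim q m) : ∃ d, ∀ (M : OpRep k),
    IsHecke q m M.op → ∀ (good : Module.End k M.carrier → Prop), good 1 → ¬ good 0 →
    (∀ a b, M.IsEndo a → M.IsEndo b → good (a + b) → good a ∨ good b) →
    ∀ n, (∀ a, M.IsEndo a → good a → n ≤ Module.finrank k (LinearMap.range a)) → n ≤ d := by
  obtain ⟨d, hd⟩ := h
  refine ⟨d, fun M hM good h1 h0 hadd n hn => ?_⟩
  obtain ⟨e, he, -, hg, hI⟩ := exists_good_indec_sub M good h1 h0 hadd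
  exact (hn e he hg).trans (hd _ hI (isHecke_sub hM he))

/-- The inclusion of a representation into the induced one. -/
def indIncl (q : k) (m : ℕ) (N : OpRep k) : N.carrier →ₗ[k] (ind q m N).carrier where
  toFun v := (⟨Pi.single (m + 1) v, fun j hj => Pi.single_eq_of_ne (by omega) _⟩ :
    supportedBelow k N.carrier (m + 2))
  map_add' v w := Subtype.ext (Pi.single_add _ _ _)
  map_smul' c v := Subtype.ext (Pi.single_smul _ _ _)

/-- The projection from the induced representation. -/
def indProj (q : k) (m : ℕ) (N : OpRep k) : (ind q m N).carrier →ₗ[k] N.carrier :=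
  LinearMap.proj (m + 1) ∘ₗ (supportedBelow k N.carrier (m + 2)).subtype

theorem indProj_indIncl (N : OpRep k) (v : N.carrier) :
    indProj q m N (indIncl q m N v) = v :=
  Pi.single_eq_same (M := fun _ => N.carrier) (m + 1) v

theorem indProj_op (N : OpRep k) {i : ℕ} (hi : i < m) (F : (ind q m N).carrier) :
    indProj q m N ((ind q m N).op i F) = N.op i (indProj q m N F) := by
  have := congrFun (ind_op_apply (q := q) (N := N) (show i ≤ m by omega) F) (m + 1)
  exact this.trans (indFun_gt (by omega))

theorem indIncl_op (N : OpRep k) {i : ℕ} (hi : i < m) (v : N.carrier) :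
    indIncl q m N (N.op i v) = (ind q m N).op i (indIncl q m N v) := by
  refine Subtype.ext (Eq.trans ?_ (ind_op_apply (q := q) (N := N) (show i ≤ m by omega) _).symm)
  funext j
  change Pi.single (M := fun _ => N.carrier) (m + 1) (N.op i v) j = indFun q N.op i
    (Pi.single (M := fun _ => N.carrier) (m + 1) v) j
  have hz : ∀ j, j ≠ m + 1 → Pi.single (M := fun _ => N.carrier) (m + 1) v j = 0 :=
    fun j hj => Pi.single_eq_of_ne hj _
  rcases eq_or_ne j (m + 1) with rfl | hj
  · rw [indFun_gt (by omega), Pi.single_eq_same, Pi.single_eq_same]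
  · rw [Pi.single_eq_of_ne hj]
    obtain h | rfl | rfl | h : j < i ∨ j = i ∨ j = i + 1 ∨ i + 1 < j := by omega
    · rw [indFun_lt h, hz _ hj, map_zero]
    · rw [indFun_self, hz _ hj, hz _ (by omega), smul_zero, add_zero]
    · rw [indFun_succ, hz _ (by omega), smul_zero]
    · rw [indFun_gt h, hz _ hj, map_zero]

theorem BoundedDim.of_succ (h : BoundedDim q (m + 1)) : BoundedDim q m := by
  obtain ⟨d, hd⟩ := h.exists_forall_le
  refine ⟨d, fun N hN hH => ?_⟩
  let c : Module.End k (ind q m N).carrier → Module.End k N.carrier := fun a =>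
    indProj q m N ∘ₗ a ∘ₗ indIncl q m N
  let good : Module.End k (ind q m N).carrier → Prop := fun a => IsUnit (c a)
  have hc1 : c 1 = 1 := LinearMap.ext fun v => indProj_indIncl (q := q) N v
  have hc0 : c 0 = 0 := LinearMap.ext fun v => map_zero (indProj q m N)
  have hcE : ∀ a, (ind q m N).IsEndo a → N.IsEndo (c a) := fun a ha => by
    refine isEndo_iff.2 fun i v => ?_
    by_cases hi : i < m
    · change indProj q m N (a (indIncl q m N (N.op i v))) = _
      rw [indIncl_op N hi, isEndo_iff.1 ha, indProj_op N hi]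
      rfl
    · rw [hH.zero i (by omega)]
      exact map_zero _
  have := hN.1
  refine hd (ind q m N) (isHecke_ind hH) good (by simp only [good, hc1, isUnit_one])
    (by simp only [good, hc0, isUnit_zero_iff]; exact zero_ne_one) (fun a b ha hb hab => ?_) _
    (fun a ha hg => ?_)
  · have hab' : c (a + b) = c a + c b := LinearMap.ext fun v => map_add (indProj q m N) _ _
    simp only [good, hab'] at hab
    exact hN.isUnit_or_of_add (hcE a ha) (hcE b hb) hab
  · have hinj : Function.Injective (a ∘ₗ indIncl q m N) := by
      have h1 : Function.Injective (c a) :=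
        LinearMap.ker_eq_bot.1 ((LinearMap.isUnit_iff_ker_eq_bot _).1 hg)
      exact Function.Injective.of_comp (f := indProj q m N) h1
    rw [← LinearMap.finrank_range_of_inj hinj]
    exact Submodule.finrank_mono (LinearMap.range_comp_le_range _ _)

theorem BoundedDim.of_le (h : BoundedDim q m) {l : ℕ} (hl : l ≤ m) : BoundedDim q l := by
  induction m, hl using Nat.le_induction with
  | base => exact h
  | succ n _ ih => exact ih h.of_succ

end OpRep

section WordOperators

variable {k : Type} [Field k] {L : Type} {U : Type} [AddCommGroup U] [Module k U]

/-- Exchange two neighbouring letters of a word. -/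
def swapAt (i : ℕ) (w : ℕ → L) : ℕ → L := w ∘ Equiv.swap i (i + 1)

theorem swapAt_left (i : ℕ) (w : ℕ → L) : swapAt i w i = w (i + 1) := by simp [swapAt]

theorem swapAt_right (i : ℕ) (w : ℕ → L) : swapAt i w (i + 1) = w i := by simp [swapAt]

theorem swapAt_of_ne {i j : ℕ} (w : ℕ → L) (h : j ≠ i) (h' : j ≠ i + 1) :
    swapAt i w j = w j := by simp [swapAt, Equiv.swap_apply_of_ne_of_ne h h']

theorem swapAt_swapAt (i : ℕ) (w : ℕ → L) : swapAt i (swapAt i w) = w := by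
  ext j; simp [swapAt]

theorem swapAt_of_eq {i : ℕ} {w : ℕ → L} (h : w i = w (i + 1)) : swapAt i w = w := by
  funext j
  by_cases h1 : j = i
  · rw [h1, swapAt_left, h]
  by_cases h2 : j = i + 1
  · rw [h2, swapAt_right, h]
  exact swapAt_of_ne w h1 h2

theorem comp_swapAt {L' : Type} (φ : L → L') (i : ℕ) (w : ℕ → L) :
    φ ∘ swapAt i w = swapAt i (φ ∘ w) := rfl

variable {i : ℕ} {w : ℕ → L}

theorem swapAt_comm {j : ℕ} (hij : i + 1 < j) (w : ℕ → L) :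
    swapAt i (swapAt j w) = swapAt j (swapAt i w) := by
  funext l
  by_cases h1 : l = i
  · subst h1
    rw [swapAt_left, swapAt_of_ne _ (by omega) (by omega), swapAt_of_ne _ (by omega) (by omega),
      swapAt_left]
  by_cases h2 : l = i + 1
  · subst h2
    rw [swapAt_right, swapAt_of_ne _ (by omega) (by omega), swapAt_of_ne _ (by omega) (by omega),
      swapAt_right]
  rw [swapAt_of_ne _ h1 h2]
  by_cases h3 : l = j
  · subst h3
    rw [swapAt_left, swapAt_left, swapAt_of_ne _ (by omega) (by omega)]
  by_cases h4 : l = j + 1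
  · subst h4
    rw [swapAt_right, swapAt_right, swapAt_of_ne _ (by omega) (by omega)]
  rw [swapAt_of_ne _ h3 h4, swapAt_of_ne _ h3 h4, swapAt_of_ne _ h1 h2]

/-- The word with three consecutive letters replaced. -/
def setThree (i : ℕ) (w : ℕ → L) (x y z : L) : ℕ → L :=
  Function.update (Function.update (Function.update w i x) (i + 1) y) (i + 1 + 1) z

theorem setThree_zero (x y z : L) : setThree i w x y z i = x := by
  rw [setThree, Function.update_of_ne (by omega), Function.update_of_ne (by omega),
    Function.update_self]

theorem setThree_one (x y z : L) : setThree i w x y z (i + 1) = y := by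
  simp [setThree]

theorem setThree_two (x y z : L) : setThree i w x y z (i + 1 + 1) = z := by
  simp [setThree]

theorem setThree_self : setThree i w (w i) (w (i + 1)) (w (i + 1 + 1)) = w := by
  simp [setThree]

theorem swapAt_setThree (x y z : L) : swapAt i (setThree i w x y z) = setThree i w y x z := by
  funext j
  by_cases h1 : j = i
  · rw [h1, swapAt_left, setThree_zero, setThree_one]
  by_cases h2 : j = i + 1
  · rw [h2, swapAt_right, setThree_zero, setThree_one]
  rw [swapAt_of_ne _ h1 h2]
  by_cases h3 : j = i + 1 + 1
  · rw [h3, setThree_two, setThree_two]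
  simp [setThree, h1, h2, h3]

theorem swapAt_succ_setThree (x y z : L) :
    swapAt (i + 1) (setThree i w x y z) = setThree i w x z y := by
  funext j
  by_cases h2 : j = i + 1
  · rw [h2, swapAt_left, setThree_one, setThree_two]
  by_cases h3 : j = i + 1 + 1
  · rw [h3, swapAt_right, setThree_one, setThree_two]
  rw [swapAt_of_ne _ h2 h3]
  simp [setThree, h2, h3]

variable [LinearOrder L]

/-- The action of a Hecke generator on functions on words. -/
def wordOp (q : k) (i : ℕ) : Module.End k ((ℕ → L) → U) where
  toFun F w := if w i = w (i + 1) then q • F w else if w i < w (i + 1) then q • F (swapAt i w)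
    else F (swapAt i w) + (q - 1) • F w
  map_add' F G := by
    ext w
    simp only [Pi.add_apply, smul_add]
    split_ifs
    · rfl
    · rfl
    · abel
  map_smul' c F := by
    ext w
    simp only [Pi.smul_apply, RingHom.id_apply]
    split_ifs <;> simp only [smul_comm c, smul_add]

variable {q : k} {F : (ℕ → L) → U}

theorem wordOp_eq (h : w i = w (i + 1)) : wordOp q i F w = q • F w := if_pos h

theorem wordOp_lt (h : w i < w (i + 1)) : wordOp q i F w = q • F (swapAt i w) :=
  (if_neg h.ne).trans (if_pos h)

theorem wordOp_gt (h : w (i + 1) < w i) :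
    wordOp q i F w = F (swapAt i w) + (q - 1) • F w :=
  (if_neg h.ne').trans (if_neg h.not_gt)

theorem wordOp_quad : wordOp q i (wordOp q i F) = (q - 1) • wordOp q i F + q • F := by
  ext w
  simp only [Pi.add_apply, Pi.smul_apply]
  rcases lt_trichotomy (w i) (w (i + 1)) with h | h | h
  · rw [wordOp_lt h, wordOp_lt h, wordOp_gt (by rwa [swapAt_left, swapAt_right]), swapAt_swapAt]
    module
  · rw [wordOp_eq h, wordOp_eq h]
    module
  · rw [wordOp_gt h, wordOp_gt h, wordOp_lt (by rwa [swapAt_left, swapAt_right]), swapAt_swapAt]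
    module

theorem wordOp_congr {G : (ℕ → L) → U} {w' : ℕ → L} (h : F w = G w')
    (h' : F (swapAt i w) = G (swapAt i w')) (h1 : w i = w' i) (h2 : w (i + 1) = w' (i + 1)) :
    wordOp q i F w = wordOp q i G w' := by
  change (if _ then _ else _) = (if _ then _ else _)
  rw [h, h', h1, h2]

theorem wordOp_comm {j : ℕ} (hij : i + 1 < j) :
    wordOp q i (wordOp q j F) = wordOp q j (wordOp q i F) := by
  ext w
  have a1 : swapAt i w j = w j := swapAt_of_ne _ (by omega) (by omega)
  have a2 : swapAt i w (j + 1) = w (j + 1) := swapAt_of_ne _ (by omega) (by omega)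
  have a3 : swapAt j w i = w i := swapAt_of_ne _ (by omega) (by omega)
  have a4 : swapAt j w (i + 1) = w (i + 1) := swapAt_of_ne _ (by omega) (by omega)
  simp only [wordOp, LinearMap.coe_mk, AddHom.coe_mk, a1, a2, a3, a4, swapAt_comm hij]
  split_ifs <;> module

theorem wordOp_setThree (x y z : L) : wordOp q i F (setThree i w x y z) =
    if x = y then q • F (setThree i w x y z) else if x < y then q • F (setThree i w y x z) else
      F (setThree i w y x z) + (q - 1) • F (setThree i w x y z) := by
  simp only [wordOp, LinearMap.coe_mk, AddHom.coe_mk, setThree_zero, setThree_one, swapAt_setThree]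

theorem wordOp_succ_setThree (x y z : L) : wordOp q (i + 1) F (setThree i w x y z) =
    if y = z then q • F (setThree i w x y z) else if y < z then q • F (setThree i w x z y) else
      F (setThree i w x z y) + (q - 1) • F (setThree i w x y z) := by
  simp only [wordOp, LinearMap.coe_mk, AddHom.coe_mk, setThree_two, setThree_one,
    swapAt_succ_setThree]

set_option linter.unusedSimpArgs false in
theorem wordOp_braid : wordOp q (i + 1) (wordOp q i (wordOp q (i + 1) F)) =
    wordOp q i (wordOp q (i + 1) (wordOp q i F)) := by
  ext w
  rw [← setThree_self (i := i) (w := w)]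
  generalize w i = x
  generalize w (i + 1) = y
  generalize w (i + 1 + 1) = z
  simp only [wordOp_setThree, wordOp_succ_setThree]
  rcases lt_trichotomy x y with h1 | rfl | h1
  · rcases lt_trichotomy y z with h2 | rfl | h2
    · have h3 := h1.trans h2
      simp only [h1, h1.ne, h1.ne', h1.not_gt, h2, h2.ne, h2.ne', h2.not_gt, h3, h3.ne, h3.ne', h3.not_gt, if_true, if_false, lt_irrefl, smul_add]
    · simp only [h1, h1.ne, h1.ne', h1.not_gt, if_true, if_false, lt_irrefl, smul_add]
    · rcases lt_trichotomy x z with h3 | rfl | h3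
      · simp only [h1, h1.ne, h1.ne', h1.not_gt, h2, h2.ne, h2.ne', h2.not_gt, h3, h3.ne, h3.ne', h3.not_gt, if_true, if_false, lt_irrefl, smul_add]; module
      · simp only [h1, h1.ne, h1.ne', h1.not_gt, if_true, if_false, lt_irrefl, smul_add]; module
      · simp only [h1, h1.ne, h1.ne', h1.not_gt, h2, h2.ne, h2.ne', h2.not_gt, h3, h3.ne, h3.ne', h3.not_gt, if_true, if_false, lt_irrefl, smul_add]; module
  · rcases lt_trichotomy x z with h2 | rfl | h2
    · simp only [h2, h2.ne, h2.ne', h2.not_gt, if_true, if_false, lt_irrefl, smul_add]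
    · rfl
    · simp only [h2, h2.ne, h2.ne', h2.not_gt, if_true, if_false, lt_irrefl, smul_add]; module
  · rcases lt_trichotomy y z with h2 | rfl | h2
    · rcases lt_trichotomy x z with h3 | rfl | h3
      · simp only [h1, h1.ne, h1.ne', h1.not_gt, h2, h2.ne, h2.ne', h2.not_gt, h3, h3.ne, h3.ne', h3.not_gt, if_true, if_false, lt_irrefl, smul_add]; module
      · simp only [h1, h1.ne, h1.ne', h1.not_gt, if_true, if_false, lt_irrefl, smul_add]; module
      · simp only [h1, h1.ne, h1.ne', h1.not_gt, h2, h2.ne, h2.ne', h2.not_gt, h3, h3.ne, h3.ne', h3.not_gt, if_true, if_false, lt_irrefl, smul_add]; module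
    · simp only [h1, h1.ne, h1.ne', h1.not_gt, if_true, if_false, lt_irrefl, smul_add]; module
    · have h3 := h2.trans h1
      simp only [h1, h1.ne, h1.ne', h1.not_gt, h2, h2.ne, h2.ne', h2.not_gt, h3, h3.ne, h3.ne', h3.not_gt, if_true, if_false, lt_irrefl, smul_add]; module

theorem wordOp_comp {L' : Type} [LinearOrder L'] {φ : L → L'} (hφ : Monotone φ)
    (G : (ℕ → L') → U) :
    wordOp q i (fun w => G (φ ∘ w)) w = wordOp q i G (φ ∘ w) := by
  rcases lt_trichotomy (w i) (w (i + 1)) with h | h | h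
  · rw [wordOp_lt h, comp_swapAt]
    rcases (hφ h.le).lt_or_eq with h' | h'
    · rw [wordOp_lt h']
    · rw [wordOp_eq h', swapAt_of_eq h']
  · rw [wordOp_eq h, wordOp_eq (congrArg φ h)]
  · rw [wordOp_gt h, comp_swapAt]
    rcases (hφ h.le).lt_or_eq with h' | h'
    · rw [wordOp_gt h']
    · rw [wordOp_eq h'.symm, swapAt_of_eq h'.symm]
      module

end WordOperators

section Push

variable {k : Type} [Field k] {L : Type} {U : Type} [AddCommGroup U] [Module k U]

theorem swapAt_update_of_ne {i l : ℕ} (w : ℕ → L) (h : l ≠ i) (h' : l ≠ i + 1) (x : L) :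
    swapAt i (Function.update w l x) = Function.update (swapAt i w) l x := by
  funext j
  by_cases h1 : j = i
  · subst h1
    rw [swapAt_left, Function.update_of_ne h'.symm, Function.update_of_ne h.symm, swapAt_left]
  by_cases h2 : j = i + 1
  · subst h2
    rw [swapAt_right, Function.update_of_ne h.symm, Function.update_of_ne h'.symm, swapAt_right]
  rw [swapAt_of_ne _ h1 h2]
  by_cases h3 : j = l
  · subst h3; rw [Function.update_self, Function.update_self]
  · rw [Function.update_of_ne h3, Function.update_of_ne h3, swapAt_of_ne _ h1 h2]

theorem swapAt_update_left (i : ℕ) (w : ℕ → L) (x : L) :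
    swapAt i (Function.update w i x) = Function.update (swapAt i w) (i + 1) x := by
  funext j
  by_cases h1 : j = i
  · subst h1
    rw [swapAt_left, Function.update_of_ne (by omega), Function.update_of_ne (by omega),
      swapAt_left]
  by_cases h2 : j = i + 1
  · subst h2
    rw [swapAt_right, Function.update_self, Function.update_self]
  rw [swapAt_of_ne _ h1 h2, Function.update_of_ne h1, Function.update_of_ne h2,
    swapAt_of_ne _ h1 h2]

theorem swapAt_update_right (i : ℕ) (w : ℕ → L) (x : L) :
    swapAt i (Function.update w (i + 1) x) = Function.update (swapAt i w) i x := by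
  have := swapAt_update_left i (swapAt i w) x
  rw [swapAt_swapAt] at this
  rw [← this, swapAt_swapAt]

variable [LinearOrder L]

/-- Sum a function over the ways of changing one of the first `l` letters from `a` to `b`,
weighted by powers of `q`. -/
def pushSum (q : k) (a b : L) (G : (ℕ → L) → U) : ℕ → (ℕ → L) → U
  | 0, _ => 0
  | l + 1, w => (if w l = a then q else 1) • pushSum q a b G l w +
      if w l = a then G (Function.update w l b) else 0

/-- The letters of the word compare in the same way with `a` and `b`, unless they are `a`. -/
def Separated (a b : L) (w : ℕ → L) : Prop :=
  ∀ i, w i ≠ b ∧ (w i < a → w i < b) ∧ (a < w i → b < w i)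

variable {q : k} {a b : L} {G : (ℕ → L) → U} {w : ℕ → L} {i l : ℕ}

theorem pushSum_succ : pushSum q a b G (l + 1) w = (if w l = a then q else 1) • pushSum q a b G l w +
    if w l = a then G (Function.update w l b) else 0 := rfl

theorem pushSum_succ_of_eq (h : w l = a) : pushSum q a b G (l + 1) w =
    q • pushSum q a b G l w + G (Function.update w l b) := by
  rw [pushSum_succ, if_pos h, if_pos h]

theorem pushSum_succ_of_ne (h : w l ≠ a) :
    pushSum q a b G (l + 1) w = pushSum q a b G l w := by
  rw [pushSum_succ, if_neg h, if_neg h, one_smul, add_zero]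

theorem wordOp_smul_add {F₁ F₂ : (ℕ → L) → U} (c : k) :
    wordOp q i (fun w => c • F₁ w + F₂ w) w = c • wordOp q i F₁ w + wordOp q i F₂ w := by
  have : (fun w => c • F₁ w + F₂ w) = c • F₁ + F₂ := rfl
  rw [this, map_add, map_smul]; rfl

theorem pushSum_wordOp_step (hl : l ≠ i) (hl' : l ≠ i + 1)
    (h : pushSum q a b (wordOp q i G) l w = wordOp q i (pushSum q a b G l) w) :
    pushSum q a b (wordOp q i G) (l + 1) w = wordOp q i (pushSum q a b G (l + 1)) w := by
  have hs : swapAt i w l = w l := swapAt_of_ne w hl hl'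
  by_cases hw : w l = a
  · rw [pushSum_succ_of_eq hw, h]
    have e1 : wordOp q i (pushSum q a b G (l + 1)) w = wordOp q i
        (fun w => q • pushSum q a b G l w + G (Function.update w l b)) w :=
      wordOp_congr (pushSum_succ_of_eq hw) (pushSum_succ_of_eq (hs.trans hw)) rfl rfl
    rw [e1, wordOp_smul_add]
    congr 1
    exact wordOp_congr rfl (by rw [swapAt_update_of_ne _ hl hl'])
      (Function.update_of_ne hl.symm _ _) (Function.update_of_ne hl'.symm _ _)
  · rw [pushSum_succ_of_ne hw, h]
    exact wordOp_congr (pushSum_succ_of_ne hw).symm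
      (pushSum_succ_of_ne (by rwa [hs])).symm rfl rfl

theorem pushSum_wordOp_of_le (hl : l ≤ i) :
    pushSum q a b (wordOp q i G) l w = wordOp q i (pushSum q a b G l) w := by
  induction l with
  | zero =>
    have : pushSum q a b G 0 = 0 := funext fun _ => rfl
    rw [this, map_zero]; rfl
  | succ l ih => exact pushSum_wordOp_step (by omega) (by omega) (ih (by omega))

theorem pushSum_wordOp_add_two (hab : a < b) (hw : Separated a b w) :
    pushSum q a b (wordOp q i G) (i + 1 + 1) w =
      wordOp q i (pushSum q a b G (i + 1 + 1)) w := by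
  have ih := pushSum_wordOp_of_le (q := q) (a := a) (b := b) (G := G) (w := w) le_rfl (i := i)
  obtain ⟨-, x2, x3⟩ := hw i
  obtain ⟨-, y2, y3⟩ := hw (i + 1)
  have sl := swapAt_left i w
  have sr := swapAt_right i w
  have ul : Function.update w i b i = b := Function.update_self _ _ _
  have ul' : Function.update w i b (i + 1) = w (i + 1) := Function.update_of_ne (by omega) _ _
  have ur : Function.update w (i + 1) b i = w i := Function.update_of_ne (by omega) _ _
  have ur' : Function.update w (i + 1) b (i + 1) = b := Function.update_self _ _ _
  have s1 := swapAt_update_left i w b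
  have s2 := swapAt_update_right i w b
  by_cases hx : w i = a <;> by_cases hy : w (i + 1) = a
  · have hxy : w i = w (i + 1) := hx.trans hy.symm
    rw [wordOp_eq hxy] at ih ⊢
    rw [swapAt_of_eq hxy] at s1 s2
    rw [pushSum_succ_of_eq hy, pushSum_succ_of_eq hx, pushSum_succ_of_eq hy, pushSum_succ_of_eq hx,
      ih, wordOp_gt (by rwa [ul, ul', hy]), wordOp_lt (by rwa [ur, ur', hx]), s1, s2]
    module
  · have e1 : ∀ H : (ℕ → L) → U, pushSum q a b H (i + 1 + 1) w =
        q • pushSum q a b H i w + H (Function.update w i b) := fun H => by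
      rw [pushSum_succ_of_ne hy, pushSum_succ_of_eq hx]
    have e2 : pushSum q a b G (i + 1 + 1) (swapAt i w) =
        q • pushSum q a b G i (swapAt i w) + G (swapAt i (Function.update w i b)) := by
      rw [pushSum_succ_of_eq (by rwa [sr]), pushSum_succ_of_ne (by rwa [sl]), s1]
    rcases lt_or_gt_of_ne hy with h | h
    · have hlt : w (i + 1) < w i := by rwa [hx]
      rw [wordOp_gt hlt] at ih ⊢
      rw [e1, e1, e2, ih, wordOp_gt (by rw [ul, ul']; exact y2 h)]
      module
    · have hlt : w i < w (i + 1) := by rwa [hx]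
      rw [wordOp_lt hlt] at ih ⊢
      rw [e1, e2, ih, wordOp_lt (by rw [ul, ul']; exact y3 h)]
      module
  · have e1 : ∀ H : (ℕ → L) → U, pushSum q a b H (i + 1 + 1) w =
        q • pushSum q a b H i w + H (Function.update w (i + 1) b) := fun H => by
      rw [pushSum_succ_of_eq hy, pushSum_succ_of_ne hx]
    have e2 : pushSum q a b G (i + 1 + 1) (swapAt i w) =
        q • pushSum q a b G i (swapAt i w) + G (swapAt i (Function.update w (i + 1) b)) := by
      rw [pushSum_succ_of_ne (by rwa [sr]), pushSum_succ_of_eq (by rwa [sl]), s2]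
    rcases lt_or_gt_of_ne hx with h | h
    · have hlt : w i < w (i + 1) := by rwa [hy]
      rw [wordOp_lt hlt] at ih ⊢
      rw [e1, e2, ih, wordOp_lt (by rw [ur, ur']; exact x2 h)]
      module
    · have hlt : w (i + 1) < w i := by rwa [hy]
      rw [wordOp_gt hlt] at ih ⊢
      rw [e1, e1, e2, ih, wordOp_gt (by rw [ur, ur']; exact x3 h)]
      module
  · rw [pushSum_succ_of_ne hy, pushSum_succ_of_ne hx, ih]
    refine wordOp_congr ?_ ?_ rfl rfl
    · rw [pushSum_succ_of_ne hy, pushSum_succ_of_ne hx]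
    · rw [pushSum_succ_of_ne (by rwa [sr]), pushSum_succ_of_ne (by rwa [sl])]

/-- Pushing commutes with the Hecke generators. -/
theorem pushSum_wordOp (hab : a < b) (hw : Separated a b w) (hl : i + 1 < l) :
    pushSum q a b (wordOp q i G) l w = wordOp q i (pushSum q a b G l) w := by
  induction l, hl using Nat.le_induction with
  | base => exact pushSum_wordOp_add_two hab hw
  | succ l hl ih => exact pushSum_wordOp_step (by omega) (by omega) ih

theorem pushSum_add (G H : (ℕ → L) → U) :
    pushSum q a b (G + H) l w = pushSum q a b G l w + pushSum q a b H l w := by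
  induction l with
  | zero => simp [pushSum]
  | succ l ih =>
    rw [pushSum_succ, pushSum_succ, pushSum_succ, ih]
    split_ifs
    · rw [Pi.add_apply]; module
    · module

theorem pushSum_smul (c : k) (G : (ℕ → L) → U) :
    pushSum q a b (c • G) l w = c • pushSum q a b G l w := by
  induction l with
  | zero => simp [pushSum]
  | succ l ih =>
    rw [pushSum_succ, pushSum_succ, ih]
    split_ifs
    · rw [Pi.smul_apply]; module
    · module

theorem pushSum_eq_zero (h : ∀ i < l, w i = a → G (Function.update w i b) = 0) :
    pushSum q a b G l w = 0 := by
  induction l with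
  | zero => rfl
  | succ l ih =>
    rw [pushSum_succ, ih fun i hi => h i (by omega), smul_zero, zero_add]
    split_ifs with hl
    · exact h l (by omega) hl
    · rfl

theorem pushSum_add_of_ne {p : ℕ} (h : ∀ i, p ≤ i → i < l → w i ≠ a) (hl : p ≤ l) :
    pushSum q a b G l w = pushSum q a b G p w := by
  induction l, hl using Nat.le_induction with
  | base => rfl
  | succ l hl ih =>
    rw [pushSum_succ_of_ne (h l hl (by omega)), ih fun i hi hil => h i hi (by omega)]

/-- Pushing over a block of length the quantum characteristic. -/
theorem pushSum_block {p e : ℕ} {c d : U} (he : 0 < e) (hq : ∑ t ∈ Finset.range e, q ^ t = 0)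
    (hp : ∀ i < p, w i ≠ a) (hpe : ∀ i < e, w (p + i) = a)
    (hG : ∀ i < e, G (Function.update w (p + i) b) = d + if i = e - 1 then c else 0) :
    pushSum q a b G (p + e) w = c := by
  have h0 : pushSum q a b G p w = 0 :=
    pushSum_eq_zero fun i hi h => absurd h (hp i hi)
  have key : ∀ t < e, pushSum q a b G (p + t) w = (∑ s ∈ Finset.range t, q ^ s) • d := by
    intro t ht
    induction t with
    | zero => simpa using h0
    | succ t ih =>
      rw [← add_assoc, pushSum_succ_of_eq (hpe t (by omega)), ih (by omega), hG t (by omega),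
        if_neg (by omega), geom_sum_succ]
      module
  obtain ⟨e, rfl⟩ : ∃ e', e = e' + 1 := ⟨e - 1, by omega⟩
  rw [← add_assoc, pushSum_succ_of_eq (hpe e (by omega)), key e (by omega), hG e (by omega),
    if_pos (by omega)]
  rw [geom_sum_succ] at hq
  calc _ = (q * ∑ s ∈ Finset.range e, q ^ s + 1) • d + c := by module
    _ = c := by rw [hq, zero_smul, zero_add]

end Push

section MixedWords

variable {k : Type} [Field k] {U : Type} [AddCommGroup U] [Module k U]

/-- Words in `0, 1, 2, 3` of length `n`, padded with `0`, with one letter `1` and one letter `3`. -/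
def IsMixed (n : ℕ) (w : ℕ → Fin 4) : Prop :=
  ∃ i < n, ∃ j < n, w i = 1 ∧ w j = 3 ∧ (∀ l, l ≠ i → l ≠ j → w l = 0 ∨ w l = 2) ∧
    ∀ l, n ≤ l → w l = 0

/-- Words in `0` and `2`. -/
def IsPlain (w : ℕ → Fin 4) : Prop := ∀ l, w l = 0 ∨ w l = 2

/-- Identify the letters `2` and `3`. -/
def collapseTop : Fin 4 → Fin 4 := ![0, 1, 2, 2]

/-- Identify the letters `0` and `1`. -/
def collapseBot : Fin 4 → Fin 4 := ![0, 0, 2, 3]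

theorem collapseTop_monotone : Monotone collapseTop := by
  intro a b; revert a b; decide

theorem collapseBot_monotone : Monotone collapseBot := by
  intro a b; revert a b; decide

variable {n i : ℕ} {w : ℕ → Fin 4} {q : k}

theorem swapAt_apply (i : ℕ) (w : ℕ → Fin 4) (j : ℕ) :
    swapAt i w j = w (Equiv.swap i (i + 1) j) := rfl

theorem swap_succ_lt (hi : i + 1 < n) (l : ℕ) : Equiv.swap i (i + 1) l < n ↔ l < n := by
  rw [Equiv.swap_apply_def]
  split_ifs <;> omega

theorem IsMixed.swapAt (hi : i + 1 < n) (h : IsMixed n w) : IsMixed n (swapAt i w) := by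
  obtain ⟨a, ha, b, hb, h1, h2, h3, h4⟩ := h
  refine ⟨Equiv.swap i (i + 1) a, (swap_succ_lt hi a).2 ha, Equiv.swap i (i + 1) b,
    (swap_succ_lt hi b).2 hb, ?_, ?_, fun l hl hl' => ?_, fun l hl => ?_⟩
  · rw [swapAt_apply, Equiv.swap_apply_self, h1]
  · rw [swapAt_apply, Equiv.swap_apply_self, h2]
  · rw [swapAt_apply]
    refine h3 _ (fun h => hl ?_) (fun h => hl' ?_)
    · rw [← h, Equiv.swap_apply_self]
    · rw [← h, Equiv.swap_apply_self]
  · rw [swapAt_apply]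
    refine h4 _ (not_lt.1 fun h => ?_)
    rw [swap_succ_lt hi] at h
    omega

theorem isMixed_swapAt (hi : i + 1 < n) : IsMixed n (swapAt i w) ↔ IsMixed n w :=
  ⟨fun h => by simpa only [swapAt_swapAt] using h.swapAt hi, fun h => h.swapAt hi⟩

theorem IsPlain.swapAt (h : IsPlain w) : IsPlain (swapAt i w) := fun _ => h _

theorem IsPlain.separated_bot (h : IsPlain w) : Separated 0 1 w := fun i => by
  rcases h i with h | h <;> rw [h] <;> decide

theorem IsPlain.separated_top (h : IsPlain w) : Separated 2 3 w := fun i => by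
  rcases h i with h | h <;> rw [h] <;> decide

theorem wordOp_eq_zero {F : (ℕ → Fin 4) → U} (h : F w = 0) (h' : F (swapAt i w) = 0) :
    wordOp q i F w = 0 := by
  have : wordOp q i F w = wordOp q i (0 : (ℕ → Fin 4) → U) w := wordOp_congr h h' rfl rfl
  rw [this, map_zero]; rfl

theorem map_wordOp {V : Type} [AddCommGroup V] [Module k V] (J : U →ₗ[k] V)
    (F : (ℕ → Fin 4) → U) : J (wordOp q i F w) = wordOp q i (fun w => J (F w)) w := by
  change J (if _ then _ else if _ then _ else _) = if _ then _ else if _ then _ else _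
  split_ifs <;> simp only [map_add, map_smul]

/-- Functions on mixed words which are sums of functions of the two collapsed words, with pushed
sums related by `J`. -/
def mixedModule (q : k) (n : ℕ) (J : Module.End k U) : Submodule k ((ℕ → Fin 4) → U) where
  carrier := {F | (∀ w, ¬ IsMixed n w → F w = 0) ∧ ∃ G G' : (ℕ → Fin 4) → U,
    (∀ w, IsMixed n w → F w = G (collapseTop ∘ w) + G' (collapseBot ∘ w)) ∧
    ∀ w, IsPlain w → pushSum q 2 3 G' n w = J (pushSum q 0 1 G n w)}
  add_mem' := by
    rintro F H ⟨hF, G, G', h1, h2⟩ ⟨hH, K, K', h3, h4⟩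
    refine ⟨fun w hw => by rw [Pi.add_apply, hF w hw, hH w hw, add_zero], G + K, G' + K',
      fun w hw => ?_, fun w hw => ?_⟩
    · simp only [Pi.add_apply, h1 w hw, h3 w hw]
      abel
    · rw [pushSum_add, pushSum_add, h2 w hw, h4 w hw, map_add]
  zero_mem' := by
    have h : ∀ (a b : Fin 4) w, pushSum q a b (0 : (ℕ → Fin 4) → U) n w = 0 := fun a b w =>
      pushSum_eq_zero fun _ _ _ => rfl
    exact ⟨fun _ _ => rfl, 0, 0, fun w _ => (add_zero 0).symm, fun w _ => by rw [h, h, map_zero]⟩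
  smul_mem' := by
    rintro c F ⟨hF, G, G', h1, h2⟩
    refine ⟨fun w hw => by rw [Pi.smul_apply, hF w hw, smul_zero], c • G, c • G',
      fun w hw => ?_, fun w hw => ?_⟩
    · simp only [Pi.smul_apply, h1 w hw, smul_add]
    · rw [pushSum_smul, pushSum_smul, h2 w hw, map_smul]

theorem wordOp_mem_mixedModule {J : Module.End k U} (hi : i + 1 < n) {F : (ℕ → Fin 4) → U}
    (hF : F ∈ mixedModule q n J) : wordOp q i F ∈ mixedModule q n J := by
  obtain ⟨hF, G, G', h1, h2⟩ := hF
  refine ⟨fun w hw => wordOp_eq_zero (hF w hw) (hF _ (by rwa [isMixed_swapAt hi])),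
    wordOp q i G, wordOp q i G', fun w hw => ?_, fun w hw => ?_⟩
  · rw [← wordOp_comp collapseTop_monotone, ← wordOp_comp collapseBot_monotone, ← Pi.add_apply,
      ← map_add]
    exact wordOp_congr (h1 w hw) (h1 _ (hw.swapAt hi)) rfl rfl
  · rw [pushSum_wordOp (by decide) hw.separated_bot hi,
      pushSum_wordOp (by decide) hw.separated_top hi, map_wordOp]
    exact wordOp_congr (h2 w hw) (h2 _ hw.swapAt) rfl rfl

instance [FiniteDimensional k U] (J : Module.End k U) :
    FiniteDimensional k (mixedModule q n J) := by
  let ext : (Fin n → Fin 4) → (ℕ → Fin 4) := fun v l => if h : l < n then v ⟨l, h⟩ else 0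
  let f : mixedModule q n J →ₗ[k] ((Fin n → Fin 4) → U) :=
    LinearMap.funLeft k U ext ∘ₗ (mixedModule q n J).subtype
  refine Module.Finite.of_injective f fun F G hFG => Subtype.ext (funext fun w => ?_)
  by_cases hw : IsMixed n w
  · have : ext (fun l => w l) = w := by
      obtain ⟨-, -, -, -, -, -, -, h⟩ := hw
      funext l
      by_cases hl : l < n
      · simp only [ext, dif_pos hl]
      · simp only [ext, dif_neg hl, h l (by omega)]
    have h := congrFun hFG (fun l : Fin n => w l)
    change F.1 (ext fun l => w l) = G.1 (ext fun l => w l) at h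
    rwa [this] at h
  · rw [F.2.1 w hw, G.2.1 w hw]

namespace OpRep

/-- The representation on `mixedModule`. -/
def mixed [FiniteDimensional k U] (q : k) (n : ℕ) (J : Module.End k U) : OpRep k where
  carrier := mixedModule q n J
  op i := if h : i + 1 < n then (wordOp q i).restrict (p := mixedModule q n J)
    (q := mixedModule q n J) (fun _ hF => wordOp_mem_mixedModule h hF) else 0

theorem mixed_op_apply [FiniteDimensional k U] {J : Module.End k U} (hi : i + 1 < n)
    (F : mixedModule q n J) :
    (show mixedModule q n J from (mixed q n J).op i F).1 = wordOp q i F.1 := by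
  simp only [mixed, dif_pos hi]
  rfl

theorem isHecke_mixed [FiniteDimensional k U] (J : Module.End k U) :
    IsHecke q (n - 1) (mixed q n J).op where
  quad i hi := by
    refine LinearMap.ext fun F => Subtype.ext ?_
    simp only [mixed, dif_pos (show i + 1 < n by omega)]
    exact wordOp_quad
  braid i := by
    by_cases h : i + 1 < n - 1
    · refine LinearMap.ext fun F => Subtype.ext ?_
      simp only [mixed, dif_pos (show i + 1 < n by omega),
        dif_pos (show i + 1 + 1 < n by omega)]
      exact wordOp_braid
    · have : (mixed q n J).op (i + 1) = 0 := dif_neg (by omega)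
      rw [this, zero_mul, zero_mul, mul_zero, zero_mul]
  comm i j hij := by
    by_cases h : j < n - 1
    · refine LinearMap.ext fun F => Subtype.ext ?_
      simp only [mixed, dif_pos (show i + 1 < n by omega),
        dif_pos (show j + 1 < n by omega)]
      exact wordOp_comm hij
    · have : (mixed q n J).op j = 0 := dif_neg (by omega)
      rw [this]
      exact Commute.zero_right _
  zero i hi := dif_neg (by omega)

end OpRep

end MixedWords

section BaseWords

/-- The word with `e` letters `0` followed by `e` letters `2`. -/
def baseWord (e : ℕ) (l : ℕ) : Fin 4 := if l < e then 0 else if l < e + e then 2 else 0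

/-- The base word with one `0` replaced by `1` and one `2` replaced by `3`. -/
def mixWord (e i j : ℕ) : ℕ → Fin 4 :=
  Function.update (Function.update (baseWord e) i 1) (e + j) 3

variable {e i j l r : ℕ} {w : ℕ → Fin 4}

theorem baseWord_lt (h : l < e) : baseWord e l = 0 := if_pos h

theorem baseWord_mid (h : l < e) : baseWord e (e + l) = 2 := by
  rw [baseWord, if_neg (by omega), if_pos (by omega)]

theorem baseWord_ge (h : e + e ≤ l) : baseWord e l = 0 := by
  rw [baseWord, if_neg (by omega), if_neg (by omega)]

theorem isPlain_baseWord : IsPlain (baseWord e) := fun l => by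
  rw [baseWord]
  split_ifs <;> simp

theorem swapAt_update (r l : ℕ) (w : ℕ → Fin 4) (x : Fin 4) :
    swapAt r (Function.update w l x) =
      Function.update (swapAt r w) (Equiv.swap r (r + 1) l) x := by
  rw [swapAt, Function.update_comp_equiv, Equiv.symm_swap]
  rfl

theorem swapAt_baseWord_left (hr : r + 1 < e) : swapAt r (baseWord e) = baseWord e :=
  swapAt_of_eq (by rw [baseWord_lt (by omega), baseWord_lt hr])

theorem swapAt_baseWord_right (hr : r + 1 < e) : swapAt (e + r) (baseWord e) = baseWord e :=
  swapAt_of_eq (by rw [baseWord_mid (by omega), add_assoc, baseWord_mid hr])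

theorem swapAt_mixWord_left (hr : r + 1 < e) :
    swapAt r (mixWord e i j) = mixWord e (Equiv.swap r (r + 1) i) j := by
  rw [mixWord, swapAt_update, swapAt_update, swapAt_baseWord_left hr,
    Equiv.swap_apply_of_ne_of_ne (x := e + j) (by omega) (by omega), mixWord]

theorem swapAt_mixWord_right (hr : r + 1 < e) (hi : i < e) :
    swapAt (e + r) (mixWord e i j) = mixWord e i (Equiv.swap r (r + 1) j) := by
  rw [mixWord, swapAt_update, swapAt_update, swapAt_baseWord_right hr,
    Equiv.swap_apply_of_ne_of_ne (x := i) (by omega) (by omega), mixWord]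
  congr 1
  simp only [Equiv.swap_apply_def]
  split_ifs <;> omega

theorem mixWord_left_self (hi : i < e) : mixWord e i j i = 1 := by
  rw [mixWord, Function.update_of_ne (by omega), Function.update_self]

theorem mixWord_left (hl : l < e) (h : l ≠ i) : mixWord e i j l = 0 := by
  rw [mixWord, Function.update_of_ne (by omega), Function.update_of_ne h, baseWord_lt hl]

theorem mixWord_right_self : mixWord e i j (e + j) = 3 := by
  rw [mixWord, Function.update_self]

theorem mixWord_right (hi : i < e) (hl : l < e) (h : l ≠ j) : mixWord e i j (e + l) = 2 := by
  rw [mixWord, Function.update_of_ne (by omega), Function.update_of_ne (by omega),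
    baseWord_mid hl]

theorem isMixed_mixWord (hi : i < e) (hj : j < e) : IsMixed (e + e) (mixWord e i j) := by
  refine ⟨i, by omega, e + j, by omega, mixWord_left_self hi, mixWord_right_self,
    fun l h1 h2 => ?_, fun l hl => ?_⟩
  · rw [mixWord, Function.update_of_ne h2, Function.update_of_ne h1]
    exact isPlain_baseWord l
  · rw [mixWord, Function.update_of_ne (by omega), Function.update_of_ne (by omega),
      baseWord_ge hl]

theorem IsPlain.collapseTop (h : IsPlain w) : collapseTop ∘ w = w := funext fun l => by
  rcases h l with h | h <;> rw [Function.comp_apply, h] <;> rfl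

theorem IsPlain.collapseBot (h : IsPlain w) : collapseBot ∘ w = w := funext fun l => by
  rcases h l with h | h <;> rw [Function.comp_apply, h] <;> rfl

theorem IsPlain.collapseBot_update (h : IsPlain w) (hi : w i = 0) :
    _root_.collapseBot ∘ Function.update w i 1 = w := by
  rw [Function.comp_update, h.collapseBot]
  exact (congrArg (Function.update w i) hi.symm).trans (Function.update_eq_self i w)

theorem IsPlain.collapseTop_update (h : IsPlain w) (hi : w i = 2) :
    _root_.collapseTop ∘ Function.update w i 3 = w := by
  rw [Function.comp_update, h.collapseTop]
  exact (congrArg (Function.update w i) hi.symm).trans (Function.update_eq_self i w)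

theorem collapseTop_mixWord (hi : i < e) (hj : j < e) :
    collapseTop ∘ mixWord e i j = Function.update (baseWord e) i 1 := by
  rw [mixWord, Function.comp_update, Function.comp_update, isPlain_baseWord.collapseTop]
  have h : Function.update (baseWord e) i 1 (e + j) = 2 := by
    rw [Function.update_of_ne (by omega), baseWord_mid hj]
  exact (congrArg (Function.update _ (e + j)) h.symm).trans (Function.update_eq_self _ _)

theorem collapseBot_mixWord (hi : i < e) :
    collapseBot ∘ mixWord e i j = Function.update (baseWord e) (e + j) 3 := by
  rw [mixWord, Function.comp_update, isPlain_baseWord.collapseBot_update (baseWord_lt hi)]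
  rfl

theorem collapse_comm : collapseTop ∘ collapseBot = collapseBot ∘ collapseTop := by decide

theorem IsMixed.eq_mixWord (hw : IsMixed (e + e) w)
    (h : collapseBot ∘ (collapseTop ∘ w) = baseWord e) :
    ∃ i < e, ∃ j < e, w = mixWord e i j := by
  obtain ⟨i, hi, j, hj, h1, h2, h3, -⟩ := hw
  have e1 := congrFun h i
  have e2 := congrFun h j
  simp only [Function.comp_apply, h1, h2] at e1 e2
  have hi' : i < e := by
    by_contra hc
    rw [baseWord, if_neg hc, if_pos hi] at e1
    exact absurd e1 (by decide)
  have hj' : e ≤ j := by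
    by_contra hc
    rw [baseWord, if_pos (by omega)] at e2
    exact absurd e2 (by decide)
  obtain ⟨j, rfl⟩ := Nat.exists_eq_add_of_le hj'
  refine ⟨i, hi', j, by omega, funext fun l => ?_⟩
  by_cases hl : l = i
  · rw [hl, h1, mixWord_left_self hi']
  by_cases hl' : l = e + j
  · rw [hl', h2, mixWord_right_self]
  rw [mixWord, Function.update_of_ne hl', Function.update_of_ne hl, ← h]
  rcases h3 l hl hl' with h | h <;> simp only [Function.comp_apply, h] <;> rfl

variable {k : Type} [Field k] {U : Type} [AddCommGroup U] [Module k U] {q : k}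
  {F : (ℕ → Fin 4) → U}

theorem wordOp_left_self (hr : r + 1 < e) : wordOp q r F (mixWord e r j) =
    F (mixWord e (r + 1) j) + (q - 1) • F (mixWord e r j) := by
  rw [wordOp_gt, swapAt_mixWord_left hr, Equiv.swap_apply_left]
  rw [mixWord_left hr (by omega), mixWord_left_self (by omega)]
  decide

theorem wordOp_left_succ (hr : r + 1 < e) : wordOp q r F (mixWord e (r + 1) j) =
    q • F (mixWord e r j) := by
  rw [wordOp_lt, swapAt_mixWord_left hr, Equiv.swap_apply_right]
  rw [mixWord_left (l := r) (by omega) (by omega), mixWord_left_self hr]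
  decide

theorem wordOp_left_of_ne (hr : r + 1 < e) (h : i ≠ r) (h' : i ≠ r + 1) :
    wordOp q r F (mixWord e i j) = q • F (mixWord e i j) := by
  rw [wordOp_eq]
  rw [mixWord_left (by omega) h.symm, mixWord_left hr h'.symm]

theorem wordOp_right_self (hr : r + 1 < e) (hi : i < e) : wordOp q (e + r) F (mixWord e i r) =
    F (mixWord e i (r + 1)) + (q - 1) • F (mixWord e i r) := by
  rw [wordOp_gt, swapAt_mixWord_right hr hi, Equiv.swap_apply_left]
  rw [add_assoc, mixWord_right hi hr (by omega), mixWord_right_self]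
  decide

theorem wordOp_right_succ (hr : r + 1 < e) (hi : i < e) :
    wordOp q (e + r) F (mixWord e i (r + 1)) = q • F (mixWord e i r) := by
  rw [wordOp_lt, swapAt_mixWord_right hr hi, Equiv.swap_apply_right]
  rw [add_assoc, mixWord_right (l := r) hi (by omega) (by omega), mixWord_right_self]
  decide

theorem wordOp_right_of_ne (hr : r + 1 < e) (hi : i < e) (h : j ≠ r) (hs : j ≠ r + 1) :
    wordOp q (e + r) F (mixWord e i j) = q • F (mixWord e i j) := by
  rw [wordOp_eq]
  rw [add_assoc, mixWord_right hi (by omega) h.symm, mixWord_right hi hr hs.symm]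

/-- Functions supported on the words `mixWord e i j`. -/
def BaseSupported (e : ℕ) (F : (ℕ → Fin 4) → U) : Prop :=
  ∀ w, (∀ i < e, ∀ j < e, w ≠ mixWord e i j) → F w = 0

theorem BaseSupported.ext {G : (ℕ → Fin 4) → U} (hF : BaseSupported e F) (hG : BaseSupported e G)
    (h : ∀ i < e, ∀ j < e, F (mixWord e i j) = G (mixWord e i j)) : F = G := by
  funext w
  by_cases hw : ∀ i < e, ∀ j < e, w ≠ mixWord e i j
  · rw [hF w hw, hG w hw]
  · push Not at hw
    obtain ⟨i, hi, j, hj, rfl⟩ := hw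
    exact h i hi j hj

theorem BaseSupported.wordOp_left (hF : BaseSupported e F) (hr : r + 1 < e) :
    BaseSupported e (wordOp q r F) := fun w hw => by
  refine wordOp_eq_zero (hF w hw) (hF _ fun i hi j hj h => ?_)
  have := congrArg (swapAt r) h
  rw [swapAt_swapAt, swapAt_mixWord_left hr] at this
  exact hw _ ((swap_succ_lt hr i).2 hi) j hj this

theorem BaseSupported.wordOp_right (hF : BaseSupported e F) (hr : r + 1 < e) :
    BaseSupported e (wordOp q (e + r) F) := fun w hw => by
  refine wordOp_eq_zero (hF w hw) (hF _ fun i hi j hj h => ?_)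
  have := congrArg (swapAt (e + r)) h
  rw [swapAt_swapAt, swapAt_mixWord_right hr hi] at this
  exact hw i hi _ ((swap_succ_lt hr j).2 hj) this

end BaseWords

section Sweep

variable {k : Type} [Field k] {U : Type} [AddCommGroup U] [Module k U] {q : k}
  {V : Type} [AddCommGroup V] [Module k V]

/-- The product `T (e - 1 - t) * ⋯ * T (e - 2)` of `t` factors. -/
def sweepTerm (T : ℕ → Module.End k V) (e : ℕ) : ℕ → Module.End k V
  | 0 => 1
  | t + 1 => T (e - 2 - t) * sweepTerm T e t

/-- The sum of the products of consecutive generators ending with `T (e - 2)`. -/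
def sweep (T : ℕ → Module.End k V) (e : ℕ) : Module.End k V :=
  ∑ t ∈ Finset.range e, sweepTerm T e t

theorem commute_sweep {T : ℕ → Module.End k V} {e : ℕ} {a : Module.End k V}
    (h : ∀ i, Commute a (T i)) : Commute a (sweep T e) := by
  refine Commute.sum_right _ _ _ fun t ht => ?_
  clear ht
  induction t with
  | zero => exact Commute.one_right _
  | succ t ih => exact (h _).mul_right ih

/-- Evaluations at `e` points on which neighbouring generators act as on words. -/
structure IsEvaluation (q : k) (e : ℕ) (T : ℕ → Module.End k V) (ev : ℕ → V →ₗ[k] U) : Prop where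
  self : ∀ r F, r + 1 < e → ev r (T r F) = ev (r + 1) F + (q - 1) • ev r F
  succ : ∀ r F, r + 1 < e → ev (r + 1) (T r F) = q • ev r F
  of_ne : ∀ r i F, r + 1 < e → i < e → i ≠ r → i ≠ r + 1 → ev i (T r F) = q • ev i F

variable {e : ℕ} {T : ℕ → Module.End k V} {ev : ℕ → V →ₗ[k] U}

theorem IsEvaluation.sweepTerm_apply (h : IsEvaluation q e T ev) {F : V} {c d : U}
    (hF : ∀ i < e, ev i F = d + if i = e - 1 then c else 0) :
    ∀ t < e, ∀ i < e, ev i (sweepTerm T e t F) = q ^ t • d + if i + t = e - 1 then c else 0 := by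
  intro t
  induction t with
  | zero =>
    intro _ i hi
    change ev i F = _
    rw [hF i hi, pow_zero, one_smul, add_zero]
  | succ t ih =>
    intro ht i hi
    have ih := ih (by omega)
    obtain ⟨r, hr⟩ : ∃ r, r = e - 2 - t := ⟨_, rfl⟩
    change ev i (T (e - 2 - t) (sweepTerm T e t F)) = _
    rw [← hr]
    have hr1 : r + 1 < e := by omega
    rcases eq_or_ne i r with rfl | h1
    · rw [h.self _ _ hr1, ih _ hr1, ih _ hi, if_pos (by omega), if_neg (by omega),
        if_pos (by omega)]
      module
    rcases eq_or_ne i (r + 1) with rfl | h2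
    · rw [h.succ _ _ hr1, ih _ (by omega), if_neg (by omega), if_neg (by omega)]
      module
    · rw [h.of_ne _ _ _ hr1 hi h1 h2, ih _ hi, if_neg (by omega), if_neg (by omega)]
      module

theorem IsEvaluation.sweep_apply (h : IsEvaluation q e T ev)
    (hq : ∑ t ∈ Finset.range e, q ^ t = 0) {F : V} {c d : U}
    (hF : ∀ i < e, ev i F = d + if i = e - 1 then c else 0) {i : ℕ} (hi : i < e) :
    ev i (sweep T e F) = c := by
  rw [sweep, LinearMap.sum_apply, map_sum, Finset.sum_congr rfl fun t ht =>
    h.sweepTerm_apply hF t (Finset.mem_range.1 ht) i hi, Finset.sum_add_distrib, ← Finset.sum_smul,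
    hq, zero_smul, zero_add, Finset.sum_eq_single (e - 1 - i), if_pos (by omega)]
  · intro t _ ht
    rw [if_neg (by omega)]
  · intro ht
    rw [Finset.mem_range] at ht
    omega

/-- Vectors that all but the last generator multiply by `q`. -/
def IsQInvariant (q : k) (e : ℕ) (T : ℕ → Module.End k V) (F : V) : Prop :=
  ∀ r, r + 2 < e → T r F = q • F

theorem IsQInvariant.map {F : V} (h : IsQInvariant q e T F) {a : Module.End k V}
    (ha : ∀ i, Commute a (T i)) : IsQInvariant q e T (a F) := fun r hr => by
  have : a (T r F) = T r (a F) := congrArg (fun f => f F) (ha r).eq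
  rw [← this, h r hr, map_smul]

theorem IsEvaluation.eq_of_isQInvariant (h : IsEvaluation q e T ev) {F : V}
    (hF : IsQInvariant q e T F) {i : ℕ} (hi : i + 1 < e) : ev i F = ev 0 F := by
  induction i with
  | zero => rfl
  | succ i ih =>
    rw [← ih (by omega)]
    have h1 := h.self i F (by omega)
    rw [hF i hi, map_smul] at h1
    calc ev (i + 1) F = (ev (i + 1) F + (q - 1) • ev i F) - (q - 1) • ev i F := by abel
      _ = ev i F := by rw [← h1]; module

end Sweep

section ShiftOperator

variable {k : Type} [Field k]

/-- The nilpotent shift on `k ^ N`. -/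
def shiftEnd (k : Type) [Field k] (N : ℕ) : Module.End k (Fin N → k) where
  toFun z i := if h : i.1 + 1 < N then z ⟨i.1 + 1, h⟩ else 0
  map_add' x y := by
    ext i
    simp only [Pi.add_apply]
    split_ifs <;> simp
  map_smul' c x := by
    ext i
    simp only [Pi.smul_apply, RingHom.id_apply]
    split_ifs <;> simp

theorem shiftEnd_pow_apply {N : ℕ} (t : ℕ) (z : Fin N → k) (i : Fin N) :
    (shiftEnd k N ^ t) z i = if h : i.1 + t < N then z ⟨i.1 + t, h⟩ else 0 := by
  induction t generalizing z with
  | zero => simp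
  | succ t ih =>
    rw [pow_succ, Module.End.mul_apply, ih]
    simp only [shiftEnd, LinearMap.coe_mk, AddHom.coe_mk, add_assoc]
    split_ifs <;> first | rfl | omega

/-- An endomorphism commuting with the shift is injective if it does not kill the first basis
vector. -/
theorem injective_of_commute_shiftEnd {N : ℕ} {A : Module.End k (Fin (N + 1) → k)}
    (hA : Commute A (shiftEnd k (N + 1))) (h0 : A (Pi.single 0 1) ≠ 0) :
    Function.Injective A := by
  classical
  rw [← LinearMap.ker_eq_bot, LinearMap.ker_eq_bot']
  intro z hz
  by_contra hne
  have hex : ∃ t, (shiftEnd k (N + 1) ^ t) z = 0 := ⟨N + 1, by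
    ext i; rw [shiftEnd_pow_apply, dif_neg (by omega)]; rfl⟩
  obtain ⟨t, ht⟩ : ∃ t, Nat.find hex = t + 1 := by
    refine Nat.exists_eq_succ_of_ne_zero fun h => hne ?_
    have := Nat.find_spec hex
    rwa [h, pow_zero] at this
  have h1 := Nat.find_spec hex
  rw [ht, pow_succ', Module.End.mul_apply] at h1
  have h2 : (shiftEnd k (N + 1) ^ t) z ≠ 0 := Nat.find_min hex (by omega)
  set y := (shiftEnd k (N + 1) ^ t) z with hy
  have hy0 : ∀ i, i ≠ 0 → y i = 0 := by
    intro i hi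
    obtain ⟨j, rfl⟩ := Fin.exists_succ_eq.2 hi
    have := congrFun h1 j.castSucc
    simp only [shiftEnd, LinearMap.coe_mk, AddHom.coe_mk, Fin.val_castSucc, add_lt_add_iff_right,
      j.2, dif_pos, Pi.zero_apply] at this
    exact this
  have hy1 : y = y 0 • Pi.single 0 1 := by
    ext i
    rcases eq_or_ne i 0 with rfl | hi
    · simp
    · simp [hy0 i hi, hi]
  have hAy : A y = 0 := by
    have : A y = (shiftEnd k (N + 1) ^ t) (A z) := congrArg (fun f => f z) (hA.pow_right t).eq
    rw [this, hz, map_zero]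
  rw [hy1, map_smul, smul_eq_zero] at hAy
  rcases hAy with h | h
  · exact h2 (by rw [hy1, h, zero_smul])
  · exact h0 h

end ShiftOperator

section MixedVectors

variable {k : Type} [Field k] {U : Type} [AddCommGroup U] [Module k U] {q : k} {e : ℕ}

open Classical in
/-- The component of `mixVec` in functions of the word with collapsed top. -/
noncomputable def mixVecTop (e : ℕ) (c b : U) (v : ℕ → Fin 4) : U :=
  (if collapseBot ∘ v = baseWord e then b else 0) +
    if v = Function.update (baseWord e) (e - 1) 1 then c else 0

open Classical in
/-- The component of `mixVec` in functions of the word with collapsed bottom. -/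
noncomputable def mixVecBot (e : ℕ) (d : U) (v : ℕ → Fin 4) : U :=
  if v = Function.update (baseWord e) (e + (e - 1)) 3 then d else 0

open Classical in
/-- A function on mixed words supported on the words `mixWord e i j`. -/
noncomputable def mixVec (e : ℕ) (c d b : U) (w : ℕ → Fin 4) : U :=
  if IsMixed (e + e) w then
    mixVecTop e c b (collapseTop ∘ w) + mixVecBot e d (collapseBot ∘ w) else 0

variable {c d b : U}

theorem collapseBot_update_baseWord (he : 0 < e) :
    collapseBot ∘ Function.update (baseWord e) (e - 1) 1 = baseWord e :=
  isPlain_baseWord.collapseBot_update (baseWord_lt (by omega))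

theorem collapseTop_update_baseWord (he : 0 < e) :
    collapseTop ∘ Function.update (baseWord e) (e + (e - 1)) 3 = baseWord e :=
  isPlain_baseWord.collapseTop_update (baseWord_mid (by omega))

theorem mixVecTop_eq_zero (he : 0 < e) {v : ℕ → Fin 4} (h : collapseBot ∘ v ≠ baseWord e) :
    mixVecTop e c b v = 0 := by
  rw [mixVecTop, if_neg h, if_neg, add_zero]
  rintro rfl
  exact h (collapseBot_update_baseWord he)

theorem mixVecBot_eq_zero (he : 0 < e) {v : ℕ → Fin 4} (h : collapseTop ∘ v ≠ baseWord e) :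
    mixVecBot e d v = 0 := by
  rw [mixVecBot, if_neg]
  rintro rfl
  exact h (collapseTop_update_baseWord he)

theorem update_baseWord_inj {i j : ℕ} {x : Fin 4} (hx : x ≠ 0 ∧ x ≠ 2) :
    Function.update (baseWord e) i x = Function.update (baseWord e) j x ↔ i = j := by
  refine ⟨fun h => ?_, fun h => by rw [h]⟩
  by_contra hij
  have := congrFun h i
  rw [Function.update_self, Function.update_of_ne hij] at this
  rcases isPlain_baseWord (e := e) i with h | h
  · exact hx.1 (this.trans h)
  · exact hx.2 (this.trans h)

theorem mixVecTop_update {i : ℕ} (hi : i < e) :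
    mixVecTop e c b (Function.update (baseWord e) i 1) = b + if i = e - 1 then c else 0 := by
  simp only [mixVecTop, isPlain_baseWord.collapseBot_update (baseWord_lt hi), if_true,
    update_baseWord_inj (show (1 : Fin 4) ≠ 0 ∧ (1 : Fin 4) ≠ 2 by decide)]

theorem mixVecBot_update {j : ℕ} :
    mixVecBot e d (Function.update (baseWord e) (e + j) 3) = if j = e - 1 then d else 0 := by
  simp only [mixVecBot, update_baseWord_inj (show (3 : Fin 4) ≠ 0 ∧ (3 : Fin 4) ≠ 2 by decide),
    add_right_inj]

theorem mixVec_mixWord {i j : ℕ} (hi : i < e) (hj : j < e) :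
    mixVec e c d b (mixWord e i j) =
      b + (if i = e - 1 then c else 0) + if j = e - 1 then d else 0 := by
  rw [mixVec, if_pos (isMixed_mixWord hi hj), collapseTop_mixWord hi hj, collapseBot_mixWord hi,
    mixVecTop_update hi, mixVecBot_update]

theorem baseSupported_mixVec (he : 0 < e) : BaseSupported e (mixVec e c d b) := fun w hw => by
  rw [mixVec]
  split_ifs with h
  · have h1 : collapseBot ∘ (collapseTop ∘ w) ≠ baseWord e := fun h' => by
      obtain ⟨i, hi, j, hj, hw'⟩ := h.eq_mixWord h'
      exact hw i hi j hj hw'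
    have h2 : collapseTop ∘ (collapseBot ∘ w) ≠ baseWord e := by
      rwa [← Function.comp_assoc, collapse_comm, Function.comp_assoc]
    rw [mixVecTop_eq_zero he h1, mixVecBot_eq_zero he h2, add_zero]
  · rfl

theorem pushSum_bot_baseWord (he : 0 < e) (hq : ∑ t ∈ Finset.range e, q ^ t = 0)
    {G : (ℕ → Fin 4) → U}
    (hG : ∀ i < e, G (Function.update (baseWord e) i 1) = d + if i = e - 1 then c else 0) :
    pushSum q 0 1 G (e + e) (baseWord e) = c := by
  rw [pushSum_add_of_ne (p := 0 + e) (fun i hi hi' => ?_) (by omega)]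
  · refine pushSum_block he hq (fun i hi => by omega) (fun i hi => ?_) (d := d) fun i hi => ?_
    · rw [zero_add, baseWord_lt hi]
    · rw [zero_add, hG i hi]
  · obtain ⟨l, rfl⟩ := Nat.exists_eq_add_of_le (show e ≤ i by omega)
    rw [baseWord_mid (by omega)]
    decide

theorem pushSum_top_baseWord (he : 0 < e) (hq : ∑ t ∈ Finset.range e, q ^ t = 0)
    {G : (ℕ → Fin 4) → U}
    (hG : ∀ i < e, G (Function.update (baseWord e) (e + i) 3) = d + if i = e - 1 then c else 0) :
    pushSum q 2 3 G (e + e) (baseWord e) = c := by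
  refine pushSum_block he hq (fun i hi => ?_) (fun i hi => baseWord_mid hi) hG
  rw [baseWord_lt hi]
  decide

theorem mixVec_mem (he : 0 < e) (hq : ∑ t ∈ Finset.range e, q ^ t = 0) (J : Module.End k U)
    (c b : U) : mixVec e c (J c) b ∈ mixedModule q (e + e) J := by
  refine ⟨fun w hw => if_neg hw, mixVecTop e c b, mixVecBot e (J c), fun w hw => if_pos hw,
    fun w hw => ?_⟩
  by_cases h : w = baseWord e
  · subst h
    rw [pushSum_bot_baseWord he hq fun i hi => mixVecTop_update hi,
      pushSum_top_baseWord he hq (d := 0) fun i _ => by rw [mixVecBot_update, zero_add]]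
  · rw [pushSum_eq_zero, pushSum_eq_zero, map_zero]
    · intro i _ hi
      exact mixVecTop_eq_zero he (by rwa [hw.collapseBot_update hi])
    · intro i _ hi
      exact mixVecBot_eq_zero he (by rwa [hw.collapseTop_update hi])

namespace OpRep

variable [FiniteDimensional k U] {J : Module.End k U}

/-- Evaluation at the word `mixWord e i j`. -/
def mixEval (q : k) (J : Module.End k U) (e i j : ℕ) :
    (mixed q (e + e) J).carrier →ₗ[k] U :=
  LinearMap.proj (mixWord e i j) ∘ₗ (mixedModule q (e + e) J).subtype

theorem isEvaluation_left (he : 0 < e) (j : ℕ) : IsEvaluation q e (mixed q (e + e) J).op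
    fun i => mixEval q J e i j where
  self r F hr := (congrFun (mixed_op_apply (show r + 1 < e + e by omega) F) _).trans
    (wordOp_left_self hr)
  succ r F hr := (congrFun (mixed_op_apply (show r + 1 < e + e by omega) F) _).trans
    (wordOp_left_succ hr)
  of_ne r i F hr _ h h' := (congrFun (mixed_op_apply (show r + 1 < e + e by omega) F) _).trans
    (wordOp_left_of_ne hr h h')

theorem isEvaluation_right {i : ℕ} (hi : i < e) :
    IsEvaluation q e (fun r => (mixed q (e + e) J).op (e + r)) fun j => mixEval q J e i j where
  self r F hr := (congrFun (mixed_op_apply (show e + r + 1 < e + e by omega) F) _).trans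
    (wordOp_right_self hr hi)
  succ r F hr := (congrFun (mixed_op_apply (show e + r + 1 < e + e by omega) F) _).trans
    (wordOp_right_succ hr hi)
  of_ne r j F hr _ h hs := (congrFun (mixed_op_apply (show e + r + 1 < e + e by omega) F) _).trans
    (wordOp_right_of_ne hr hi h hs)

/-- The vectors multiplied by `q` under the generators inside both blocks. -/
def MixInvariant (q : k) (J : Module.End k U) (e : ℕ) (F : (mixed q (e + e) J).carrier) : Prop :=
  IsQInvariant q e (mixed q (e + e) J).op F ∧
    IsQInvariant q e (fun r => (mixed q (e + e) J).op (e + r)) F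

theorem MixInvariant.map {F : (mixed q (e + e) J).carrier} (hF : MixInvariant q J e F)
    {a : Module.End k (mixed q (e + e) J).carrier} (ha : (mixed q (e + e) J).IsEndo a) :
    MixInvariant q J e (a F) := ⟨hF.1.map ha, hF.2.map fun i => ha (e + i)⟩

/-- Invariant vectors take the same values as `mixVec` on the words `mixWord e i j`. -/
theorem MixInvariant.mixEval_eq {F : (mixed q (e + e) J).carrier} (hF : MixInvariant q J e F)
    (he : 2 ≤ e) (hq : ∑ t ∈ Finset.range e, q ^ t = 0) : ∃ c b, ∀ i < e, ∀ j < e,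
      mixEval q J e i j F = b + (if i = e - 1 then c else 0) + if j = e - 1 then J c else 0 := by
  obtain ⟨-, G, G', h1, h2⟩ := F.2
  have hval : ∀ i < e, ∀ j < e, mixEval q J e i j F = G (Function.update (baseWord e) i 1) +
      G' (Function.update (baseWord e) (e + j) 3) := fun i hi j hj => by
    have := h1 _ (isMixed_mixWord hi hj)
    rw [collapseTop_mixWord hi hj, collapseBot_mixWord hi] at this
    exact this
  have hG : ∀ i < e, G (Function.update (baseWord e) i 1) = G (Function.update (baseWord e) 0 1) +
      if i = e - 1 then G (Function.update (baseWord e) (e - 1) 1) -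
        G (Function.update (baseWord e) 0 1) else 0 := fun i hi => by
    split_ifs with h
    · rw [h]; abel
    · have := (isEvaluation_left (by omega) 0).eq_of_isQInvariant hF.1 (i := i) (by omega)
      simp only [hval i hi 0 (by omega), hval 0 (by omega) 0 (by omega), add_left_inj] at this
      rw [this, add_zero]
  have hG' : ∀ j < e, G' (Function.update (baseWord e) (e + j) 3) =
      G' (Function.update (baseWord e) (e + 0) 3) +
      if j = e - 1 then G' (Function.update (baseWord e) (e + (e - 1)) 3) -
        G' (Function.update (baseWord e) (e + 0) 3) else 0 := fun j hj => by
    split_ifs with h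
    · rw [h]; abel
    · have := (isEvaluation_right (i := 0) (by omega)).eq_of_isQInvariant hF.2 (i := j) (by omega)
      simp only [hval 0 (by omega) j hj, hval 0 (by omega) 0 (by omega), add_right_inj] at this
      rw [this]; exact (add_zero _).symm
  have hJ := h2 _ (isPlain_baseWord (e := e))
  rw [pushSum_bot_baseWord (by omega) hq hG, pushSum_top_baseWord (by omega) hq hG'] at hJ
  rw [hJ] at hG'
  refine ⟨G (Function.update (baseWord e) (e - 1) 1) - G (Function.update (baseWord e) 0 1),
    G (Function.update (baseWord e) 0 1) + G' (Function.update (baseWord e) (e + 0) 3),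
    fun i hi j hj => ?_⟩
  rw [hval i hi j hj, hG i hi, hG' j hj]
  abel

end OpRep

end MixedVectors

theorem sweep_mem {k V : Type} [Field k] [AddCommGroup V] [Module k V] {T : ℕ → Module.End k V}
    {e : ℕ} {N : Submodule k V} (h : ∀ r, r + 1 < e → ∀ F ∈ N, T r F ∈ N) {F : V} (hF : F ∈ N) :
    sweep T e F ∈ N := by
  rw [sweep, LinearMap.sum_apply]
  refine N.sum_mem fun t ht => ?_
  rw [Finset.mem_range] at ht
  induction t with
  | zero => exact hF
  | succ t ih => exact h _ (by omega) _ (ih (by omega))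

namespace OpRep

section MixedInfinite

variable {k : Type} [Field k] {U : Type} [AddCommGroup U] [Module k U] [FiniteDimensional k U]
  {q : k} {e : ℕ} {J : Module.End k U}

/-- The vectors supported on the words `mixWord e i j`. -/
def baseSubmodule (q : k) (e : ℕ) (J : Module.End k U) :
    Submodule k (mixed q (e + e) J).carrier where
  carrier := {F | BaseSupported e F.1}
  add_mem' {F G} hF hG w hw := by
    change F.1 w + G.1 w = 0
    rw [hF w hw, hG w hw, add_zero]
  zero_mem' _ _ := rfl
  smul_mem' c F hF w hw := by
    change c • F.1 w = 0
    rw [hF w hw, smul_zero]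

theorem eq_of_mixEval {F G : (mixed q (e + e) J).carrier} (hF : F ∈ baseSubmodule q e J)
    (hG : G ∈ baseSubmodule q e J)
    (h : ∀ i < e, ∀ j < e, mixEval q J e i j F = mixEval q J e i j G) : F = G :=
  Subtype.ext (BaseSupported.ext hF hG h)

theorem op_left_mem_baseSubmodule {r : ℕ} (hr : r + 1 < e) {F : (mixed q (e + e) J).carrier}
    (hF : F ∈ baseSubmodule q e J) : (mixed q (e + e) J).op r F ∈ baseSubmodule q e J := by
  have h := mixed_op_apply (q := q) (J := J) (show r + 1 < e + e by omega) F
  change BaseSupported e _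
  exact h.symm ▸ BaseSupported.wordOp_left hF hr

theorem op_right_mem_baseSubmodule {r : ℕ} (hr : r + 1 < e) {F : (mixed q (e + e) J).carrier}
    (hF : F ∈ baseSubmodule q e J) : (mixed q (e + e) J).op (e + r) F ∈ baseSubmodule q e J := by
  have h := mixed_op_apply (q := q) (J := J) (show e + r + 1 < e + e by omega) F
  change BaseSupported e _
  exact h.symm ▸ BaseSupported.wordOp_right hF hr

/-- The vector given by `mixVec`. -/
noncomputable def mixVector (he : 0 < e) (hq : ∑ t ∈ Finset.range e, q ^ t = 0)
    (J : Module.End k U) (c b : U) : (mixed q (e + e) J).carrier :=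
  (⟨mixVec e c (J c) b, mixVec_mem he hq J c b⟩ : mixedModule q (e + e) J)

variable (he : 0 < e) (hq : ∑ t ∈ Finset.range e, q ^ t = 0)

theorem mixVector_mem_baseSubmodule (c b : U) : mixVector he hq J c b ∈ baseSubmodule q e J :=
  baseSupported_mixVec he

theorem mixEval_mixVector {i j : ℕ} (hi : i < e) (hj : j < e) (c b : U) :
    mixEval q J e i j (mixVector he hq J c b) =
      b + (if i = e - 1 then c else 0) + if j = e - 1 then J c else 0 :=
  mixVec_mixWord hi hj

theorem mixInvariant_mixVector (c b : U) : MixInvariant q J e (mixVector he hq J c b) := by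
  have hm := mixVector_mem_baseSubmodule (J := J) he hq c b
  constructor
  · intro r hr
    refine eq_of_mixEval (op_left_mem_baseSubmodule (by omega) hm)
      (Submodule.smul_mem _ _ hm) fun i hi j hj => ?_
    have h := isEvaluation_left (q := q) (J := J) he j
    rw [map_smul]
    rcases eq_or_ne i r with rfl | h1
    · refine (h.self i _ (by omega)).trans ?_
      rw [mixEval_mixVector he hq hi hj, mixEval_mixVector he hq (by omega) hj,
        if_neg (by omega), if_neg (show i ≠ e - 1 by omega)]
      module
    rcases eq_or_ne i (r + 1) with rfl | h2
    · refine (h.succ r _ (by omega)).trans ?_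
      rw [mixEval_mixVector he hq hi hj, mixEval_mixVector he hq (by omega) hj,
        if_neg (by omega), if_neg (show r + 1 ≠ e - 1 by omega)]
    · exact h.of_ne r i _ (by omega) hi h1 h2
  · intro r hr
    refine eq_of_mixEval (op_right_mem_baseSubmodule (by omega) hm)
      (Submodule.smul_mem _ _ hm) fun i hi j hj => ?_
    have h := isEvaluation_right (q := q) (J := J) hi
    rw [map_smul]
    rcases eq_or_ne j r with rfl | h1
    · refine (h.self j _ (by omega)).trans ?_
      rw [mixEval_mixVector he hq hi hj, mixEval_mixVector he hq hi (by omega),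
        if_neg (show j + 1 ≠ e - 1 by omega), if_neg (show j ≠ e - 1 by omega)]
      module
    rcases eq_or_ne j (r + 1) with rfl | h2
    · refine (h.succ r _ (by omega)).trans ?_
      rw [mixEval_mixVector he hq hi hj, mixEval_mixVector he hq hi (by omega),
        if_neg (show r ≠ e - 1 by omega), if_neg (show r + 1 ≠ e - 1 by omega)]
    · exact h.of_ne r j _ (by omega) hj h1 h2

theorem sweep_left_mixVector (c : U) :
    sweep (mixed q (e + e) J).op e (mixVector he hq J c 0) = mixVector he hq J 0 c := by
  refine eq_of_mixEval (sweep_mem (fun r hr F hF => op_left_mem_baseSubmodule hr hF)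
    (mixVector_mem_baseSubmodule he hq _ _)) (mixVector_mem_baseSubmodule he hq _ _)
    fun i hi j hj => ?_
  rw [(isEvaluation_left he j).sweep_apply hq (c := c) (d := if j = e - 1 then J c else 0)
    (fun i hi => ?_) hi, mixEval_mixVector he hq hi hj]
  · simp
  · rw [mixEval_mixVector he hq hi hj, zero_add, add_comm]

theorem sweep_right_mixVector (c : U) :
    sweep (fun r => (mixed q (e + e) J).op (e + r)) e (mixVector he hq J c 0) =
      mixVector he hq J 0 (J c) := by
  refine eq_of_mixEval (sweep_mem (fun r hr F hF => op_right_mem_baseSubmodule hr hF)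
    (mixVector_mem_baseSubmodule he hq _ _)) (mixVector_mem_baseSubmodule he hq _ _)
    fun i hi j hj => ?_
  rw [(isEvaluation_right hi).sweep_apply hq (c := J c) (d := if i = e - 1 then c else 0)
    (fun j hj => ?_) hj, mixEval_mixVector he hq hi hj]
  · simp
  · rw [mixEval_mixVector he hq hi hj, zero_add]

/-- The vectors `mixVector he hq J c 0`, depending linearly on `c`. -/
noncomputable def mixTop (J : Module.End k U) : U →ₗ[k] (mixed q (e + e) J).carrier where
  toFun c := mixVector he hq J c 0
  map_add' c d := by
    refine eq_of_mixEval (mixVector_mem_baseSubmodule he hq _ _)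
      (Submodule.add_mem _ (mixVector_mem_baseSubmodule he hq _ _)
        (mixVector_mem_baseSubmodule he hq _ _)) fun i hi j hj => ?_
    rw [map_add]
    simp only [mixEval_mixVector he hq hi hj, map_add]
    split_ifs <;> abel
  map_smul' c d := by
    refine eq_of_mixEval (mixVector_mem_baseSubmodule he hq _ _)
      (Submodule.smul_mem _ _ (mixVector_mem_baseSubmodule he hq _ _)) fun i hi j hj => ?_
    rw [RingHom.id_apply, map_smul]
    simp only [mixEval_mixVector he hq hi hj, map_smul]
    split_ifs <;> module

/-- The endomorphism of `U` induced by an endomorphism of `mixed q (e + e) J`. -/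
noncomputable def mixCoeff (J : Module.End k U) (a : Module.End k (mixed q (e + e) J).carrier) :
    Module.End k U :=
  (mixEval q J e (e - 1) 0 - mixEval q J e 0 0) ∘ₗ a ∘ₗ mixTop he hq J

theorem mixCoeff_one (he2 : 2 ≤ e) : mixCoeff he hq J 1 = 1 := by
  refine LinearMap.ext fun c => ?_
  change mixEval q J e (e - 1) 0 (mixVector he hq J c 0) -
    mixEval q J e 0 0 (mixVector he hq J c 0) = c
  rw [mixEval_mixVector he hq (by omega) (by omega), mixEval_mixVector he hq (by omega) (by omega),
    if_pos rfl, if_neg (by omega), if_neg (by omega)]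
  abel

theorem commute_mixCoeff (he2 : 2 ≤ e) {a : Module.End k (mixed q (e + e) J).carrier}
    (ha : (mixed q (e + e) J).IsEndo a) : Commute (mixCoeff he hq J a) J := by
  have key : ∀ c, mixEval q J e 0 0 (a (mixVector he hq J 0 c)) = mixCoeff he hq J a c ∧
      mixEval q J e 0 0 (a (mixVector he hq J 0 (J c))) = J (mixCoeff he hq J a c) := by
    intro c
    obtain ⟨c', b', h⟩ := ((mixInvariant_mixVector he hq c 0).map ha).mixEval_eq he2 hq
    have hc : mixCoeff he hq J a c = c' := by
      change mixEval q J e (e - 1) 0 (a (mixVector he hq J c 0)) -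
        mixEval q J e 0 0 (a (mixVector he hq J c 0)) = c'
      rw [h _ (by omega) _ (by omega), h _ (by omega) _ (by omega), if_pos rfl, if_neg (by omega),
        if_neg (by omega)]
      abel
    rw [hc]
    constructor
    · have h1 : a (sweep (mixed q (e + e) J).op e (mixVector he hq J c 0)) =
          sweep (mixed q (e + e) J).op e (a (mixVector he hq J c 0)) :=
        congrArg (fun f => f (mixVector he hq J c 0)) (commute_sweep (e := e) ha).eq
      rw [← sweep_left_mixVector he hq, h1]
      exact (isEvaluation_left he 0).sweep_apply hq (d := b') (fun i hi => by
        rw [h i hi 0 he, if_neg (show 0 ≠ e - 1 by omega), add_zero]) he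
    · have h1 : a (sweep (fun r => (mixed q (e + e) J).op (e + r)) e (mixVector he hq J c 0)) =
          sweep (fun r => (mixed q (e + e) J).op (e + r)) e (a (mixVector he hq J c 0)) :=
        congrArg (fun f => f (mixVector he hq J c 0))
          (commute_sweep (e := e) fun i => ha (e + i)).eq
      rw [← sweep_right_mixVector he hq, h1]
      exact (isEvaluation_right he).sweep_apply hq (d := b') (fun j hj => by
        rw [h 0 he j hj, if_neg (show 0 ≠ e - 1 by omega), add_zero]) he
  exact LinearMap.ext fun c => (key (J c)).1.symm.trans (key c).2

end MixedInfinite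

variable {k : Type} [Field k] {q : k} {e m : ℕ}

theorem not_boundedDim (he : 2 ≤ e) (hq : ∑ t ∈ Finset.range e, q ^ t = 0) :
    ¬ BoundedDim q (e + e - 1) := fun h => by
  obtain ⟨d, hd⟩ := h.exists_forall_le
  have he' : 0 < e := by omega
  let J := shiftEnd k (d + 1)
  let good : Module.End k (mixed q (e + e) J).carrier → Prop :=
    fun a => mixCoeff he' hq J a (Pi.single 0 1) ≠ 0
  have hne : (Pi.single 0 1 : Fin (d + 1) → k) ≠ 0 := by simp
  have := hd (mixed q (e + e) J) (isHecke_mixed J) good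
    (by simp only [good, mixCoeff_one he' hq he]; exact hne)
    (fun h => h ?_) (fun a b _ _ hab => ?_) (d + 1) (fun a ha hg => ?_)
  · omega
  · exact map_zero (mixEval q J e (e - 1) 0 - mixEval q J e 0 0)
  · by_contra! hc
    have h1 : mixCoeff he' hq J a (Pi.single 0 1) = 0 := by
      by_contra h; exact hc.1 h
    have h2 : mixCoeff he' hq J b (Pi.single 0 1) = 0 := by
      by_contra h; exact hc.2 h
    refine hab (Eq.trans (b := mixCoeff he' hq J a (Pi.single 0 1) +
      mixCoeff he' hq J b (Pi.single 0 1))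
      (map_add (mixEval q J e (e - 1) 0 - mixEval q J e 0 0) _ _) ?_)
    rw [h1, h2, add_zero]
  · have h1 := injective_of_commute_shiftEnd (commute_mixCoeff he' hq he ha) hg
    have h2 : Function.Injective (a ∘ₗ mixTop he' hq J) :=
      Function.Injective.of_comp (f := mixEval q J e (e - 1) 0 - mixEval q J e 0 0) h1
    have h3 : Module.finrank k (Fin (d + 1) → k) = d + 1 := by simp
    refine (h3.symm.trans (LinearMap.finrank_range_of_inj h2).symm).le.trans ?_
    exact Submodule.finrank_mono (LinearMap.range_comp_le_range _ _)

theorem not_finitelyMany_isHecke (hq1 : q ≠ 1) (he : orderOf q ≠ 0)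
    (h : 2 * orderOf q ≤ m + 1) :
    ¬ FinitelyMany fun M : OpRep k => M.Indec ∧ IsHecke q m M.op := fun hf => by
  have h1 : orderOf q ≠ 1 := fun h => hq1 (orderOf_eq_one_iff.1 h)
  have h2 : ∑ t ∈ Finset.range (orderOf q), q ^ t = 0 := by
    have := mul_geom_sum q (orderOf q)
    rw [pow_orderOf_eq_one, sub_self] at this
    exact (mul_eq_zero.1 this).resolve_left (sub_ne_zero.2 hq1)
  exact not_boundedDim (by omega) h2 ((boundedDim_of_finitelyMany hf).of_le (by omega))

end OpRep

namespace HeckeA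

variable {K : Type} [Field K] {q : K} {n : ℕ}

/-- The generators, extended by zero. -/
def gen (K : Type) [Field K] (q : K) (n i : ℕ) : HeckeA K q n :=
  if h : i < n - 1 then RingQuot.mkAlgHom K (HeckeARel K q (n - 1)) (FreeAlgebra.ι K ⟨i, h⟩) else 0

theorem gen_of_lt {i : ℕ} (h : i < n - 1) : gen K q n i =
    RingQuot.mkAlgHom K (HeckeARel K q (n - 1)) (FreeAlgebra.ι K ⟨i, h⟩) := dif_pos h

theorem gen_of_le {i : ℕ} (h : n - 1 ≤ i) : gen K q n i = 0 := dif_neg (by omega)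

theorem isHecke_gen : IsHecke q (n - 1) (gen K q n) where
  quad i hi := by
    have h := RingQuot.mkAlgHom_rel K (HeckeARel.quad (K := K) (q := q) (m := n - 1) ⟨i, hi⟩)
    rw [map_mul, map_add, map_sub, map_one, map_zero, AlgHom.commutes, ← gen_of_lt hi,
      Algebra.algebraMap_eq_smul_one] at h
    calc gen K q n i * gen K q n i
        = (gen K q n i + 1) * (gen K q n i - q • (1 : HeckeA K q n)) +
          ((q - 1) • gen K q n i + q • (1 : HeckeA K q n)) := by
          rw [add_mul, mul_sub, mul_smul_comm, mul_one, one_mul]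
          module
      _ = _ := by rw [h, zero_add]
  braid i := by
    by_cases hi : i + 1 < n - 1
    · have h := RingQuot.mkAlgHom_rel K (HeckeARel.braid (K := K) (q := q) (m := n - 1)
        ⟨i, by omega⟩ ⟨i + 1, hi⟩ rfl)
      simp only [map_mul] at h
      rwa [← gen_of_lt hi, ← gen_of_lt (by omega)] at h
    · rw [gen_of_le (i := i + 1) (by omega), zero_mul, zero_mul, mul_zero, zero_mul]
  comm i j hij := by
    by_cases hj : j < n - 1
    · have h := RingQuot.mkAlgHom_rel K (HeckeARel.comm (K := K) (q := q) (m := n - 1)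
        ⟨i, by omega⟩ ⟨j, hj⟩ hij)
      simp only [map_mul] at h
      rwa [← gen_of_lt hj, ← gen_of_lt (by omega)] at h
    · rw [gen_of_le (i := j) (by omega)]
      exact Commute.zero_right _
  zero _ hi := gen_of_le hi

theorem gen_induction {P : HeckeA K q n → Prop} (algebraMap : ∀ c, P (algebraMap K _ c))
    (gen : ∀ i, P (gen K q n i)) (add : ∀ x y, P x → P y → P (x + y))
    (mul : ∀ x y, P x → P y → P (x * y)) (x : HeckeA K q n) : P x := by
  obtain ⟨y, rfl⟩ := RingQuot.mkAlgHom_surjective K (HeckeARel K q (n - 1)) x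
  induction y using FreeAlgebra.induction with
  | grade0 c => rw [AlgHom.commutes]; exact algebraMap c
  | grade1 i => rw [← gen_of_lt i.2]; exact gen i
  | mul a b ha hb => rw [map_mul]; exact mul _ _ ha hb
  | add a b ha hb => rw [map_add]; exact add _ _ ha hb

/-- The algebra homomorphism given by elements satisfying the Hecke relations. -/
def lift {A : Type} [Ring A] [Algebra K A] {T : ℕ → A} (h : IsHecke q (n - 1) T) :
    HeckeA K q n →ₐ[K] A :=
  RingQuot.liftAlgHom K ⟨FreeAlgebra.lift K fun i : Fin (n - 1) => T i, by
    rintro _ _ (i | ⟨i, j, hij⟩ | ⟨i, j, hij⟩)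
    · simp only [map_mul, map_add, map_sub, map_one, map_zero, FreeAlgebra.lift_ι_apply,
        AlgHom.commutes]
      rw [Algebra.algebraMap_eq_smul_one, add_mul, mul_sub, mul_smul_comm, mul_one, one_mul, h.quad i i.2]
      module
    · simp only [map_mul, FreeAlgebra.lift_ι_apply, hij]
      exact h.braid i
    · simp only [map_mul, FreeAlgebra.lift_ι_apply]
      exact (h.comm i j hij).eq⟩

theorem lift_gen {A : Type} [Ring A] [Algebra K A] {T : ℕ → A} (h : IsHecke q (n - 1) T) (i : ℕ) :
    lift h (gen K q n i) = T i := by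
  by_cases hi : i < n - 1
  · rw [gen_of_lt hi, lift, RingQuot.liftAlgHom_mkAlgHom_apply, FreeAlgebra.lift_ι_apply]
  · rw [gen_of_le (by omega), map_zero, h.zero i (by omega)]

end HeckeA

namespace FDRightModule

variable {K : Type} [Field K] {q : K} {n : ℕ}

/-- The operators given by the generators on a module. -/
def toOpRep (M : FDRightModule K (HeckeA K q n)) : OpRep K where
  carrier := M.carrier
  op i := Algebra.lsmul K K M.carrier (MulOpposite.op (HeckeA.gen K q n i))

theorem isHecke_toOpRep (M : FDRightModule K (HeckeA K q n)) :
    IsHecke q (n - 1) M.toOpRep.op :=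
  HeckeA.isHecke_gen.op.map (Algebra.lsmul K K M.carrier)

/-- The module given by operators satisfying the Hecke relations. -/
def ofOpRep (M : OpRep K) (h : IsHecke q (n - 1) M.op) : FDRightModule K (HeckeA K q n) :=
  let φ : (HeckeA K q n)ᵐᵒᵖ →ₐ[K] Module.End K M.carrier := AlgHom.opComm (HeckeA.lift h.op)
  letI : Module (HeckeA K q n)ᵐᵒᵖ M.carrier := Module.compHom M.carrier φ.toRingHom
  { carrier := M.carrier
    isFinDim := M.isFinDim
    isTower := ⟨fun c x v => congrArg (fun f : Module.End K M.carrier => f v) (map_smul φ c x)⟩ }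

theorem toOpRep_ofOpRep (M : OpRep K) (h : IsHecke q (n - 1) M.op) :
    (ofOpRep M h).toOpRep = M := by
  have : ∀ i, (ofOpRep M h).toOpRep.op i = M.op i := fun i =>
    congrArg MulOpposite.unop (HeckeA.lift_gen h.op i)
  exact congrArg (@OpRep.mk K _ M.carrier M.isAddCommGroup M.isModule M.isFinDim) (funext this)

theorem map_smul_of_intertwines {M N : FDRightModule K (HeckeA K q n)}
    {f : M.carrier →ₗ[K] N.carrier} (hf : OpRep.Intertwines M.toOpRep N.toOpRep f)
    (x : (HeckeA K q n)ᵐᵒᵖ) (v : M.carrier) : f (x • v) = x • f v := by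
  obtain ⟨x, rfl⟩ := MulOpposite.op_surjective x
  induction x using HeckeA.gen_induction generalizing v with
  | algebraMap c =>
    rw [← MulOpposite.algebraMap_apply, algebraMap_smul, algebraMap_smul, map_smul]
  | gen i => exact hf i v
  | add x y hx hy => rw [MulOpposite.op_add, add_smul, add_smul, map_add, hx, hy]
  | mul x y hx hy => rw [MulOpposite.op_mul, mul_smul, mul_smul, hy, hx]

theorem intertwines_of_map_smul {M N : FDRightModule K (HeckeA K q n)}
    {f : M.carrier →ₗ[K] N.carrier} (hf : ∀ (x : (HeckeA K q n)ᵐᵒᵖ) v, f (x • v) = x • f v) :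
    OpRep.Intertwines M.toOpRep N.toOpRep f := fun _ v => hf _ v

theorem iso_toOpRep {M N : FDRightModule K (HeckeA K q n)} :
    M.toOpRep.Iso N.toOpRep ↔ Nonempty (M.carrier ≃ₗ[(HeckeA K q n)ᵐᵒᵖ] N.carrier) := by
  refine ⟨fun ⟨f, hf⟩ => ⟨{ f with map_smul' := map_smul_of_intertwines hf }⟩, fun ⟨f⟩ =>
    ⟨f.restrictScalars K, intertwines_of_map_smul fun x v => map_smul f x v⟩⟩

theorem indec_toOpRep {M : FDRightModule K (HeckeA K q n)} :
    M.toOpRep.Indec ↔ IsIndecomposableModule (HeckeA K q n)ᵐᵒᵖ M.carrier := by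
  refine and_congr_right fun _ => ⟨fun h N₁ N₂ hN => ?_, fun h e he hee => ?_⟩
  · have hp := Submodule.isIdempotentElem_projection hN
    rcases h ((N₁.projection N₂ hN).restrictScalars K)
      (OpRep.isEndo_iff.2 (intertwines_of_map_smul fun x v => map_smul (N₁.projection N₂ hN) x v))
      (LinearMap.ext fun v => congrArg (fun f => f v) hp.eq) with h0 | h1
    · refine Or.inl ((Submodule.eq_bot_iff _).2 fun v hv => ?_)
      exact (Submodule.projection_apply_of_mem_left hN hv).symm.trans
        (congrArg (fun f : Module.End K M.carrier => f v) h0)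
    · refine Or.inr ((Submodule.eq_bot_iff _).2 fun v hv => ?_)
      exact (congrArg (fun f : Module.End K M.carrier => f v) h1).symm.trans
        ((Submodule.projection_apply_eq_zero_iff hN).2 hv)
  · let E : Module.End (HeckeA K q n)ᵐᵒᵖ M.carrier :=
      { e with map_smul' := map_smul_of_intertwines (OpRep.isEndo_iff.1 he) }
    have hE : IsIdempotentElem E := LinearMap.ext fun v => congrArg (fun f => f v) hee
    rcases h _ _ (LinearMap.IsIdempotentElem.isCompl hE) with h0 | h1
    · refine Or.inl (LinearMap.ext fun v => ?_)
      exact congrArg (fun f : Module.End (HeckeA K q n)ᵐᵒᵖ M.carrier => f v)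
        (LinearMap.range_eq_bot.1 h0 : E = 0)
    · refine Or.inr (LinearMap.ext fun v => LinearMap.ker_eq_bot.1 h1 ?_)
      exact congrArg (fun f : Module.End K M.carrier => f v) hee

end FDRightModule

theorem exists_list_of_finite_quot {α : Type*} {r : α → α → Prop} (hr : Equivalence r)
    (h : Finite (Quot r)) : ∃ L : List α, ∀ x, ∃ y ∈ L, r x y := by
  have := Fintype.ofFinite (Quot r)
  refine ⟨(Finset.univ.toList).map Quot.out, fun x => ⟨(Quot.mk r x).out,
    List.mem_map_of_mem (Finset.mem_toList.2 (Finset.mem_univ _)), ?_⟩⟩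
  exact (hr.quot_mk_eq_iff _ _).1 (Quot.out_eq (Quot.mk r x)).symm

theorem finite_quot_of_list {α β : Type*} {r : α → α → Prop} {s : α → β → Prop} {L : List β}
    (hL : ∀ x, ∃ y ∈ L, s x y) (hs : ∀ x x' y, s x y → s x' y → r x x') : Finite (Quot r) := by
  choose f hf hsf using hL
  have := (List.finite_toSet L).to_subtype
  refine Finite.of_injective (fun x : Quot r => (⟨f x.out, hf _⟩ : {y | y ∈ L})) fun x y h => ?_
  have h1 : f x.out = f y.out := congrArg Subtype.val h
  rw [← Quot.out_eq x, ← Quot.out_eq y]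
  exact Quot.sound (hs _ _ _ (hsf x.out) (h1 ▸ hsf y.out))

theorem hasFiniteRepresentationType_heckeA_iff {K : Type} [Field K] {q : K} {n : ℕ} :
    HasFiniteRepresentationType K (HeckeA K q n) ↔
      OpRep.FinitelyMany fun M : OpRep K => M.Indec ∧ IsHecke q (n - 1) M.op := by
  constructor
  · intro h
    obtain ⟨L, hL⟩ := exists_list_of_finite_quot
      ⟨fun _ => ⟨LinearEquiv.refl _ _⟩, fun ⟨f⟩ => ⟨f.symm⟩, fun ⟨f⟩ ⟨g⟩ => ⟨f.trans g⟩⟩ h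
    refine ⟨L.map fun M => M.1.toOpRep, fun M ⟨hM, hT⟩ => ?_⟩
    obtain ⟨N, hN, h⟩ := hL ⟨.ofOpRep M hT, FDRightModule.indec_toOpRep.1
      (by rwa [FDRightModule.toOpRep_ofOpRep])⟩
    have h' := FDRightModule.iso_toOpRep.2 h
    rw [FDRightModule.toOpRep_ofOpRep] at h'
    exact ⟨_, List.mem_map_of_mem hN, h'⟩
  · rintro ⟨L, hL⟩
    exact finite_quot_of_list (s := fun M N => M.1.toOpRep.Iso N)
      (fun M => hL _ ⟨FDRightModule.indec_toOpRep.2 M.2, M.1.isHecke_toOpRep⟩)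
      fun _ _ _ h h' => FDRightModule.iso_toOpRep.1 (h.trans h'.symm)

theorem natCast_lt_two_mul_multOrder_iff {M : Type*} [Monoid M] {x : M} {n : ℕ} :
    (n : ℕ∞) < 2 * multOrder x ↔ orderOf x = 0 ∨ n < 2 * orderOf x := by
  rw [multOrder]
  split_ifs with h
  · simp [h]
  · simp only [h, false_or]
    exact_mod_cast Iff.rfl

theorem heckeA_finite_representation_type_iff
    (R : Type) [Field R] (q : R) (hq0 : q ≠ 0) (hq1 : q ≠ 1) (n : ℕ) (hn : 1 ≤ n) :
    HasFiniteRepresentationType R (HeckeA R q n) ↔ (n : ℕ∞) < 2 * multOrder q := by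
  rw [hasFiniteRepresentationType_heckeA_iff, natCast_lt_two_mul_multOrder_iff]
  refine ⟨fun h => ?_, fun h => OpRep.finitelyMany_isHecke hq0 hq1 _ (by omega)⟩
  by_contra! hc
  exact OpRep.not_finitelyMany_isHecke hq1 hc.1 (by omega) h
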